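/- Every planar graph in which any two distinct cycles of length at most 5 are at distance at least 3 (i.e., d* ≥ 3) is (I,F)-colorable. -/

import Mathlib

open SimpleGraph

namespace IFPaper

variable {V : Type}

/-- An `(I,F)`-coloring of a graph, encoded as a Boolean coloring where
`true` means color `I` and `false` means color `F`:  the `I`-colored vertices
form an independent set and the `F`-colored vertices induce a forest
(no cycle has all of its vertices colored `F`). -/
def IFColoring (G : SimpleGraph V) (c : V → Bool) : Prop :=
  (∀ ⦃u v : V⦄, G.Adj u v → c u = true → c v = false) ∧
  (∀ (v : V) (w : G.Walk v v), w.IsCycle → ¬ (∀ x ∈ w.support, c x = false))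

/-- A graph is `(I,F)`-colorable if it admits an `(I,F)`-coloring. -/
def IFColorable (G : SimpleGraph V) : Prop := ∃ c : V → Bool, IFColoring G c

/-- An `(I,F)`-coloring of the subgraph of `G` induced on the set `S`. -/
def IFColoringOn (G : SimpleGraph V) (S : Set V) (c : V → Bool) : Prop :=
  (∀ ⦃u v : V⦄, u ∈ S → v ∈ S → G.Adj u v → c u = true → c v = false) ∧
  (∀ (v : V) (w : G.Walk v v), w.IsCycle → (∀ x ∈ w.support, x ∈ S) →
    ¬ (∀ x ∈ w.support, c x = false))

/-- A splitting `F`-path of (the vertex set `Q` of) a cycle: a path all of whose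
vertices get color `F`, whose two endpoints lie on `Q`, and all of whose other
vertices (at least one) do not lie on `Q`. -/
def IsSplittingFPath (G : SimpleGraph V) (Q : Set V) (c : V → Bool)
    {a b : V} (p : G.Walk a b) : Prop :=
  p.IsPath ∧ (∀ x ∈ p.support, c x = false) ∧ a ∈ Q ∧ b ∈ Q ∧ 2 ≤ p.length ∧
  ∀ x ∈ p.support, x ≠ a → x ≠ b → x ∉ Q

/-- A super IF-coloring of `(G, Q)`: an `(I,F)`-coloring of `G` with no
splitting `F`-path of `Q`. -/
def SuperIFColoring (G : SimpleGraph V) (Q : Set V) (c : V → Bool) : Prop :=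
  IFColoring G c ∧ ∀ (a b : V) (p : G.Walk a b), ¬ IsSplittingFPath G Q c p

/-- `d* ≥ 3`: any two distinct cycles of length at most `5` are at distance at
least `3`. -/
def Cycles5Apart (G : SimpleGraph V) : Prop :=
  ∀ ⦃u v : V⦄ (c1 : G.Walk u u) (c2 : G.Walk v v),
    c1.IsCycle → c2.IsCycle → c1.length ≤ 5 → c2.length ≤ 5 →
    {e : Sym2 V | e ∈ c1.edges} ≠ {e : Sym2 V | e ∈ c2.edges} →
    ∀ x ∈ c1.support, ∀ y ∈ c2.support, 3 ≤ G.dist x y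

/-- A claw of the cycle `C`: a vertex not on `C` with three neighbors on `C`. -/
def HasClaw (G : SimpleGraph V) {v : V} (C : G.Walk v v) : Prop :=
  ∃ x : V, x ∉ C.support ∧ ∃ a b c : V, a ∈ C.support ∧ b ∈ C.support ∧ c ∈ C.support ∧
    a ≠ b ∧ a ≠ c ∧ b ≠ c ∧ G.Adj x a ∧ G.Adj x b ∧ G.Adj x c

/-- A triclaw of the cycle `C`: a triangle `x y z` disjoint from `C`, joined by
three edges to three distinct vertices of `C`. -/
def HasTriclaw (G : SimpleGraph V) {v : V} (C : G.Walk v v) : Prop :=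
  ∃ x y z : V, x ∉ C.support ∧ y ∉ C.support ∧ z ∉ C.support ∧
    G.Adj x y ∧ G.Adj y z ∧ G.Adj x z ∧
    ∃ a b c : V, a ∈ C.support ∧ b ∈ C.support ∧ c ∈ C.support ∧
      a ≠ b ∧ a ≠ c ∧ b ≠ c ∧ G.Adj x a ∧ G.Adj y b ∧ G.Adj z c

/-- A bad cycle is a `9`-cycle having a claw or a triclaw. -/
def IsBadCycle (G : SimpleGraph V) {v : V} (C : G.Walk v v) : Prop :=
  C.IsCycle ∧ C.length = 9 ∧ (HasClaw G C ∨ HasTriclaw G C)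

/-- A good cycle is a cycle that is not bad. -/
def IsGoodCycle (G : SimpleGraph V) {v : V} (C : G.Walk v v) : Prop :=
  C.IsCycle ∧ ¬ IsBadCycle G C

/-- The interior of an arc parametrized by `[0,1]`. -/
def ArcInterior (γ : ℝ → ℝ × ℝ) : Set (ℝ × ℝ) := γ '' Set.Ioo 0 1

/-- The image of an arc parametrized by `[0,1]`. -/
def ArcImage (γ : ℝ → ℝ × ℝ) : Set (ℝ × ℝ) := γ '' Set.Icc 0 1

/-- A plane embedding of a simple graph: an injective placement of the vertices
in the plane together with, for every edge, a simple arc joining the images of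
its endpoints, such that arcs meet only at common endpoints and no arc passes
through a vertex. -/
structure IsPlaneEmbedding (G : SimpleGraph V) (vtx : V → ℝ × ℝ)
    (arc : V → V → ℝ → ℝ × ℝ) : Prop where
  vtx_inj : Function.Injective vtx
  arc_cont : ∀ ⦃u v : V⦄, G.Adj u v → ContinuousOn (arc u v) (Set.Icc 0 1)
  arc_injOn : ∀ ⦃u v : V⦄, G.Adj u v → Set.InjOn (arc u v) (Set.Icc 0 1)
  arc_start : ∀ ⦃u v : V⦄, G.Adj u v → arc u v 0 = vtx u
  arc_end : ∀ ⦃u v : V⦄, G.Adj u v → arc u v 1 = vtx v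
  arc_symm : ∀ ⦃u v : V⦄, G.Adj u v → ∀ t : ℝ, arc v u t = arc u v (1 - t)
  arc_avoids_vtx : ∀ ⦃u v : V⦄, G.Adj u v → ∀ w : V, vtx w ∉ ArcInterior (arc u v)
  arc_disjoint : ∀ ⦃u v u' v' : V⦄, G.Adj u v → G.Adj u' v' → s(u, v) ≠ s(u', v') →
    ArcInterior (arc u v) ∩ ArcInterior (arc u' v') = ∅

/-- A graph is planar if it admits a plane embedding. -/
def IsPlanarGraph (G : SimpleGraph V) : Prop :=
  ∃ (vtx : V → ℝ × ℝ) (arc : V → V → ℝ → ℝ × ℝ), IsPlaneEmbedding G vtx arc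

/-- The subset of the plane covered by a plane drawing of `G`. -/
def Drawing (G : SimpleGraph V) (vtx : V → ℝ × ℝ) (arc : V → V → ℝ → ℝ × ℝ) :
    Set (ℝ × ℝ) :=
  Set.range vtx ∪ ⋃ (u : V) (v : V) (_ : G.Adj u v), ArcImage (arc u v)

/-- The subset of the plane covered by the drawing of a walk `w`. -/
def WalkDrawing (G : SimpleGraph V) (arc : V → V → ℝ → ℝ × ℝ)
    {a b : V} (w : G.Walk a b) : Set (ℝ × ℝ) :=
  ⋃ (u : V) (v : V) (_ : G.Adj u v) (_ : s(u, v) ∈ w.edges), ArcImage (arc u v)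

/-- A face of a plane drawing: a connected component of the complement of the
drawing. -/
def IsFace (G : SimpleGraph V) (vtx : V → ℝ × ℝ) (arc : V → V → ℝ → ℝ × ℝ)
    (f : Set (ℝ × ℝ)) : Prop :=
  ∃ p : ℝ × ℝ, p ∉ Drawing G vtx arc ∧
    f = connectedComponentIn (Drawing G vtx arc)ᶜ p

/-- The outer face: the unbounded face. -/
def IsOuterFace (G : SimpleGraph V) (vtx : V → ℝ × ℝ) (arc : V → V → ℝ → ℝ × ℝ)
    (f : Set (ℝ × ℝ)) : Prop :=
  IsFace G vtx arc f ∧ ¬ Bornology.IsBounded f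

/-- A vertex is on a face if its image lies on the boundary of the face. -/
def VertexOnFace (vtx : V → ℝ × ℝ) (f : Set (ℝ × ℝ)) (v : V) : Prop :=
  vtx v ∈ frontier f

/-- The face `f` is bounded by the (closed) walk `w`. -/
def FaceBoundedBy (G : SimpleGraph V) (vtx : V → ℝ × ℝ) (arc : V → V → ℝ → ℝ × ℝ)
    (f : Set (ℝ × ℝ)) {a : V} (w : G.Walk a a) : Prop :=
  IsFace G vtx arc f ∧ frontier f = WalkDrawing G arc w

/-- A vertex lies (strictly) inside the cycle `C` of the plane graph. -/
def VertexInsideCycle (G : SimpleGraph V) (vtx : V → ℝ × ℝ)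
    (arc : V → V → ℝ → ℝ × ℝ) {a : V} (C : G.Walk a a) (v : V) : Prop :=
  vtx v ∉ WalkDrawing G arc C ∧
  Bornology.IsBounded (connectedComponentIn (WalkDrawing G arc C)ᶜ (vtx v))

/-- A vertex lies (strictly) outside the cycle `C` of the plane graph. -/
def VertexOutsideCycle (G : SimpleGraph V) (vtx : V → ℝ × ℝ)
    (arc : V → V → ℝ → ℝ × ℝ) {a : V} (C : G.Walk a a) (v : V) : Prop :=
  vtx v ∉ WalkDrawing G arc C ∧
  ¬ Bornology.IsBounded (connectedComponentIn (WalkDrawing G arc C)ᶜ (vtx v))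

/-- A cycle of a plane graph is separating if its interior and its exterior
each contain a vertex of the graph. -/
def IsSeparatingCycle (G : SimpleGraph V) (vtx : V → ℝ × ℝ)
    (arc : V → V → ℝ → ℝ × ℝ) {a : V} (C : G.Walk a a) : Prop :=
  (∃ v : V, VertexInsideCycle G vtx arc C v) ∧
  (∃ v : V, VertexOutsideCycle G vtx arc C v)

/-- The cycle `C` has no chord in `G`. -/
def Chordless (G : SimpleGraph V) {a : V} (C : G.Walk a a) : Prop :=
  ∀ ⦃u v : V⦄, u ∈ C.support → v ∈ C.support → G.Adj u v → s(u, v) ∈ C.edges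

/-- The precoloring `c0` of the cycle `C0` extends to a super IF-coloring of
`(G, C0)`. -/
def ExtendsToSuper (G : SimpleGraph V) {v0 : V} (C0 : G.Walk v0 v0)
    (c0 : V → Bool) : Prop :=
  ∃ c : V → Bool, SuperIFColoring G {x | x ∈ C0.support} c ∧
    ∀ x ∈ C0.support, c x = c0 x

/-- A counterexample to the extension theorem: a planar graph with `d* ≥ 3`, a
good cycle `C0` of length at most `9`, and an `(I,F)`-coloring of `G[V(C0)]`
which does not extend to a super IF-coloring of `(G, C0)`. -/
def IsCounterexample (G : SimpleGraph V) {v0 : V} (C0 : G.Walk v0 v0)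
    (c0 : V → Bool) : Prop :=
  IsPlanarGraph G ∧ Cycles5Apart G ∧ IsGoodCycle G C0 ∧ C0.length ≤ 9 ∧
  IFColoringOn G {x | x ∈ C0.support} c0 ∧ ¬ ExtendsToSuper G C0 c0

/-- The quantity `|V(G)| + |E(G)|`. -/
noncomputable def graphSize {V : Type} [Fintype V] (G : SimpleGraph V) : ℕ :=
  Fintype.card V + G.edgeSet.ncard

/-- A minimal counterexample to the extension theorem: one minimizing
`|V(G)| + |E(G)|` among all counterexamples. -/
def IsMinimalCounterexample [Fintype V] (G : SimpleGraph V) {v0 : V}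
    (C0 : G.Walk v0 v0) (c0 : V → Bool) : Prop :=
  IsCounterexample G C0 c0 ∧
  ∀ (n : ℕ) (G' : SimpleGraph (Fin n)) (v0' : Fin n) (C0' : G'.Walk v0' v0')
    (c0' : Fin n → Bool), IsCounterexample G' C0' c0' →
      graphSize G ≤ graphSize G'

/-- A chord of the cycle `C` splitting it into two cycles of lengths `l1` and
`l2`: an edge between two non-consecutive vertices of `C` together with two
cycles of lengths `l1` and `l2` which both use the chord, use otherwise only
edges of `C`, and together partition the edges of `C`. -/
def HasChordSplit (G : SimpleGraph V) {a : V} (C : G.Walk a a) (l1 l2 : ℕ) : Prop :=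
  ∃ u v : V, u ∈ C.support ∧ v ∈ C.support ∧ G.Adj u v ∧ s(u, v) ∉ C.edges ∧
    ∃ (c1 c2 : G.Walk u u), c1.IsCycle ∧ c2.IsCycle ∧
      c1.length = l1 ∧ c2.length = l2 ∧
      s(u, v) ∈ c1.edges ∧ s(u, v) ∈ c2.edges ∧
      (∀ e ∈ c1.edges, e ≠ s(u, v) → e ∈ C.edges) ∧
      (∀ e ∈ c2.edges, e ≠ s(u, v) → e ∈ C.edges) ∧
      (∀ e ∈ C.edges, (e ∈ c1.edges ↔ e ∉ c2.edges))

/-- A `(l1, l2, l3)`-claw of the cycle `C`: a claw which together with `C`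
forms three cycles of lengths `l1`, `l2` and `l3`. -/
def HasClawSplit (G : SimpleGraph V) {a : V} (C : G.Walk a a) (l1 l2 l3 : ℕ) : Prop :=
  ∃ x : V, x ∉ C.support ∧ ∃ v1 v2 v3 : V,
    v1 ∈ C.support ∧ v2 ∈ C.support ∧ v3 ∈ C.support ∧
    v1 ≠ v2 ∧ v1 ≠ v3 ∧ v2 ≠ v3 ∧ G.Adj x v1 ∧ G.Adj x v2 ∧ G.Adj x v3 ∧
    ∃ (w1 w2 w3 : G.Walk x x), w1.IsCycle ∧ w2.IsCycle ∧ w3.IsCycle ∧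
      w1.length = l1 ∧ w2.length = l2 ∧ w3.length = l3 ∧
      (∀ e ∈ w1.edges, e ∈ C.edges ∨ e = s(x, v1) ∨ e = s(x, v2) ∨ e = s(x, v3)) ∧
      (∀ e ∈ w2.edges, e ∈ C.edges ∨ e = s(x, v1) ∨ e = s(x, v2) ∨ e = s(x, v3)) ∧
      (∀ e ∈ w3.edges, e ∈ C.edges ∨ e = s(x, v1) ∨ e = s(x, v2) ∨ e = s(x, v3)) ∧
      (∀ e ∈ C.edges, (e ∈ w1.edges ∧ e ∉ w2.edges ∧ e ∉ w3.edges) ∨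
        (e ∉ w1.edges ∧ e ∈ w2.edges ∧ e ∉ w3.edges) ∨
        (e ∉ w1.edges ∧ e ∉ w2.edges ∧ e ∈ w3.edges))

/-- A special `9`-cycle: a `9`-cycle having a `(3,8)`-chord or a
`(5,5,5)`-claw. -/
def IsSpecial9Cycle (G : SimpleGraph V) {a : V} (C : G.Walk a a) : Prop :=
  C.IsCycle ∧ C.length = 9 ∧ (HasChordSplit G C 3 8 ∨ HasClawSplit G C 5 5 5)

/-- Two cycles are normally adjacent if they share exactly one edge and
exactly two vertices. -/
def NormallyAdjacent (G : SimpleGraph V) {a b : V}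
    (c1 : G.Walk a a) (c2 : G.Walk b b) : Prop :=
  (∃ e : Sym2 V, {e' : Sym2 V | e' ∈ c1.edges} ∩ {e' : Sym2 V | e' ∈ c2.edges} = {e}) ∧
  (∃ x y : V, x ≠ y ∧ {z : V | z ∈ c1.support} ∩ {z : V | z ∈ c2.support} = {x, y})

/-- A `3`-fold cover `(H, L)` of `G`. -/
def IsDPCover (G : SimpleGraph V) {W : Type} (H : SimpleGraph W)
    (L : V → Finset W) : Prop :=
  (∀ v : V, (L v).card = 3) ∧
  (∀ ⦃u v : V⦄, u ≠ v → Disjoint (L u) (L v)) ∧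
  (∀ v : V, ∀ a ∈ L v, ∀ b ∈ L v, ¬ H.Adj a b) ∧
  (∀ ⦃a b : W⦄, H.Adj a b → ∃ u v : V, G.Adj u v ∧ a ∈ L u ∧ b ∈ L v) ∧
  (∀ ⦃u v : V⦄, u ≠ v → ∀ a ∈ L u, ∀ b ∈ L v, ∀ b' ∈ L v,
    H.Adj a b → H.Adj a b' → b = b')

/-- `G` is DP-`3`-colorable: for every `3`-fold cover `(H, L)` of `G` there is
an independent transversal picking one vertex from each fiber. -/
def DP3Colorable (G : SimpleGraph V) : Prop :=
  ∀ (W : Type) (H : SimpleGraph W) (L : V → Finset W), IsDPCover G H L →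
    ∃ f : V → W, (∀ v : V, f v ∈ L v) ∧ ∀ u v : V, ¬ H.Adj (f u) (f v)


set_option linter.all false

section Coloring
open scoped Classical
open Finset

section EvenSets

/-- The boundary modulo `2` of a set of edges. -/
noncomputable def bd (Z : Finset (Sym2 V)) (v : V) : ZMod 2 :=
  ∑ e ∈ Z, if v ∈ e then 1 else 0

/-- The indicator of a vertex modulo `2`. -/
noncomputable def pt (s : V) (v : V) : ZMod 2 := if v = s then 1 else 0

/-- `v` is incident to an edge of `Z`. -/
def On (Z : Finset (Sym2 V)) (v : V) : Prop := ∃ e ∈ Z, v ∈ e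

/-- A minimal nonempty set of edges with all degrees even. -/
def IsCirc (Z : Finset (Sym2 V)) : Prop :=
  Z.Nonempty ∧ bd Z = 0 ∧ ∀ W ⊆ Z, bd W = 0 → W = ∅ ∨ W = Z

def Loopless (Z : Finset (Sym2 V)) : Prop := ∀ v, s(v, v) ∉ Z

lemma Loopless.mono {Z W : Finset (Sym2 V)} (h : Loopless Z) (hW : W ⊆ Z) : Loopless W :=
  fun v hv => h v (hW hv)

lemma add_self_zmod (x : ZMod 2) : x + x = 0 := CharTwo.add_self_eq_zero x

lemma two_zmod_pi : (2 : V → ZMod 2) = 0 := by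
  ext v; exact (by decide : (2 : ZMod 2) = 0)

lemma zmod_cases (x : ZMod 2) : x = 0 ∨ x = 1 := by
  revert x; decide

lemma pt_self (s : V) : pt s s = 1 := by simp [pt]

lemma pt_ne {s v : V} (h : v ≠ s) : pt s v = 0 := by simp [pt, h]

@[simp] lemma bd_empty : bd (∅ : Finset (Sym2 V)) = 0 := by ext v; simp [bd]

lemma bd_union {A B : Finset (Sym2 V)} (h : Disjoint A B) : bd (A ∪ B) = bd A + bd B := by
  ext v; simp [bd, sum_union h]

lemma bd_sdiff {A B : Finset (Sym2 V)} (h : B ⊆ A) : bd (A \ B) = bd A + bd B := by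
  have h1 : bd (A \ B) + bd B = bd A := by
    rw [← bd_union sdiff_disjoint, sdiff_union_of_subset h]
  rw [← h1]; ext v; simp only [Pi.add_apply]
  rw [add_assoc, add_self_zmod, add_zero]

lemma bd_symmDiff (A B : Finset (Sym2 V)) : bd (symmDiff A B) = bd A + bd B := by
  have h0 : symmDiff A B = (A \ B) ∪ (B \ A) := rfl
  have h1 : Disjoint (A \ B) (B \ A) := disjoint_sdiff_sdiff
  have h2 : A \ B = A \ (A ∩ B) := by simp
  have h3 : B \ A = B \ (A ∩ B) := by simp
  rw [h0, bd_union h1, h2, h3, bd_sdiff inter_subset_left,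
    bd_sdiff inter_subset_right]
  ext v; simp only [Pi.add_apply]
  have := add_self_zmod (bd (A ∩ B) v)
  linear_combination this

lemma bd_singleton {a b : V} (h : a ≠ b) : bd {s(a, b)} = pt a + pt b := by
  ext v
  simp only [bd, pt, sum_singleton, Sym2.mem_iff, Pi.add_apply]
  by_cases h1 : v = a <;> by_cases h2 : v = b <;> simp_all

lemma bd_insert {a b : V} {Z : Finset (Sym2 V)} (h : a ≠ b) (hZ : s(a, b) ∉ Z) :
    bd (insert s(a, b) Z) = pt a + pt b + bd Z := by
  rw [insert_eq, bd_union (by simpa using hZ), bd_singleton h]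

lemma bd_erase {a b : V} {Z : Finset (Sym2 V)} (h : a ≠ b) (hZ : s(a, b) ∈ Z) :
    bd (Z.erase s(a, b)) = pt a + pt b + bd Z := by
  rw [erase_eq, bd_sdiff (by simpa using hZ), bd_singleton h, add_comm]

lemma bd_eq_zero_of_not_on {Z : Finset (Sym2 V)} {v : V} (h : ¬ On Z v) : bd Z v = 0 := by
  apply sum_eq_zero
  intro e he
  rw [if_neg]
  exact fun hv => h ⟨e, he, hv⟩

lemma On.mono {Z W : Finset (Sym2 V)} {v : V} (h : On Z v) (hZ : Z ⊆ W) : On W v :=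
  let ⟨e, he, hv⟩ := h; ⟨e, hZ he, hv⟩

lemma on_iff {Z : Finset (Sym2 V)} {v : V} : On Z v ↔ ∃ w, s(v, w) ∈ Z := by
  constructor
  · rintro ⟨e, he, hv⟩
    obtain ⟨w, rfl⟩ := Sym2.mem_iff_exists.1 hv
    exact ⟨w, he⟩
  · rintro ⟨w, hw⟩
    exact ⟨_, hw, by simp⟩

lemma on_left {Z : Finset (Sym2 V)} {v w : V} (h : s(v, w) ∈ Z) : On Z v := ⟨_, h, by simp⟩
lemma on_right {Z : Finset (Sym2 V)} {v w : V} (h : s(v, w) ∈ Z) : On Z w := ⟨_, h, by simp⟩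

/-- The boundary in terms of the neighbours. -/
lemma bd_nbrs {Z : Finset (Sym2 V)} {v : V} (N : Finset V)
    (hN : ∀ w, s(v, w) ∈ Z → w ∈ N) :
    bd Z v = ∑ w ∈ N, if s(v, w) ∈ Z then 1 else 0 := by
  unfold bd
  rw [← sum_filter, ← sum_filter, sum_const, sum_const]
  congr 1
  symm
  refine card_bij (fun w _ => s(v, w)) ?_ ?_ ?_
  · intro w hw; simp at hw ⊢; exact hw.2
  · intro w1 h1 w2 h2 h; exact Sym2.congr_right.1 h
  · intro e he
    simp only [mem_filter] at he
    obtain ⟨w, rfl⟩ := Sym2.mem_iff_exists.1 he.2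
    exact ⟨w, by simp [he.1, hN w he.1], rfl⟩

/-- In an even set, an edge at `v` is followed by another one. -/
lemma exists_other {Z : Finset (Sym2 V)} {v w : V} (hZ : bd Z v = 0)
    (h : s(v, w) ∈ Z) : ∃ x, x ≠ w ∧ s(v, x) ∈ Z := by
  by_contra hc
  push Not at hc
  have := bd_nbrs (Z := Z) (v := v) {w} (by
    intro x hx; by_contra hxw; exact hc x (by simpa using hxw) hx)
  rw [hZ, sum_singleton, if_pos h] at this
  exact absurd this (by decide)

lemma card_le_of_even {Z : Finset (Sym2 V)} (hl : Loopless Z) (hne : Z.Nonempty)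
    (hZ : bd Z = 0) : 3 ≤ Z.card := by
  obtain ⟨e, he⟩ := hne
  induction e with | _ a b =>
  have hab : a ≠ b := by rintro rfl; exact hl _ he
  obtain ⟨c, hc, hac⟩ := exists_other (congrFun hZ a) he
  obtain ⟨d, hd, hbd⟩ := exists_other (congrFun hZ b) (Sym2.eq_swap ▸ he)
  have hca : a ≠ c := by rintro rfl; exact hl _ hac
  have : ({s(a, b), s(a, c), s(b, d)} : Finset (Sym2 V)).card = 3 := by
    rw [card_insert_of_notMem, card_insert_of_notMem, card_singleton]
    · simp; tauto
    · simp; tauto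
  rw [← this]
  apply card_le_card
  intro e; simp; rintro (rfl | rfl | rfl) <;> assumption

/-- Every edge of an even set lies in a circuit. -/
lemma exists_circ {Z : Finset (Sym2 V)} (hZ : bd Z = 0) {e : Sym2 V} (he : e ∈ Z) :
    ∃ C ⊆ Z, IsCirc C ∧ e ∈ C := by
  obtain ⟨C, hC, hmin⟩ := exists_min_image
    (Z.powerset.filter (fun C => bd C = 0 ∧ e ∈ C)) card ⟨Z, by simp [hZ, he]⟩
  simp only [mem_filter, mem_powerset] at hC hmin
  refine ⟨C, hC.1, ⟨⟨e, hC.2.2⟩, hC.2.1, ?_⟩, hC.2.2⟩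
  intro W hW hbW
  by_cases heW : e ∈ W
  · right
    exact eq_of_subset_of_card_le hW (hmin W ⟨hW.trans hC.1, hbW, heW⟩)
  · left
    have h1 := hmin (C \ W) ⟨sdiff_subset.trans hC.1,
      by rw [bd_sdiff hW, hbW, hC.2.1, add_zero], by simp [heW, hC.2.2]⟩
    rw [card_sdiff_of_subset hW] at h1
    have h2 := card_le_card hW
    have h3 : 0 < C.card := card_pos.2 ⟨e, hC.2.2⟩
    exact card_eq_zero.1 (by omega)

lemma edges_subset_circ_eq {Z W : Finset (Sym2 V)} (hZ : IsCirc Z) (hW : W ⊆ Z)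
    (hb : bd W = 0) (hne : W.Nonempty) : W = Z :=
  (hZ.2.2 W hW hb).resolve_left hne.ne_empty

variable {G : SimpleGraph V}

/-- `Z` consists of edges of `G`. -/
def EIn (G : SimpleGraph V) (Z : Finset (Sym2 V)) : Prop := ∀ u v, s(u, v) ∈ Z → G.Adj u v

lemma EIn.loopless {Z : Finset (Sym2 V)} (h : EIn G Z) : Loopless Z :=
  fun v hv => (h v v hv).ne rfl

lemma EIn.mono {Z W : Finset (Sym2 V)} (h : EIn G Z) (hW : W ⊆ Z) : EIn G W :=
  fun u v hv => h u v (hW hv)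

lemma EIn.union {Z W : Finset (Sym2 V)} (h : EIn G Z) (hW : EIn G W) : EIn G (Z ∪ W) := by
  intro u v hv
  rcases mem_union.1 hv with h1 | h1
  exacts [h _ _ h1, hW _ _ h1]

lemma EIn.symmDiff {Z W : Finset (Sym2 V)} (h : EIn G Z) (hW : EIn G W) :
    EIn G (symmDiff Z W) :=
  (h.union hW).mono symmDiff_le_sup

lemma EIn.insert {Z : Finset (Sym2 V)} (h : EIn G Z) {a b : V} (hab : G.Adj a b) :
    EIn G (insert s(a, b) Z) := by
  intro u v hv
  rcases mem_insert.1 hv with h1 | h1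
  · rw [Sym2.eq_iff] at h1
    rcases h1 with ⟨rfl, rfl⟩ | ⟨rfl, rfl⟩
    exacts [hab, hab.symm]
  · exact h _ _ h1

lemma EIn.empty : EIn G ∅ := by intro u v h; simp at h

lemma bd_walk_edges {s t : V} (p : G.Walk s t) (hp : p.IsTrail) :
    bd p.edges.toFinset = pt s + pt t := by
  induction p with
  | nil => ext v; simp [add_self_zmod]
  | @cons u v w h p ih =>
    rw [Walk.isTrail_cons] at hp
    rw [Walk.edges_cons, List.toFinset_cons, bd_insert h.ne (by simpa using hp.2), ih hp.1]
    linear_combination pt v * two_zmod_pi (V := V)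

lemma exists_walk_of_odd (A : Finset (Sym2 V)) (hA : EIn G A) {s t : V} (hb : bd A = pt s + pt t) :
    ∃ p : G.Walk s t, ∀ e ∈ p.edges, e ∈ A := by
  induction hn : A.card generalizing A s with
  | zero =>
    by_cases hst : s = t
    · subst hst; exact ⟨.nil, by simp⟩
    rw [card_eq_zero] at hn
    subst hn
    have := congrFun hb s
    simp [pt, hst] at this
  | succ n ih =>
    by_cases hst : s = t
    · subst hst; exact ⟨.nil, by simp⟩
    have h1 : On A s := by
      by_contra h
      have := congrFun hb s
      rw [bd_eq_zero_of_not_on h] at this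
      simp [pt, hst] at this
    obtain ⟨x, hx⟩ := on_iff.1 h1
    have hadj := hA _ _ hx
    obtain ⟨p, hp⟩ := ih (A.erase s(s, x)) (s := x) (hA.mono (erase_subset _ _)) (by
      rw [bd_erase hadj.ne hx, hb]
      linear_combination pt s * two_zmod_pi (V := V))
      (by rw [card_erase_of_mem hx, hn]; rfl)
    refine ⟨.cons hadj p, ?_⟩
    intro e he
    rw [Walk.edges_cons, List.mem_cons] at he
    rcases he with rfl | he
    · exact hx
    · exact mem_of_mem_erase (hp e he)

lemma exists_path_of_odd (A : Finset (Sym2 V)) (hA : EIn G A) {s t : V} (hb : bd A = pt s + pt t) :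
    ∃ p : G.Walk s t, p.IsPath ∧ ∀ e ∈ p.edges, e ∈ A := by
  obtain ⟨p, hp⟩ := exists_walk_of_odd A hA hb
  exact ⟨p.bypass, p.bypass_isPath, fun e he => hp e (p.edges_bypass_subset_edges he)⟩

/-- Removing an edge from a circuit leaves a path. -/
lemma IsCirc.exists_path {Z : Finset (Sym2 V)} (hZ : IsCirc Z) (hG : EIn G Z) {s t : V}
    (h : s(s, t) ∈ Z) :
    ∃ p : G.Walk s t, p.IsPath ∧ p.edges.toFinset = Z.erase s(s, t) := by
  have hst := (hG _ _ h).ne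
  obtain ⟨p, hp, hpe⟩ := exists_path_of_odd (Z.erase s(s, t)) (hG.mono (erase_subset _ _))
    (s := s) (t := t) (by rw [bd_erase hst h, hZ.2.1, add_zero])
  refine ⟨p, hp, ?_⟩
  have hsub : p.edges.toFinset ⊆ Z.erase s(s, t) := fun e he => hpe e (by simpa using he)
  have h2 : insert s(s, t) p.edges.toFinset = Z := by
    apply edges_subset_circ_eq hZ
    · intro e he
      rcases mem_insert.1 he with rfl | he
      · exact h
      · exact mem_of_mem_erase (hsub he)
    · rw [bd_insert hst (fun hc => by simpa using hsub hc), bd_walk_edges p hp.isTrail]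
      ext v; simp only [Pi.add_apply, Pi.zero_apply]; exact add_self_zmod _
    · simp
  rw [← h2, erase_insert]
  exact fun hc => by simpa using hsub hc

lemma on_iff_mem_support {Z : Finset (Sym2 V)} {s t : V} (h : s(s, t) ∈ Z)
    (p : G.Walk s t) (hp : p.edges.toFinset = Z.erase s(s, t)) (v : V) :
    On Z v ↔ v ∈ p.support := by
  constructor
  · intro hv
    obtain ⟨w, hw⟩ := on_iff.1 hv
    by_cases he : s(v, w) = s(s, t)
    · rw [Sym2.eq_iff] at he
      rcases he with ⟨rfl, rfl⟩ | ⟨rfl, rfl⟩ <;> simp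
    · have : s(v, w) ∈ p.edges := by
        rw [← List.mem_toFinset, hp]; exact mem_erase.2 ⟨he, hw⟩
      exact p.fst_mem_support_of_mem_edges this
  · intro hv
    by_cases hvs : v = s
    · subst hvs; exact on_left h
    rw [Walk.mem_support_iff_exists_mem_edges] at hv
    rcases hv with rfl | ⟨e, he, hve⟩
    · exact on_right h
    · refine ⟨e, ?_, hve⟩
      rw [← List.mem_toFinset, hp] at he
      exact mem_of_mem_erase he

lemma IsCirc.card_on [Fintype V] {Z : Finset (Sym2 V)} (hZ : IsCirc Z) (hG : EIn G Z) :
    (univ.filter (On Z)).card = Z.card := by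
  obtain ⟨e, he⟩ := hZ.1
  induction e with | _ a b =>
  obtain ⟨p, hp, hpe⟩ := hZ.exists_path hG he
  have h1 : univ.filter (On Z) = p.support.toFinset := by
    ext v; simp [on_iff_mem_support he p hpe]
  have h2 : Z.card = p.edges.toFinset.card + 1 := by
    rw [hpe, card_erase_add_one he]
  rw [h1, h2, List.toFinset_card_of_nodup hp.support_nodup,
    List.toFinset_card_of_nodup hp.isTrail.edges_nodup]
  simp

/-- Two vertices of a circuit split it into two arcs. -/
lemma IsCirc.exists_arc {Z : Finset (Sym2 V)} (hZ : IsCirc Z) (hl : Loopless Z) {s t : V}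
    (hs : On Z s) (ht : On Z t) : ∃ A ⊆ Z, bd A = pt s + pt t := by
  let G : SimpleGraph V := ⟨fun u v => s(u, v) ∈ Z, ⟨fun u v h => by
    rwa [Sym2.eq_swap]⟩, ⟨fun v h => hl v h⟩⟩
  have hG : EIn G Z := fun u v h => h
  obtain ⟨x, hx⟩ := on_iff.1 hs
  obtain ⟨p, hp, hpe⟩ := hZ.exists_path hG hx
  rw [on_iff_mem_support hx p hpe] at ht
  refine ⟨(p.takeUntil t ht).edges.toFinset, ?_, bd_walk_edges _ (hp.takeUntil ht).isTrail⟩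
  intro e he
  have : e ∈ p.edges := p.edges_takeUntil_subset_edges ht (by simpa using he)
  rw [← List.mem_toFinset, hpe] at this
  exact mem_of_mem_erase this

end EvenSets

section Plane
variable [Finite V] {Φ : Type} {G : SimpleGraph V} {side : V → V → Φ}

/-- The edges of `G` with exactly one side in `A`. -/
noncomputable def J (G : SimpleGraph V) (side : V → V → Φ) (A : Set Φ) : Finset (Sym2 V) :=
  (Set.toFinite {e : Sym2 V | ∃ u v, e = s(u, v) ∧ G.Adj u v ∧ side u v ∈ A ∧ side v u ∉ A}).toFinset

lemma mem_J {A : Set Φ} {u v : V} :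
    s(u, v) ∈ J G side A ↔ G.Adj u v ∧ ¬ (side u v ∈ A ↔ side v u ∈ A) := by
  simp only [J, Set.Finite.mem_toFinset, Set.mem_ofPred_eq, Sym2.eq_iff]
  constructor
  · rintro ⟨a, b, ⟨rfl, rfl⟩ | ⟨rfl, rfl⟩, h, h1, h2⟩
    · exact ⟨h, by tauto⟩
    · exact ⟨h.symm, by tauto⟩
  · rintro ⟨h, h1⟩
    by_cases h2 : side u v ∈ A
    · exact ⟨u, v, by simp, h, h2, by tauto⟩
    · exact ⟨v, u, by simp, h.symm, by tauto, h2⟩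

lemma eIn_J {A : Set Φ} : EIn G (J G side A) := fun _ _ h => (mem_J.1 h).1

lemma eset_ext {Z W : Finset (Sym2 V)} (h : ∀ u v, s(u, v) ∈ Z ↔ s(u, v) ∈ W) : Z = W := by
  ext e; induction e with | _ a b => exact h a b

lemma J_symmDiff (A B : Set Φ) :
    J G side (symmDiff A B) = symmDiff (J G side A) (J G side B) := by
  apply eset_ext
  intro u v
  simp only [mem_symmDiff, mem_J, Set.mem_symmDiff]
  tauto

lemma J_compl (A : Set Φ) : J G side Aᶜ = J G side A := by
  apply eset_ext
  intro u v
  simp only [mem_J, Set.mem_compl_iff]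
  tauto

/-- A combinatorial plane structure: `side u v` is the face to the left of the dart `u v`. -/
structure Pl (G : SimpleGraph V) (side : V → V → Φ) : Prop where
  even : ∀ A : Set Φ, bd (J G side A) = 0
  cyc : ∀ Z, EIn G Z → bd Z = 0 → ∃ A : Set Φ, J G side A = Z
  loc : ∀ (A : Set Φ) (v : V), (∀ w, G.Adj v w → (side v w ∈ A ↔ side w v ∈ A)) →
    ∀ w w', G.Adj v w → G.Adj v w' → side v w ∈ A → side v w' ∈ A

lemma Pl.map {Φ' : Type} (h : Pl G side) {H : SimpleGraph V} (hH : H ≤ G) (f : Φ → Φ')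
    (hf : ∀ u v, G.Adj u v → ¬ H.Adj u v → f (side u v) = f (side v u))
    (hcyc : ∀ Z, EIn H Z → bd Z = 0 → ∃ A : Set Φ', J H (fun u v => f (side u v)) A = Z) :
    Pl H (fun u v => f (side u v)) := by
  have key : ∀ A : Set Φ', J H (fun u v => f (side u v)) A = J G side (f ⁻¹' A) := by
    intro A
    apply eset_ext
    intro u v
    simp only [mem_J, Set.mem_preimage]
    constructor
    · rintro ⟨h1, h2⟩; exact ⟨hH h1, h2⟩
    · rintro ⟨h1, h2⟩
      refine ⟨?_, h2⟩
      by_contra h3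
      rw [hf u v h1 h3] at h2
      exact h2 Iff.rfl
  refine ⟨fun A => by rw [key]; exact h.even _, hcyc, ?_⟩
  intro A v hv w w' hw hw' hA
  refine h.loc (f ⁻¹' A) v ?_ w w' (hH hw) (hH hw') hA
  intro x hx
  by_cases hx' : H.Adj v x
  · exact hv x hx'
  · simp only [Set.mem_preimage, hf v x hx hx']

/-- Deleting edges. -/
lemma Pl.del (h : Pl G side) {H : SimpleGraph V} (hH : H ≤ G) :
    ∃ (Φ' : Type) (f : Φ → Φ'), Pl H (fun u v => f (side u v)) ∧
      (∀ p, (∀ u v, G.Adj u v → ¬ H.Adj u v → s(u, v) ∉ J G side {p}) →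
        J H (fun u v => f (side u v)) {f p} = J G side {p}) ∧
      ∀ A : Set Φ, (∀ u v, G.Adj u v → ¬ H.Adj u v → s(u, v) ∉ J G side A) →
        ∃ A' : Set Φ', ∀ a, f a ∈ A' ↔ a ∈ A := by
  let r : Φ → Φ → Prop := fun a b => ∃ u v, G.Adj u v ∧ ¬ H.Adj u v ∧ a = side u v ∧ b = side v u
  have hlift : ∀ A : Set Φ, (∀ u v, G.Adj u v → ¬ H.Adj u v → s(u, v) ∉ J G side A) →
      ∃ A' : Set (Quot r), ∀ a, Quot.mk r a ∈ A' ↔ a ∈ A := by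
    intro A hA
    refine ⟨{q | Quot.lift (· ∈ A) ?_ q}, fun a => Iff.rfl⟩
    rintro a b ⟨u, v, h1, h2, rfl, rfl⟩
    have := hA u v h1 h2
    rw [mem_J] at this
    apply propext
    tauto
  have hJ : ∀ A : Set Φ, (∀ u v, G.Adj u v → ¬ H.Adj u v → s(u, v) ∉ J G side A) →
      ∀ A' : Set (Quot r), (∀ a, Quot.mk r a ∈ A' ↔ a ∈ A) →
      J H (fun u v => Quot.mk r (side u v)) A' = J G side A := by
    intro A hA A' hA'
    apply eset_ext
    intro u v
    have := hA u v
    simp only [mem_J, hA'] at this ⊢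
    have := @hH u v
    tauto
  refine ⟨Quot r, Quot.mk r, h.map hH _ ?_ ?_, ?_, hlift⟩
  · intro u v h1 h2
    exact Quot.sound ⟨u, v, h1, h2, rfl, rfl⟩
  · intro Z hZ hb
    obtain ⟨A, rfl⟩ := h.cyc Z (fun u v huv => hH (hZ u v huv)) hb
    have hA : ∀ u v, G.Adj u v → ¬ H.Adj u v → s(u, v) ∉ J G side A :=
      fun u v _ h2 h3 => h2 (hZ u v h3)
    obtain ⟨A', hA'⟩ := hlift A hA
    exact ⟨A', hJ A hA A' hA'⟩
  · intro p hp
    obtain ⟨A', hA'⟩ := hlift {p} hp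
    apply hJ {p} hp
    intro a
    constructor
    · intro ha
      have h1 : Quot.mk r a = Quot.mk r p := ha
      rw [← hA', h1, hA']
      rfl
    · rintro rfl; rfl

/-- Gluing all faces outside a circuit. -/
lemma Pl.glue (h : Pl G side) {Z : Finset (Sym2 V)} (hZ : IsCirc Z) {A : Set Φ}
    (hA : J G side A = Z) (hin : ∀ u v, G.Adj u v → s(u, v) ∉ Z → side u v ∈ A) :
    ∃ (p : Φ) (f : Φ → Φ), Pl G (fun u v => f (side u v)) ∧
      J G (fun u v => f (side u v)) {p} = Z := by
  have hp : ∃ p, p ∉ A := by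
    obtain ⟨e, he⟩ := hZ.1
    induction e with | _ a b =>
    rw [← hA, mem_J] at he
    by_cases h1 : side a b ∈ A
    · exact ⟨side b a, by tauto⟩
    · exact ⟨_, h1⟩
  obtain ⟨p, hp⟩ := hp
  have hin' : ∀ u v, G.Adj u v → s(u, v) ∉ Z → side v u ∈ A := fun u v h1 h2 =>
    hin v u h1.symm (by rwa [Sym2.eq_swap])
  refine ⟨p, fun a => if a ∈ A then a else p, h.map le_rfl (fun a => if a ∈ A then a else p) (fun u v h1 h2 => absurd h1 h2) ?_, ?_⟩
  · intro W hW hb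
    obtain ⟨B, hB⟩ := h.cyc W hW hb
    have hsub : J G side (B \ A) ⊆ Z := by
      intro e he
      induction e with | _ a b =>
      rw [mem_J] at he
      by_contra hc
      have := hin a b he.1 hc
      have := hin' a b he.1 hc
      simp only [Set.mem_diff] at he
      tauto
    have hstep : ∀ C : Set Φ, (∀ a ∈ A, a ∈ C ↔ a ∈ B) →
        (∀ u v, s(u, v) ∈ Z → side v u ∉ A → (side v u ∈ B ↔ p ∈ C)) →
        J G (fun u v => if side u v ∈ A then side u v else p) C = W := by
      intro C h1 h2
      have key : ∀ u v, G.Adj u v →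
          ((if side u v ∈ A then side u v else p) ∈ C ↔ side u v ∈ B) := by
        intro u v huv
        by_cases h9 : side u v ∈ A
        · rw [if_pos h9]; exact h1 _ h9
        · rw [if_neg h9, h2 v u ?_ h9]
          by_contra hc
          exact h9 (hin' v u huv.symm hc)
      subst hB
      apply eset_ext
      intro u v
      rw [mem_J, mem_J]
      refine and_congr_right fun huv => ?_
      rw [key u v huv, key v u huv.symm]
    rcases hZ.2.2 _ hsub (h.even _) with h0 | h0
    · refine ⟨B ∩ A, hstep _ (fun a ha => by simp [ha]) ?_⟩
      intro u v huv hv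
      have hn : s(u, v) ∉ J G side (B \ A) := by rw [h0]; simp
      rw [← hA] at huv
      rw [mem_J] at hn huv
      simp only [Set.mem_diff, Set.mem_inter_iff] at hn ⊢
      tauto
    · refine ⟨(B ∩ A) ∪ {p}, hstep _ (fun a ha => ?_) ?_⟩
      · have : a ≠ p := by rintro rfl; exact hp ha
        simp [ha, this]
      intro u v huv hv
      have hn : s(u, v) ∈ J G side (B \ A) := by rw [h0]; exact huv
      rw [← hA] at huv
      rw [mem_J] at hn huv
      simp only [Set.mem_diff, Set.mem_union, Set.mem_singleton_iff] at hn ⊢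
      tauto
  · subst hA
    apply eset_ext
    intro u v
    have key : ∀ a, ((if a ∈ A then a else p) ∈ ({p} : Set Φ)) ↔ a ∉ A := by
      intro a
      by_cases h9 : a ∈ A
      · have : a ≠ p := fun h2 => hp (h2 ▸ h9)
        simp [h9, this]
      · simp [h9]
    rw [mem_J, mem_J, key, key, not_iff_not]

/-- The graph obtained by merging `q` into `p`. -/
def mergeG (G : SimpleGraph V) (p q : V) : SimpleGraph V where
  Adj u v := u ≠ q ∧ v ≠ q ∧ u ≠ v ∧ (G.Adj u v ∨ (u = p ∧ G.Adj q v) ∨ (v = p ∧ G.Adj u q))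
  symm := ⟨fun u v h => ⟨h.2.1, h.1, h.2.2.1.symm, by
    rcases h.2.2.2 with h | ⟨h, h'⟩ | ⟨h, h'⟩
    exacts [.inl h.symm, .inr (.inr ⟨h, h'.symm⟩), .inr (.inl ⟨h, h'.symm⟩)]⟩⟩
  loopless := ⟨fun v h => h.2.2.1 rfl⟩

/-- The vertex map identifying `q` with `p`. -/
noncomputable def mrg (p q v : V) : V := if v = q then p else v

lemma bd_image {p q : V} (hpq : p ≠ q) {Z : Finset (Sym2 V)} (hZ : EIn G Z)
    (hne : s(p, q) ∉ Z) (hcn : ∀ w, G.Adj p w → ¬ G.Adj q w) (v : V) :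
    bd (Z.image (Sym2.map (mrg p q))) v =
      if v = q then 0 else if v = p then bd Z p + bd Z q else bd Z v := by
  unfold bd
  have hinj : Set.InjOn (Sym2.map (mrg p q)) Z := by
    intro e he e' he' h
    induction e with | _ a b =>
    induction e' with | _ c d =>
    have h1 := hZ _ _ he
    have h2 := hZ _ _ he'
    simp only [Sym2.map_mk, Sym2.eq_iff, mrg] at h ⊢
    have a1 := h1.ne
    have a2 := h2.ne
    have a3 := h1.symm
    have a4 := h2.symm
    have := hcn a; have := hcn b; have := hcn c; have := hcn d
    have n1 : ¬ (a = p ∧ b = q) := by rintro ⟨rfl, rfl⟩; exact hne he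
    have n2 : ¬ (a = q ∧ b = p) := by rintro ⟨rfl, rfl⟩; exact hne (Sym2.eq_swap ▸ he)
    have n3 : ¬ (c = p ∧ d = q) := by rintro ⟨rfl, rfl⟩; exact hne he'
    have n4 : ¬ (c = q ∧ d = p) := by rintro ⟨rfl, rfl⟩; exact hne (Sym2.eq_swap ▸ he')
    grind
  rw [sum_image hinj]
  by_cases hvq : v = q
  · rw [if_pos hvq]
    apply sum_eq_zero
    intro e he
    rw [if_neg]
    simp only [Sym2.mem_map, mrg]
    rintro ⟨a, -, ha⟩
    grind
  rw [if_neg hvq]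
  by_cases hvp : v = p
  · rw [if_pos hvp, ← sum_add_distrib]
    apply sum_congr rfl
    intro e he
    have n1 : ¬ (p ∈ e ∧ q ∈ e) := by
      rintro h
      rw [Sym2.mem_and_mem_iff hpq] at h
      exact hne (h ▸ he)
    simp only [Sym2.mem_map, mrg]
    subst hvp
    by_cases h1 : v ∈ e
    · rw [if_pos ⟨v, h1, if_neg hpq⟩, if_pos h1, if_neg (by tauto)]; simp
    · by_cases h2 : q ∈ e
      · rw [if_pos ⟨q, h2, by simp⟩, if_neg h1, if_pos h2]; simp
      · rw [if_neg, if_neg h1, if_neg h2]; simp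
        rintro ⟨a, ha, h3⟩
        grind
  · rw [if_neg hvp]
    apply sum_congr rfl
    intro e he
    congr 1
    simp only [Sym2.mem_map, mrg, eq_iff_iff]
    grind

/-- Contracting the edge `p q`. -/
lemma Pl.merge (h : Pl G side) {p q : V} (hpq : G.Adj p q)
    (hcn : ∀ w, G.Adj p w → ¬ G.Adj q w) :
    ∃ side' : V → V → Φ, Pl (mergeG G p q) side' ∧
      ∀ A : Set Φ, (∀ w, s(q, w) ∉ J G side A) → J (mergeG G p q) side' A = J G side A := by
  have hne := hpq.ne
  have hcn' : ∀ w, G.Adj q w → ¬ G.Adj p w := fun w h1 h2 => hcn w h2 h1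
  let side' : V → V → Φ := fun u v =>
    if u = p ∧ ¬ G.Adj p v then side q v else if v = p ∧ ¬ G.Adj u p then side u q else side u v
  have hJ : ∀ A, J (mergeG G p q) side' A =
      ((J G side A).erase s(p, q)).image (Sym2.map (mrg p q)) := by
    intro A
    apply eset_ext
    intro u v
    simp only [mem_J, mem_image, mem_erase]
    constructor
    · rintro ⟨⟨h1, h2, h3, h4⟩, h5⟩
      simp only [side'] at h5
      by_cases hG : G.Adj u v
      · refine ⟨s(u, v), ⟨by simp [Sym2.eq_iff, h1, h2], mem_J.2 ⟨hG, ?_⟩⟩, by simp [mrg, h1, h2]⟩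
        have := hG.symm
        have e1 : ¬ (u = p ∧ ¬ G.Adj p v) := by rintro ⟨rfl, h⟩; exact h hG
        have e2 : ¬ (v = p ∧ ¬ G.Adj u p) := by rintro ⟨rfl, h⟩; exact h hG
        have e3 : ¬ (v = p ∧ ¬ G.Adj p u) := by rintro ⟨rfl, h⟩; exact h hG.symm
        have e4 : ¬ (u = p ∧ ¬ G.Adj v p) := by rintro ⟨rfl, h⟩; exact h hG.symm
        simpa only [if_neg e1, if_neg e2, if_neg e3, if_neg e4] using h5
      · rcases h4 with h4 | ⟨rfl, h4⟩ | ⟨rfl, h4⟩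
        · exact absurd h4 hG
        · have h6 : ¬ G.Adj v u := fun h => hG h.symm
          refine ⟨s(q, v), ⟨by simp [Sym2.eq_iff, h2, hne.symm, h3.symm], mem_J.2 ⟨h4, ?_⟩⟩,
            by simp [mrg, h2]⟩
          simpa [hG, h6, h3.symm] using h5
        · have h6 : ¬ G.Adj v u := fun h => hG h.symm
          refine ⟨s(u, q), ⟨by simp [Sym2.eq_iff, h2, hne.symm, h3, h1], mem_J.2 ⟨h4, ?_⟩⟩,
            by simp [mrg, h1]⟩
          simpa [hG, h6, h3] using h5
    · rintro ⟨e, ⟨h1, h2⟩, h3⟩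
      have main : ∀ a b, G.Adj a b → ¬ (side a b ∈ A ↔ side b a ∈ A) → s(a, b) ≠ s(p, q) →
          (mergeG G p q).Adj (mrg p q a) (mrg p q b) ∧
          ¬ (side' (mrg p q a) (mrg p q b) ∈ A ↔ side' (mrg p q b) (mrg p q a) ∈ A) := by
        clear h1 h2 h3
        intro a b h1 h2 h3
        have hab := h1.ne
        by_cases ha : a = q
        · subst ha
          have hbp : b ≠ p := by rintro rfl; exact h3 Sym2.eq_swap
          have e1 : ¬ G.Adj p b := hcn' b h1
          have e2 : ¬ G.Adj b p := fun h => e1 h.symm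
          simp [mrg, hab.symm, mergeG, side', hne, hbp.symm, h1, e1, e2, hbp, h2]
        by_cases hb : b = q
        · subst hb
          have hap : a ≠ p := by rintro rfl; exact h3 rfl
          have e1 : ¬ G.Adj p a := hcn' a h1.symm
          have e2 : ¬ G.Adj a p := fun h => e1 h.symm
          simp [mrg, hab, mergeG, side', hne, hap.symm, h1, e1, e2, hap, h2]
        have e1 : ¬ (a = p ∧ ¬ G.Adj p b) := by rintro ⟨rfl, h⟩; exact h h1
        have e2 : ¬ (b = p ∧ ¬ G.Adj a p) := by rintro ⟨rfl, h⟩; exact h h1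
        have e3 : ¬ (b = p ∧ ¬ G.Adj p a) := by rintro ⟨rfl, h⟩; exact h h1.symm
        have e4 : ¬ (a = p ∧ ¬ G.Adj b p) := by rintro ⟨rfl, h⟩; exact h h1.symm
        have e5 : mrg p q a = a := if_neg ha
        have e6 : mrg p q b = b := if_neg hb
        rw [e5, e6]
        refine ⟨⟨ha, hb, hab, .inl h1⟩, ?_⟩
        simpa only [side', if_neg e1, if_neg e2, if_neg e3, if_neg e4] using h2
      induction e with | _ a b =>
      rw [mem_J] at h2
      rw [Sym2.map_mk, Sym2.eq_iff] at h3
      rcases h3 with ⟨rfl, rfl⟩ | ⟨rfl, rfl⟩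
      · exact main a b h2.1 h2.2 h1
      · exact main b a h2.1.symm (by tauto) (by rwa [Sym2.eq_swap])
  have hE : ∀ A, EIn G ((J G side A).erase s(p, q)) := fun A => eIn_J.mono (erase_subset _ _)
  refine ⟨side', ⟨?_, ?_, ?_⟩, ?_⟩
  · intro A
    rw [hJ]
    ext v
    rw [bd_image hne (hE A) (by simp) hcn]
    have h1 : bd ((J G side A).erase s(p, q)) = 0 ∨
        bd ((J G side A).erase s(p, q)) = pt p + pt q := by
      by_cases h2 : s(p, q) ∈ J G side A
      · right; rw [bd_erase hne h2, h.even, add_zero]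
      · left; rw [erase_eq_of_notMem h2, h.even]
    rcases h1 with h1 | h1 <;> rw [h1]
    · simp
    · simp only [Pi.add_apply, Pi.zero_apply, pt]
      split_ifs <;> simp_all [add_self_zmod]
  · intro Z hZ hb
    let W : Finset (Sym2 V) := (Set.toFinite
      {e : Sym2 V | (e ∈ G.edgeSet ∧ e ≠ s(p, q)) ∧ e.map (mrg p q) ∈ Z}).toFinset
    have hmW : ∀ e, e ∈ W ↔ e ∈ G.edgeSet ∧ e ≠ s(p, q) ∧ e.map (mrg p q) ∈ Z := by
      intro e
      simp only [W, Set.Finite.mem_toFinset, Set.mem_ofPred_eq, and_assoc]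
    have hWG : EIn G W := fun u v huv => ((hmW _).1 huv).1
    have hWp : s(p, q) ∉ W := fun hc => ((hmW _).1 hc).2.1 rfl
    have hWZ : W.image (Sym2.map (mrg p q)) = Z := by
      ext e
      simp only [mem_image, hmW]
      constructor
      · rintro ⟨e, he, rfl⟩; exact he.2.2
      · intro he
        induction e with | _ u v =>
        obtain ⟨h1, h2, h3, h4 | ⟨rfl, h4⟩ | ⟨rfl, h4⟩⟩ := hZ _ _ he
        · exact ⟨s(u, v), ⟨h4, by simp [Sym2.eq_iff, h1, h2], by simpa [mrg, h1, h2] using he⟩,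
            by simp [mrg, h1, h2]⟩
        · exact ⟨s(q, v), ⟨h4, by simp [Sym2.eq_iff, h1.symm, h3.symm],
            by simpa [mrg, h2] using he⟩, by simp [mrg, h2]⟩
        · exact ⟨s(u, q), ⟨h4, by simp [Sym2.eq_iff, h1, h3],
            by simpa [mrg, h1] using he⟩, by simp [mrg, h1]⟩
    have hbW := fun v => bd_image hne hWG hWp hcn v
    rw [hWZ, hb] at hbW
    have h3 : bd W = 0 ∨ bd W = pt p + pt q := by
      have e1 := hbW p
      simp only [if_neg hne] at e1
      rcases zmod_cases (bd W p) with e2 | e2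
      · left; ext v
        have e3 := hbW v
        by_cases hvp : v = p
        · subst hvp; exact e2
        by_cases hvq : v = q
        · subst hvq; simpa [e2] using e1.symm
        · simpa [hvp, hvq] using e3.symm
      · right; ext v
        have e3 := hbW v
        by_cases hvp : v = p
        · subst hvp; simp [e2, pt, hne]
        by_cases hvq : v = q
        · subst hvq; rw [e2] at e1; simp [pt, hvp]
          rcases zmod_cases (bd W v) with e4 | e4
          · rw [e4] at e1; simp at e1
          · exact e4
        · simpa [hvp, hvq, pt] using e3.symm
    have h4 : ∃ W', EIn G W' ∧ bd W' = 0 ∧ W'.erase s(p, q) = W := by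
      rcases h3 with h3 | h3
      · exact ⟨W, hWG, h3, erase_eq_of_notMem hWp⟩
      · refine ⟨insert s(p, q) W, hWG.insert hpq, ?_, erase_insert hWp⟩
        rw [bd_insert hne hWp, h3]
        linear_combination (pt p + pt q) * two_zmod_pi (V := V)
    obtain ⟨W', hW', hb', hWW⟩ := h4
    obtain ⟨A, rfl⟩ := h.cyc W' hW' hb'
    exact ⟨A, by rw [hJ A, hWW, hWZ]⟩
  · intro A v hv
    by_cases hvq : v = q
    · subst hvq; intro w w' hw; exact absurd rfl hw.1
    by_cases hvp : v = p
    · subst hvp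
      have n1 : ∀ w, G.Adj v w → w ≠ q → (side v w ∈ A ↔ side w v ∈ A) := by
        intro w hw hwq
        have := hv w ⟨hvq, hwq, hw.ne, .inl hw⟩
        simpa [side', hw, hw.symm, hw.ne.symm] using this
      have n2 : ∀ w, G.Adj q w → w ≠ v → (side q w ∈ A ↔ side w q ∈ A) := by
        intro w hw hwq
        have := hv w ⟨hvq, hw.ne.symm, hwq.symm, .inr (.inl ⟨rfl, hw⟩)⟩
        have e1 := hcn' w hw
        have e2 : ¬ G.Adj w v := fun h => e1 h.symm
        simpa [side', e1, hwq, e2] using this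
      have n3 : (side v q ∈ A ↔ side q v ∈ A) := by
        by_contra hc
        have h1 := congrFun (h.even A) v
        rw [bd_nbrs {q}] at h1
        · simp only [sum_singleton, mem_J] at h1
          rw [if_pos ⟨hpq, hc⟩] at h1
          exact one_ne_zero h1
        · intro w hw
          rw [mem_J] at hw
          by_contra hwq
          exact hw.2 (n1 w hw.1 (by simpa using hwq))
      have l1 := h.loc A v (fun w hw => by
        by_cases hwq : w = q
        · subst hwq; exact n3
        · exact n1 w hw hwq)
      have l2 := h.loc A q (fun w hw => by
        by_cases hwq : w = v
        · subst hwq; exact n3.symm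
        · exact n2 w hw hwq)
      have l3 : ∀ w, (mergeG G v q).Adj v w → (side' v w ∈ A ↔ side v q ∈ A) := by
        rintro w ⟨h1, h2, h3, h4⟩
        by_cases hw : G.Adj v w
        · simp only [side', hw, h3, h3.symm, not_true, and_false, if_false, false_and]
          exact ⟨l1 w q hw hpq, l1 q w hpq hw⟩
        · have hw' : G.Adj q w := by
            rcases h4 with h4 | h4 | h4
            exacts [absurd h4 hw, h4.2, absurd h4.1.symm h3]
          simp only [side', hw, not_false_eq_true, and_self, if_true]
          rw [n3]
          exact ⟨l2 w v hw' hpq.symm, l2 v w hpq.symm hw'⟩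
      intro w w' hw hw' hA
      rw [l3 w' hw', ← l3 w hw]; exact hA
    · have l3 : ∀ w, (mergeG G p q).Adj v w → ∃ x, G.Adj v x ∧ side' v w = side v x ∧
          side' w v = side x v := by
        rintro w ⟨h1, h2, h3, h4⟩
        by_cases hw : G.Adj v w
        · refine ⟨w, hw, ?_, ?_⟩ <;> simp only [side', hvp, false_and, if_false] <;> rw [if_neg]
          · rintro ⟨rfl, h⟩; exact h hw
          · rintro ⟨rfl, h⟩; exact h hw.symm
        · obtain ⟨rfl, h5⟩ : w = p ∧ G.Adj v q := by tauto
          have hw' : ¬ G.Adj w v := fun h => hw h.symm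
          refine ⟨q, h5, ?_, ?_⟩
          · simp [side', hvp, hw]
          · simp [side', hvp, hw']
      have l4 : ∀ x, G.Adj v x → ∃ w, (mergeG G p q).Adj v w ∧ side' v w = side v x ∧
          side' w v = side x v := by
        intro x hx
        by_cases hxq : x = q
        · subst hxq
          have hw : ¬ G.Adj v p := fun h => hcn v h.symm hx.symm
          have hw' : ¬ G.Adj p v := fun h => hw h.symm
          refine ⟨p, ⟨hvq, hne, hvp, .inr (.inr ⟨rfl, hx⟩)⟩, ?_, ?_⟩
          · simp [side', hvp, hw]
          · simp [side', hw']
        · refine ⟨x, ⟨hvq, hxq, hx.ne, .inl hx⟩, ?_, ?_⟩ <;>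
            simp only [side', hvp, false_and, if_false] <;> rw [if_neg]
          · rintro ⟨rfl, h⟩; exact h hx
          · rintro ⟨rfl, h⟩; exact h hx.symm
      intro w w' hw hw' hA
      obtain ⟨x, hx, e1, -⟩ := l3 w hw
      obtain ⟨x', hx', e2, -⟩ := l3 w' hw'
      rw [e1] at hA
      rw [e2]
      refine h.loc A v ?_ x x' hx hx' hA
      intro y hy
      obtain ⟨z, hz, e3, e4⟩ := l4 y hy
      rw [← e3, ← e4]
      exact hv z hz
  · intro A hA
    rw [hJ, erase_eq_of_notMem (by rw [Sym2.eq_swap]; exact hA p)]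
    have : ∀ e ∈ J G side A, Sym2.map (mrg p q) e = e := by
      intro e he
      induction e with | _ a b =>
      have h1 : a ≠ q := by rintro rfl; exact hA _ he
      have h2 : b ≠ q := by rintro rfl; rw [Sym2.eq_swap] at he; exact hA _ he
      simp [mrg, h1, h2]
    rw [image_congr (g := id) (fun e he => this e he), image_id]

end Plane

section Plane2
variable [Finite V] {G : SimpleGraph V}

/-- A plane structure whose outer face is bounded by `E0` (if `E0` is nonempty). -/
def PlO (G : SimpleGraph V) (E0 : Finset (Sym2 V)) : Prop :=
  ∃ (Φ : Type) (side : V → V → Φ) (p : Φ), Pl G side ∧ (E0 = ∅ ∨ J G side {p} = E0)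

lemma PlO.del {E0 : Finset (Sym2 V)} (h : PlO G E0) {H : SimpleGraph V} (hH : H ≤ G)
    (hE : EIn H E0) : PlO H E0 := by
  obtain ⟨Φ, side, p, h1, h2⟩ := h
  obtain ⟨Φ', f, h3, h4, -⟩ := h1.del hH
  refine ⟨Φ', _, f p, h3, h2.imp id fun h2 => ?_⟩
  rw [h4 p, h2]
  intro u v h5 h6 h7
  exact h6 (hE u v (h2 ▸ h7))

lemma PlO.merge {E0 : Finset (Sym2 V)} (h : PlO G E0) {p q : V} (hpq : G.Adj p q)
    (hcn : ∀ w, G.Adj p w → ¬ G.Adj q w) (hq : ¬ On E0 q) : PlO (mergeG G p q) E0 := by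
  obtain ⟨Φ, side, p, h1, h2⟩ := h
  obtain ⟨side', h3, h4⟩ := h1.merge hpq hcn
  refine ⟨Φ, _, p, h3, h2.imp id fun h2 => ?_⟩
  rw [h4, h2]
  intro w hw
  rw [h2] at hw
  exact hq (on_left hw)

/-- Deleting a set of vertices. -/
def delG (G : SimpleGraph V) (D : Set V) : SimpleGraph V where
  Adj u v := G.Adj u v ∧ u ∉ D ∧ v ∉ D
  symm := ⟨fun u v h => ⟨h.1.symm, h.2.2, h.2.1⟩⟩
  loopless := ⟨fun v h => h.1.ne rfl⟩

/-- Adding an edge. -/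
def addG (G : SimpleGraph V) (p q : V) : SimpleGraph V where
  Adj u v := u ≠ v ∧ (G.Adj u v ∨ (u = p ∧ v = q) ∨ (u = q ∧ v = p))
  symm := ⟨fun u v h => ⟨h.1.symm, by
    rcases h.2 with h | ⟨h, h'⟩ | ⟨h, h'⟩
    exacts [.inl h.symm, .inr (.inr ⟨h', h⟩), .inr (.inl ⟨h', h⟩)]⟩⟩
  loopless := ⟨fun v h => h.1 rfl⟩

lemma delG_le (D : Set V) : delG G D ≤ G := fun _ _ h => h.1

/-- Suppressing a vertex of degree two. -/
lemma PlO.suppress {E0 : Finset (Sym2 V)} (h : PlO G E0) {v a b : V}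
    (hN : ∀ w, G.Adj v w ↔ w = a ∨ w = b) (hab : a ≠ b) (hadj : ¬ G.Adj a b)
    (hv : ¬ On E0 v) : PlO (addG (delG G {v}) a b) E0 := by
  have h1 : G.Adj a v := ((hN a).2 (.inl rfl)).symm
  have := h.merge h1 (fun w hw hw' => by
    rcases (hN w).1 hw' with rfl | rfl
    · exact hw.ne rfl
    · exact hadj hw) hv
  convert this using 1
  ext x y
  simp only [addG, delG, mergeG, hN, Set.mem_singleton_iff, G.adj_comm x v]
  have hb := ((hN b).2 (.inr rfl)).ne
  have ha := h1.ne
  constructor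
  · rintro ⟨h2, ⟨h3, h4, h5⟩ | ⟨rfl, rfl⟩ | ⟨rfl, rfl⟩⟩ <;> simp_all
    all_goals exact Ne.symm hb
  · rintro ⟨h2, h3, h4, h5 | ⟨rfl, rfl | rfl⟩ | ⟨rfl, rfl | rfl⟩⟩ <;> simp_all

lemma addG_comm (G : SimpleGraph V) (a b c d : V) :
    addG (addG G a b) c d = addG (addG G c d) a b := by
  ext u v
  simp only [addG]
  tauto

lemma PlO.suppress' {E0 : Finset (Sym2 V)} {v a b : V}
    (h : PlO (addG (addG G a v) v b) E0) (hK : ∀ w, ¬ G.Adj v w) (hav : a ≠ v) (hbv : b ≠ v)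
    (hab : a ≠ b) (hadj : ¬ G.Adj a b) (hv : ¬ On E0 v) : PlO (addG G a b) E0 := by
  have := h.suppress (v := v) (a := a) (b := b) (by
    intro w
    simp only [addG, hK]
    constructor
    · rintro ⟨-, hh⟩; tauto
    · rintro (rfl | rfl)
      · exact ⟨hav.symm, by tauto⟩
      · exact ⟨hbv.symm, by tauto⟩) hab (by simp only [addG]; tauto) hv
  convert this using 1
  ext x y
  have k1 := hK y
  have k2 : ¬ G.Adj x v := fun h => hK x h.symm
  simp only [addG, delG, Set.mem_singleton_iff]
  by_cases hx : x = v <;> by_cases hy : y = v <;> simp_all [eq_comm]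

/-- Replacing a path through deleted vertices by an edge. -/
lemma PlO.path {E0 : Finset (Sym2 V)} (h : PlO G E0) {D : Set V} {p x y z q : V}
    (hE : EIn (delG G D) E0)
    (h1 : G.Adj p x) (h2 : G.Adj x y) (h3 : G.Adj y z) (h4 : G.Adj z q)
    (hx : x ∈ D) (hy : y ∈ D) (hz : z ∈ D) (hp : p ∉ D) (hq : q ∉ D)
    (hxz : x ≠ z) (hpq : p ≠ q) (hn : ¬ G.Adj p q) : PlO (addG (delG G D) p q) E0 := by
  have hEon : ∀ v ∈ D, ¬ On E0 v := by
    intro v hv ho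
    obtain ⟨w, hw⟩ := on_iff.1 ho
    exact (hE _ _ hw).2.1 hv
  have nxy := h2.ne
  have nyz := h3.ne
  have npx : p ≠ x := by rintro rfl; exact hp hx
  have npy : p ≠ y := by rintro rfl; exact hp hy
  have npz : p ≠ z := by rintro rfl; exact hp hz
  have nqx : q ≠ x := by rintro rfl; exact hq hx
  have nqy : q ≠ y := by rintro rfl; exact hq hy
  have nqz : q ≠ z := by rintro rfl; exact hq hz
  let H0 := addG (addG (addG (addG (delG G D) y z) z q) p x) x y
  have hH0 : H0 ≤ G := by
    rintro u v ⟨-, (⟨-, (⟨-, (⟨-, (⟨hh, -⟩ | ⟨rfl, rfl⟩ | ⟨rfl, rfl⟩)⟩ | ⟨rfl, rfl⟩ | ⟨rfl, rfl⟩)⟩ |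
      ⟨rfl, rfl⟩ | ⟨rfl, rfl⟩)⟩ | ⟨rfl, rfl⟩ | ⟨rfl, rfl⟩)⟩
    exacts [hh, h3, h3.symm, h4, h4.symm, h1, h1.symm, h2, h2.symm]
  have h0 : PlO H0 E0 := h.del hH0 (fun u v huv => by
    have := hE u v huv
    have hne := this.1.ne
    simp [H0, addG, this, hne])
  have hK : ∀ v ∈ D, ∀ w, ¬ (delG G D).Adj v w := fun v hv w hw => hw.2.1 hv
  have e1 : PlO (addG (addG (addG (delG G D) z q) p y) y z) E0 := by
    have := h0.suppress' (fun w hw => by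
      rcases hw with ⟨-, ⟨-, hw | hw | hw⟩ | hw | hw⟩
      · exact hK x hx w hw
      · exact nxy hw.1
      · exact hxz hw.1
      · exact hxz hw.1
      · exact nqx hw.1.symm) npx nxy.symm npy (by
      rintro ⟨-, ⟨-, hw | hw | hw⟩ | hw | hw⟩
      · exact hK y hy p hw.symm
      · exact npy hw.1
      · exact npz hw.1
      · exact npz hw.1
      · exact hpq hw.1) (hEon x hx)
    rwa [addG_comm (delG G D), addG_comm _ y z] at this
  have e2 : PlO (addG (addG (delG G D) p z) z q) E0 := by
    have := e1.suppress' (fun w hw => by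
      rcases hw with ⟨-, hw | hw | hw⟩
      · exact hK y hy w hw
      · exact nyz hw.1
      · exact nqy hw.1.symm) npy nyz.symm npz (by
      rintro ⟨-, hw | hw | hw⟩
      · exact hK z hz p hw.symm
      · exact npz hw.1
      · exact hpq hw.1) (hEon y hy)
    rwa [addG_comm] at this
  exact e2.suppress' (fun w hw => hK z hz w hw) npz nqz hpq (fun hw => hn hw.1) (hEon z hz)

section Euler
variable {Φ : Type} {side : V → V → Φ}

lemma bd_sum_zero (W : Finset V) (Z : Finset (Sym2 V)) (hl : Loopless Z)
    (hW : ∀ v, On Z v → v ∈ W) : ∑ v ∈ W, bd Z v = 0 := by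
  unfold bd
  rw [sum_comm]
  apply sum_eq_zero
  intro e he
  induction e with | _ a b =>
  have hab : a ≠ b := by rintro rfl; exact hl _ he
  rw [← sum_filter, show W.filter (fun v => v ∈ s(a, b)) = {a, b} by
    ext v; simp only [mem_filter, Sym2.mem_iff, mem_insert, mem_singleton]
    constructor
    · exact fun h => h.2
    · rintro (rfl | rfl)
      · exact ⟨hW _ (on_left he), .inl rfl⟩
      · exact ⟨hW _ (on_right he), .inr rfl⟩]
  rw [sum_pair hab]; exact add_self_zmod 1

/-- The number of edges is at most `|W| - 1` plus the number of generators of the cycle space. -/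
lemma card_edges_le_of_span (E : Finset (Sym2 V)) (hl : Loopless E) (W : Finset V) (v0 : V)
    (hv0 : v0 ∈ W) (hW : ∀ v, On E v → v ∈ W) (k : ℕ)
    (hk : (E.powerset.filter (fun Z => bd Z = 0)).card ≤ 2 ^ k) :
    E.card + 1 ≤ W.card + k := by
  let f : Finset (Sym2 V) → Finset V := fun Z => (W.erase v0).filter (fun v => bd Z v = 1)
  have hmaps : ∀ Z ∈ E.powerset, f Z ∈ (W.erase v0).powerset := fun Z _ => by
    simp [f, filter_subset]
  have hdet : ∀ Z ⊆ E, ∀ Z' ⊆ E, f Z = f Z' → bd Z = bd Z' := by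
    intro Z hZ Z' hZ' hf
    have h1 : ∀ v, v ≠ v0 → bd Z v = bd Z' v := by
      intro v hv
      by_cases hvW : v ∈ W
      · have h2 : v ∈ f Z ↔ v ∈ f Z' := by rw [hf]
        simp only [f, mem_filter, mem_erase, hv, hvW, ne_eq, not_false_eq_true,
          true_and] at h2
        rcases zmod_cases (bd Z v) with h3 | h3 <;> rcases zmod_cases (bd Z' v) with h4 | h4 <;>
          simp_all
      · rw [bd_eq_zero_of_not_on fun h => hvW (hW _ (h.mono hZ)),
          bd_eq_zero_of_not_on fun h => hvW (hW _ (h.mono hZ'))]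
    ext v
    by_cases hv : v = v0
    · subst hv
      have e1 := bd_sum_zero W Z (hl.mono hZ) (fun v h => hW v (h.mono hZ))
      have e2 := bd_sum_zero W Z' (hl.mono hZ') (fun v h => hW v (h.mono hZ'))
      rw [← add_sum_erase _ _ hv0] at e1 e2
      rw [sum_congr rfl (fun x hx => h1 x (ne_of_mem_erase hx))] at e1
      exact add_right_cancel (e1.trans e2.symm)
    · exact h1 v hv
  have hcard := card_le_mul_card_image_of_maps_to (f := f) hmaps (2 ^ k) (by
    intro B hB
    by_cases hne : (E.powerset.filter (fun Z => f Z = B)).Nonempty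
    · obtain ⟨Z0, hZ0⟩ := hne
      simp only [mem_filter, mem_powerset] at hZ0
      refine le_trans ?_ hk
      refine card_le_card_of_injOn (fun Z => symmDiff Z Z0) ?_ ?_
      · intro Z hZ
        simp only [mem_coe, mem_filter, mem_powerset] at hZ ⊢
        refine ⟨(symmDiff_le_sup : symmDiff Z Z0 ≤ _).trans (union_subset hZ.1 hZ0.1), ?_⟩
        rw [bd_symmDiff, hdet Z hZ.1 Z0 hZ0.1 (hZ.2.trans hZ0.2.symm)]
        ext v; exact add_self_zmod _
      · intro Z _ Z' _ h
        exact symmDiff_left_injective Z0 h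
    · rw [not_nonempty_iff_eq_empty] at hne
      rw [hne]; simp)
  rw [card_powerset, card_powerset, ← pow_add,
    Nat.pow_le_pow_iff_right (by norm_num), card_erase_of_mem hv0] at hcard
  have : 0 < W.card := card_pos.2 ⟨v0, hv0⟩
  omega

/-- A form of Euler's formula. -/
lemma Pl.euler (h : Pl G side) (E : Finset (Sym2 V)) (hE : ∀ u v, s(u, v) ∈ E ↔ G.Adj u v)
    (W : Finset V) (v0 : V) (hv0 : v0 ∈ W) (hW : ∀ u v, G.Adj u v → u ∈ W) (p : Φ) :
    ∃ S : Finset (Finset (Sym2 V)), (∀ Z ∈ S, Z.Nonempty ∧ ∃ q, q ≠ p ∧ J G side {q} = Z) ∧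
      E.card + 1 ≤ W.card + S.card ∧ ∑ Z ∈ S, Z.card + (J G side {p}).card ≤ 2 * E.card := by
  haveI := Fintype.ofFinite V
  let F : Finset Φ := univ.image (fun d : V × V => side d.1 d.2)
  have hF : ∀ u v, side u v ∈ F := fun u v => mem_image.2 ⟨(u, v), by simp, rfl⟩
  let S := ((F.erase p).image (fun q => J G side {q})).erase ∅
  have hS : ∀ Z, Z ∈ S ↔ Z ≠ ∅ ∧ ∃ q, (q ≠ p ∧ q ∈ F) ∧ J G side {q} = Z := by
    intro Z; simp [S]
  have hJE : ∀ A, J G side A ⊆ E := by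
    intro A e he
    induction e with | _ a b => rw [hE]; exact eIn_J _ _ he
  refine ⟨S, ?_, ?_, ?_⟩
  · intro Z hZ
    obtain ⟨h1, q, h2, h3⟩ := (hS Z).1 hZ
    exact ⟨nonempty_iff_ne_empty.2 h1, q, h2.1, h3⟩
  · refine card_edges_le_of_span E (fun v hv => ((hE v v).1 hv).ne rfl) W v0 hv0 ?_ _ ?_
    · intro v hv
      obtain ⟨w, hw⟩ := on_iff.1 hv
      exact hW _ _ ((hE _ _).1 hw)
    · rw [← card_powerset]
      refine card_le_card_of_surjOn (fun T => T.fold symmDiff ∅ id) ?_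
      intro Z hZ
      simp only [mem_coe, mem_filter, mem_powerset] at hZ
      obtain ⟨A, hA⟩ := h.cyc Z (fun u v huv => (hE _ _).1 (hZ.1 huv)) hZ.2
      have h1 : ∃ A, p ∉ A ∧ J G side A = Z := by
        by_cases hp : p ∈ A
        · exact ⟨Aᶜ, by simpa using hp, by rw [J_compl, hA]⟩
        · exact ⟨A, hp, hA⟩
      clear hA
      obtain ⟨A, hpA, hA⟩ := h1
      have h2 : J G side (↑(F.filter (· ∈ A)) : Set Φ) = Z := by
        rw [← hA]; apply eset_ext; intro u v
        simp [mem_J, hF]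
      have h3 : ∀ B : Finset Φ, B ⊆ F.erase p → ∃ T ∈ S.powerset,
          T.fold symmDiff ∅ id = J G side (↑B : Set Φ) := by
        intro B
        induction B using Finset.induction_on with
        | empty =>
          intro _
          refine ⟨∅, by simp, ?_⟩
          simp only [fold_empty]
          apply eset_ext; intro u v; simp [mem_J]
        | insert q B hq ih =>
          intro hB
          obtain ⟨T, hT, hT'⟩ := ih (fun x hx => hB (mem_insert_of_mem hx))
          have e1 : J G side (↑(insert q B) : Set Φ) =
              symmDiff (J G side {q}) (J G side (↑B : Set Φ)) := by
            rw [← J_symmDiff]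
            congr 1
            ext x
            simp only [coe_insert, Set.mem_insert_iff, mem_coe, Set.mem_symmDiff,
              Set.mem_singleton_iff]
            by_cases hx : x = q
            · subst hx; simp [hq]
            · simp [hx]
          rw [e1, ← hT']
          have hqF := hB (mem_insert_self q B)
          by_cases hem : J G side {q} = ∅
          · refine ⟨T, hT, ?_⟩
            rw [hem]; exact (bot_symmDiff _).symm
          have hqS : J G side {q} ∈ S := (hS _).2 ⟨hem, q, by simpa using hqF, rfl⟩
          by_cases hqT : J G side {q} ∈ T
          · refine ⟨T.erase (J G side {q}), ?_, ?_⟩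
            · rw [mem_powerset] at hT ⊢; exact (erase_subset _ _).trans hT
            · conv_rhs => rw [← insert_erase hqT]
              rw [fold_insert (by simp)]
              simp
          · refine ⟨insert (J G side {q}) T, ?_, ?_⟩
            · rw [mem_powerset] at hT ⊢; exact insert_subset hqS hT
            · rw [fold_insert hqT]; rfl
      obtain ⟨T, hT, hT'⟩ := h3 (F.filter (· ∈ A)) (by
        intro x hx
        simp only [mem_filter] at hx
        exact mem_erase.2 ⟨fun h => hpA (h ▸ hx.2), hx.1⟩)
      exact ⟨T, by simpa using hT, by rw [← h2, ← hT']⟩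
  · have hch : ∀ Z ∈ S, ∃ q, (q ≠ p ∧ q ∈ F) ∧ J G side {q} = Z := fun Z hZ => ((hS Z).1 hZ).2
    let g : Finset (Sym2 V) → Φ := fun Z => if hZ : Z ∈ S then (hch Z hZ).choose else p
    have hg : ∀ Z (hZ : Z ∈ S), g Z = (hch Z hZ).choose := fun Z hZ => dif_pos hZ
    have hg1 : ∀ Z ∈ S, g Z ≠ p ∧ g Z ∈ F := fun Z hZ => by
      rw [hg Z hZ]; exact (hch Z hZ).choose_spec.1
    have hg2 : ∀ Z ∈ S, J G side {g Z} = Z := fun Z hZ => by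
      rw [hg Z hZ]; exact (hch Z hZ).choose_spec.2
    let P : Finset Φ := insert p (S.image g)
    have hpn : p ∉ S.image g := by
      simp only [mem_image, not_exists, not_and]
      intro Z hZ h; exact (hg1 Z hZ).1 h
    have hginj : Set.InjOn g S := by
      intro Z hZ Z' hZ' h
      rw [← hg2 Z hZ, ← hg2 Z' hZ', h]
    have h1 : ∑ Z ∈ S, Z.card + (J G side {p}).card = ∑ q ∈ P, (J G side {q}).card := by
      rw [sum_insert hpn, sum_image hginj, add_comm]
      congr 1
      exact sum_congr rfl fun Z hZ => by rw [hg2 Z hZ]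
    rw [h1]
    have h2 : ∀ q ∈ P, (J G side {q}).card = ∑ e ∈ E, if e ∈ J G side {q} then 1 else 0 := by
      intro q _
      rw [← sum_filter, sum_const, smul_eq_mul, mul_one]
      congr 1
      ext e; simp only [mem_filter]
      exact ⟨fun h => ⟨hJE _ h, h⟩, fun h => h.2⟩
    rw [sum_congr rfl h2, sum_comm, mul_comm, ← smul_eq_mul, ← sum_const]
    apply sum_le_sum
    intro e he
    induction e with | _ a b =>
    rw [← sum_filter, sum_const, smul_eq_mul, mul_one]
    refine le_trans (card_le_card (t := {side a b, side b a}) ?_) card_le_two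
    intro q hq
    simp only [mem_filter, mem_J, Set.mem_singleton_iff, mem_insert,
      mem_singleton] at hq ⊢
    by_contra hc
    push Not at hc
    exact hq.2.2 (by simp [hc.1.symm, hc.2.symm])

end Euler
end Plane2

section Fst

/-- `S` induces a forest in `H`, even after connecting all vertices of `B` (edges inside `B`
are ignored). -/
def Fst (H : SimpleGraph V) (S B : Finset V) : Prop :=
  ∀ X ⊆ S, X.Nonempty → ∃ v ∈ X, ∀ w w', w ∈ X ∪ B → w' ∈ X ∪ B → H.Adj v w → H.Adj v w' → w = w'

variable {H H' : SimpleGraph V} {S S' B : Finset V}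

lemma Fst.mono (h : Fst H S B) (hS : S' ⊆ S)
    (hH : ∀ u v, u ∈ S' → v ∈ S' ∪ B → H'.Adj u v → H.Adj u v) : Fst H' S' B := by
  intro X hX hne
  obtain ⟨v, hv, h1⟩ := h X (hX.trans hS) hne
  refine ⟨v, hv, fun w w' hw hw' ha ha' => h1 w w' hw hw' (hH _ _ (hX hv) ?_ ha) (hH _ _ (hX hv) ?_ ha')⟩
  · exact union_subset_union_left hX hw
  · exact union_subset_union_left hX hw'

lemma Fst.addLeaf (h : Fst H S B) {v : V}
    (hv : ∀ w w', w ∈ S ∪ B → w' ∈ S ∪ B → H.Adj v w → H.Adj v w' → w = w') :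
    Fst H (insert v S) B := by
  intro X hX hne
  by_cases hvX : v ∈ X
  · have key : ∀ w ∈ X ∪ B, H.Adj v w → w ∈ S ∪ B := by
      intro w hw ha
      rcases mem_union.1 hw with hw | hw
      · rcases mem_insert.1 (hX hw) with rfl | hw
        · exact absurd rfl ha.ne
        · exact mem_union_left _ hw
      · exact mem_union_right _ hw
    exact ⟨v, hvX, fun w w' hw hw' ha ha' => hv w w' (key w hw ha) (key w' hw' ha') ha ha'⟩
  · exact h X (fun x hx => (mem_insert.1 (hX hx)).resolve_left
      (by rintro rfl; exact hvX hx)) hne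

/-- Adding the edge `p q` creates no cycle. -/
def Sep (H : SimpleGraph V) (S B : Finset V) (p q : V) : Prop :=
  p ≠ q ∧ ¬ H.Adj p q ∧ (p ∈ S ∨ q ∈ S) ∧ Fst (addG H p q) S B

lemma addG_swap (p q : V) : addG H p q = addG H q p := by
  ext u v; simp only [addG]; tauto

lemma Sep.symm {p q : V} (h : Sep H S B p q) : Sep H S B q p :=
  ⟨h.1.symm, fun h' => h.2.1 h'.symm, h.2.2.1.symm, by rw [addG_swap]; exact h.2.2.2⟩

lemma Sep.fst {p q : V} (h : Sep H S B p q) : Fst H S B :=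
  h.2.2.2.mono le_rfl fun u v _ _ h => ⟨h.ne, .inl h⟩

lemma Sep.subdiv (hd : Disjoint S B) {p q v : V} (h : Sep H S B p q)
    (hvS : v ∉ S) (hvB : v ∉ B)
    (hN : ∀ w ∈ S ∪ B, H.Adj v w → w = p ∨ w = q) : Fst H (insert v S) B := by
  wlog hp : p ∈ S generalizing p q
  · exact this h.symm (fun w hw ha => (hN w hw ha).symm) (h.2.2.1.resolve_left hp)
  obtain ⟨hpq, hn, -, hF⟩ := h
  intro X hX hne
  by_cases hvX : v ∈ X
  swap
  · obtain ⟨x, hx, h1⟩ := hF X (fun x hx => (mem_insert.1 (hX hx)).resolve_left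
      (by rintro rfl; exact hvX hx)) hne
    exact ⟨x, hx, fun w w' hw hw' ha ha' => h1 w w' hw hw' ⟨ha.ne, .inl ha⟩ ⟨ha'.ne, .inl ha'⟩⟩
  have hN' : ∀ w ∈ X ∪ B, H.Adj v w → w = p ∨ w = q := by
    intro w hw ha
    refine hN w ?_ ha
    rcases mem_union.1 hw with hw | hw
    · rcases mem_insert.1 (hX hw) with rfl | hw
      · exact absurd rfl ha.ne
      · exact mem_union_left _ hw
    · exact mem_union_right _ hw
  by_cases hc : (p ∈ X ∪ B ∧ H.Adj v p) ∧ (q ∈ X ∪ B ∧ H.Adj v q)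
  swap
  · refine ⟨v, hvX, fun w w' hw hw' ha ha' => ?_⟩
    rcases hN' w hw ha with rfl | rfl <;> rcases hN' w' hw' ha' with rfl | rfl <;> tauto
  have hpX : p ∈ X := by
    have := Finset.disjoint_left.1 hd hp
    have := hc.1.1
    simp only [mem_union] at this; tauto
  have hpv : p ≠ v := by rintro rfl; exact hvS hp
  have hqv : q ≠ v := fun h => hc.2.2.ne h.symm
  obtain ⟨x, hx, h1⟩ := hF (X.erase v) (fun x hx => by
    rw [mem_erase] at hx
    exact (mem_insert.1 (hX hx.2)).resolve_left hx.1) ⟨p, by simp [hpX, hpv]⟩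
  have hm : ∀ w, w ≠ v → w ∈ X ∪ B → w ∈ X.erase v ∪ B := by
    intro w hw; simp only [mem_union, mem_erase]; tauto
  rw [mem_erase] at hx
  refine ⟨x, hx.2, ?_⟩
  by_cases hxp : x = p
  · subst hxp
    have hq : ∀ w, w ∈ X ∪ B → H.Adj x w → w = v := by
      intro w hw ha
      by_contra hwv
      have := h1 w q (hm _ hwv hw) (hm _ hqv hc.2.1) ⟨ha.ne, .inl ha⟩ ⟨hpq, by tauto⟩
      subst this; exact hn ha
    intro w w' hw hw' ha ha'
    rw [hq w hw ha, hq w' hw' ha']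
  by_cases hxq : x = q
  · subst hxq
    have hq : ∀ w, w ∈ X ∪ B → H.Adj x w → w = v := by
      intro w hw ha
      by_contra hwv
      have := h1 w p (hm _ hwv hw) (hm _ hpv hc.1.1) ⟨ha.ne, .inl ha⟩ ⟨hxp, by tauto⟩
      subst this; exact hn ha.symm
    intro w w' hw hw' ha ha'
    rw [hq w hw ha, hq w' hw' ha']
  · have hxv : ¬ H.Adj x v := by
      intro ha
      rcases hN' x (mem_union_left _ hx.2) ha.symm with h | h
      exacts [hxp h, hxq h]
    intro w w' hw hw' ha ha'
    refine h1 w w' (hm _ ?_ hw) (hm _ ?_ hw') ⟨ha.ne, .inl ha⟩ ⟨ha'.ne, .inl ha'⟩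
    · rintro rfl; exact hxv ha
    · rintro rfl; exact hxv ha'

lemma Sep.mono {p q : V} (h : Sep H S B p q) (hS : S' ⊆ S) (hp : p ∈ S' ∨ q ∈ S') :
    Sep H S' B p q :=
  ⟨h.1, h.2.1, hp, h.2.2.2.mono hS fun _ _ _ _ h => h⟩

lemma Sep.join (hd : Disjoint S B) {p q z : V} (h : Sep H S B p q) (hp : p ∈ S ∪ B)
    (hq : q ∈ S ∪ B) (hz : z ∈ S ∪ B) : Sep H S B p z ∨ Sep H S B q z := by
  induction hn : S.card using Nat.strong_induction_on generalizing S p q z with | _ n ih =>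
  obtain ⟨v, hv, hv1⟩ := h.2.2.2 S le_rfl (by rcases h.2.2.1 with h | h <;> exact ⟨_, h⟩)
  have hv2 : ∀ w w', w ∈ S ∪ B → w' ∈ S ∪ B → H.Adj v w → H.Adj v w' → w = w' :=
    fun w w' hw hw' ha ha' => hv1 w w' hw hw' ⟨ha.ne, .inl ha⟩ ⟨ha'.ne, .inl ha'⟩
  have hSe : insert v (S.erase v) = S := insert_erase hv
  have hd' : Disjoint (S.erase v) B := hd.mono_left (erase_subset _ _)
  have hvB : v ∉ B := Finset.disjoint_left.1 hd hv
  have hcard : (S.erase v).card < n := by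
    rw [← hn]; exact card_erase_lt_of_mem hv
  have hsub : S.erase v ∪ B ⊆ S ∪ B := union_subset_union_left (erase_subset _ _)
  have hm : ∀ w, w ≠ v → w ∈ S ∪ B → w ∈ S.erase v ∪ B := by
    intro w hw; simp only [mem_union, mem_erase]; tauto
  -- the case where the leaf is an end of the separated pair
  have endcase : ∀ p q, Sep H S B p q → q ∈ S ∪ B → v = p →
      (∀ w w', w ∈ S ∪ B → w' ∈ S ∪ B → (addG H p q).Adj v w → (addG H p q).Adj v w' → w = w') →
      Sep H S B p z ∨ Sep H S B q z := by
    rintro p q h hq rfl hv1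
    have hno : ∀ w ∈ S ∪ B, ¬ H.Adj v w := by
      intro w hw ha
      have := hv1 w q hw hq ⟨ha.ne, .inl ha⟩ ⟨h.1, .inr (.inl ⟨rfl, rfl⟩)⟩
      subst this; exact h.2.1 ha
    by_cases hzv : z = v
    · subst hzv; exact .inr h.symm
    · refine .inl ⟨Ne.symm hzv, hno z hz, .inl hv, ?_⟩
      rw [← hSe]
      refine Fst.addLeaf ((h.fst.mono (erase_subset v S) (H' := addG H v z)) ?_) ?_
      · rintro a b ha hb ⟨-, hab | hab | hab⟩
        · exact hab
        · exact absurd hab.1 (ne_of_mem_erase ha)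
        · have := hm
          rw [hab.2] at hb
          simp only [mem_union, mem_erase] at hb
          tauto
      · have key : ∀ w, w ∈ S.erase v ∪ B → (addG H v z).Adj v w → w = z := by
          rintro w hw ⟨hne, h1 | h1 | h1⟩
          · exact absurd h1 (hno w (hsub hw))
          · exact h1.2
          · exact absurd h1.1.symm hzv
        intro w w' hw hw' ha ha'
        rw [key w hw ha, key w' hw' ha']
  by_cases hvp : v = p
  · exact endcase p q h hq hvp hv1
  by_cases hvq : v = q
  · exact (endcase q p h.symm hp hvq (by rw [addG_swap q p]; exact hv1)).symm
  have h' : Sep H (S.erase v) B p q := h.mono (erase_subset _ _) (by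
    rcases h.2.2.1 with h | h
    · left; simp [h, Ne.symm hvp]
    · right; simp [h, Ne.symm hvq])
  by_cases hvz : v = z
  · subst hvz
    by_cases hz' : ∃ z' ∈ S ∪ B, H.Adj v z'
    · obtain ⟨z', hz'1, hz'2⟩ := hz'
      have lift : ∀ p, v ≠ p → p ∈ S ∪ B → Sep H (S.erase v) B p z' → Sep H S B p v := by
        intro p hvp hp h
        refine ⟨Ne.symm hvp, fun ha => h.1 (hv2 _ _ hp hz'1 ha.symm hz'2), .inr hv, ?_⟩
        rw [← hSe]
        have h2 : Sep (addG H p v) (S.erase v) B p z' := by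
          refine ⟨h.1, ?_, h.2.2.1, h.2.2.2.mono le_rfl ?_⟩
          · rintro ⟨-, h3 | h3 | h3⟩
            · exact h.2.1 h3
            · exact hz'2.ne h3.2.symm
            · exact hvp h3.1.symm
          · rintro a b ha hb ⟨hne, ⟨-, h3 | h3 | h3⟩ | h3⟩
            · exact ⟨hne, .inl h3⟩
            · rw [h3.2] at hb
              simp only [mem_union, mem_erase] at hb
              tauto
            · exact absurd h3.1 (ne_of_mem_erase ha)
            · exact ⟨hne, .inr h3⟩
        refine h2.subdiv hd' (by simp) hvB ?_
        rintro w hw ⟨hne, h3 | h3 | h3⟩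
        · exact .inr (hv2 _ _ (hsub hw) hz'1 h3 hz'2)
        · exact absurd h3.1 hvp
        · exact .inl h3.2
      rcases ih _ hcard hd' h' (hm _ (Ne.symm hvp) hp) (hm _ (Ne.symm hvq) hq)
        (hm _ hz'2.ne.symm hz'1) rfl with h1 | h1
      · exact .inl (lift p hvp hp h1)
      · exact .inr (lift q hvq hq h1)
    · push Not at hz'
      left
      refine ⟨Ne.symm hvp, fun ha => hz' p hp ha.symm, .inr hv, ?_⟩
      rw [← hSe]
      refine Fst.addLeaf ((h.fst.mono (erase_subset v S) (H' := addG H p v)) ?_) ?_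
      · rintro a b ha hb ⟨-, hab | hab | hab⟩
        · exact hab
        · rw [hab.2] at hb
          simp only [mem_union, mem_erase] at hb
          tauto
        · exact absurd hab.1 (ne_of_mem_erase ha)
      · have key : ∀ w, w ∈ S.erase v ∪ B → (addG H p v).Adj v w → w = p := by
          rintro w hw ⟨hne, h1 | h1 | h1⟩
          · exact absurd h1 (hz' w (hsub hw))
          · exact absurd h1.1 hvp
          · exact h1.2
        intro w w' hw hw' ha ha'
        rw [key w hw ha, key w' hw' ha']
  · have lift : ∀ p, v ≠ p → Sep H (S.erase v) B p z → Sep H S B p z := by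
      intro p hvp h
      refine ⟨h.1, h.2.1, h.2.2.1.imp (mem_of_mem_erase) (mem_of_mem_erase), ?_⟩
      rw [← hSe]
      refine h.2.2.2.addLeaf ?_
      rintro w w' hw hw' ⟨-, h1 | h1 | h1⟩ ⟨-, h2 | h2 | h2⟩
      · exact hv2 w w' (hsub hw) (hsub hw') h1 h2
      all_goals first | exact absurd h1.1 hvp | exact absurd h1.1 hvz | exact absurd h2.1 hvp | exact absurd h2.1 hvz
    rcases ih _ hcard hd' h' (hm _ (Ne.symm hvp) hp) (hm _ (Ne.symm hvq) hq)
      (hm _ (Ne.symm hvz) hz) rfl with h1 | h1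
    · exact .inl (lift p hvp h1)
    · exact .inr (lift q hvq h1)

/-- Splitting a merged vertex. -/
lemma Fst.unmerge {G : SimpleGraph V} {p q : V} (hpq : p ≠ q) (hn : ¬ G.Adj p q)
    (hcn : ∀ w, G.Adj p w → ¬ G.Adj q w) (hd : Disjoint S B) (h : Fst (mergeG G p q) S B)
    (hp : p ∈ S ∪ B) (hqS : q ∉ S) (hqB : q ∉ B) (hpB : p ∈ B → ∀ w ∈ B, ¬ G.Adj q w) :
    Sep G (insert q S) B p q := by
  refine ⟨hpq, hn, .inr (mem_insert_self _ _), ?_⟩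
  intro X hX hne
  have hsub : X.erase q ⊆ S := fun x hx => by
    rw [mem_erase] at hx
    exact (mem_insert.1 (hX hx.2)).resolve_left hx.1
  have main : ∀ Y ⊆ S, Y.Nonempty → (∀ x, x ∈ X ∪ B → x ≠ q → x ∈ Y ∪ B) →
      (q ∈ X → p ∈ Y ∪ B) → (∀ y ∈ Y, y ≠ p → y ∈ X) → (p ∈ Y → q ∈ X ∨ p ∈ X) →
      ∃ v ∈ X, ∀ w w', w ∈ X ∪ B → w' ∈ X ∪ B → (addG G p q).Adj v w →
        (addG G p q).Adj v w' → w = w' := by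
    intro Y hYS hYne hXY hqX hYX hpY
    obtain ⟨y, hy, h1⟩ := h Y hYS hYne
    have hyq : y ≠ q := by rintro rfl; exact hqS (hYS hy)
    by_cases hyp : y = p
    · subst hyp
      -- neighbours of the merged vertex
      have a1 : ∀ w ∈ X ∪ B, G.Adj y w → w ∈ Y ∪ B ∧ (mergeG G y q).Adj y w := by
        intro w hw ha
        have : w ≠ q := by rintro rfl; exact hn ha
        exact ⟨hXY w hw this, hyq, this, ha.ne, .inl ha⟩
      have a2 : ∀ w ∈ X ∪ B, G.Adj q w → w ∈ Y ∪ B ∧ (mergeG G y q).Adj y w := by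
        intro w hw ha
        have : y ≠ w := by rintro rfl; exact hn ha.symm
        exact ⟨hXY w hw ha.ne.symm, hyq, ha.ne.symm, this, .inr (.inl ⟨rfl, ha⟩)⟩
      have a3 : ∀ w w', w ∈ X ∪ B → w' ∈ X ∪ B → G.Adj y w → ¬ G.Adj q w' := by
        intro w w' hw hw' ha ha'
        have b1 := a1 w hw ha
        have b2 := a2 w' hw' ha'
        have := h1 w w' b1.1 b2.1 b1.2 b2.2
        subst this
        exact hcn w ha ha'
      have a4 : ∀ w w', w ∈ X ∪ B → w' ∈ X ∪ B → G.Adj y w → G.Adj y w' → w = w' := by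
        intro w w' hw hw' ha ha'
        have b1 := a1 w hw ha
        have b2 := a1 w' hw' ha'
        exact h1 w w' b1.1 b2.1 b1.2 b2.2
      have a5 : ∀ w w', w ∈ X ∪ B → w' ∈ X ∪ B → G.Adj q w → G.Adj q w' → w = w' := by
        intro w w' hw hw' ha ha'
        have b1 := a2 w hw ha
        have b2 := a2 w' hw' ha'
        exact h1 w w' b1.1 b2.1 b1.2 b2.2
      by_cases hq : q ∈ X
      · by_cases hyX : y ∈ X
        · by_cases hex : ∃ w ∈ X ∪ B, G.Adj y w
          · obtain ⟨w0, hw0, ha0⟩ := hex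
            have key : ∀ w ∈ X ∪ B, (addG G y q).Adj q w → w = y := by
              rintro w hw ⟨-, h2 | h2 | h2⟩
              · exact absurd h2 (a3 w0 w hw0 hw ha0)
              · exact absurd h2.1.symm hyq
              · exact h2.2
            exact ⟨q, hq, fun w w' hw hw' ha ha' => by rw [key w hw ha, key w' hw' ha']⟩
          · push Not at hex
            have key : ∀ w ∈ X ∪ B, (addG G y q).Adj y w → w = q := by
              rintro w hw ⟨-, h2 | h2 | h2⟩
              · exact absurd h2 (hex w hw)
              · exact h2.2
              · exact absurd h2.1 hyq
            exact ⟨y, hyX, fun w w' hw hw' ha ha' => by rw [key w hw ha, key w' hw' ha']⟩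
        · have hyXB : y ∉ X ∪ B := by
            have := Finset.disjoint_left.1 hd (hYS hy)
            simp [hyX, this]
          have key : ∀ w ∈ X ∪ B, (addG G y q).Adj q w → G.Adj q w := by
            rintro w hw ⟨-, h2 | h2 | h2⟩
            · exact h2
            · exact absurd h2.1.symm hyq
            · exact absurd (h2.2 ▸ hw) hyXB
          exact ⟨q, hq, fun w w' hw hw' ha ha' => a5 w w' hw hw' (key w hw ha) (key w' hw' ha')⟩
      · have hyX : y ∈ X := (hpY hy).resolve_left hq
        have hqXB : q ∉ X ∪ B := by simp [hq, hqB]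
        have key : ∀ w ∈ X ∪ B, (addG G y q).Adj y w → G.Adj y w := by
          rintro w hw ⟨-, h2 | h2 | h2⟩
          · exact h2
          · exact absurd (h2.2 ▸ hw) hqXB
          · exact absurd h2.1 hyq
        exact ⟨y, hyX, fun w w' hw hw' ha ha' => a4 w w' hw hw' (key w hw ha) (key w' hw' ha')⟩
    · have hG : ∀ w, (addG G p q).Adj y w → G.Adj y w := by
        rintro w ⟨-, h2 | h2 | h2⟩
        · exact h2
        · exact absurd h2.1 hyp
        · exact absurd h2.1 hyq
      have a1 : ∀ w ∈ X ∪ B, G.Adj y w → mrg p q w ∈ Y ∪ B ∧ (mergeG G p q).Adj y (mrg p q w) := by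
        intro w hw ha
        by_cases hwq : w = q
        · subst hwq
          have hw' : w ∈ X := (mem_union.1 hw).resolve_right hqB
          simp only [mrg, if_true]
          exact ⟨hqX hw', hyq, hpq, hyp, .inr (.inr ⟨rfl, ha⟩)⟩
        · simp only [mrg, if_neg hwq]
          exact ⟨hXY w hw hwq, hyq, hwq, ha.ne, .inl ha⟩
      refine ⟨y, hYX y hy hyp, fun w w' hw hw' ha ha' => ?_⟩
      have b1 := a1 w hw (hG _ ha)
      have b2 := a1 w' hw' (hG _ ha')
      have b3 := h1 _ _ b1.1 b2.1 b1.2 b2.2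
      have c1 := hcn y
      have c2 := (hG _ ha).symm
      have c3 := (hG _ ha').symm
      simp only [mrg] at b3
      by_cases d1 : w = q <;> by_cases d2 : w' = q
      · rw [d1, d2]
      · rw [if_pos d1, if_neg d2] at b3
        subst b3; subst d1
        exact absurd c2 (c1 c3)
      · rw [if_neg d1, if_pos d2] at b3
        subst b3; subst d2
        exact absurd c3 (c1 c2)
      · rwa [if_neg d1, if_neg d2] at b3
  by_cases hq : q ∈ X
  · by_cases hpS : p ∈ S
    · refine main (insert p (X.erase q)) (insert_subset hpS hsub) ⟨p, by simp⟩ ?_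
        (fun _ => by simp) ?_ (fun _ => .inl hq)
      · intro x; simp only [mem_union, mem_insert, mem_erase]; tauto
      · intro y; simp only [mem_insert, mem_erase]; tauto
    · have hpB' : p ∈ B := (mem_union.1 hp).resolve_left hpS
      by_cases hXe : (X.erase q).Nonempty
      · refine main (X.erase q) hsub hXe ?_ (fun _ => by simp [hpB']) ?_ (fun _ => .inl hq)
        · intro x; simp only [mem_union, mem_erase]; tauto
        · intro y; simp only [mem_erase]; tauto
      · rw [not_nonempty_iff_eq_empty] at hXe
        have hXq : ∀ x ∈ X, x = q := by
          intro x hx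
          by_contra hxq
          have : x ∈ X.erase q := by simp [hx, hxq]
          rw [hXe] at this; simp at this
        have key : ∀ w ∈ X ∪ B, (addG G p q).Adj q w → w = p := by
          rintro w hw ⟨hne, h2 | h2 | h2⟩
          · rcases mem_union.1 hw with hw | hw
            · exact absurd (hXq w hw).symm hne
            · exact absurd h2 (hpB hpB' w hw)
          · exact absurd h2.1.symm hpq
          · exact h2.2
        exact ⟨q, hq, fun w w' hw hw' ha ha' => by rw [key w hw ha, key w' hw' ha']⟩
  · have hXS : X ⊆ S := by rwa [erase_eq_of_notMem hq] at hsub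
    exact main X hXS hne (fun x hx _ => hx) (fun h => absurd h hq) (fun y hy _ => hy)
      (fun h => .inr h)

end Fst

section Shapes
variable {G H : SimpleGraph V}

/-- A nonempty even edge set with at most five edges. -/
def Short (G : SimpleGraph V) (Z : Finset (Sym2 V)) : Prop :=
  EIn G Z ∧ bd Z = 0 ∧ Z.Nonempty ∧ Z.card ≤ 5

/-- Distinct short sets are at distance at least three. -/
def Far (G : SimpleGraph V) : Prop :=
  ∀ Z Z', Short G Z → Short G Z' → Z ≠ Z' → ∀ a b, On Z a → On Z' b →
    a ≠ b ∧ ¬ G.Adj a b ∧ ∀ w, G.Adj a w → ¬ G.Adj w b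

lemma Short.mono {Z : Finset (Sym2 V)} (h : Short G Z) (hH : G ≤ H) : Short H Z :=
  ⟨fun u v huv => hH (h.1 u v huv), h.2⟩

lemma Far.mono (h : Far G) (hH : H ≤ G) : Far H := by
  intro Z Z' h1 h2 h3 a b h4 h5
  obtain ⟨h6, h7, h8⟩ := h Z Z' (h1.mono hH) (h2.mono hH) h3 a b h4 h5
  exact ⟨h6, fun h => h7 (hH h), fun w h h' => h8 w (hH h) (hH h')⟩

lemma Far.eq (h : Far G) {Z Z' : Finset (Sym2 V)} (h1 : Short G Z) (h2 : Short G Z') {a : V}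
    (ha : On Z a) (hb : On Z' a) : Z = Z' := by
  by_contra hne
  exact (h Z Z' h1 h2 hne a a ha hb).1 rfl

lemma Far.eq_adj (h : Far G) {Z Z' : Finset (Sym2 V)} (h1 : Short G Z) (h2 : Short G Z') {a b : V}
    (ha : On Z a) (hb : On Z' b) (hab : G.Adj a b) : Z = Z' := by
  by_contra hne
  exact (h Z Z' h1 h2 hne a b ha hb).2.1 hab

lemma Far.eq_adj2 (h : Far G) {Z Z' : Finset (Sym2 V)} (h1 : Short G Z) (h2 : Short G Z') {a b w : V}
    (ha : On Z a) (hb : On Z' b) (haw : G.Adj a w) (hwb : G.Adj w b) : Z = Z' := by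
  by_contra hne
  exact (h Z Z' h1 h2 hne a b ha hb).2.2 w haw hwb

/-- The edge set of a triangle. -/
noncomputable def tri (x y z : V) : Finset (Sym2 V) := {s(x, y), s(y, z), s(x, z)}

lemma mem_tri {x y z : V} {e : Sym2 V} : e ∈ tri x y z ↔ e = s(x, y) ∨ e = s(y, z) ∨ e = s(x, z) := by
  simp [tri]

lemma on_tri {x y z v : V} : On (tri x y z) v ↔ v = x ∨ v = y ∨ v = z := by
  simp only [On, mem_tri]
  constructor
  · rintro ⟨e, rfl | rfl | rfl, h⟩ <;> simp only [Sym2.mem_iff] at h <;> tauto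
  · rintro (rfl | rfl | rfl)
    exacts [⟨s(v, y), by simp⟩, ⟨s(x, v), by simp⟩, ⟨s(y, v), by simp⟩]

lemma tri_perm {x y z : V} : tri x y z = tri y z x ∧ tri x y z = tri y x z := by
  constructor <;> ext e <;> simp only [mem_tri]
  · rw [Sym2.eq_swap (a := y) (b := x), Sym2.eq_swap (a := z) (b := x)]; tauto
  · rw [Sym2.eq_swap (a := y) (b := x)]; tauto

lemma bd_path2 {x y z : V} (h1 : x ≠ y) (h2 : y ≠ z) (h3 : x ≠ z) :
    bd ({s(x, y), s(y, z)} : Finset (Sym2 V)) = pt x + pt z := by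
  rw [bd_insert h1 (by simp [h1, h3]), bd_singleton h2]
  linear_combination (pt y) * two_zmod_pi (V := V)

lemma bd_path3 {w x y z : V} (h0 : w ≠ x) (h1 : x ≠ y) (h2 : y ≠ z) (h3 : x ≠ z) (h4 : w ≠ y) :
    bd ({s(w, x), s(x, y), s(y, z)} : Finset (Sym2 V)) = pt w + pt z := by
  rw [bd_insert h0 (by simp; tauto), bd_path2 h1 h2 h3]
  linear_combination (pt x) * two_zmod_pi (V := V)

lemma tri_short {x y z : V} (h1 : G.Adj x y) (h2 : G.Adj y z) (h3 : G.Adj x z) :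
    Short G (tri x y z) := by
  refine ⟨(((EIn.empty).insert h3).insert h2).insert h1, ?_, ⟨_, mem_insert_self _ _⟩, ?_⟩
  · rw [tri, bd_insert h1.ne (by simp [h1.ne, h1.ne', h2.ne, h2.ne', h3.ne, h3.ne']),
      bd_insert h2.ne (by simp [h1.ne, h1.ne', h2.ne, h2.ne', h3.ne, h3.ne']), bd_singleton h3.ne]
    linear_combination (pt x + pt y + pt z) * two_zmod_pi (V := V)
  · exact card_le_three.trans (by norm_num)

lemma tri_card {x y z : V} (h1 : G.Adj x y) (h2 : G.Adj y z) (h3 : G.Adj x z) :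
    (tri x y z).card = 3 := by
  rw [tri, card_insert_of_notMem (by simp [h1.ne, h1.ne', h2.ne, h2.ne', h3.ne, h3.ne']),
    card_insert_of_notMem (by simp [h1.ne, h1.ne', h2.ne, h2.ne', h3.ne, h3.ne']),
    card_singleton]

lemma Short.cons_path {S : Finset (Sym2 V)} {a b c : V} (hS : EIn G S) (hb : bd S = pt a + pt c)
    (hab : G.Adj a b) (hbc : G.Adj b c) (hac : a ≠ c) (h1 : s(a, b) ∉ S) (h2 : s(b, c) ∉ S)
    (hc : S.card ≤ 3) : Short G (insert s(a, b) (insert s(b, c) S)) := by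
  refine ⟨(hS.insert hbc).insert hab, ?_, ⟨_, mem_insert_self _ _⟩, ?_⟩
  · rw [bd_insert hab.ne (by simp [h1, hab.ne, hac]), bd_insert hbc.ne h2, hb]
    linear_combination (pt a + pt b + pt c) * two_zmod_pi (V := V)
  · refine (card_insert_le _ _).trans ?_
    have := card_insert_le s(b, c) S
    omega

/-- The edge set of a quadrilateral. -/
noncomputable def quad (w x y z : V) : Finset (Sym2 V) := {s(w, x), s(x, y), s(y, z), s(z, w)}

lemma mem_quad {w x y z : V} {e : Sym2 V} :
    e ∈ quad w x y z ↔ e = s(w, x) ∨ e = s(x, y) ∨ e = s(y, z) ∨ e = s(z, w) := by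
  simp [quad]

lemma quad_short {w x y z : V} (h1 : G.Adj w x) (h2 : G.Adj x y) (h3 : G.Adj y z) (h4 : G.Adj z w)
    (h5 : w ≠ y) (h6 : x ≠ z) : Short G (quad w x y z) := by
  have a1 := h1.ne
  have a2 := h2.ne
  have a3 := h3.ne
  have a4 := h4.ne
  refine ⟨((((EIn.empty).insert h4).insert h3).insert h2).insert h1, ?_, ⟨_, mem_insert_self _ _⟩, ?_⟩
  · rw [quad, bd_insert a1 (by simp; tauto), bd_insert a2 (by simp; tauto), bd_insert a3 (by simp; tauto),
      bd_singleton a4]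
    linear_combination (pt w + pt x + pt y + pt z) * two_zmod_pi (V := V)
  · exact card_le_four.trans (by norm_num)

/-- The edge set of a pentagon. -/
noncomputable def pent (v w x y z : V) : Finset (Sym2 V) := {s(v, w), s(w, x), s(x, y), s(y, z), s(z, v)}

lemma mem_pent {v w x y z : V} {e : Sym2 V} :
    e ∈ pent v w x y z ↔ e = s(v, w) ∨ e = s(w, x) ∨ e = s(x, y) ∨ e = s(y, z) ∨ e = s(z, v) := by
  simp [pent]

lemma pent_short {v w x y z : V} (h0 : G.Adj v w) (h1 : G.Adj w x) (h2 : G.Adj x y) (h3 : G.Adj y z)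
    (h4 : G.Adj z v) (h5 : w ≠ y) (h6 : x ≠ z) (h7 : v ≠ x) (h8 : v ≠ y) (h9 : w ≠ z) :
    Short G (pent v w x y z) := by
  have a0 := h0.ne
  have a1 := h1.ne
  have a2 := h2.ne
  have a3 := h3.ne
  have a4 := h4.ne
  refine ⟨(((((EIn.empty).insert h4).insert h3).insert h2).insert h1).insert h0, ?_,
    ⟨_, mem_insert_self _ _⟩, ?_⟩
  · rw [pent, bd_insert a0 (by simp; tauto), bd_insert a1 (by simp; tauto), bd_insert a2 (by simp; tauto),
      bd_insert a3 (by simp; tauto), bd_singleton a4]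
    linear_combination (pt v + pt w + pt x + pt y + pt z) * two_zmod_pi (V := V)
  · exact card_le_five

lemma Short.isCirc {Z : Finset (Sym2 V)} (hZ : Short G Z) : IsCirc Z := by
  refine ⟨hZ.2.2.1, hZ.2.1, fun W hW h0 => or_iff_not_imp_left.2 fun hne => ?_⟩
  by_contra hWZ
  have h1 := card_le_of_even (hZ.1.mono hW).loopless (nonempty_iff_ne_empty.2 hne) h0
  have h2 := card_le_of_even (hZ.1.mono (sdiff_subset (t := W))).loopless
    (sdiff_nonempty.2 fun h => hWZ (hW.antisymm h)) (by rw [bd_sdiff hW, hZ.2.1, h0, add_zero])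
  rw [card_sdiff_of_subset hW] at h2
  have := hZ.2.2.2
  omega

/-- A chord of a circuit with at most nine edges lies in a short set. -/
lemma chord_short {Z : Finset (Sym2 V)} (hZ : IsCirc Z) (hG : EIn G Z) (h9 : Z.card ≤ 9) {a b : V}
    (ha : On Z a) (hb : On Z b) (hab : G.Adj a b) (hn : s(a, b) ∉ Z) :
    ∃ S, Short G S ∧ s(a, b) ∈ S ∧ S ⊆ insert s(a, b) Z := by
  obtain ⟨A, hA, hbA⟩ := hZ.exists_arc hG.loopless ha hb
  have piece : ∀ A ⊆ Z, bd A = pt a + pt b → A.card ≤ 4 →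
      ∃ S, Short G S ∧ s(a, b) ∈ S ∧ S ⊆ insert s(a, b) Z := by
    intro A hA hbA h4
    refine ⟨insert s(a, b) A, ⟨(hG.mono hA).insert hab, ?_, ⟨_, mem_insert_self _ _⟩, ?_⟩,
      mem_insert_self _ _, insert_subset_insert _ hA⟩
    · rw [bd_insert hab.ne (fun h => hn (hA h)), hbA]
      linear_combination (pt a + pt b) * two_zmod_pi (V := V)
    · exact (card_insert_le _ _).trans (by omega)
  by_cases h4 : A.card ≤ 4
  · exact piece A hA hbA h4
  · refine piece (Z \ A) sdiff_subset ?_ ?_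
    · rw [bd_sdiff hA, hZ.2.1, hbA, zero_add]
    · rw [card_sdiff_of_subset hA]; omega

lemma path_split {s t : V} (p : G.Walk s t) (hp : p.IsPath) {v : V} (hv : v ∈ p.support) :
    ∃ (p1 : G.Walk s v) (p2 : G.Walk v t), p1.IsPath ∧ p2.IsPath ∧
      p1.edges.toFinset ∪ p2.edges.toFinset = p.edges.toFinset ∧
      Disjoint p1.edges.toFinset p2.edges.toFinset ∧
      ∀ w, w ∈ p.support ↔ w ∈ p1.support ∨ w ∈ p2.support := by
  have hs := p.take_spec hv
  refine ⟨p.takeUntil v hv, p.dropUntil v hv, hp.takeUntil hv, hp.dropUntil hv, ?_, ?_, ?_⟩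
  · have h := congrArg (fun w => w.edges.toFinset) hs
    rw [← h]
    simp only [Walk.edges_append, List.toFinset_append]
  · have h := hp.isTrail.edges_nodup
    rw [← hs, Walk.edges_append, List.nodup_append] at h
    rw [Finset.disjoint_left]
    intro e h1 h2
    simp only [List.mem_toFinset] at h1 h2
    exact h.2.2 e h1 e h2 rfl
  · intro w
    conv_lhs => rw [← hs]
    exact Walk.mem_support_append_iff _ _

/-- Splitting a circuit at three vertices. -/
lemma IsCirc.three_split {Z : Finset (Sym2 V)} (hZ : IsCirc Z) (hG : EIn G Z) {a b c : V}
    (ha : On Z a) (hb : On Z b) (hc : On Z c) :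
    ∃ P Q R : Finset (Sym2 V), P ∪ Q ∪ R = Z ∧ Disjoint P Q ∧ Disjoint (P ∪ Q) R ∧
      bd P = pt a + pt b ∧ bd Q = pt b + pt c ∧ bd R = pt a + pt c := by
  obtain ⟨t, ht⟩ := on_iff.1 ha
  obtain ⟨p, hp, hpe⟩ := hZ.exists_path hG ht
  have hb' := (on_iff_mem_support ht p hpe b).1 hb
  have hc' := (on_iff_mem_support ht p hpe c).1 hc
  have hat : a ≠ t := (hG _ _ ht).ne
  obtain ⟨p1, p2, h1, h2, h3, h4, h5⟩ := path_split p hp hb'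
  have hni : s(a, t) ∉ p1.edges.toFinset ∪ p2.edges.toFinset := by rw [h3, hpe]; simp
  have hZe : insert s(a, t) (p1.edges.toFinset ∪ p2.edges.toFinset) = Z := by
    rw [h3, hpe, insert_erase ht]
  rcases (h5 c).1 hc' with hc1 | hc1
  · obtain ⟨q1, q2, g1, g2, g3, g4, g5⟩ := path_split p1 h1 hc1
    rw [← g3] at hni hZe h4
    refine ⟨insert s(a, t) p2.edges.toFinset, q2.edges.toFinset, q1.edges.toFinset, ?_, ?_, ?_, ?_, ?_, ?_⟩
    · rw [← hZe]; ext e; simp only [mem_union, mem_insert]; tauto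
    · simp only [Finset.disjoint_left, mem_insert, mem_union] at *
      rintro e (rfl | he) he'
      · tauto
      · exact h4 (.inr he') he
    · simp only [Finset.disjoint_left, mem_insert, mem_union] at *
      rintro e ((rfl | he) | he) he'
      · tauto
      · exact h4 (.inl he') he
      · exact g4 he' he
    · rw [bd_insert hat (by simp only [mem_union] at hni; tauto), bd_walk_edges _ h2.isTrail]
      linear_combination (pt t) * two_zmod_pi (V := V)
    · rw [bd_walk_edges _ g2.isTrail, add_comm]
    · rw [bd_walk_edges _ g1.isTrail]
  · obtain ⟨q1, q2, g1, g2, g3, g4, g5⟩ := path_split p2 h2 hc1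
    rw [← g3] at hni hZe h4
    refine ⟨p1.edges.toFinset, q1.edges.toFinset, insert s(a, t) q2.edges.toFinset, ?_, ?_, ?_, ?_, ?_, ?_⟩
    · rw [← hZe]; ext e; simp only [mem_union, mem_insert]; tauto
    · simp only [Finset.disjoint_left, mem_insert, mem_union] at *
      intro e he he'
      exact h4 he (.inl he')
    · simp only [Finset.disjoint_left, mem_insert, mem_union] at *
      rintro e (he | he) (rfl | he')
      · tauto
      · exact h4 he (.inr he')
      · tauto
      · exact g4 he he'
    · rw [bd_walk_edges _ h1.isTrail]
    · rw [bd_walk_edges _ g1.isTrail]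
    · rw [bd_insert hat (by simp only [mem_union] at hni; tauto), bd_walk_edges _ g2.isTrail]
      linear_combination (pt t) * two_zmod_pi (V := V)

lemma eq_singleton_of_bd {A : Finset (Sym2 V)} {a b : V} (hab : a ≠ b) (h1 : A.card ≤ 1)
    (hb : bd A = pt a + pt b) : A = {s(a, b)} := by
  have on : ∀ v, bd A v ≠ 0 → On A v := fun v h => by
    by_contra h'; exact h (bd_eq_zero_of_not_on h')
  obtain ⟨e, he, hae⟩ := on a (by rw [hb, Pi.add_apply, pt_self, pt_ne hab]; simp)
  obtain ⟨e', he', hbe⟩ := on b (by rw [hb, Pi.add_apply, pt_self, pt_ne hab.symm]; simp)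
  have hee := card_le_one.1 h1 e he e' he'
  subst hee
  have : e = s(a, b) := ((Sym2.mem_and_mem_iff hab).1 ⟨hae, hbe⟩)
  subst this
  ext e'
  simp only [mem_singleton]
  exact ⟨fun h => card_le_one.1 h1 _ h _ he, by rintro rfl; exact he⟩

end Shapes

section Reducible
variable [Fintype V] {G H : SimpleGraph V} {U B : Finset V} {E0 : Finset (Sym2 V)}

/-- `v` has a neighbour in `B`. -/
def Att (G : SimpleGraph V) (B : Finset V) (v : V) : Prop := ∃ b ∈ B, G.Adj v b

/-- There is neither a claw nor a triclaw in `U` with feet in `B`. -/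
def Good (G : SimpleGraph V) (U B : Finset V) : Prop :=
  (∀ v ∈ U, ∀ a ∈ B, ∀ b ∈ B, ∀ c ∈ B, a ≠ b → b ≠ c → a ≠ c →
    G.Adj v a → G.Adj v b → ¬ G.Adj v c) ∧
  (∀ x ∈ U, ∀ y ∈ U, ∀ z ∈ U, G.Adj x y → G.Adj y z → G.Adj x z →
    Att G B x → Att G B y → ¬ Att G B z)

lemma Good.mono {U' B' : Finset V} (h : Good G U B) (hH : H ≤ G) (hU : U' ⊆ U) (hB : B' ⊆ B) :
    Good H U' B' := by
  have hA : ∀ v, Att H B' v → Att G B v := fun v ⟨b, hb, hv⟩ => ⟨b, hB hb, hH hv⟩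
  refine ⟨fun v hv a ha b hb c hc h1 h2 h3 h4 h5 h6 => ?_, fun x hx y hy z hz h1 h2 h3 h4 h5 h6 => ?_⟩
  · exact h.1 v (hU hv) a (hB ha) b (hB hb) c (hB hc) h1 h2 h3 (hH h4) (hH h5) (hH h6)
  · exact h.2 x (hU hx) y (hU hy) z (hU hz) (hH h1) (hH h2) (hH h3) (hA _ h4) (hA _ h5) (hA _ h6)

/-- An instance of the precoloring extension problem. -/
structure Inst (G : SimpleGraph V) (U B : Finset V) (E0 : Finset (Sym2 V)) : Prop where
  disj : Disjoint U B
  edge : ∀ u v, G.Adj u v → s(u, v) ∈ E0 ∨ ((u ∈ U ∨ v ∈ U) ∧ u ∈ U ∪ B ∧ v ∈ U ∪ B)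
  e0 : EIn G E0
  on : ∀ v, On E0 v ↔ v ∈ B
  circ : E0 = ∅ ∨ IsCirc E0
  le : E0.card ≤ 9
  pl : PlO G E0
  far : Far G
  good : E0.card = 9 → Good G U B

/-- Every precoloring of `B` extends. -/
def ECol (G : SimpleGraph V) (U B : Finset V) : Prop :=
  ∀ c0 : V → Bool, ∃ c : V → Bool, (∀ v ∈ B, c v = c0 v) ∧
    (∀ u ∈ U, ∀ v, G.Adj u v → c u = true → c v = false) ∧
    Fst G (U.filter (fun v => c v = false)) (B.filter (fun v => c v = false))

/-- A minimal counterexample to the extension property. -/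
structure MCE (G : SimpleGraph V) (U B : Finset V) (E0 : Finset (Sym2 V)) {Φ : Type}
    (side : V → V → Φ) (p0 : Φ) : Prop where
  inst : Inst G U B E0
  plane : Pl G side
  outer : E0 = ∅ ∨ J G side {p0} = E0
  hmin : ∀ (G' : SimpleGraph V) (U' B' : Finset V) (E0' : Finset (Sym2 V)), U'.card < U.card →
    Inst G' U' B' E0' → ECol G' U' B'
  hno : ¬ ECol G U B

/-- The neighbours of `v`. -/
noncomputable def nb (G : SimpleGraph V) (v : V) : Finset V := univ.filter (G.Adj v)

lemma mem_nb {v w : V} : w ∈ nb G v ↔ G.Adj v w := by simp [nb]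

lemma Inst.b_not_u (h : Inst G U B E0) {v : V} (hv : v ∈ B) : v ∉ U :=
  disjoint_right.1 h.disj hv

lemma Inst.u_not_b (h : Inst G U B E0) {v : V} (hv : v ∈ U) : v ∉ B :=
  Finset.disjoint_left.1 h.disj hv

lemma Inst.u_not_on (h : Inst G U B E0) {v : V} (hv : v ∈ U) : ¬ On E0 v :=
  fun h' => h.u_not_b hv ((h.on v).1 h')

lemma Inst.adj_mem (h : Inst G U B E0) {u v : V} (huv : G.Adj u v) : v ∈ U ∪ B := by
  rcases h.edge u v huv with h1 | h1
  · exact mem_union_right _ ((h.on v).1 (on_right h1))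
  · exact h1.2.2

lemma Inst.adj_cases (h : Inst G U B E0) {u v : V} (huv : G.Adj u v) : v ∈ U ∨ v ∈ B :=
  mem_union.1 (h.adj_mem huv)

lemma Inst.adj_bb (h : Inst G U B E0) {u v : V} (hu : u ∈ B) (hv : v ∈ B) (huv : G.Adj u v) :
    s(u, v) ∈ E0 := by
  rcases h.edge u v huv with h1 | ⟨h1 | h1, -⟩
  exacts [h1, absurd h1 (h.b_not_u hu), absurd h1 (h.b_not_u hv)]

lemma Inst.empty_of (h : Inst G U B E0) (h0 : E0 = ∅) : B = ∅ := by
  ext v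
  simp only [← h.on, h0, On, notMem_empty, false_and, exists_false]

/-- Deleting vertices. -/
lemma Inst.del (h : Inst G U B E0) {D : Finset V} (hD : D ⊆ U) : Inst (delG G D) (U \ D) B E0 := by
  have hBD : ∀ v ∈ B, v ∉ D := fun v hv hvD => h.b_not_u hv (hD hvD)
  have he : EIn (delG G (D : Set V)) E0 := fun u v huv =>
    ⟨h.e0 u v huv, by simpa using hBD _ ((h.on _).1 (on_left huv)),
      by simpa using hBD _ ((h.on _).1 (on_right huv))⟩
  refine ⟨h.disj.mono_left sdiff_subset, ?_, he, h.on, h.circ, h.le, h.pl.del (delG_le _) he,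
    h.far.mono (delG_le _), fun h9 => (h.good h9).mono (delG_le _) sdiff_subset le_rfl⟩
  rintro u v ⟨huv, h1, h2⟩
  simp only [mem_coe] at h1 h2
  simpa [mem_union, mem_sdiff, h1, h2] using h.edge u v huv

lemma card_sdiff_lt {U D : Finset V} (hD : D ⊆ U) (hne : D.Nonempty) : (U \ D).card < U.card := by
  have := card_pos.2 hne
  have := card_le_card hD
  rw [card_sdiff_of_subset hD]; omega

variable {Φ : Type} {side : V → V → Φ} {p0 : Φ}

/-- A coloring of a vertex-deleted subgraph does not extend. -/
lemma MCE.no_ext (M : MCE G U B E0 side p0) {D : Finset V} (hD : D ⊆ U) {c c' : V → Bool} {c0 : V → Bool}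
    (heq : ∀ v, v ∉ D → c' v = c v)
    (hI : ∀ u ∈ U \ D, ∀ v, (delG G D).Adj u v → c u = true → c v = false)
    (hD' : ∀ d ∈ D, ∀ v, G.Adj d v → c' d = true → c' v = false)
    (hF : Fst G (U.filter (fun v => c' v = false)) (B.filter (fun v => c v = false)))
    (hB : ∀ v ∈ B, c v = c0 v) : 
    ∃ c : V → Bool, (∀ v ∈ B, c v = c0 v) ∧
    (∀ u ∈ U, ∀ v, G.Adj u v → c u = true → c v = false) ∧
    Fst G (U.filter (fun v => c v = false)) (B.filter (fun v => c v = false)) := by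
  have hBD : ∀ v ∈ B, v ∉ D := fun v hv hvD => M.inst.b_not_u hv (hD hvD)
  refine ⟨c', fun v hv => (heq v (hBD v hv)).trans (hB v hv), ?_, ?_⟩
  · intro u hu v huv hcu
    by_cases huD : u ∈ D
    · exact hD' u huD v huv hcu
    · by_cases hvD : v ∈ D
      · by_contra hcv
        rw [Bool.not_eq_false] at hcv
        rw [hD' v hvD u huv.symm hcv] at hcu
        exact absurd hcu (by simp)
      · rw [heq v hvD]
        rw [heq u huD] at hcu
        exact hI u (by simp [hu, huD]) v ⟨huv, by simpa using huD, by simpa using hvD⟩ hcu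
  · convert hF using 1
    ext v
    simp only [mem_filter]
    exact and_congr_right fun hv => by rw [heq v (hBD v hv)]

/-- Vertices of `U` have degree at least three. -/
lemma MCE.deg (M : MCE G U B E0 side p0) {v : V} (hv : v ∈ U) : 3 ≤ (nb G v).card := by
  by_contra hlt
  push Not at hlt
  apply M.hno
  intro c0
  have hD : {v} ⊆ U := by simpa using hv
  obtain ⟨c, h1, h2, h3⟩ := M.hmin _ _ _ _ (card_sdiff_lt hD ⟨v, by simp⟩) (M.inst.del hD) c0
  set D : Finset V := {v} with hDdef
  have hF : Fst G ((U \ D).filter (fun v => c v = false)) (B.filter (fun v => c v = false)) := by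
    refine h3.mono le_rfl ?_
    intro a b ha hb hab
    have h4 : b ≠ v := by
      rintro rfl
      simp [hDdef, M.inst.u_not_b hv] at hb
    have h5 : a ≠ v := by
      rintro rfl
      simp [hDdef] at ha
    exact ⟨hab, by simpa [hDdef] using h5, by simpa [hDdef] using h4⟩
  by_cases hall : ∀ w, G.Adj v w → c w = false
  · refine M.no_ext hD (c := c) (c' := Function.update c v true) (fun w hw => ?_) h2 ?_ ?_ h1
    · exact Function.update_of_ne (by simpa [hDdef] using hw) _ _
    · intro d hd w hdw _
      simp only [hDdef, mem_singleton] at hd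
      subst hd
      rw [Function.update_of_ne hdw.ne']
      exact hall w hdw
    · convert hF using 1
      ext w
      by_cases hw : w = v
      · subst hw; simp [hDdef]
      · simp [hDdef, hw]
  · push Not at hall
    obtain ⟨w, hw, hcw⟩ := hall
    refine M.no_ext hD (c := c) (c' := Function.update c v false) (fun w hw => ?_) h2 ?_ ?_ h1
    · exact Function.update_of_ne (by simpa [hDdef] using hw) _ _
    · intro d hd w hdw hd'
      simp only [hDdef, mem_singleton] at hd
      subst hd
      simp at hd'
    · have := hF.addLeaf (v := v) (by
        intro x x' hx hx' hvx hvx'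
        have hfalse : ∀ y, y ∈ (U \ D).filter (fun v => c v = false) ∪ B.filter (fun v => c v = false) →
            c y = false := by
          intro y hy; simp only [mem_union, mem_filter] at hy; tauto
        have hwx : w ≠ x := by rintro rfl; exact hcw (hfalse _ hx)
        have hwx' : w ≠ x' := by rintro rfl; exact hcw (hfalse _ hx')
        by_contra hxx
        have : ({w, x, x'} : Finset V) ⊆ nb G v := by
          intro y hy
          simp only [mem_insert, mem_singleton] at hy
          rcases hy with rfl | rfl | rfl <;> simpa [mem_nb]
        have h4 := card_le_card this
        rw [card_eq_three.2 ⟨w, x, x', hwx, hwx', hxx, rfl⟩] at h4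
        omega)
      convert this using 1
      ext w
      by_cases hw : w = v
      · subst hw; simp [hv]
      · simp [hDdef, hw]

/-- Some dart at `v` has its left face in `A`. -/
def Ins (G : SimpleGraph V) (side : V → V → Φ) (A : Set Φ) (v : V) : Prop :=
  ∃ w, G.Adj v w ∧ side v w ∈ A

lemma side_iff {A : Set Φ} {v w : V} (hvw : G.Adj v w) (h : s(v, w) ∉ J G side A) :
    side v w ∈ A ↔ side w v ∈ A := by
  rw [mem_J] at h; tauto

lemma Ins.all (hP : Pl G side) {A : Set Φ} {v : V} (hv : ¬ On (J G side A) v) (h : Ins G side A v)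
    {w : V} (hw : G.Adj v w) : side v w ∈ A ∧ side w v ∈ A := by
  obtain ⟨x, hx, hxA⟩ := h
  have h1 : ∀ w, G.Adj v w → (side v w ∈ A ↔ side w v ∈ A) := fun w hw =>
    side_iff hw fun h => hv (on_left h)
  have h2 := hP.loc A v h1 x w hx hw hxA
  exact ⟨h2, (h1 w hw).1 h2⟩

lemma MCE.b_not_ins (M : MCE G U B E0 side p0) {A : Set Φ} (hp : p0 ∉ A) {v : V} (hv : v ∈ B)
    (hon : ¬ On (J G side A) v) : ¬ Ins G side A v := by
  intro h
  obtain ⟨w, hw⟩ := on_iff.1 ((M.inst.on v).2 hv)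
  have h0 : J G side {p0} = E0 := M.outer.resolve_left (by rintro rfl; simp at hw)
  rw [← h0, mem_J] at hw
  obtain ⟨h1, h2⟩ := h.all M.plane hon hw.1
  simp only [Set.mem_singleton_iff] at hw
  have h3 : side v w ≠ p0 := fun h => hp (h ▸ h1)
  have h4 : side w v ≠ p0 := fun h => hp (h ▸ h2)
  tauto

/-- The vertices of `U` strictly inside. -/
noncomputable def insd (G : SimpleGraph V) (side : V → V → Φ) (U : Finset V) (A : Set Φ) : Finset V :=
  U.filter (fun v => ¬ On (J G side A) v ∧ Ins G side A v)

lemma mem_insd {A : Set Φ} {v : V} :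
    v ∈ insd G side U A ↔ v ∈ U ∧ ¬ On (J G side A) v ∧ Ins G side A v := by
  simp [insd]

/-- The vertices of an edge set. -/
noncomputable def vs (Z : Finset (Sym2 V)) : Finset V := univ.filter (On Z)

lemma mem_vs {Z : Finset (Sym2 V)} {v : V} : v ∈ vs Z ↔ On Z v := by simp [vs]

lemma MCE.ins_adj (M : MCE G U B E0 side p0) {A : Set Φ} (hp : p0 ∉ A) {v w : V}
    (hv : v ∈ insd G side U A) (hvw : G.Adj v w) : w ∈ insd G side U A ∨ On (J G side A) w := by
  rw [mem_insd] at hv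
  by_cases hw : On (J G side A) w
  · exact .inr hw
  · left
    have h1 : Ins G side A w := ⟨v, hvw.symm, (hv.2.2.all M.plane hv.2.1 hvw).2⟩
    exact mem_insd.2 ⟨(M.inst.adj_cases hvw).resolve_right
      fun h => M.b_not_ins hp h hw h1, hw, h1⟩

lemma exA (hP : Pl G side) {Z : Finset (Sym2 V)} (hZ : EIn G Z) (hb : bd Z = 0) (p : Φ) :
    ∃ A : Set Φ, J G side A = Z ∧ p ∉ A := by
  obtain ⟨A, hA⟩ := hP.cyc Z hZ hb
  by_cases h : p ∈ A
  · exact ⟨Aᶜ, by rw [J_compl, hA], by simpa using h⟩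
  · exact ⟨A, hA, h⟩

/-- A circuit of length at most nine with a vertex inside has length nine and a claw or triclaw
inside. -/
lemma MCE.step2 (M : MCE G U B E0 side p0) {A : Set Φ} (hp : p0 ∉ A) (hZ : IsCirc (J G side A))
    (h9 : (J G side A).card ≤ 9) (hne : J G side A ≠ E0) (hin : (insd G side U A).Nonempty) :
    (J G side A).card = 9 ∧ ¬ Good G (insd G side U A) (vs (J G side A)) := by
  by_contra hcon
  have hgood : (J G side A).card = 9 → Good G (insd G side U A) (vs (J G side A)) := by tauto
  set Z := J G side A with hZdef
  set N := insd G side U A with hN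
  have hNU : N ⊆ U := fun v hv => (mem_insd.1 hv).1
  have hNon : ∀ v ∈ N, ¬ On Z v := fun v hv => (mem_insd.1 hv).2.1
  apply M.hno
  intro c0
  obtain ⟨c1, h1, h2, h3⟩ := M.hmin _ _ _ _ (card_sdiff_lt hNU hin) (M.inst.del hNU) c0
  -- a vertex of `U` on `Z`
  obtain ⟨u, huU, huZ⟩ : ∃ u ∈ U, On Z u := by
    by_contra hc
    push Not at hc
    have hsub : Z ⊆ E0 := by
      intro e he
      induction e with | _ a b =>
      rcases M.inst.edge a b (eIn_J _ _ he) with h | ⟨h | h, -⟩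
      exacts [h, absurd (on_left he) (hc _ h), absurd (on_right he) (hc _ h)]
    rcases M.inst.circ with h0 | h0
    · obtain ⟨e, he⟩ := hZ.1
      simpa [h0] using hsub he
    · exact hne (edges_subset_circ_eq h0 hsub hZ.2.1 hZ.1)
  have hlt : N.card < U.card := card_lt_card
    (Finset.ssubset_iff_subset_ne.2 ⟨hNU, fun h => hNon u (h ▸ huU) huZ⟩)
  let H : SimpleGraph V := ⟨fun a b => G.Adj a b ∧ (s(a, b) ∈ Z ∨ a ∈ N ∨ b ∈ N),
    ⟨fun a b h => ⟨h.1.symm, by rw [Sym2.eq_swap]; tauto⟩⟩, ⟨fun a h => h.1.ne rfl⟩⟩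
  have hHG : H ≤ G := fun a b h => h.1
  have hZH : EIn H Z := fun a b h => ⟨eIn_J _ _ h, .inl h⟩
  have hpl : PlO H Z := by
    obtain ⟨Φ', f, g1, -, g2⟩ := M.plane.del hHG
    obtain ⟨A', hA'⟩ := g2 A (fun a b hab hn h => hn (hZH _ _ h))
    have hJ : J H (fun u v => f (side u v)) A' = Z := by
      apply eset_ext
      intro a b
      rw [mem_J, hA', hA', hZdef, mem_J]
      constructor
      · exact fun h => ⟨hHG h.1, h.2⟩
      · exact fun h => ⟨hZH a b (mem_J.2 h), h.2⟩
    obtain ⟨p, f2, g3, g4⟩ := g1.glue hZ hJ (by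
      rintro a b ⟨hab, h⟩ hn
      rw [hA']
      rcases h with h | h | h
      · exact absurd h hn
      · exact ((mem_insd.1 h).2.2.all M.plane (hNon _ h) hab).1
      · exact ((mem_insd.1 h).2.2.all M.plane (hNon _ h) hab.symm).2)
    exact ⟨_, _, p, g3, .inr g4⟩
  have hinst : Inst H N (vs Z) Z := by
    refine ⟨Finset.disjoint_left.2 fun v hv hv' => hNon v hv (mem_vs.1 hv'), ?_, hZH,
      fun v => mem_vs.symm, .inr hZ, h9, hpl, M.inst.far.mono hHG, fun h => (hgood h).mono hHG le_rfl le_rfl⟩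
    rintro a b ⟨hab, h | h | h⟩
    · exact .inl h
    · exact .inr ⟨.inl h, by simp [h], by simpa [mem_vs] using M.ins_adj hp h hab⟩
    · exact .inr ⟨.inr h, by simpa [mem_vs] using M.ins_adj hp h hab.symm, by simp [h]⟩
  obtain ⟨c2, g1, g2, g3⟩ := M.hmin _ _ _ _ hlt hinst c1
  have hBN : ∀ v ∈ B, v ∉ N := fun v hv hvD => M.inst.b_not_u hv (hNU hvD)
  let c : V → Bool := fun v => if v ∈ N then c2 v else c1 v
  have hcN : ∀ v ∈ N, c v = c2 v := fun v hv => if_pos hv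
  have hcn : ∀ v, v ∉ N → c v = c1 v := fun v hv => if_neg hv
  have hcZ : ∀ v, v ∈ N ∨ On Z v → c v = c2 v := by
    rintro v (hv | hv)
    · exact hcN v hv
    · rw [hcn v (fun h => hNon v h hv), g1 v (mem_vs.2 hv)]
  refine M.no_ext hNU (c := c1) (c' := c) hcn h2 ?_ ?_ h1
  · intro d hd v hdv hcd
    rw [hcZ v (M.ins_adj hp hd hdv)]
    rw [hcN d hd] at hcd
    exact g2 d hd v ⟨hdv, .inr (.inl hd)⟩ hcd
  · intro X hX hXne
    by_cases hXN : (X ∩ N).Nonempty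
    · obtain ⟨v, hv, g4⟩ := g3 (X ∩ N) (by
        intro v hv
        simp only [mem_inter] at hv
        have := hX hv.1
        simp only [mem_filter, hcN v hv.2] at this ⊢
        exact ⟨hv.2, this.2⟩) hXN
      simp only [mem_inter] at hv
      have key : ∀ w, w ∈ X ∪ B.filter (fun v => c1 v = false) → G.Adj v w →
          w ∈ (X ∩ N) ∪ (vs Z).filter (fun v => c2 v = false) := by
        intro w hw hvw
        have hcw : c w = false := by
          rcases mem_union.1 hw with hw | hw
          · exact (mem_filter.1 (hX hw)).2
          · rw [mem_filter] at hw
            rw [hcn w (hBN w hw.1), hw.2]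
        have h5 := M.ins_adj hp hv.2 hvw
        rw [hcZ w h5] at hcw
        simp only [mem_union, mem_inter, mem_filter, mem_vs]
        rcases h5 with h5 | h5
        · left
          rcases mem_union.1 hw with hw | hw
          · exact ⟨hw, h5⟩
          · exact absurd h5 (hBN w (mem_filter.1 hw).1)
        · exact .inr ⟨h5, hcw⟩
      exact ⟨v, hv.1, fun w w' hw hw' ha ha' => g4 w w' (key w hw ha) (key w' hw' ha')
        ⟨ha, .inr (.inl hv.2)⟩ ⟨ha', .inr (.inl hv.2)⟩⟩
    · rw [not_nonempty_iff_eq_empty] at hXN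
      have hXN' : ∀ v ∈ X, v ∉ N := fun v hv hv' => by
        have : v ∈ X ∩ N := mem_inter.2 ⟨hv, hv'⟩
        simp [hXN] at this
      obtain ⟨v, hv, g4⟩ := h3 X (by
        intro v hv
        have := hX hv
        simp only [mem_filter, hcn v (hXN' v hv), mem_sdiff] at this ⊢
        exact ⟨⟨this.1, hXN' v hv⟩, this.2⟩) hXne
      have key : ∀ w, w ∈ X ∪ B.filter (fun v => c1 v = false) → w ∉ N := by
        intro w hw
        rcases mem_union.1 hw with hw | hw
        · exact hXN' w hw
        · exact hBN w (mem_filter.1 hw).1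
      exact ⟨v, hv, fun w w' hw hw' ha ha' => g4 w w' hw hw'
        ⟨ha, by simpa using hXN' v hv, by simpa using key w hw⟩
        ⟨ha', by simpa using hXN' v hv, by simpa using key w' hw'⟩⟩

lemma MCE.step2' (M : MCE G U B E0 side p0) {A : Set Φ} (hp : p0 ∉ A) (hJ : (J G side A).Nonempty)
    (h9 : (J G side A).card ≤ 9) (hne : E0 = ∅ ∨ ¬ E0 ⊆ J G side A)
    (hin : (insd G side U A).Nonempty) :
    IsCirc (J G side A) ∧ (J G side A).card = 9 ∧ ¬ Good G (insd G side U A) (vs (J G side A)) := by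
  induction hn : (J G side A).card using Nat.strong_induction_on generalizing A with
  | _ n ih =>
  by_cases hZ : IsCirc (J G side A)
  · rw [← hn]
    refine ⟨hZ, M.step2 hp hZ h9 ?_ hin⟩
    rintro rfl
    rcases hne with h | h
    · exact hJ.ne_empty h
    · exact h le_rfl
  · exfalso
    obtain ⟨e, he⟩ := hJ
    obtain ⟨C, hC, hC1, -⟩ := exists_circ (M.plane.even A) he
    have hCE : EIn G C := eIn_J.mono hC
    obtain ⟨A1, hA1, hp1⟩ := exA M.plane hCE hC1.2.1 p0
    have hss : C ≠ J G side A := by rintro rfl; exact hZ hC1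
    have hA2 : J G side (symmDiff A A1) = J G side A \ C := by
      rw [J_symmDiff, hA1, symmDiff_of_ge hC]
    have hne2 : (J G side A \ C).Nonempty := by
      rw [sdiff_nonempty]
      exact fun h => hss (hC.antisymm h)
    have c1 := card_le_of_even hCE.loopless hC1.1 hC1.2.1
    have c2 : 3 ≤ (J G side A \ C).card :=
      card_le_of_even (hA2 ▸ eIn_J.loopless) hne2 (hA2 ▸ M.plane.even _)
    have c3 : (J G side A \ C).card + C.card = (J G side A).card := by
      rw [card_sdiff_of_subset hC]; have := card_le_card hC; omega
    obtain ⟨w, hw⟩ := hin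
    rw [mem_insd] at hw
    obtain ⟨hwU, hwon, x, hwx, hxA⟩ := hw
    by_cases hx1 : side w x ∈ A1
    · obtain ⟨-, h, -⟩ := ih C.card (by omega) hp1 (by rw [hA1]; exact hC1.1) (by rw [hA1]; omega)
        (by rw [hA1]; exact hne.imp id fun h h' => h (h'.trans hC))
        ⟨w, mem_insd.2 ⟨hwU, by rw [hA1]; exact fun h => hwon (h.mono hC), x, hwx, hx1⟩⟩ (by rw [hA1])
      omega
    · obtain ⟨-, h, -⟩ := ih (J G side A \ C).card (by omega) (A := symmDiff A A1)
        (by simp [Set.mem_symmDiff, hp, hp1]) (by rw [hA2]; exact hne2) (by rw [hA2]; omega)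
        (by rw [hA2]; exact hne.imp id fun h h' => h (h'.trans sdiff_subset))
        ⟨w, mem_insd.2 ⟨hwU, by rw [hA2]; exact fun h => hwon (h.mono sdiff_subset), x, hwx,
          by simp [Set.mem_symmDiff, hxA, hx1]⟩⟩ (by rw [hA2])
      omega

lemma MCE.none (M : MCE G U B E0 side p0) {A : Set Φ} (hp : p0 ∉ A) (hJ : (J G side A).Nonempty)
    (h8 : (J G side A).card ≤ 8) (hne : E0 = ∅ ∨ ¬ E0 ⊆ J G side A) {w : V} (hw : w ∈ U)
    (hon : ¬ On (J G side A) w) : ¬ Ins G side A w := by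
  intro h
  have := (M.step2' hp hJ (by omega) hne ⟨w, mem_insd.2 ⟨hw, hon, h⟩⟩).2.1
  omega

lemma sum_deg_le (E : Finset (Sym2 V)) (hl : Loopless E) (X : Finset V) :
    ∑ v ∈ X, (E.filter (fun e => v ∈ e)).card ≤ 2 * E.card := by
  simp only [card_filter]
  rw [sum_comm, mul_comm, ← smul_eq_mul, ← sum_const]
  refine sum_le_sum fun e he => ?_
  rw [← card_filter]
  induction e with | _ a b =>
  refine (card_le_card (t := {a, b}) fun v hv => ?_).trans card_le_two
  simpa using (mem_filter.1 hv).2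

lemma card_nb_le (E : Finset (Sym2 V)) {v : V} (hE : ∀ w, G.Adj v w → s(v, w) ∈ E) :
    (nb G v).card ≤ (E.filter (fun e => v ∈ e)).card := by
  refine card_le_card_of_injOn (fun w => s(v, w)) ?_ ?_
  · intro w hw
    simp only [mem_coe, mem_nb] at hw
    simp [hE w hw]
  · intro w hw w' hw' h
    exact Sym2.congr_right.1 h

/-- The outer face has no vertex of `U` on it. -/
lemma MCE.not_outer (M : MCE G U B E0 side p0) (h0 : E0 ≠ ∅) {u w : V} (hu : u ∈ U)
    (huw : G.Adj u w) : side u w ≠ p0 := by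
  intro hside
  have hJ : J G side {p0} = E0 := M.outer.resolve_left h0
  have hcirc := M.inst.circ.resolve_left h0
  let X : Finset V := U.filter (fun v => Ins G side {p0} v)
  have hX : ∀ v ∈ X, ∀ w, G.Adj v w → side v w = p0 ∧ side w v = p0 := by
    intro v hv w hvw
    rw [mem_filter] at hv
    exact hv.2.all M.plane (by rw [hJ]; exact M.inst.u_not_on hv.1) hvw
  let E' : Finset (Sym2 V) := univ.filter (fun e => ∃ v ∈ X, ∃ w, G.Adj v w ∧ e = s(v, w))
  have hE' : ∀ a b, s(a, b) ∈ E' → G.Adj a b ∧ side a b = p0 ∧ side b a = p0 := by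
    intro a b h
    simp only [E', mem_filter, mem_univ, true_and] at h
    obtain ⟨v, hv, w, hvw, h⟩ := h
    have := hX v hv w hvw
    rcases Sym2.eq_iff.1 h with ⟨rfl, rfl⟩ | ⟨rfl, rfl⟩
    exacts [⟨hvw, this⟩, ⟨hvw.symm, this.symm⟩]
  have hE'G : EIn G E' := fun a b h => (hE' a b h).1
  have hdisj : Disjoint E' E0 := by
    rw [Finset.disjoint_left]
    intro e he he0
    induction e with | _ a b =>
    rw [← hJ, mem_J] at he0
    have := hE' _ _ he
    simp [this.2.1, this.2.2] at he0
  have hev : ∀ Z ⊆ E' ∪ E0, bd Z = 0 → Z = ∅ ∨ Z = E0 := by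
    intro Z hZ hb
    obtain ⟨A, hA⟩ := M.plane.cyc Z ((hE'G.union M.inst.e0).mono hZ) hb
    refine hcirc.2.2 Z (fun e he => ?_) hb
    refine (mem_union.1 (hZ he)).resolve_left fun he' => ?_
    induction e with | _ a b =>
    rw [← hA, mem_J] at he
    have := hE' _ _ he'
    simp [this.2.1, this.2.2] at he
  have huX : u ∈ X := mem_filter.2 ⟨hu, w, huw, hside⟩
  have hk : ((E' ∪ E0).powerset.filter (fun Z => bd Z = 0)).card ≤ 2 ^ 1 := by
    refine (card_le_card (t := {∅, E0}) fun Z hZ => ?_).trans (card_le_two.trans (by norm_num))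
    have hZ' := mem_filter.1 hZ
    simpa using hev Z (mem_powerset.1 hZ'.1) hZ'.2
  have hcard := card_edges_le_of_span (E' ∪ E0) (hE'G.union M.inst.e0).loopless (X ∪ B) u
    (by simp [huX]) (by
      rintro v ⟨e, he, hv⟩
      rw [mem_union] at he ⊢
      rcases he with he | he
      · simp only [E', mem_filter, mem_univ, true_and] at he
        obtain ⟨x, hx, y, hxy, rfl⟩ := he
        rcases Sym2.mem_iff.1 hv with rfl | rfl
        · exact .inl hx
        · refine (M.inst.adj_cases hxy).imp_left fun h => ?_
          exact mem_filter.2 ⟨h, x, hxy.symm, (hX x hx v hxy).2⟩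
      · exact .inr ((M.inst.on v).1 ⟨e, he, hv⟩)) 1 (by convert hk)
  have hXB : Disjoint X B := M.inst.disj.mono_left (filter_subset _ _)
  rw [card_union_of_disjoint hdisj, card_union_of_disjoint hXB] at hcard
  have hB : B.card = E0.card := by
    rw [← hcirc.card_on M.inst.e0]
    congr 1
    ext v; simp [M.inst.on]
  have h1 := sum_deg_le E' hE'G.loopless X
  have h2 : X.card * 3 ≤ ∑ v ∈ X, (E'.filter (fun e => v ∈ e)).card := by
    rw [← smul_eq_mul]
    refine card_nsmul_le_sum _ _ _ fun v hv => (M.deg (mem_filter.1 hv).1).trans ?_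
    exact card_nb_le E' fun w hvw => by
      simp only [E', mem_filter, mem_univ, true_and]
      exact ⟨v, hv, w, hvw, rfl⟩
  have h3 : 0 < X.card := card_pos.2 ⟨u, huX⟩
  omega

lemma bd_union_zero {P Q : Finset (Sym2 V)} {a b : V} (hd : Disjoint P Q) (hP : bd P = pt a + pt b)
    (hQ : bd Q = pt a + pt b) : bd (P ∪ Q) = 0 := by
  rw [bd_union hd, hP, hQ]
  linear_combination (pt a + pt b) * two_zmod_pi (V := V)

lemma nonempty_of_bd {P : Finset (Sym2 V)} {a b : V} (hab : a ≠ b) (hP : bd P = pt a + pt b) :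
    P.Nonempty := by
  rw [nonempty_iff_ne_empty]
  rintro rfl
  have := congrFun hP a
  simp [pt_self, pt_ne hab] at this

lemma on_of_bd {P : Finset (Sym2 V)} {a b : V} (hab : a ≠ b) (hP : bd P = pt a + pt b) :
    On P a ∧ On P b := by
  constructor
  · by_contra h
    have := bd_eq_zero_of_not_on h
    rw [hP, Pi.add_apply, pt_self, pt_ne hab] at this
    simp at this
  · by_contra h
    have := bd_eq_zero_of_not_on h
    rw [hP, Pi.add_apply, pt_self, pt_ne hab.symm] at this
    simp at this

lemma disj_of_not_on {P Q : Finset (Sym2 V)} (h : ∀ e ∈ Q, ∃ v ∈ e, ¬ On P v) : Disjoint P Q := by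
  rw [Finset.disjoint_left]
  intro e he he'
  obtain ⟨v, hv, hn⟩ := h e he'
  exact hn ⟨e, he, hv⟩

lemma or_rot {p q r : Prop} : (q ∨ r ∨ p) ↔ (p ∨ q ∨ r) := by tauto

lemma or_sw {p q r : Prop} : (p ∨ r ∨ q) ↔ (p ∨ q ∨ r) := by tauto

lemma insert_union_perm {e : Sym2 V} {P Q : Finset (Sym2 V)} :
    insert e (Q ∪ P) = {e} ∪ P ∪ Q ∧ insert e (P ∪ Q) = P ∪ {e} ∪ Q ∧
      insert e (P ∪ Q) = P ∪ Q ∪ {e} := by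
  refine ⟨?_, ?_, ?_⟩ <;> ext x <;> simp only [mem_insert, mem_union, mem_singleton] <;> tauto

/-- The three neighbours of a vertex off a circuit of length at most nine split the circuit into
arcs of lengths `1`, `4` and `4`. -/
lemma claw_split (hf : Far G) {Z : Finset (Sym2 V)} (hZ : IsCirc Z) (hG : EIn G Z) (h9 : Z.card ≤ 9)
    {v a b c : V} (hv : ¬ On Z v) (ha : On Z a) (hb : On Z b) (hc : On Z c) (hab : a ≠ b)
    (hbc : b ≠ c) (hac : a ≠ c) (hva : G.Adj v a) (hvb : G.Adj v b) (hvc : G.Adj v c) :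
    Z.card = 9 ∧ ∃ x y z, (∀ w, (w = x ∨ w = y ∨ w = z) ↔ (w = a ∨ w = b ∨ w = c)) ∧
      x ≠ y ∧ y ≠ z ∧ x ≠ z ∧
      s(x, y) ∈ Z ∧ ∃ X Y : Finset (Sym2 V), X.card = 4 ∧ Y.card = 4 ∧ insert s(x, y) (X ∪ Y) = Z ∧
        bd X = pt x + pt z ∧ bd Y = pt y + pt z ∧ s(x, y) ∉ X ∪ Y ∧ Disjoint X Y := by
  have piece : ∀ (P : Finset (Sym2 V)) (a b : V), P ⊆ Z → bd P = pt a + pt b → a ≠ b → G.Adj v a →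
      G.Adj v b → P.card ≤ 3 → Short G (insert s(v, a) (insert s(v, b) P)) := by
    intro P a b hP hb hab ha1 hb1 h3
    have := Short.cons_path (G := G) (S := P) (a := a) (b := v) (c := b) (hG.mono hP) hb ha1.symm hb1 hab
      (fun h => hv ⟨_, hP h, by simp⟩) (fun h => hv ⟨_, hP h, by simp⟩) h3
    rwa [Sym2.eq_swap (a := a)] at this
  have two : ∀ (P Q : Finset (Sym2 V)) (a b c : V), P ⊆ Z → Q ⊆ Z → bd P = pt a + pt b →
      bd Q = pt b + pt c → a ≠ b → b ≠ c → a ≠ c → G.Adj v a → G.Adj v b → G.Adj v c →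
      P.card ≤ 3 → Q.card ≤ 3 → False := by
    intro P Q a b c hP hQ hbP hbQ hab hbc hac hva hvb hvc h3 h3'
    have e := hf.eq (piece P a b hP hbP hab hva hvb h3) (piece Q b c hQ hbQ hbc hvb hvc h3')
      (a := v) (on_left (mem_insert_self _ _)) (on_left (mem_insert_self _ _))
    have h1 : s(v, a) ∈ insert s(v, b) (insert s(v, c) Q) := by rw [← e]; simp
    simp only [mem_insert, Sym2.eq_iff, true_and] at h1
    rcases h1 with (h1 | ⟨h1, -⟩) | (h1 | ⟨h1, -⟩) | h1
    · exact hab h1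
    · exact hvb.ne h1
    · exact hac h1
    · exact hvc.ne h1
    · exact hv ⟨_, hQ h1, by simp⟩
  obtain ⟨P, Q, R, hZe, hPQ, hPQR, hbP, hbQ, hbR⟩ := hZ.three_split hG ha hb hc
  have hP : P ⊆ Z := by rw [← hZe]; intro e he; simp [he]
  have hQ : Q ⊆ Z := by rw [← hZe]; intro e he; simp [he]
  have hR : R ⊆ Z := by rw [← hZe]; intro e he; simp [he]
  have hsum : P.card + Q.card + R.card = Z.card := by
    rw [← hZe, card_union_of_disjoint hPQR, card_union_of_disjoint hPQ]
  have n1 := card_pos.2 (nonempty_of_bd hab hbP)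
  have n2 := card_pos.2 (nonempty_of_bd hbc hbQ)
  have n3 := card_pos.2 (nonempty_of_bd hac hbR)
  have t1 : ¬ (P.card ≤ 3 ∧ Q.card ≤ 3) := fun h =>
    two P Q a b c hP hQ hbP hbQ hab hbc hac hva hvb hvc h.1 h.2
  have t2 : ¬ (Q.card ≤ 3 ∧ R.card ≤ 3) := fun h =>
    two Q R b c a hQ hR hbQ (by rw [hbR, add_comm]) hbc hac.symm hab.symm hvb hvc hva h.1 h.2
  have t3 : ¬ (P.card ≤ 3 ∧ R.card ≤ 3) := fun h =>
    two P R b a c hP hR (by rw [hbP, add_comm]) hbR hab.symm hac hbc hvb hva hvc h.1 h.2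
  have hdPR : Disjoint P R := hPQR.mono_left subset_union_left
  have hdQR : Disjoint Q R := hPQR.mono_left subset_union_right
  refine ⟨by omega, ?_⟩
  have hcase : (P.card = 1 ∧ Q.card = 4 ∧ R.card = 4) ∨ (P.card = 4 ∧ Q.card = 1 ∧ R.card = 4) ∨
      (P.card = 4 ∧ Q.card = 4 ∧ R.card = 1) := by omega
  rcases hcase with ⟨h1, h2, h3⟩ | ⟨h1, h2, h3⟩ | ⟨h1, h2, h3⟩
  · have hPe := eq_singleton_of_bd hab h1.le hbP
    subst hPe
    refine ⟨a, b, c, fun w => Iff.rfl, hab, hbc, hac, hP (by simp), R, Q, h3, h2, ?_, hbR, hbQ, ?_, hdQR.symm⟩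
    · rw [← hZe]; exact insert_union_perm.1
    · simp only [disjoint_singleton_left] at hPQ hdPR
      simp [hPQ, hdPR]
  · have hPe := eq_singleton_of_bd hbc h2.le hbQ
    subst hPe
    refine ⟨b, c, a, fun w => or_rot, hbc, hac.symm, hab.symm, hQ (by simp), P, R, h1, h3, ?_,
      by rw [hbP, add_comm], by rw [hbR, add_comm], ?_, hdPR⟩
    · rw [← hZe]; exact insert_union_perm.2.1
    · simp only [disjoint_singleton_left, disjoint_singleton_right] at hPQ hdQR
      simp [hPQ, hdQR]
  · have hPe := eq_singleton_of_bd hac h3.le hbR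
    subst hPe
    refine ⟨a, c, b, fun w => or_sw, hac, hbc.symm, hab, hR (by simp), P, Q, h1, h2, ?_,
      hbP, by rw [hbQ, add_comm], ?_, hPQ⟩
    · rw [← hZe]; exact insert_union_perm.2.2
    · simp only [disjoint_singleton_left, disjoint_singleton_right] at hdPR hdQR
      simp [hdPR, hdQR]

/-- A vertex of `U` has at most two neighbours in `B`. -/
lemma Inst.no_claw (h : Inst G U B E0) {v a b c : V} (hv : v ∈ U) (ha : a ∈ B) (hb : b ∈ B)
    (hc : c ∈ B) (hab : a ≠ b) (hbc : b ≠ c) (hac : a ≠ c) (hva : G.Adj v a) (hvb : G.Adj v b) :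
    ¬ G.Adj v c := by
  intro hvc
  rcases h.circ with h0 | h0
  · simp [h.empty_of h0] at ha
  · have h9 := (claw_split h.far h0 h.e0 h.le (h.u_not_on hv) ((h.on a).2 ha) ((h.on b).2 hb)
      ((h.on c).2 hc) hab hbc hac hva hvb hvc).1
    exact (h.good h9).1 v hv a ha b hb c hc hab hbc hac hva hvb hvc

lemma MCE.e0_piece (M : MCE G U B E0 side p0) {Z P S : Finset (Sym2 V)} (hZ : IsCirc Z) (hP : P ⊆ Z)
    (hne : P ≠ Z) (hS : ∀ e ∈ S, e ∈ P ∨ ∃ u ∈ e, u ∈ U) : E0 = ∅ ∨ ¬ E0 ⊆ S := by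
  by_contra hcon
  push Not at hcon
  have h1 : E0 ⊆ P := fun e he => (hS e (hcon.2 he)).resolve_right fun ⟨u, hu, huU⟩ =>
    M.inst.u_not_on huU ⟨e, he, hu⟩
  have h2 := edges_subset_circ_eq hZ (h1.trans hP) (M.inst.circ.resolve_left hcon.1.ne_empty).2.1 hcon.1
  exact hne (hP.antisymm (h2 ▸ h1))

lemma MCE.none_set (M : MCE G U B E0 side p0) {Z P S : Finset (Sym2 V)} {A : Set Φ} (hp : p0 ∉ A)
    (hA : J G side A = S) (hZ : IsCirc Z) (hP : P ⊆ Z) (hPZ : P.card < Z.card)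
    (hS : ∀ e ∈ S, e ∈ P ∨ ∃ u ∈ e, u ∈ U) (hne : S.Nonempty) (h8 : S.card ≤ 8)
    {u v : V} (hu : u ∈ U) (hon : ¬ On S u) (huv : G.Adj u v) : side u v ∉ A := by
  subst hA
  intro h
  exact M.none hp hne h8 (M.e0_piece hZ hP (by rintro rfl; omega) hS) hu hon ⟨v, huv, h⟩

lemma MCE.claw_inside (M : MCE G U B E0 side p0) {A : Set Φ} (hp : p0 ∉ A) (hZ : IsCirc (J G side A))
    (h9 : (J G side A).card = 9) {w a b c : V} (hw : w ∈ insd G side U A)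
    (ha : On (J G side A) a) (hb : On (J G side A) b) (hc : On (J G side A) c) (hab : a ≠ b)
    (hbc : b ≠ c) (hac : a ≠ c) (hwa : G.Adj w a) (hwb : G.Adj w b) (hwc : G.Adj w c) :
    ∃ x y z, insd G side U A = {w} ∧ (∀ v, G.Adj w v ↔ v = x ∨ v = y ∨ v = z) ∧
      On (J G side A) x ∧ On (J G side A) y ∧ On (J G side A) z ∧ s(x, y) ∈ J G side A ∧
      x ≠ y ∧ y ≠ z ∧ x ≠ z := by
  have hwm := mem_insd.1 hw
  obtain ⟨-, x, y, z, hperm, hxy, hyz, hxz, hxyZ, X, Y, hX, hY, hZe, hbX, hbY, hnXY, hXY⟩ :=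
    claw_split M.inst.far hZ eIn_J h9.le hwm.2.1 ha hb hc hab hbc hac hwa hwb hwc
  have hadj : ∀ v, v = x ∨ v = y ∨ v = z → G.Adj w v ∧ On (J G side A) v := by
    intro v hv
    rcases (hperm v).1 hv with rfl | rfl | rfl
    exacts [⟨hwa, ha⟩, ⟨hwb, hb⟩, ⟨hwc, hc⟩]
  obtain ⟨hwx, hxo⟩ := hadj x (by simp)
  obtain ⟨hwy, hyo⟩ := hadj y (by simp)
  obtain ⟨hwz, hzo⟩ := hadj z (by simp)
  have hxyG : G.Adj x y := eIn_J _ _ hxyZ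
  have hT := tri_short hwx hxyG hwy
  set Z := J G side A with hZdef
  have hXZ : X ⊆ Z := by rw [← hZe]; intro e he; simp [he]
  have hYZ : Y ⊆ Z := by rw [← hZe]; intro e he; simp [he]
  have hwZ : ∀ e ∈ Z, w ∉ e := fun e he h => hwm.2.1 ⟨e, he, h⟩
  have hIns : insd G side U A = {w} := by
    have d1 : Disjoint X {s(x, w), s(w, z)} := disj_of_not_on (by
      intro e he
      refine ⟨w, ?_, fun h => hwm.2.1 (h.mono hXZ)⟩
      simp only [mem_insert, mem_singleton] at he
      rcases he with rfl | rfl <;> simp)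
    have b1 : bd (X ∪ {s(x, w), s(w, z)}) = 0 :=
      bd_union_zero d1 hbX (bd_path2 hwx.ne' hwz.ne hxz)
    have e1 : EIn G (X ∪ {s(x, w), s(w, z)}) :=
      (eIn_J.mono hXZ).union (((EIn.empty).insert hwz).insert hwx.symm)
    obtain ⟨A1, hA1, hp1⟩ := exA M.plane hT.1 hT.2.1 p0
    obtain ⟨A2, hA2, hp2⟩ := exA M.plane e1 b1 p0
    have hA3 : J G side (symmDiff A (symmDiff A1 A2)) = Y ∪ {s(y, w), s(w, z)} := by
      rw [J_symmDiff, J_symmDiff, hA1, hA2, ← hZdef]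
      ext e
      by_cases hwe : w ∈ e
      · obtain ⟨v, rfl⟩ := Sym2.mem_iff_exists.1 hwe
        have h1 : s(w, v) ∉ Z := fun h => hwZ _ h hwe
        have h2 : s(w, v) ∉ X := fun h => h1 (hXZ h)
        have h3 : s(w, v) ∉ Y := fun h => h1 (hYZ h)
        simp only [mem_symmDiff, h1, h2, h3, mem_union, mem_tri, mem_insert,
          mem_singleton, Sym2.eq_iff, true_and, hwx.ne, hwy.ne, hwz.ne, false_and, false_or,
          or_false, and_true, not_false_eq_true, and_false]
        by_cases v = x <;> by_cases v = y <;> by_cases v = z <;> simp_all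
      · have h1 : ∀ v, e ≠ s(w, v) ∧ e ≠ s(v, w) := fun v => by constructor <;> rintro rfl <;> simp at hwe
        have h6 : ¬ (e ∈ X ∧ e ∈ Y) := fun h => Finset.disjoint_left.1 hXY h.1 h.2
        have h7 : ¬ (e = s(x, y) ∧ (e ∈ X ∨ e ∈ Y)) := by
          rintro ⟨rfl, h⟩; exact hnXY (mem_union.2 h)
        rw [← hZe]
        simp only [mem_symmDiff, mem_union, mem_tri, mem_insert,
          mem_singleton, (h1 _).1, (h1 _).2, false_or, or_false]
        clear * - h6 h7
        tauto
    have hp3 : p0 ∉ symmDiff A (symmDiff A1 A2) := by simp [Set.mem_symmDiff, hp, hp1, hp2]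
    ext u
    rw [mem_singleton]
    refine ⟨fun hu => ?_, by rintro rfl; exact hw⟩
    by_contra huw
    have hum := mem_insd.1 hu
    obtain ⟨v, huv, hvA⟩ := hum.2.2
    have hux : u ≠ x := by rintro rfl; exact hum.2.1 hxo
    have huy : u ≠ y := by rintro rfl; exact hum.2.1 hyo
    have huz : u ≠ z := by rintro rfl; exact hum.2.1 hzo
    have k1 : side u v ∉ A1 := by
      refine M.none_set hp1 hA1 hZ (P := {s(x, y)}) (by simpa using hxyZ) (by rw [h9]; simp) ?_
        hT.2.2.1 (hT.2.2.2.trans (by norm_num)) hum.1 ?_ huv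
      · intro e he
        rw [mem_tri] at he
        rcases he with rfl | rfl | rfl
        exacts [.inr ⟨w, by simp, hwm.1⟩, .inl (by simp), .inr ⟨w, by simp, hwm.1⟩]
      · rw [on_tri]; tauto
    have hsz : ∀ (X : Finset (Sym2 V)) (x : V), X.card = 4 → (X ∪ {s(x, w), s(w, z)}).card ≤ 8 := by
      intro X x hX
      refine (card_union_le _ _).trans ?_
      have := card_le_two (a := s(x, w)) (b := s(w, z))
      omega
    have hon : ∀ (X : Finset (Sym2 V)) (x : V), X ⊆ Z → u ≠ x → ¬ On (X ∪ {s(x, w), s(w, z)}) u := by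
      rintro X x hX hux ⟨e, he, hue⟩
      simp only [mem_union, mem_insert, mem_singleton] at he
      rcases he with he | rfl | rfl
      · exact hum.2.1 ⟨e, hX he, hue⟩
      · simp only [Sym2.mem_iff] at hue; tauto
      · simp only [Sym2.mem_iff] at hue; tauto
    have hcov : ∀ (X : Finset (Sym2 V)) (x : V), ∀ e ∈ X ∪ {s(x, w), s(w, z)}, e ∈ X ∨ ∃ u ∈ e, u ∈ U := by
      intro X x e he
      simp only [mem_union, mem_insert, mem_singleton] at he
      rcases he with he | rfl | rfl
      exacts [.inl he, .inr ⟨w, by simp, hwm.1⟩, .inr ⟨w, by simp, hwm.1⟩]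
    have k2 : side u v ∉ A2 :=
      M.none_set hp2 hA2 hZ hXZ (by omega) (hcov X x) ⟨s(x, w), by simp⟩ (hsz X x hX) hum.1 (hon X x hXZ hux) huv
    have k3 : side u v ∉ symmDiff A (symmDiff A1 A2) :=
      M.none_set hp3 hA3 hZ hYZ (by omega) (hcov Y y) ⟨s(y, w), by simp⟩ (hsz Y y hY) hum.1 (hon Y y hYZ huy) huv
    simp [Set.mem_symmDiff, hvA, k1, k2] at k3
  refine ⟨x, y, z, hIns, ?_, hxo, hyo, hzo, hxyZ, hxy, hyz, hxz⟩
  · intro d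
    refine ⟨fun hd => ?_, ?_⟩
    · by_contra hdn
      push Not at hdn
      have hdZ : On Z d := by
        rcases M.ins_adj hp hw hd with h | h
        · rw [hIns, mem_singleton] at h
          exact absurd h hd.ne'
        · exact h
      obtain ⟨-, x', y', z', hperm', hxy', -, -, hxyZ', -⟩ :=
        claw_split M.inst.far hZ eIn_J h9.le hwm.2.1 hxo hzo hdZ hxz (Ne.symm hdn.2.2) (Ne.symm hdn.1) hwx hwz hd
      have hadj' : ∀ v, v = x' ∨ v = y' ∨ v = z' → G.Adj w v ∧ v ≠ y := by
        intro v hv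
        rcases (hperm' v).1 hv with rfl | rfl | rfl
        exacts [⟨hwx, hxy⟩, ⟨hwz, hyz.symm⟩, ⟨hd, hdn.2.1⟩]
      obtain ⟨hwx', hxy1⟩ := hadj' x' (by simp)
      obtain ⟨hwy', hyy1⟩ := hadj' y' (by simp)
      have hT' := tri_short hwx' (eIn_J _ _ hxyZ') hwy'
      have := M.inst.far.eq hT hT' (a := w) (on_tri.2 (by simp)) (on_tri.2 (by simp))
      have h1 : On (tri w x' y') y := by rw [← this, on_tri]; simp
      rw [on_tri] at h1
      rcases h1 with h1 | h1 | h1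
      exacts [hwy.ne h1.symm, hxy1 h1.symm, hyy1 h1.symm]
    · rintro (rfl | rfl | rfl)
      exacts [hwx, hwy, hwz]

lemma bd_path3_union {P : Finset (Sym2 V)} {a x y b : V} (hP : bd P = pt a + pt b) (hPx : ¬ On P x)
    (hPy : ¬ On P y) (h0 : a ≠ x) (h1 : x ≠ y) (h2 : y ≠ b) (h3 : x ≠ b) (h4 : a ≠ y) :
    bd (P ∪ {s(a, x), s(x, y), s(y, b)}) = 0 := by
  refine bd_union_zero (disj_of_not_on ?_) hP (bd_path3 h0 h1 h2 h3 h4)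
  intro e he
  simp only [mem_insert, mem_singleton] at he
  rcases he with rfl | rfl | rfl
  exacts [⟨x, by simp, hPx⟩, ⟨x, by simp, hPx⟩, ⟨y, by simp, hPy⟩]

lemma card_path3_union_le {P : Finset (Sym2 V)} {a x y b : V} :
    (P ∪ {s(a, x), s(x, y), s(y, b)}).card ≤ P.card + 3 :=
  (card_union_le _ _).trans (Nat.add_le_add_left card_le_three _)

lemma eIn_path3_union {P : Finset (Sym2 V)} {a x y b : V} (hP : EIn G P) (h1 : G.Adj x a)
    (h2 : G.Adj x y) (h3 : G.Adj y b) : EIn G (P ∪ {s(a, x), s(x, y), s(y, b)}) :=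
  hP.union ((((EIn.empty).insert h3).insert h2).insert h1.symm)

lemma on_path3_union {P : Finset (Sym2 V)} {a x y b u : V} (h : On (P ∪ {s(a, x), s(x, y), s(y, b)}) u) :
    On P u ∨ u = a ∨ u = x ∨ u = y ∨ u = b := by
  obtain ⟨e, he, hu⟩ := h
  simp only [mem_union, mem_insert, mem_singleton] at he
  rcases he with he | rfl | rfl | rfl
  · exact .inl ⟨e, he, hu⟩
  all_goals simp only [Sym2.mem_iff] at hu; tauto

/-- The feet of two triangle corners are at distance at least three. -/
lemma Far.three_le (hf : Far G) {x y z a b : V} (hxy : G.Adj x y) (hyz : G.Adj y z) (hxz : G.Adj x z)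
    (hxa : G.Adj x a) (hyb : G.Adj y b) (ha : a ≠ y ∧ a ≠ z) (hb : b ≠ x ∧ b ≠ z)
    {P : Finset (Sym2 V)} (hP : EIn G P) (hbd : bd P = pt a + pt b) (hPx : ¬ On P x) (hPy : ¬ On P y) :
    a ≠ b ∧ 3 ≤ P.card := by
  have hT := tri_short hxy hyz hxz
  have hn : a ≠ b := by
    rintro rfl
    have := hf.eq (tri_short hxy hyb hxa) hT (a := x) (by simp [on_tri]) (by simp [on_tri])
    have h2 : On (tri x y z) a := by rw [← this]; simp [on_tri]
    rw [on_tri] at h2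
    have := hxa.ne'
    tauto
  refine ⟨hn, ?_⟩
  by_contra hlt
  have h0 : Short G (P ∪ {s(a, x), s(x, y), s(y, b)}) :=
    ⟨eIn_path3_union hP hxa hxy hyb, bd_path3_union hbd hPx hPy hxa.ne' hxy.ne hyb.ne hb.1.symm ha.1,
      ⟨s(a, x), by simp⟩, card_path3_union_le.trans (by omega)⟩
  have := hf.eq h0 hT (a := x) ⟨s(a, x), by simp⟩ (by simp [on_tri])
  have h2 : On (tri x y z) a := by rw [← this]; exact ⟨s(a, x), by simp⟩
  rw [on_tri] at h2
  have := hxa.ne'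
  tauto

lemma MCE.triclaw_inside (M : MCE G U B E0 side p0) {A : Set Φ} (hp : p0 ∉ A) (hZ : IsCirc (J G side A))
    (h9 : (J G side A).card = 9) {x y z a b c : V} (hx : x ∈ insd G side U A)
    (hy : y ∈ insd G side U A) (hz : z ∈ insd G side U A) (hxy : G.Adj x y) (hyz : G.Adj y z)
    (hxz : G.Adj x z) (ha : On (J G side A) a) (hb : On (J G side A) b) (hc : On (J G side A) c)
    (hxa : G.Adj x a) (hyb : G.Adj y b) (hzc : G.Adj z c) : insd G side U A = {x, y, z} := by
  have hxm := mem_insd.1 hx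
  have hym := mem_insd.1 hy
  have hzm := mem_insd.1 hz
  set Z := J G side A with hZdef
  obtain ⟨P, Q, R, hPQR, dPQ, dR, bP, bQ, bR⟩ := hZ.three_split eIn_J ha hb hc
  have hPZ : P ⊆ Z := by rw [← hPQR]; intro e he; simp [he]
  have hQZ : Q ⊆ Z := by rw [← hPQR]; intro e he; simp [he]
  have hRZ : R ⊆ Z := by rw [← hPQR]; intro e he; simp [he]
  have ne : ∀ {u v : V}, On Z u → ¬ On Z v → u ≠ v := by rintro u v h1 h2 rfl; exact h2 h1
  have nm : ∀ {X : Finset (Sym2 V)} {u : V}, X ⊆ Z → ¬ On Z u → ¬ On X u := fun h1 h2 h3 => h2 (h3.mono h1)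
  have hax := ne ha hxm.2.1
  have hay := ne ha hym.2.1
  have haz := ne ha hzm.2.1
  have hbx := ne hb hxm.2.1
  have hby := ne hb hym.2.1
  have hbz := ne hb hzm.2.1
  have hcx := ne hc hxm.2.1
  have hcy := ne hc hym.2.1
  have hcz := ne hc hzm.2.1
  obtain ⟨hab, cP⟩ := M.inst.far.three_le hxy hyz hxz hxa hyb ⟨hay, haz⟩ ⟨hbx, hbz⟩ (eIn_J.mono hPZ) bP
    (nm hPZ hxm.2.1) (nm hPZ hym.2.1)
  obtain ⟨hbc, cQ⟩ := M.inst.far.three_le hyz hxz.symm hxy.symm hyb hzc ⟨hbz, hbx⟩ ⟨hcy, hcx⟩ (eIn_J.mono hQZ) bQ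
    (nm hQZ hym.2.1) (nm hQZ hzm.2.1)
  obtain ⟨hac, cR⟩ := M.inst.far.three_le hxz hyz.symm hxy hxa hzc ⟨haz, hay⟩ ⟨hcx, hcy⟩ (eIn_J.mono hRZ) bR
    (nm hRZ hxm.2.1) (nm hRZ hzm.2.1)
  have hcard : P.card + Q.card + R.card = 9 := by
    rw [← card_union_of_disjoint dPQ, ← card_union_of_disjoint dR, hPQR, h9]
  obtain ⟨A0, hA0, hp0⟩ := exA M.plane (tri_short hxy hyz hxz).1 (tri_short hxy hyz hxz).2.1 p0
  obtain ⟨A1, hA1, hp1⟩ := exA M.plane (eIn_path3_union (eIn_J.mono hPZ) hxa hxy hyb)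
    (bd_path3_union bP (nm hPZ hxm.2.1) (nm hPZ hym.2.1) hax hxy.ne hby.symm hbx.symm hay) p0
  obtain ⟨A2, hA2, hp2⟩ := exA M.plane (eIn_path3_union (eIn_J.mono hQZ) hyb hyz hzc)
    (bd_path3_union bQ (nm hQZ hym.2.1) (nm hQZ hzm.2.1) hby hyz.ne hcz.symm hcy.symm hbz) p0
  have hA3 : J G side (symmDiff A (symmDiff A0 (symmDiff A1 A2))) = R ∪ {s(a, x), s(x, z), s(z, c)} := by
    rw [J_symmDiff, J_symmDiff, J_symmDiff, hA0, hA1, hA2, ← hZdef]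
    have hyb' : s(b, y) = s(y, b) := Sym2.eq_swap
    ext e
    by_cases he : e ∈ Z
    · have off : ∀ u v, ¬ On Z u ∨ ¬ On Z v → e ≠ s(u, v) := by
        rintro u v (h | h) rfl
        exacts [h (on_left he), h (on_right he)]
      have k1 : ¬ (e ∈ P ∧ e ∈ Q) := fun h => Finset.disjoint_left.1 dPQ h.1 h.2
      have k2 : ¬ ((e ∈ P ∨ e ∈ Q) ∧ e ∈ R) := fun h => Finset.disjoint_left.1 dR (mem_union.2 h.1) h.2
      have k3 : (e ∈ P ∨ e ∈ Q) ∨ e ∈ R := by rw [← hPQR] at he; simpa only [mem_union] using he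
      simp only [mem_symmDiff, mem_union, mem_tri, mem_insert, hyb',
          mem_singleton, off a x (.inr hxm.2.1), off x y (.inl hxm.2.1), off y b (.inl hym.2.1), off y z (.inl hym.2.1),
          off z c (.inl hzm.2.1), off x z (.inl hxm.2.1), he, or_false, false_or]
      clear * - k1 k2 k3
      tauto
    · have q1 : e ∉ P := fun h => he (hPZ h)
      have q2 : e ∉ Q := fun h => he (hQZ h)
      have q3 : e ∉ R := fun h => he (hRZ h)
      have dxy := hxy.ne
      have dyz := hyz.ne
      have dxz := hxz.ne
      simp only [mem_symmDiff, mem_union, mem_tri, mem_insert, hyb',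
          mem_singleton, he, q1, q2, q3, false_or]
      by_cases n : e = s(a, x) ∨ e = s(x, y) ∨ e = s(y, b) ∨ e = s(y, z) ∨ e = s(z, c) ∨ e = s(x, z)
      · rcases n with rfl | rfl | rfl | rfl | rfl | rfl <;> clear * - hax hay haz hbx hby hbz hcx hcy hcz dxy dyz dxz hab hbc hac <;>
          simp [*, Ne.symm, eq_comm] <;> try grind
      simp_all
  have hp3 : p0 ∉ symmDiff A (symmDiff A0 (symmDiff A1 A2)) := by simp [Set.mem_symmDiff, hp, hp0, hp1, hp2]
  have hcov : ∀ (X : Finset (Sym2 V)) (a x y b : V), x ∈ U → y ∈ U →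
      ∀ e ∈ X ∪ {s(a, x), s(x, y), s(y, b)}, e ∈ X ∨ ∃ u ∈ e, u ∈ U := by
    intro X a x y b hx hy e he
    simp only [mem_union, mem_insert, mem_singleton] at he
    rcases he with he | rfl | rfl | rfl
    exacts [.inl he, .inr ⟨x, by simp, hx⟩, .inr ⟨x, by simp, hx⟩, .inr ⟨y, by simp, hy⟩]
  ext u
  simp only [mem_insert, mem_singleton]
  refine ⟨fun hu => ?_, by rintro (rfl | rfl | rfl) <;> assumption⟩
  by_contra hn
  push Not at hn
  have hum := mem_insd.1 hu
  obtain ⟨v, huv, hvA⟩ := hum.2.2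
  have hon : ∀ (X : Finset (Sym2 V)) (a x y b : V), X ⊆ Z → On Z a → u ≠ x → u ≠ y → On Z b →
      ¬ On (X ∪ {s(a, x), s(x, y), s(y, b)}) u := by
    intro X a x y b hX ha h1 h2 hb h
    rcases on_path3_union h with h | rfl | rfl | rfl | rfl
    exacts [nm hX hum.2.1 h, hum.2.1 ha, h1 rfl, h2 rfl, hum.2.1 hb]
  have k0 : side u v ∉ A0 := by
    refine M.none_set hp0 hA0 hZ (P := ∅) (by simp) (by rw [h9]; simp) ?_
      (tri_short hxy hyz hxz).2.2.1 ((tri_short hxy hyz hxz).2.2.2.trans (by norm_num)) hum.1 ?_ huv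
    · intro e he
      rw [mem_tri] at he
      rcases he with rfl | rfl | rfl
      exacts [.inr ⟨x, by simp, hxm.1⟩, .inr ⟨y, by simp, hym.1⟩, .inr ⟨x, by simp, hxm.1⟩]
    · rw [on_tri]; tauto
  have k1 : side u v ∉ A1 :=
    M.none_set hp1 hA1 hZ hPZ (by omega) (hcov P a x y b hxm.1 hym.1) ⟨s(a, x), by simp⟩
      (card_path3_union_le.trans (by omega)) hum.1 (hon P a x y b hPZ ha hn.1 hn.2.1 hb) huv
  have k2 : side u v ∉ A2 :=
    M.none_set hp2 hA2 hZ hQZ (by omega) (hcov Q b y z c hym.1 hzm.1) ⟨s(b, y), by simp⟩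
      (card_path3_union_le.trans (by omega)) hum.1 (hon Q b y z c hQZ hb hn.2.1 hn.2.2 hc) huv
  have k3 : side u v ∉ symmDiff A (symmDiff A0 (symmDiff A1 A2)) :=
    M.none_set hp3 hA3 hZ hRZ (by omega) (hcov R a x z c hxm.1 hzm.1) ⟨s(a, x), by simp⟩
      (card_path3_union_le.trans (by omega)) hum.1 (hon R a x z c hRZ ha hn.1 hn.2.2 hc) huv
  simp [Set.mem_symmDiff, hvA, k0, k1, k2] at k3

/-- The inside of a circuit of length nine which is not good. -/
lemma MCE.bad_in (M : MCE G U B E0 side p0) {A : Set Φ} (hp : p0 ∉ A) (hJ : (J G side A).Nonempty)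
    (h9 : (J G side A).card ≤ 9) (hne : E0 = ∅ ∨ ¬ E0 ⊆ J G side A) {u v : V} (hu : u ∈ U)
    (hon : ¬ On (J G side A) u) (huv : G.Adj u v) (hA : side u v ∈ A) :
    IsCirc (J G side A) ∧ (J G side A).card = 9 ∧
    ((∃ x y z, insd G side U A = {u} ∧ (∀ v, G.Adj u v ↔ v = x ∨ v = y ∨ v = z) ∧
      On (J G side A) x ∧ On (J G side A) y ∧ On (J G side A) z ∧ s(x, y) ∈ J G side A ∧
      x ≠ y ∧ y ≠ z ∧ x ≠ z) ∨
    ∃ y z, insd G side U A = {u, y, z} ∧ G.Adj u y ∧ G.Adj y z ∧ G.Adj u z) := by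
  have hui : u ∈ insd G side U A := mem_insd.2 ⟨hu, hon, v, huv, hA⟩
  obtain ⟨h1, h2, h3⟩ := M.step2' hp hJ h9 hne ⟨u, hui⟩
  refine ⟨h1, h2, ?_⟩
  rw [Good, not_and_or] at h3
  rcases h3 with h3 | h3
  · push Not at h3
    obtain ⟨w, hw, a, ha, b, hb, c, hc, hab, hbc, hac, hwa, hwb, hwc⟩ := h3
    obtain ⟨x, y, z, hI, h4⟩ := M.claw_inside hp h1 h2 hw (mem_vs.1 ha) (mem_vs.1 hb) (mem_vs.1 hc)
      hab hbc hac hwa hwb hwc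
    rw [hI, mem_singleton] at hui
    subst hui
    exact .inl ⟨x, y, z, hI, h4⟩
  · push Not at h3
    obtain ⟨x, hx, y, hy, z, hz, hxy, hyz, hxz, ⟨a, ha, hxa⟩, ⟨b, hb, hyb⟩, ⟨c, hc, hzc⟩⟩ := h3
    have hI := M.triclaw_inside hp h1 h2 hx hy hz hxy hyz hxz (mem_vs.1 ha) (mem_vs.1 hb) (mem_vs.1 hc)
      hxa hyb hzc
    right
    rw [hI] at hui ⊢
    simp only [mem_insert, mem_singleton] at hui
    rcases hui with rfl | rfl | rfl
    · exact ⟨y, z, rfl, hxy, hyz, hxz⟩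
    · exact ⟨x, z, by ext; simp only [mem_insert, mem_singleton]; tauto, hxy.symm, hxz, hyz⟩
    · exact ⟨x, y, by ext; simp only [mem_insert, mem_singleton]; tauto, hxz.symm, hxy, hyz.symm⟩

/-- Two corners of a triangle outside of the precolored circuit are not both attached to it. -/
lemma MCE.not_att_two (M : MCE G U B E0 side p0) {x y z a b : V} (hx : x ∈ U) (hy : y ∈ U) (hz : z ∈ U)
    (hxy : G.Adj x y) (hyz : G.Adj y z) (hxz : G.Adj x z) (ha : a ∈ B) (hb : b ∈ B) (hxa : G.Adj x a) :
    ¬ G.Adj y b := by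
  intro hyb
  have h0 : E0 ≠ ∅ := by rintro rfl; simp [M.inst.empty_of rfl] at ha
  have hJ0 : J G side {p0} = E0 := M.outer.resolve_left h0
  have hcirc := M.inst.circ.resolve_left h0
  have ne : ∀ {u v : V}, u ∈ B → v ∈ U → u ≠ v := by rintro u v h1 h2 rfl; exact M.inst.b_not_u h1 h2
  obtain ⟨P, hP, bP⟩ := hcirc.exists_arc M.inst.e0.loopless ((M.inst.on a).2 ha) ((M.inst.on b).2 hb)
  have bQ : bd (E0 \ P) = pt a + pt b := by
    rw [bd_sdiff hP, hcirc.2.1, bP, zero_add]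
  have nm : ∀ {X : Finset (Sym2 V)} {u : V}, X ⊆ E0 → u ∈ U → ¬ On X u :=
    fun h1 h2 h3 => M.inst.u_not_on h2 (h3.mono h1)
  have three : ∀ P ⊆ E0, bd P = pt a + pt b → a ≠ b ∧ 3 ≤ P.card := fun P hP bP =>
    M.inst.far.three_le hxy hyz hxz hxa hyb ⟨ne ha hy, ne ha hz⟩ ⟨ne hb hx, ne hb hz⟩
      (M.inst.e0.mono hP) bP (nm hP hx) (nm hP hy)
  have hPc := (three P hP bP).2
  have hQc := (three _ sdiff_subset bQ).2
  have hsum := card_sdiff_add_card_eq_card hP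
  have hle := M.inst.le
  have hT := tri_short hxy hyz hxz
  have key : ∀ P ⊆ E0, bd P = pt a + pt b → P.card ≤ 6 → P ≠ E0 → (9 ≤ P.card + 3 → E0.card = 9) → ∀ A : Set Φ, p0 ∉ A →
      J G side A = P ∪ {s(a, x), s(x, y), s(y, b)} → side z x ∉ A := by
    intro P hP bP h6 hPE h9 A hp hA hzA
    have hsub : E0 = ∅ ∨ ¬ E0 ⊆ J G side A := M.e0_piece hcirc hP hPE (by
      intro e he
      rw [hA] at he
      simp only [mem_union, mem_insert, mem_singleton] at he
      rcases he with he | rfl | rfl | rfl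
      exacts [.inl he, .inr ⟨x, by simp, hx⟩, .inr ⟨x, by simp, hx⟩, .inr ⟨y, by simp, hy⟩])
    have hon : ¬ On (J G side A) z := by
      rw [hA]
      intro h
      rcases on_path3_union h with h | rfl | rfl | rfl | rfl
      exacts [nm hP hz h, M.inst.b_not_u ha hz, hxz.ne rfl, hyz.ne rfl, M.inst.b_not_u hb hz]
    have hxA : On (J G side A) x := by rw [hA]; exact ⟨s(x, y), by simp, by simp⟩
    have hc9 : (J G side A).card ≤ 9 := by rw [hA]; exact card_path3_union_le.trans (by omega)
    obtain ⟨-, hc, hbad⟩ := M.bad_in hp ⟨s(x, y), by rw [hA]; simp⟩ hc9 hsub hz hon hxz.symm hzA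
    have hE9 : E0.card = 9 := h9 (by rw [← hc, hA]; exact card_path3_union_le)
    rcases hbad with ⟨d, e, f, -, hnb, hd, he, hf, -, hde, hef, hdf⟩ | ⟨y', z', hI, h1, h2, h3⟩
    · have : ∃ g, G.Adj z g ∧ g ≠ x ∧ g ≠ y ∧ On (J G side A) g := by
        have h1 := (hnb x).1 hxz.symm
        have h2 := (hnb y).1 hyz.symm
        have h3 := hxy.ne
        by_cases k1 : d ≠ x ∧ d ≠ y
        · exact ⟨d, (hnb d).2 (by simp), k1.1, k1.2, hd⟩
        by_cases k2 : e ≠ x ∧ e ≠ y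
        · exact ⟨e, (hnb e).2 (by simp), k2.1, k2.2, he⟩
        refine ⟨f, (hnb f).2 (by simp), ?_, ?_, hf⟩ <;> rintro rfl <;> grind
      obtain ⟨g, hzg, hgx, hgy, hg⟩ := this
      rw [hA] at hg
      refine (M.inst.good hE9).2 x hx y hy z hz hxy hyz hxz ⟨a, ha, hxa⟩ ⟨b, hb, hyb⟩ ⟨g, ?_, hzg⟩
      rcases on_path3_union hg with h | rfl | rfl | rfl | rfl
      exacts [(M.inst.on g).1 (h.mono hP), ha, absurd rfl hgx, absurd rfl hgy, hb]
    · have := M.inst.far.eq (tri_short h1 h2 h3) hT (a := z) (by simp [on_tri]) (by simp [on_tri])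
      have hx' : On (tri z y' z') x := by rw [this]; simp [on_tri]
      have : x ∈ insd G side U A := by rw [hI]; simpa [on_tri] using hx'
      exact (mem_insd.1 this).2.1 hxA
  obtain ⟨A, hA, hp⟩ := exA M.plane (eIn_path3_union (M.inst.e0.mono hP) hxa hxy hyb)
    (bd_path3_union bP (nm hP hx) (nm hP hy) (ne ha hx) hxy.ne (ne hb hy).symm (ne hb hx).symm (ne ha hy)) p0
  have k1 := key P hP bP (by omega) (by rintro rfl; simp at hQc) (by omega) A hp hA
  have hA2 : J G side (symmDiff {p0}ᶜ A) = E0 \ P ∪ {s(a, x), s(x, y), s(y, b)} := by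
    rw [J_symmDiff, J_compl, hJ0, hA]
    have m1 : s(a, x) ∉ E0 := fun h => M.inst.u_not_on hx (on_right h)
    have m2 : s(x, y) ∉ E0 := fun h => M.inst.u_not_on hx (on_left h)
    have m3 : s(y, b) ∉ E0 := fun h => M.inst.u_not_on hy (on_left h)
    ext e
    by_cases n1 : e = s(a, x)
    · subst n1; simp [mem_symmDiff, m1]
    by_cases n2 : e = s(x, y)
    · subst n2; simp [mem_symmDiff, m2]
    by_cases n3 : e = s(y, b)
    · subst n3; simp [mem_symmDiff, m3]
    have := @hP e
    simp only [mem_symmDiff, mem_union, mem_insert, mem_singleton, n1, n2, n3,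
      or_false, mem_sdiff]
    clear * - this
    tauto
  have k2 := key (E0 \ P) sdiff_subset bQ (by omega) (fun h => by rw [h] at hsum; omega)
    (by omega) _ (by simp [Set.mem_symmDiff, hp]) hA2
  have := M.not_outer h0 hz hxz.symm
  simp [Set.mem_symmDiff, k1, this] at k2

lemma MCE.not_sub (M : MCE G U B E0 side p0) {S : Finset (Sym2 V)} (hS : IsCirc S) {u : V} (hu : u ∈ U)
    (hon : On S u) : E0 = ∅ ∨ ¬ E0 ⊆ S := by
  by_contra hcon
  push Not at hcon
  have := edges_subset_circ_eq hS hcon.2 (M.inst.circ.resolve_left hcon.1.ne_empty).2.1 hcon.1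
  exact M.inst.u_not_on hu (this ▸ hon)

lemma MCE.mem_u_of_ins (M : MCE G U B E0 side p0) {A : Set Φ} (hp : p0 ∉ A) {v w : V}
    (hon : ¬ On (J G side A) v) (hvw : G.Adj v w) (h : side v w ∈ A) : v ∈ U :=
  (M.inst.adj_cases hvw.symm).resolve_right fun hb => M.b_not_ins hp hb hon ⟨w, hvw, h⟩

/-- Nothing lies inside a triangle with a vertex in `U`. -/
lemma MCE.tri_none (M : MCE G U B E0 side p0) {A : Set Φ} (hp : p0 ∉ A) {x y z : V} (hy : y ∈ U)
    (hxy : G.Adj x y) (hyz : G.Adj y z) (hxz : G.Adj x z) (hA : J G side A = tri x y z) {v w : V}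
    (hvw : G.Adj v w) (h : s(v, w) ∉ tri x y z) : side v w ∉ A := by
  have hT := tri_short hxy hyz hxz
  have hTc := hT.isCirc
  have off : ∀ {v w}, G.Adj v w → ¬ On (tri x y z) v → side v w ∉ A := by
    intro v w hvw hon hv
    rw [← hA] at hon
    refine M.none hp (by rw [hA]; exact hT.2.2.1) (by rw [hA]; exact hT.2.2.2.trans (by norm_num)) ?_
      (M.mem_u_of_ins hp hon hvw hv) hon ⟨w, hvw, hv⟩
    rw [hA]
    exact M.not_sub hTc hy (by simp [on_tri])
  by_cases h1 : On (tri x y z) v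
  · by_cases h2 : On (tri x y z) w
    · exfalso
      rw [on_tri] at h1 h2
      have := hvw.ne
      rw [mem_tri] at h
      rcases h1 with rfl | rfl | rfl <;> rcases h2 with rfl | rfl | rfl <;> simp_all
    · have := off hvw.symm h2
      rwa [side_iff hvw (by rw [hA]; exact h)]
  · exact off hvw h1

lemma even3 {Z : Finset (Sym2 V)} (hZ : bd Z = 0) {y x z b : V} (hxz : x ≠ z) (hxb : x ≠ b) (hzb : z ≠ b)
    (hn : ∀ v, s(y, v) ∈ Z → v = x ∨ v = z ∨ v = b) :
    ¬ (s(y, x) ∈ Z ∧ s(y, z) ∈ Z ∧ s(y, b) ∈ Z) ∧ (s(y, x) ∈ Z → s(y, z) ∈ Z ∨ s(y, b) ∈ Z) ∧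
      (s(y, z) ∈ Z → s(y, x) ∈ Z ∨ s(y, b) ∈ Z) ∧ (s(y, b) ∈ Z → s(y, x) ∈ Z ∨ s(y, z) ∈ Z) := by
  have h := bd_nbrs (Z := Z) (v := y) {x, z, b} (by intro w hw; simpa using hn w hw)
  rw [hZ, sum_insert (by simp [hxz, hxb]), sum_insert (by simp [hzb]), sum_singleton] at h
  by_cases h1 : s(y, x) ∈ Z <;> by_cases h2 : s(y, z) ∈ Z <;> by_cases h3 : s(y, b) ∈ Z <;>
    simp [h1, h2, h3] at h ⊢ <;> exact absurd h (by decide)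

lemma pair_iff {α : Type} {p q s t : α} (hpq : p ≠ q) (h1 : ¬ (s = p ↔ t = p)) (h2 : ¬ (s = q ↔ t = q)) :
    (s = p ∨ s = q) ↔ (t = p ∨ t = q) := by
  by_cases a : s = p <;> by_cases b : t = p <;> by_cases c : s = q <;> by_cases d : t = q <;> simp_all

lemma label_iff {q s t : Φ} {A : Set Φ} (h : ¬ (s = q ↔ t = q)) (h2 : s ∈ A ↔ t ∈ A) : s ∈ A ↔ q ∈ A := by
  by_cases a : s = q
  · rw [a]
  · have : t = q := by by_contra c; exact h (by simp [a, c])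
    rw [h2, this]

/-- Near a triangle, one of the two far edges at `b` is on the outer face of the edge `x y`. -/
lemma MCE.far_label (M : MCE G U B E0 side p0) {x y z b b1 b2 : V} (hy : y ∈ U) (hxy : G.Adj x y)
    (hyz : G.Adj y z) (hxz : G.Adj x z) (hbx : b ≠ x) (hbz : b ≠ z)
    (hny : ∀ v, G.Adj y v ↔ v = x ∨ v = z ∨ v = b)
    (hnb : ∀ v, G.Adj b v ↔ v = y ∨ v = b1 ∨ v = b2) (h1 : b1 ≠ y) (h2 : b2 ≠ y) (h12 : b1 ≠ b2) :
    ∃ q q', (q' = b1 ∧ q = b2 ∨ q' = b2 ∧ q = b1) ∧ ∀ A, s(x, y) ∈ J G side A → s(y, b) ∈ J G side A →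
      s(b, q) ∈ J G side A → s(x, z) ∉ J G side A → s(b, q') ∉ J G side A →
      (side x z ∈ A ↔ side b q' ∉ A) := by
  have hyb : G.Adj y b := (hny b).2 (by simp)
  by_cases hsd : side y b = side b y
  · refine ⟨b2, b1, .inl ⟨rfl, rfl⟩, fun A _ hA => ?_⟩
    rw [mem_J, hsd] at hA
    tauto
  obtain ⟨AT, hAT, hpT⟩ := exA M.plane (tri_short hxy hyz hxz).1 (tri_short hxy hyz hxz).2.1 p0
  have none : ∀ {v w}, G.Adj v w → s(v, w) ∉ tri x y z → side v w ∉ AT := fun h1 h2 =>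
    M.tri_none hpT hy hxy hyz hxz hAT h1 h2
  have dxy := hxy.ne
  have dyz := hyz.ne
  have dxz := hxz.ne
  have dyb := hyb.ne
  have sw : ∀ u v : V, s(u, v) = s(v, u) := fun _ _ => Sym2.eq_swap
  have mT : ∀ u v, s(u, v) ∈ tri x y z → G.Adj u v ∧ ¬ (side u v ∈ AT ↔ side v u ∈ AT) := by
    intro u v h; rwa [← hAT, mem_J] at h
  have ybT : s(y, b) ∉ tri x y z := by
    rw [mem_tri]; simp [Sym2.eq_iff, dxy.symm, dyz, dyb, hbx, hbz]
  -- the faces of `x y`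
  obtain ⟨q, p, hq, hp, hqp⟩ : ∃ q p, q ∈ AT ∧ p ∉ AT ∧ (side x y = q ∧ side y x = p ∨ side x y = p ∧ side y x = q) := by
    have := mT x y (by simp [mem_tri])
    by_cases h : side x y ∈ AT
    · exact ⟨_, _, h, by tauto, .inl ⟨rfl, rfl⟩⟩
    · exact ⟨side y x, side x y, by tauto, h, .inr ⟨rfl, rfl⟩⟩
  have hpq : p ≠ q := by rintro rfl; exact hp hq
  have hxyq : s(x, y) ∈ J G side {q} := by
    rw [mem_J]; simp only [Set.mem_singleton_iff]; rcases hqp with ⟨a, b⟩ | ⟨a, b⟩ <;> simp [a, b, hxy, hpq]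
  have hxyp : s(x, y) ∈ J G side {p} := by
    rw [mem_J]; simp only [Set.mem_singleton_iff]; rcases hqp with ⟨a, b⟩ | ⟨a, b⟩ <;> simp [a, b, hxy, hpq.symm]
  have hqT : J G side {q} = tri x y z := by
    refine edges_subset_circ_eq ((tri_short hxy hyz hxz).isCirc) ?_ (M.plane.even _) ⟨_, hxyq⟩
    intro e he
    induction e with | _ u v =>
    by_contra hn
    rw [mem_J] at he
    have k1 := none he.1 hn
    have k2 := none he.1.symm (by rwa [sw])
    simp only [Set.mem_singleton_iff] at he
    have k3 : side u v ≠ q := fun h => k1 (h ▸ hq)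
    have k4 : side v u ≠ q := fun h => k2 (h ▸ hq)
    tauto
  have hny' : ∀ A v, s(y, v) ∈ J G side A → v = x ∨ v = z ∨ v = b := fun A v h => (hny v).1 (mem_J.1 h).1
  have hnb' : ∀ A v, s(b, v) ∈ J G side A → v = y ∨ v = b1 ∨ v = b2 := fun A v h => (hnb v).1 (mem_J.1 h).1
  have k1 : side y b ≠ q := fun h => none hyb ybT (h ▸ hq)
  have k2 : side b y ≠ q := fun h => none hyb.symm (by rwa [sw]) (h ▸ hq)
  have hybp : s(y, b) ∈ J G side {p} := by
    by_contra hn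
    have ev := even3 (M.plane.even {p}) dxz hbx.symm hbz.symm (hny' _)
    have hyzp : s(y, z) ∈ J G side {p} := (ev.2.1 (by rwa [sw])).resolve_right hn
    have hyzq : s(y, z) ∈ J G side {q} := by rw [hqT]; simp [mem_tri]
    have key := M.plane.loc {p, q} y (by
      intro w hw
      rcases (hny w).1 hw with rfl | rfl | rfl
      · rcases hqp with ⟨a, b⟩ | ⟨a, b⟩ <;> simp [a, b]
      · rw [mem_J] at hyzp hyzq
        have e1 := hyzp.2
        have e2 := hyzq.2
        simp only [Set.mem_singleton_iff, Set.mem_insert_iff] at e1 e2 ⊢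
        exact pair_iff hpq e1 e2
      · have := side_iff hyb hn
        simp only [Set.mem_singleton_iff, Set.mem_insert_iff] at this ⊢
        rw [this, eq_false k1, eq_false k2])
    have h3 := key x b hxy.symm hyb (by rcases hqp with ⟨a, b⟩ | ⟨a, b⟩ <;> simp [a, b])
    have h4 := side_iff hyb hn
    simp only [Set.mem_singleton_iff, Set.mem_insert_iff] at h3 h4
    have h5 : side y b = p := h3.resolve_right k1
    exact hsd (h5.trans (h4.1 h5).symm)
  have evb := even3 (M.plane.even {p}) h1.symm h2.symm h12 (hnb' _)
  -- choose the label
  obtain ⟨f, f', hff, hf'⟩ : ∃ f f', (f' = b1 ∧ f = b2 ∨ f' = b2 ∧ f = b1) ∧ s(b, f') ∈ J G side {p} := by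
    rcases evb.2.1 (by rwa [sw]) with h | h
    exacts [⟨b2, b1, .inl ⟨rfl, rfl⟩, h⟩, ⟨b1, b2, .inr ⟨rfl, rfl⟩, h⟩]
  refine ⟨f, f', hff, fun A a1 a2 a3 a4 a5 => ?_⟩
  have hxzq : s(x, z) ∈ J G side {q} := by rw [hqT]; simp [mem_tri]
  rw [mem_J] at hxzq hf' a1
  have c1 := side_iff hxz a4
  have c2 := side_iff hf'.1 a5
  simp only [Set.mem_singleton_iff] at hxzq hf'
  have d1 : side x z ∈ A ↔ q ∈ A := label_iff hxzq.2 c1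
  have d2 : side b f' ∈ A ↔ p ∈ A := label_iff hf'.2 c2
  have d3 : q ∈ A ↔ p ∉ A := by
    have := a1.2
    clear * - this hqp
    rcases hqp with ⟨a, b⟩ | ⟨a, b⟩ <;> rw [a, b] at this <;> by_cases p ∈ A <;> simp_all
  rw [d1, d2, d3]

/-- The configuration used to reduce a triangle. -/
structure TCfg (G : SimpleGraph V) (U : Finset V) (side : V → V → Φ) (D : Finset V)
    (t1 t2 t3 p r q q' : V) : Prop where
  u1 : t1 ∈ U
  u2 : t2 ∈ U
  ur : r ∈ U
  uq : q ∈ U ∨ p ∉ U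
  a12 : G.Adj t1 t2
  a23 : G.Adj t2 t3
  a13 : G.Adj t1 t3
  n1 : ∀ v, G.Adj t1 v ↔ v = t2 ∨ v = t3 ∨ v = p
  n2 : ∀ v, G.Adj t2 v ↔ v = t1 ∨ v = t3 ∨ v = r
  nr : ∀ v, G.Adj r v ↔ v = t2 ∨ v = q ∨ v = q'
  p2 : p ≠ t2
  p3 : p ≠ t3
  r1 : r ≠ t1
  r3 : r ≠ t3
  qq : q ≠ q'
  q2 : q ≠ t2
  q'2 : q' ≠ t2
  lab : ∀ A, s(t1, t2) ∈ J G side A → s(t2, r) ∈ J G side A →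
      s(r, q) ∈ J G side A → s(t1, t3) ∉ J G side A → s(r, q') ∉ J G side A →
      (side t1 t3 ∈ A ↔ side r q' ∉ A)
  hD : D ⊆ U
  d1 : t1 ∈ D
  d2 : t2 ∈ D
  dr : r ∈ D
  dp : p ∉ D
  dq : q ∉ D
  kill : t3 ∈ U → (nb G t3).card = 3 → ∃ s ∈ D, G.Adj t3 s ∧ s ≠ t1 ∧ s ≠ t2

lemma TCfg.far_r {D : Finset V} {t1 t2 t3 p r q q' : V} (C : TCfg G U side D t1 t2 t3 p r q q') (hf : Far G) :
    ∀ S, Short G S → ¬ On S r := by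
  intro S hS h
  have := hf.eq_adj hS (tri_short C.a12 C.a23 C.a13) h (b := t2) (by simp [on_tri]) ((C.nr _).2 (by simp))
  rw [this, on_tri] at h
  rcases h with h | h | h
  exacts [C.r1 h, ((C.nr t2).2 (by simp)).ne h, C.r3 h]

lemma TCfg.far_q {D : Finset V} {t1 t2 t3 p r q q' : V} (C : TCfg G U side D t1 t2 t3 p r q q') (hf : Far G) :
    ∀ S, Short G S → ∀ v, G.Adj r v → v ≠ t2 → ¬ On S v := by
  intro S hS v hv hv2 h
  have hr2 : G.Adj r t2 := (C.nr _).2 (by simp)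
  have hT := tri_short C.a12 C.a23 C.a13
  have := hf.eq_adj2 hS hT h (b := t2) (by simp [on_tri]) hv.symm hr2
  rw [this, on_tri] at h
  rcases h with rfl | h | rfl
  · exact C.far_r hf _ (tri_short hv C.a12 hr2) (by simp [on_tri])
  · exact hv2 h
  · exact C.far_r hf _ (tri_short hv C.a23.symm hr2) (by simp [on_tri])

variable {D : Finset V} {t1 t2 t3 p r q q' : V}

lemma TCfg.ne_pr (C : TCfg G U side D t1 t2 t3 p r q q') : p ≠ r :=
  fun h => C.dp (h ▸ C.dr)

lemma TCfg.ne_nr (C : TCfg G U side D t1 t2 t3 p r q q') (hf : Far G) {v : V} (hv : G.Adj r v) (h2 : v ≠ t2) :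
    v ≠ t1 ∧ v ≠ t3 := by
  have hr2 : G.Adj r t2 := (C.nr _).2 (by simp)
  constructor
  · rintro rfl
    exact C.far_r hf _ (tri_short hv C.a12 hr2) (by simp [on_tri])
  · rintro rfl
    exact C.far_r hf _ (tri_short hv C.a23.symm hr2) (by simp [on_tri])

lemma TCfg.ne_pq (C : TCfg G U side D t1 t2 t3 p r q q') (hf : Far G) : p ≠ q := by
  rintro rfl
  have h1 : G.Adj t1 p := (C.n1 _).2 (by simp)
  have h2 : G.Adj t2 r := (C.n2 _).2 (by simp)
  have h3 : G.Adj r p := (C.nr _).2 (by simp)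
  exact C.far_r hf _ (quad_short h1.symm C.a12 h2 h3 C.p2 C.r1.symm)
    ⟨s(t2, r), by simp [mem_quad], by simp⟩

/-- The contracted vertices are not joined by a short path. -/
lemma TCfg.no_path (M : MCE G U B E0 side p0) (C : TCfg G U side D t1 t2 t3 p r q q')
    {S : Finset (Sym2 V)} (hS : EIn (delG G D) S) (h5 : S.card ≤ 5) (hb : bd S = pt p + pt q) : False := by
  have hf := M.inst.far
  have hSD : ∀ v w, s(v, w) ∈ S → v ∉ D := fun v w h => by simpa using (hS v w h).2.1
  have g1 : G.Adj t1 p := (C.n1 _).2 (by simp)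
  have g2 : G.Adj t2 r := (C.n2 _).2 (by simp)
  have g3 : G.Adj r q := (C.nr _).2 (by simp)
  have g4 : G.Adj r q' := (C.nr _).2 (by simp)
  have npq := C.ne_pq hf
  have npr := C.ne_pr
  obtain ⟨nq1, nq3⟩ := C.ne_nr hf g3 C.q2
  obtain ⟨nq'1, nq'3⟩ := C.ne_nr hf g4 C.q'2
  have d1 := g1.ne
  have d2 := g2.ne
  have d3 := g3.ne
  have d12 := C.a12.ne
  have d23 := C.a23.ne
  have d13 := C.a13.ne
  have e1 := C.p2
  have e2 := C.p3
  have e3 := C.r1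
  have e4 := C.r3
  have e5 := C.q2
  have hZ0 : ∀ e, e ∈ ({s(t1, p), s(t1, t2), s(t2, r), s(r, q)} : Finset (Sym2 V)) → e ∉ S := by
    intro e he heS
    simp only [mem_insert, mem_singleton] at he
    rcases he with rfl | rfl | rfl | rfl
    exacts [hSD _ _ heS C.d1, hSD _ _ heS C.d1, hSD _ _ heS C.d2, hSD _ _ heS C.dr]
  set Z : Finset (Sym2 V) := insert s(t1, p) (insert s(t1, t2) (insert s(t2, r) (insert s(r, q) S))) with hZ
  have mZ : ∀ e, e ∈ Z ↔ e = s(t1, p) ∨ e = s(t1, t2) ∨ e = s(t2, r) ∨ e = s(r, q) ∨ e ∈ S := by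
    intro e; simp [hZ]
  have hZG : EIn G Z := ((((EIn.insert (fun u v h => (hS u v h).1) g3).insert g2).insert C.a12).insert g1)
  have hZb : bd Z = 0 := by
    rw [hZ, bd_insert d1, bd_insert d12, bd_insert d2, bd_insert d3, hb]
    · linear_combination (pt t1 + pt p + pt t2 + pt r + pt q) * two_zmod_pi (V := V)
    · exact hZ0 _ (by simp)
    · rw [mem_insert, not_or]
      exact ⟨by simp [Sym2.eq_iff]; tauto, hZ0 _ (by simp)⟩
    · rw [mem_insert, mem_insert, not_or, not_or]
      exact ⟨by simp [Sym2.eq_iff]; tauto, by simp [Sym2.eq_iff]; tauto, hZ0 _ (by simp)⟩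
    · rw [mem_insert, mem_insert, mem_insert, not_or, not_or, not_or]
      exact ⟨by simp [Sym2.eq_iff]; tauto, by simp [Sym2.eq_iff]; tauto, by simp [Sym2.eq_iff]; tauto, hZ0 _ (by simp)⟩
  have hZc : Z.card ≤ 9 := by
    have a1 := card_insert_le s(r, q) S
    have a2 := card_insert_le s(t2, r) (insert s(r, q) S)
    have a3 := card_insert_le s(t1, t2) (insert s(t2, r) (insert s(r, q) S))
    have a4 := card_insert_le s(t1, p) (insert s(t1, t2) (insert s(t2, r) (insert s(r, q) S)))
    rw [hZ]; omega
  have z1 : ∀ v, s(t1, v) ∈ Z → v = p ∨ v = t2 := by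
    intro v hv
    rw [mZ] at hv
    have : s(t1, v) ∉ S := fun h => hSD _ _ h C.d1
    clear * - hv this d1 d12 d2 d3 e3 nq1
    simp only [Sym2.eq_iff] at hv
    grind
  have z2 : ∀ v, s(t2, v) ∈ Z → v = t1 ∨ v = r := by
    intro v hv
    rw [mZ] at hv
    have : s(t2, v) ∉ S := fun h => hSD _ _ h C.d2
    clear * - hv this d1 d12 d2 d3 e1 e5
    simp only [Sym2.eq_iff] at hv
    grind
  have z3 : ∀ v, s(r, v) ∈ Z → v = t2 ∨ v = q := by
    intro v hv
    rw [mZ] at hv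
    have : s(r, v) ∉ S := fun h => hSD _ _ h C.dr
    clear * - hv this d1 d12 d2 d3 e3 npr
    simp only [Sym2.eq_iff] at hv
    grind
  obtain ⟨C0, hC0, hCc, hC12⟩ := exists_circ hZb (e := s(t1, t2)) (by simp [mZ])
  have sw : ∀ u v : V, s(u, v) = s(v, u) := fun _ _ => Sym2.eq_swap
  have c2 : s(t2, r) ∈ C0 := by
    obtain ⟨x, hx, hx2⟩ := exists_other (Z := C0) (v := t2) (w := t1) (by rw [hCc.2.1]; rfl) (by rwa [sw])
    rcases z2 x (hC0 hx2) with rfl | rfl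
    exacts [absurd rfl hx, hx2]
  have c3 : s(r, q) ∈ C0 := by
    obtain ⟨x, hx, hx2⟩ := exists_other (Z := C0) (v := r) (w := t2) (by rw [hCc.2.1]; rfl) (by rwa [sw])
    rcases z3 x (hC0 hx2) with rfl | rfl
    exacts [absurd rfl hx, hx2]
  have hC9 : C0.card ≤ 9 := (card_le_card hC0).trans hZc
  have hCG := hZG.mono hC0
  have n13 : s(t1, t3) ∉ C0 := fun h => by
    rcases z1 _ (hC0 h) with h | h
    exacts [e2 h.symm, d23 h.symm]
  have n4 : s(r, q') ∉ C0 := fun h => by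
    rcases z3 _ (hC0 h) with h | h
    exacts [C.q'2 h, C.qq h.symm]
  have hT := tri_short C.a12 C.a23 C.a13
  have on3 : ¬ On C0 t3 := by
    intro h
    obtain ⟨W, hW, hW1, hW2⟩ := chord_short hCc hCG hC9 (on_left hC12) h C.a13 n13
    have hWT : W = tri t1 t2 t3 := hf.eq hW hT (on_left hW1) (by simp [on_tri])
    have : s(t2, t3) ∈ insert s(t1, t3) C0 := hW2 (by rw [hWT]; simp [mem_tri])
    rw [mem_insert] at this
    rcases this with h | h
    · rw [Sym2.eq_iff] at h; grind
    · rcases z2 _ (hC0 h) with h | h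
      exacts [d13 h.symm, e4 h.symm]
  have on4 : ¬ On C0 q' := by
    intro h
    obtain ⟨W, hW, hW1, hW2⟩ := chord_short hCc hCG hC9 (on_left c3) h g4 n4
    exact C.far_r hf W hW (on_left hW1)
  obtain ⟨A, hA, hpA⟩ := exA M.plane hCG hCc.2.1 p0
  have hne : E0 = ∅ ∨ ¬ E0 ⊆ C0 := M.not_sub hCc C.u1 (on_left hC12)
  have hlab := C.lab A (hA ▸ hC12) (hA ▸ c2) (hA ▸ c3) (hA ▸ n13) (hA ▸ n4)
  rw [← hA] at on3 on4 hne hC9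
  by_cases h13 : side t1 t3 ∈ A
  · rw [side_iff C.a13 (hA ▸ n13)] at h13
    have ht3 := M.mem_u_of_ins hpA on3 C.a13.symm h13
    obtain ⟨-, -, h⟩ := M.bad_in hpA (hA ▸ hCc.1) hC9 hne ht3 on3 C.a13.symm h13
    rcases h with ⟨x, y, z, -, hn, ox, oy, oz, -, dxy, dyz, dxz⟩ | ⟨y, z, hI, hy, hyz, hz⟩
    · obtain ⟨s, hs, hs1, hs2, hs3⟩ := C.kill ht3 (by
        have : nb G t3 = {x, y, z} := by ext v; simp [mem_nb, hn]
        rw [this, card_eq_three]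
        exact ⟨x, y, z, dxy, dxz, dyz, rfl⟩)
      have os : On C0 s := by
        rw [← hA]
        rcases (hn s).1 hs1 with rfl | rfl | rfl <;> assumption
      obtain ⟨w, hw⟩ := on_iff.1 os
      have := (mZ _).1 (hC0 hw)
      have hwS : s(s, w) ∉ S := fun h => hSD _ _ h hs
      have hsp : s ≠ p := fun h => C.dp (h ▸ hs)
      have hsq : s ≠ q := fun h => C.dq (h ▸ hs)
      have hsr : s = r := by
        clear * - this hwS hsp hsq hs2 hs3
        simp only [Sym2.eq_iff] at this
        grind
      subst hsr
      exact C.far_r hf _ (tri_short C.a23 hs1 g2) (by simp [on_tri])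
    · have hTT : tri t3 y z = tri t1 t2 t3 :=
        hf.eq (tri_short hy hyz hz) hT (a := t3) (by simp [on_tri]) (by simp [on_tri])
      have hyT : On (tri t1 t2 t3) y := by rw [← hTT]; simp [on_tri]
      have hyI : y ∈ insd G side U A := by rw [hI]; simp
      have hyo := (mem_insd.1 hyI).2.1
      rw [hA] at hyo
      rw [on_tri] at hyT
      rcases hyT with rfl | rfl | rfl
      exacts [hyo (on_left hC12), hyo (on_right hC12), hy.ne rfl]
  · have h4 : side r q' ∈ A := by by_contra hc; exact h13 (hlab.2 hc)
    rw [side_iff g4 (hA ▸ n4)] at h4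
    have hq' := M.mem_u_of_ins hpA on4 g4.symm h4
    obtain ⟨-, -, h⟩ := M.bad_in hpA (hA ▸ hCc.1) hC9 hne hq' on4 g4.symm h4
    rcases h with ⟨x, y, z, -, hn, ox, oy, oz, hxy, -⟩ | ⟨y, z, hI, hy, hyz, hz⟩
    · exact C.far_q hf _ (tri_short ((hn x).2 (by simp)) (mem_J.1 hxy).1 ((hn y).2 (by simp))) _ g4 C.q'2
        (by simp [on_tri])
    · exact C.far_q hf _ (tri_short hy hyz hz) _ g4 C.q'2 (by simp [on_tri])

end Reducible

section Insertion
variable {G H : SimpleGraph V}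

lemma mergeG_addG {p q : V} : mergeG (addG G p q) p q = mergeG G p q := by
  ext u v
  simp only [mergeG, addG]
  constructor
  · rintro ⟨h1, h2, h3, h⟩
    refine ⟨h1, h2, h3, ?_⟩
    grind
  · rintro ⟨h1, h2, h3, h⟩
    refine ⟨h1, h2, h3, ?_⟩
    grind

lemma image_mrg_of_not_on {p q : V} {W : Finset (Sym2 V)} (h : ¬ On W q) :
    W.image (Sym2.map (mrg p q)) = W := by
  have : ∀ e ∈ W, Sym2.map (mrg p q) e = e := by
    intro e he
    induction e with | _ a b =>
    have ha : a ≠ q := by rintro rfl; exact h (on_left he)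
    have hb : b ≠ q := by rintro rfl; exact h (on_right he)
    simp [mrg, ha, hb]
  rw [image_congr this]
  simp

variable [Fintype V]

/-- Short sets of a contracted graph lift. -/
lemma lift_short {p q : V} (hpq : p ≠ q) (hnp : ∀ S, EIn G S → S.card ≤ 5 → bd S ≠ pt p + pt q)
    {Z : Finset (Sym2 V)} (hZ : Short (mergeG G p q) Z) :
    ∃ W, Short G W ∧ W.image (Sym2.map (mrg p q)) = Z := by
  have hn : ¬ G.Adj p q := fun h => hnp {s(p, q)} (EIn.empty.insert h) (by simp) (bd_singleton hpq)
  have hcn : ∀ w, G.Adj p w → ¬ G.Adj q w := fun w h1 h2 =>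
    hnp {s(p, w), s(w, q)} ((EIn.empty.insert h2.symm).insert h1) (card_le_two.trans (by norm_num))
      (bd_path2 h1.ne h2.ne' hpq)
  have pre : ∀ e ∈ Z, ∃ e' : Sym2 V, e' ∈ G.edgeSet ∧ e'.map (mrg p q) = e := by
    intro e he
    induction e with | _ a b =>
    obtain ⟨h1, h2, h3, h | ⟨rfl, h⟩ | ⟨rfl, h⟩⟩ := hZ.1 a b he
    · exact ⟨s(a, b), h, by simp [mrg, h1, h2]⟩
    · exact ⟨s(q, b), h, by simp [mrg, h2]⟩
    · exact ⟨s(a, q), h, by simp [mrg, h1]⟩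
  choose! g hg1 hg2 using pre
  set W := Z.image g with hW
  have hWZ : W.image (Sym2.map (mrg p q)) = Z := by
    rw [hW, image_image]
    ext e
    simp only [mem_image, Function.comp]
    constructor
    · rintro ⟨e', he', rfl⟩; rwa [hg2 e' he']
    · intro he; exact ⟨e, he, hg2 e he⟩
  have hWG : EIn G W := by
    intro u v huv
    obtain ⟨e, he, he2⟩ := mem_image.1 huv
    have := hg1 e he
    rwa [he2] at this
  have hWc : W.card ≤ 5 := card_image_le.trans hZ.2.2.2
  have hb := bd_image hpq hWG (fun h => hn (hWG _ _ h)) hcn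
  rw [hWZ, hZ.2.1] at hb
  refine ⟨W, ⟨hWG, ?_, hZ.2.2.1.image g, hWc⟩, hWZ⟩
  have hpq' : bd W p + bd W q = 0 := by
    have := hb p; rw [if_neg hpq, if_pos rfl] at this; exact this.symm
  have ho : ∀ v, v ≠ p → v ≠ q → bd W v = 0 := by
    intro v h1 h2
    have := hb v; rw [if_neg h2, if_neg h1] at this; exact this.symm
  have hqeq : bd W q = bd W p := by
    have := congrArg (· + bd W q) hpq'
    simp only [zero_add, add_assoc, add_self_zmod, add_zero] at this
    exact this.symm
  rcases zmod_cases (bd W p) with h0 | h1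
  · ext v
    by_cases hv : v = p
    · rw [hv, h0]; rfl
    · by_cases hv2 : v = q
      · rw [hv2, hqeq, h0]; rfl
      · exact ho v hv hv2
  · exfalso
    apply hnp W hWG hWc
    ext v
    by_cases hv : v = p
    · rw [hv, h1, Pi.add_apply, pt_self, pt_ne hpq, add_zero]
    · by_cases hv2 : v = q
      · rw [hv2, hqeq, h1, Pi.add_apply, pt_self, pt_ne hpq.symm, zero_add]
      · rw [ho v hv hv2, Pi.add_apply, pt_ne hv, pt_ne hv2, add_zero]

/-- If short sets stay away from `p` and `q`, contraction does not create new ones. -/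
lemma short_merge {p q : V} (hpq : p ≠ q) (hnp : ∀ S, EIn G S → S.card ≤ 5 → bd S ≠ pt p + pt q)
    (hp : ∀ Z, Short G Z → ¬ On Z p) (hq : ∀ Z, Short G Z → ¬ On Z q)
    {Z : Finset (Sym2 V)} (hZ : Short (mergeG G p q) Z) : Short G Z := by
  obtain ⟨W, hW, rfl⟩ := lift_short hpq hnp hZ
  rwa [image_mrg_of_not_on (hq W hW)]

lemma Far.merge (hf : Far G) {p q : V} (hpq : p ≠ q)
    (hnp : ∀ S, EIn G S → S.card ≤ 5 → bd S ≠ pt p + pt q)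
    (hp : ∀ Z, Short G Z → ∀ a, On Z a → a ≠ p ∧ ¬ G.Adj a p) (hq : ∀ Z, Short G Z → ¬ On Z q) :
    Far (mergeG G p q) := by
  intro Z Z' hZ hZ' hne a b ha hb
  have hp' : ∀ Z, Short G Z → ¬ On Z p := fun Z hZ h => (hp Z hZ p h).1 rfl
  have k := short_merge hpq hnp hp' hq hZ
  have k' := short_merge hpq hnp hp' hq hZ'
  obtain ⟨h1, h2, h3⟩ := hf Z Z' k k' hne a b ha hb
  obtain ⟨a1, a2⟩ := hp Z k a ha
  obtain ⟨b1, b2⟩ := hp Z' k' b hb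
  refine ⟨h1, ?_, ?_⟩
  · rintro ⟨-, -, -, h | h | h⟩
    exacts [h2 h, a1 h.1, b1 h.1]
  · rintro w ⟨-, -, -, h | h | h⟩ ⟨-, -, -, h' | h' | h'⟩
    · exact h3 w h h'
    · exact a2 (h'.1 ▸ h)
    · exact b1 h'.1
    · exact a1 h.1
    · exact a1 h.1
    · exact a1 h.1
    · exact b2 (h.1 ▸ h').symm
    · exact h3 q h.2 h'.2
    · exact b1 h'.1

variable {U B : Finset V} {E0 : Finset (Sym2 V)}

lemma Inst.merge (h : Inst G U B E0) {p q : V} (hpq : p ≠ q) (hp : p ∈ U ∪ B) (hq : q ∈ U)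
    (hpB : p ∈ B → ∀ w ∈ B, ¬ G.Adj q w) (pl : PlO (mergeG G p q) E0) (far : Far (mergeG G p q))
    (good : E0.card = 9 → Good (mergeG G p q) (U.erase q) B) :
    Inst (mergeG G p q) (U.erase q) B E0 := by
  have hqB := h.u_not_b hq
  refine ⟨h.disj.mono_left (erase_subset _ _), ?_, ?_, h.on, h.circ, h.le, pl, far, good⟩
  · have key : ∀ v, v ≠ q → G.Adj q v → (p ∈ U.erase q ∨ v ∈ U.erase q) ∧ p ∈ U.erase q ∪ B ∧ v ∈ U.erase q ∪ B := by
      intro v hv hqv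
      have hv' := h.adj_cases hqv
      have := hpB
      simp only [mem_union, mem_erase] at hp ⊢
      by_cases p ∈ U
      · tauto
      · have : v ∉ B := fun hvB => hpB (by tauto) v hvB hqv
        tauto
    rintro u v ⟨h1, h2, h3, h4 | ⟨rfl, h4⟩ | ⟨rfl, h4⟩⟩
    · have := h.edge u v h4
      simp only [mem_union, mem_erase] at this ⊢
      tauto
    · exact .inr (key v h2 h4)
    · obtain ⟨a, b, c⟩ := key u h1 h4.symm
      exact .inr ⟨a.symm, c, b⟩
  · intro u v huv
    have := h.e0 u v huv
    refine ⟨?_, ?_, this.ne, .inl this⟩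
    · rintro rfl; exact hqB ((h.on _).1 (on_left huv))
    · rintro rfl; exact hqB ((h.on _).1 (on_right huv))

variable {Φ : Type} {side : V → V → Φ} {p0 : Φ} {D : Finset V} {t1 t2 t3 p r q q' : V}

/-- The vertex `p` of the 9-cycle `E0` is opposite to the edge `s1 s2`. -/
def Anti (E0 : Finset (Sym2 V)) (p s1 s2 : V) : Prop :=
  E0.card = 9 ∧ s(s1, s2) ∈ E0 ∧ ∃ X Y : Finset (Sym2 V), X.card = 4 ∧ Y.card = 4 ∧
    insert s(s1, s2) (X ∪ Y) = E0 ∧ bd X = pt s1 + pt p ∧ bd Y = pt s2 + pt p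

/-- A vertex which closes a claw after the contraction. -/
def Apex (G : SimpleGraph V) (U : Finset V) (E0 : Finset (Sym2 V)) (p q : V) (D : Finset V) (w : V) : Prop :=
  w ∈ U ∧ w ∉ D ∧ G.Adj w q ∧ ∃ s1 s2, G.Adj w s1 ∧ G.Adj w s2 ∧ Anti E0 p s1 s2

lemma TCfg.eIn_e0 (M : MCE G U B E0 side p0) (C : TCfg G U side D t1 t2 t3 p r q q') : EIn (delG G D) E0 :=
  (M.inst.del C.hD).e0

lemma TCfg.q_mem (M : MCE G U B E0 side p0) (C : TCfg G U side D t1 t2 t3 p r q q') : q ∈ U := by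
  refine C.uq.elim id fun hp => (M.inst.adj_cases ((C.nr q).2 (by simp))).resolve_right fun hq => ?_
  replace hp := (M.inst.adj_cases ((C.n1 p).2 (by simp))).resolve_left hp
  have h0 : E0 ≠ ∅ := by rintro rfl; simp [M.inst.empty_of rfl] at hp
  have hcirc := M.inst.circ.resolve_left h0
  obtain ⟨P, hP, bP⟩ := hcirc.exists_arc M.inst.e0.loopless ((M.inst.on _).2 hp) ((M.inst.on _).2 hq)
  have hle := M.inst.le
  have hc := card_sdiff_add_card_eq_card hP
  by_cases h4 : P.card ≤ 5
  · exact C.no_path M ((C.eIn_e0 M).mono hP) h4 bP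
  · refine C.no_path M (S := E0 \ P) ((C.eIn_e0 M).mono sdiff_subset) (by omega) ?_
    have := bd_sdiff hP
    rw [hcirc.2.1, zero_add] at this
    rw [this, bP]

lemma TCfg.not_adj_b (M : MCE G U B E0 side p0) (C : TCfg G U side D t1 t2 t3 p r q q') (hp : p ∈ B) :
    ∀ w ∈ B, ¬ G.Adj q w := by
  intro w hw hqw
  have hqD : q ∉ (D : Set V) := by simpa using C.dq
  have hwD : w ∉ (D : Set V) := by simpa using fun h => M.inst.b_not_u hw (C.hD h)
  have hadj : (delG G D).Adj w q := ⟨hqw.symm, hwD, hqD⟩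
  by_cases hpw : p = w
  · subst hpw
    exact C.no_path M (EIn.empty.insert hadj) (by simp) (bd_singleton hqw.ne')
  have h0 : E0 ≠ ∅ := by rintro rfl; simp [M.inst.empty_of rfl] at hp
  have hcirc := M.inst.circ.resolve_left h0
  have hE := C.eIn_e0 M
  have piece : ∀ P ⊆ E0, bd P = pt p + pt w → P.card ≤ 4 → False := by
    intro P hP bP h4
    refine C.no_path M (S := insert s(w, q) P) ((hE.mono hP).insert hadj) ?_ ?_
    · exact (card_insert_le _ _).trans (by omega)
    · rw [bd_insert hadj.ne, bP]
      · linear_combination (pt w) * two_zmod_pi (V := V)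
      · exact fun h => M.inst.u_not_on (C.q_mem M) (on_right (hP h))
  obtain ⟨P, hP, bP⟩ := hcirc.exists_arc M.inst.e0.loopless ((M.inst.on _).2 hp) ((M.inst.on _).2 hw)
  have hle := M.inst.le
  by_cases h4 : P.card ≤ 4
  · exact piece P hP bP h4
  · refine piece (E0 \ P) sdiff_subset ?_ ?_
    · rw [bd_sdiff hP, hcirc.2.1, bP, zero_add]
    · rw [card_sdiff_of_subset hP]; omega

/-- The contracted graph is a smaller instance, or there is an apex. -/
lemma TCfg.inst (M : MCE G U B E0 side p0) (C : TCfg G U side D t1 t2 t3 p r q q') :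
    (p ∈ B ∧ ∃ w, Apex G U E0 p q D w) ∨ Inst (mergeG (delG G D) p q) ((U \ D).erase q) B E0 := by
  by_contra hcon
  rw [not_or] at hcon
  obtain ⟨hA, hI⟩ := hcon
  have hf := M.inst.far
  have I1 := M.inst.del C.hD
  have g1 : G.Adj t1 p := (C.n1 _).2 (by simp)
  have g2 : G.Adj t2 r := (C.n2 _).2 (by simp)
  have g3 : G.Adj r q := (C.nr _).2 (by simp)
  have npq := C.ne_pq hf
  have hT := tri_short C.a12 C.a23 C.a13
  have hpD : p ∉ (D : Set V) := by simpa using C.dp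
  have hqD : q ∉ (D : Set V) := by simpa using C.dq
  have hnp : ∀ S, EIn (delG G D) S → S.card ≤ 5 → bd S ≠ pt p + pt q := fun S h1 h2 h3 => C.no_path M h1 h2 h3
  have hp : ∀ Z, Short (delG G D) Z → ∀ a, On Z a → a ≠ p ∧ ¬ (delG G D).Adj a p := by
    intro Z hZ a ha
    have hZ' := hZ.mono (delG_le (G := G) D)
    have noT : Z ≠ tri t1 t2 t3 := by
      rintro rfl
      exact (hZ.1 t1 t2 (by simp [mem_tri])).2.1 (by simpa using C.d1)
    constructor
    · rintro rfl
      exact noT (hf.eq_adj hZ' hT ha (b := t1) (by simp [on_tri]) g1.symm)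
    · intro h
      exact noT (hf.eq_adj2 hZ' hT ha (b := t1) (by simp [on_tri]) h.1 g1.symm)
  have hq : ∀ Z, Short (delG G D) Z → ¬ On Z q := fun Z hZ h =>
    C.far_q hf Z (hZ.mono (delG_le (G := G) D)) q g3 C.q2 h
  have hp' : ∀ Z, Short (delG G D) Z → ¬ On Z p := fun Z hZ h => (hp Z hZ p h).1 rfl
  have hsm : ∀ Z, Short (mergeG (delG G D) p q) Z → Short (delG G D) Z := fun Z hZ =>
    short_merge npq hnp hp' hq hZ
  have far := I1.far.merge npq hnp hp hq
  have hn : ¬ (delG G D).Adj p q := fun h => hnp {s(p, q)} (EIn.empty.insert h) (by simp) (bd_singleton npq)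
  have hcn : ∀ w, (delG G D).Adj p w → ¬ (delG G D).Adj q w := fun w h1 h2 =>
    hnp {s(p, w), s(w, q)} ((EIn.empty.insert h2.symm).insert h1) (card_le_two.trans (by norm_num))
      (bd_path2 h1.ne h2.ne' npq)
  have hqE : ¬ On E0 q := M.inst.u_not_on (C.q_mem M)
  have pl : PlO (mergeG (delG G D) p q) E0 := by
    rw [← mergeG_addG]
    refine (M.inst.pl.path (C.eIn_e0 M) g1.symm C.a12 g2 g3 (by simpa using C.d1) (by simpa using C.d2)
      (by simpa using C.dr) hpD hqD C.r1.symm npq (fun h => hn ⟨h, hpD, hqD⟩)).merge ⟨npq, .inr (.inl ⟨rfl, rfl⟩)⟩ ?_ hqE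
    intro w h1 h2
    have hwp : w ≠ p := h1.1.symm
    have hwq : w ≠ q := h2.1.symm
    refine hcn w ?_ ?_
    · rcases h1.2 with h | h | h
      exacts [h, absurd h.2 hwq, absurd h.2 hwp]
    · rcases h2.2 with h | h | h
      exacts [h, absurd h.2 hwq, absurd h.2 hwp]
  apply hI
  refine I1.merge npq ?_ (by simp [C.q_mem M, C.dq]) (fun h w hw hqw => C.not_adj_b M h w hw hqw.1) pl far ?_
  · have := M.inst.adj_cases g1
    simp only [mem_union, mem_sdiff]
    have := C.dp
    tauto
  intro h9
  have toG : ∀ {v a}, v ≠ p → a ≠ p → (mergeG (delG G D) p q).Adj v a → (delG G D).Adj v a := by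
    rintro v a h1 h2 ⟨-, -, -, h | h | h⟩
    exacts [h, absurd h.1 h1, absurd h.1 h2]
  have hE : EIn (mergeG (delG G D) p q) E0 := by
    intro u v huv
    refine ⟨?_, ?_, (M.inst.e0 u v huv).ne, .inl (C.eIn_e0 M u v huv)⟩
    · rintro rfl; exact hqE (on_left huv)
    · rintro rfl; exact hqE (on_right huv)
  constructor
  · intro v hv a ha b hb c hc hab hbc hac hva hvb hvc
    simp only [mem_erase, mem_sdiff] at hv
    obtain ⟨-, x, y, z, hperm, dxy, dyz, dxz, hxy, X, Y, cX, cY, hXY, bX, bY, -⟩ :=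
      claw_split far (M.inst.circ.resolve_left (by rintro h; simp [h] at h9)) hE M.inst.le
      (M.inst.u_not_on hv.2.1) ((M.inst.on a).2 ha) ((M.inst.on b).2 hb)
      ((M.inst.on c).2 hc) hab hbc hac hva hvb hvc
    have adj' : ∀ w, (w = x ∨ w = y ∨ w = z) → (mergeG (delG G D) p q).Adj v w ∧ w ∈ B := by
      intro w hw
      rcases (hperm w).1 hw with rfl | rfl | rfl
      exacts [⟨hva, ha⟩, ⟨hvb, hb⟩, ⟨hvc, hc⟩]
    have hS := hsm _ (tri_short (adj' x (by simp)).1 (hE _ _ hxy) (adj' y (by simp)).1)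
    have hvp : v ≠ p := by rintro rfl; exact hp' _ hS (by simp [on_tri])
    have hxp : x ≠ p := by rintro rfl; exact hp' _ hS (by simp [on_tri])
    have hyp : y ≠ p := by rintro rfl; exact hp' _ hS (by simp [on_tri])
    have vx := (toG hvp hxp (adj' x (by simp)).1).1
    have vy := (toG hvp hyp (adj' y (by simp)).1).1
    obtain ⟨vz, hz⟩ := adj' z (by simp)
    have hx := (adj' x (by simp)).2
    have hy := (adj' y (by simp)).2
    have nclaw : ¬ G.Adj v z := M.inst.no_claw hv.2.1 hx hy hz dxy dyz dxz vx vy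
    have hzp : z = p := by by_contra h; exact nclaw (toG hvp h vz).1
    subst hzp
    have vq : G.Adj v q := by
      obtain ⟨-, -, -, h | h | h⟩ := vz
      exacts [absurd h.1 nclaw, absurd h.1 hvp, h.2.1]
    exact hA ⟨hz, v, hv.2.1, hv.2.2, vq, x, y, vx, vy, h9, hxy, X, Y, cX, cY, hXY, bX, bY⟩
  · intro x hx y hy z hz hxy hyz hxz ax ay az
    simp only [mem_erase, mem_sdiff] at hx hy hz
    have hS := hsm _ (tri_short hxy hyz hxz)
    have hx' := hp _ hS x (by simp [on_tri])
    have hy' := hp _ hS y (by simp [on_tri])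
    have hz' := hp _ hS z (by simp [on_tri])
    have xy := toG hx'.1 hy'.1 hxy
    have yz := toG hy'.1 hz'.1 hyz
    have xz := toG hx'.1 hz'.1 hxz
    have att : ∀ v, v ≠ p ∧ ¬ (delG G D).Adj v p → Att (mergeG (delG G D) p q) B v →
        Att G B v ∨ (delG G D).Adj v q := by
      rintro v hv ⟨b, hb, -, -, -, h | h | h⟩
      exacts [.inl ⟨b, hb, h.1⟩, absurd h.1 hv.1, .inr h.2]
    have two : ∀ x y z, x ∈ U → y ∈ U → z ∈ U → (delG G D).Adj x y → (delG G D).Adj y z → (delG G D).Adj x z →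
        Att G B x → ¬ Att G B y := by
      rintro x y z hx hy hz xy yz xz ⟨a, ha, ha'⟩ ⟨b, hb, hb'⟩
      exact M.not_att_two hx hy hz xy.1 yz.1 xz.1 ha hb ha' hb'
    have twoq : ∀ x y, (delG G D).Adj x y → (delG G D).Adj x q → ¬ (delG G D).Adj y q :=
      fun x y h1 h2 h3 => hq _ (tri_short h1 h3 h2) (by simp [on_tri])
    have ux := hx.2.1
    have uy := hy.2.1
    have uz := hz.2.1
    rcases att x hx' ax with h1 | h1 <;> rcases att y hy' ay with h2 | h2 <;> rcases att z hz' az with h3 | h3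
    · exact two x y z ux uy uz xy yz xz h1 h2
    · exact two x y z ux uy uz xy yz xz h1 h2
    · exact two x z y ux uz uy xz yz.symm xy h1 h3
    · exact twoq y z yz h2 h3
    · exact two y z x uy uz ux yz xz.symm xy.symm h2 h3
    · exact twoq x z xz h1 h3
    · exact twoq x y xy h1 h2
    · exact twoq x y xy h1 h2

end Insertion

section Thread
variable {G H : SimpleGraph V} {S B : Finset V}

lemma Fst.leaf (h : Fst G S B) {v x : V} (hv : ∀ w ∈ S ∪ B, G.Adj v w → w = x) : Fst G (insert v S) B :=
  h.addLeaf fun w w' hw hw' h1 h2 => (hv w hw h1).trans (hv w' hw' h2).symm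

lemma Sep.extend (hd : Disjoint S B) {p q t : V} (h : Sep G S B p q) (htS : t ∉ S) (htB : t ∉ B) (hpt : p ≠ t)
    (hN : ∀ w ∈ S ∪ B, G.Adj t w → w = p) (htq : t ≠ q) (hn : ¬ G.Adj t q) : Sep G (insert t S) B t q := by
  refine ⟨htq, hn, .inl (mem_insert_self _ _), ?_⟩
  obtain ⟨h1, h2, h3, h4⟩ := h
  have hne : ∀ w ∈ S ∪ B, w ≠ t := by
    rintro w hw rfl
    rcases mem_union.1 hw with h | h
    exacts [htS h, htB h]
  refine Sep.subdiv (p := p) (q := q) hd ⟨h1, ?_, h3, h4.mono le_rfl ?_⟩ htS htB ?_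
  · rintro ⟨-, h | h | h⟩
    exacts [h2 h, hpt h.1, htq h.2.symm]
  · intro u v hu hv
    have hu' := hne u (mem_union_left _ hu)
    have hv' := hne v hv
    rintro ⟨a, ⟨-, h | h | h⟩ | h⟩
    exacts [⟨a, .inl h⟩, absurd h.1 hu', absurd h.2 hv', ⟨a, .inr h⟩]
  · rintro w hw ⟨-, h | h | h⟩
    exacts [.inl (hN w hw h), .inr h.2, absurd h.2 (hne w hw)]

lemma Sep.leaf {p q v x : V} (h : Sep G S B p q) (hv : ∀ w ∈ S ∪ B, G.Adj v w → w = x) (hp : v ≠ p) (hq : v ≠ q) :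
    Sep G (insert v S) B p q := by
  refine ⟨h.1, h.2.1, h.2.2.1.imp (mem_insert_of_mem) (mem_insert_of_mem), h.2.2.2.leaf (x := x) ?_⟩
  rintro w hw ⟨-, h | h | h⟩
  exacts [hv w hw h, absurd h.1 hp, absurd h.1 hq]

variable [Fintype V] {U : Finset V} {E0 : Finset (Sym2 V)}

lemma merge_color (hd : Disjoint U B) {p q : V} (hpq : p ≠ q) (hp : p ∈ U ∪ B) (hq : q ∈ U)
    (hpB : p ∈ B → ∀ w ∈ B, ¬ G.Adj q w) (hn : ¬ G.Adj p q) (hcn : ∀ w, G.Adj p w → ¬ G.Adj q w)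
    (hU : ∀ v, G.Adj q v → v ∈ U ∪ B)
    (h : ECol (mergeG G p q) (U.erase q) B) (c0 : V → Bool) :
    ∃ c : V → Bool, (∀ v ∈ B, c v = c0 v) ∧ (∀ u ∈ U, ∀ v, G.Adj u v → c u = true → c v = false) ∧
      c q = c p ∧ Fst G (U.filter (fun v => c v = false)) (B.filter (fun v => c v = false)) ∧
      (c p = false → Sep G (U.filter (fun v => c v = false)) (B.filter (fun v => c v = false)) p q) := by
  obtain ⟨c, h1, h2, h3⟩ := h c0
  have hqB : q ∉ B := Finset.disjoint_left.1 hd hq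
  set c1 : V → Bool := fun v => if v = q then c p else c v with hc1
  have e1 : ∀ v, v ≠ q → c1 v = c v := fun v hv => by simp [hc1, hv]
  have eq : c1 q = c p := by simp [hc1]
  have ep : c1 p = c p := e1 p hpq
  have eB : B.filter (fun v => c1 v = false) = B.filter (fun v => c v = false) := by
    ext v
    simp only [mem_filter]
    refine and_congr_right fun hv => ?_
    rw [e1 v (by rintro rfl; exact hqB hv)]
  have hF : c p = true → Fst G (U.filter (fun v => c1 v = false)) (B.filter (fun v => c1 v = false)) := by
    intro hcp
    rw [eB]
    have hqn : ∀ v, v ∈ U.filter (fun v => c1 v = false) → v ≠ q := by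
      rintro v hv rfl
      simp [eq, hcp] at hv
    refine h3.mono ?_ ?_
    · intro v hv
      have := hqn v hv
      simp only [mem_filter, mem_erase] at hv ⊢
      rw [e1 v this] at hv
      tauto
    · intro u v hu hv huv
      refine ⟨hqn u hu, ?_, huv.ne, .inl huv⟩
      rcases mem_union.1 hv with h | h
      · exact hqn v h
      · rintro rfl; exact hqB (mem_filter.1 ‹_›).1
  have hS : c p = false → Sep G (U.filter (fun v => c1 v = false)) (B.filter (fun v => c1 v = false)) p q := by
    intro hcp
    rw [eB]
    have := Fst.unmerge (G := G) (S := (U.erase q).filter (fun v => c v = false))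
      (B := B.filter (fun v => c v = false)) hpq hn hcn ?_ h3 ?_ (by simp) (by simp [hqB]) ?_
    · convert this using 1
      ext v
      simp only [mem_filter, mem_erase, mem_insert]
      by_cases hv : v = q
      · subst hv; simp [eq, hcp, hq]
      · simp [e1 v hv, hv]
    · exact hd.mono ((filter_subset _ _).trans (erase_subset _ _)) (filter_subset _ _)
    · simp only [mem_union, mem_filter, mem_erase, hcp, hpq] at hp ⊢
      tauto
    · intro h w hw
      exact hpB (mem_filter.1 h).1 w (mem_filter.1 hw).1
  refine ⟨c1, fun v hv => (e1 v (by rintro rfl; exact hqB hv)).trans (h1 v hv), ?_, by rw [eq, ep], ?_, fun h => hS (ep ▸ h)⟩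
  · intro u hu v huv hcu
    by_cases hpq' : v = p
    · subst hpq'
      have huq : u ≠ q := by rintro rfl; exact hn huv.symm
      rw [e1 _ huq] at hcu
      rw [ep]
      exact h2 u (by simp [hu, huq]) _ ⟨huq, hpq, huv.ne, .inl huv⟩ hcu
    by_cases huq : u = q
    · subst huq
      have hvq := huv.ne'
      rw [eq] at hcu
      rw [e1 v hvq]
      by_cases hpU : p ∈ U
      · exact h2 p (by simp [hpU, hpq]) v ⟨hpq, hvq, Ne.symm hpq', .inr (.inl ⟨rfl, huv⟩)⟩ hcu
      · have hpB' : p ∈ B := by simpa [hpU] using hp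
        have hvU : v ∈ U := (mem_union.1 (hU v huv)).resolve_right fun h => hpB hpB' v h huv
        by_contra hcv
        rw [Bool.not_eq_false] at hcv
        have := h2 v (by simp [hvU, hvq]) p ⟨hvq, hpq, hpq', .inr (.inr ⟨rfl, huv.symm⟩)⟩ hcv
        rw [hcu] at this
        exact absurd this (by simp)
    · rw [e1 u huq] at hcu
      by_cases hvq : v = q
      · subst hvq
        rw [eq]
        have hup : u ≠ p := by rintro rfl; exact hn huv
        exact h2 u (by simp [hu, huq]) p ⟨huq, hpq, hup, .inr (.inr ⟨rfl, huv⟩)⟩ hcu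
      · rw [e1 v hvq]
        exact h2 u (by simp [hu, huq]) v ⟨huq, hvq, huv.ne, .inl huv⟩ hcu
  · by_cases hcp : c p = true
    · exact hF hcp
    · exact (hS (by simpa using hcp)).fst

variable {Φ : Type} {side : V → V → Φ} {p0 : Φ} {D : Finset V}

/-- Extending a coloring to a deleted set. -/
lemma MCE.extend (M : MCE G U B E0 side p0) (hD : D ⊆ U) (I : Finset V) (hID : I ⊆ D) {c c0 : V → Bool}
    (hB : ∀ v ∈ B, c v = c0 v)
    (hI : ∀ u ∈ U \ D, ∀ v, (delG G D).Adj u v → c u = true → c v = false)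
    (h1 : ∀ d ∈ I, ∀ v, G.Adj d v → v ∉ I ∧ (v ∉ D → c v = false))
    {S : Finset V} (hSS : ∀ v, v ∈ D → v ∉ I → v ∈ S) (hSS' : ∀ v, v ∈ (U \ D).filter (fun v => c v = false) → v ∈ S)
    (hF : Fst G S (B.filter (fun v => c v = false))) : 
    ∃ c : V → Bool, (∀ v ∈ B, c v = c0 v) ∧
    (∀ u ∈ U, ∀ v, G.Adj u v → c u = true → c v = false) ∧
    Fst G (U.filter (fun v => c v = false)) (B.filter (fun v => c v = false)) := by
  refine M.no_ext hD (c := c) (c' := fun v => if v ∈ D then decide (v ∈ I) else c v) (fun v hv => by simp [hv])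
    hI ?_ ?_ hB
  · intro d hd v hdv hcd
    have hdI : d ∈ I := by simpa [hd] using hcd
    obtain ⟨h2, h3⟩ := h1 d hdI v hdv
    by_cases hv : v ∈ D
    · simp [hv, h2]
    · simpa [hv] using h3 hv
  · refine hF.mono ?_ fun u v _ _ h => h
    intro v hv
    simp only [mem_filter] at hv
    by_cases hvD : v ∈ D
    · simp only [hvD, if_true, decide_eq_false_iff_not] at hv
      exact hSS v hvD hv.2
    · simp only [hvD, if_false] at hv
      exact hSS' v (by simp [hv, hvD])

lemma Fst.of_del {S B : Finset V} (h : Fst (delG G D) S B) (h1 : ∀ v ∈ S ∪ B, v ∉ D) : Fst G S B :=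
  h.mono le_rfl fun u v hu hv huv =>
    ⟨huv, by simpa using h1 u (mem_union_left _ hu), by simpa using h1 v hv⟩

lemma Sep.of_del {S B : Finset V} {p q : V} (h : Sep (delG G D) S B p q) (h1 : ∀ v ∈ S ∪ B, v ∉ D) (hp : p ∉ D)
    (hq : q ∉ D) : Sep G S B p q :=
  ⟨h.1, fun h' => h.2.1 ⟨h', by simpa using hp, by simpa using hq⟩, h.2.2.1, h.2.2.2.mono le_rfl
    fun u v hu hv huv => ⟨huv.1, huv.2.imp (fun h =>
    ⟨h, by simpa using h1 u (mem_union_left _ hu), by simpa using h1 v hv⟩) id⟩⟩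

end Thread

section Charges
variable [Fintype V] {G H : SimpleGraph V} {U B : Finset V} {E0 : Finset (Sym2 V)}
variable {Φ : Type} {side : V → V → Φ} {p0 : Φ} {D : Finset V} {t1 t2 t3 p r q q' : V}

lemma TCfg.pre (M : MCE G U B E0 side p0) (C : TCfg G U side D t1 t2 t3 p r q q')
    (I : Inst (mergeG (delG G D) p q) ((U \ D).erase q) B E0) (c0 : V → Bool) :
    ∃ c : V → Bool, (∀ v ∈ B, c v = c0 v) ∧
      (∀ u ∈ U \ D, ∀ v, (delG G D).Adj u v → c u = true → c v = false) ∧ c q = c p ∧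
      Fst G ((U \ D).filter (fun v => c v = false)) (B.filter (fun v => c v = false)) ∧
      (c p = false → Sep G ((U \ D).filter (fun v => c v = false)) (B.filter (fun v => c v = false)) p q) ∧
      (∀ w ∈ (U \ D).filter (fun v => c v = false) ∪ B.filter (fun v => c v = false), w ∉ D ∧ c w = false) := by
  have hf := M.inst.far
  have I1 := M.inst.del C.hD
  have g1 : G.Adj t1 p := (C.n1 _).2 (by simp)
  have npq := C.ne_pq hf
  have hnp : ∀ S, EIn (delG G D) S → S.card ≤ 5 → bd S ≠ pt p + pt q := fun S h1 h2 h3 => C.no_path M h1 h2 h3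
  have hn : ¬ (delG G D).Adj p q := fun h => hnp {s(p, q)} (EIn.empty.insert h) (by simp) (bd_singleton npq)
  have hcn : ∀ w, (delG G D).Adj p w → ¬ (delG G D).Adj q w := fun w h1 h2 =>
    hnp {s(p, w), s(w, q)} ((EIn.empty.insert h2.symm).insert h1) (card_le_two.trans (by norm_num))
      (bd_path2 h1.ne h2.ne' npq)
  have hlt : ((U \ D).erase q).card < U.card :=
    (card_le_card (erase_subset _ _)).trans_lt (card_sdiff_lt C.hD ⟨_, C.d1⟩)
  have hpm : p ∈ U \ D ∪ B := by
    have := M.inst.adj_cases g1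
    have := C.dp
    simp only [mem_union, mem_sdiff]
    tauto
  obtain ⟨c, h1, h2, h3, h4, h5⟩ := merge_color I1.disj npq hpm (by simp [C.q_mem M, C.dq])
    (fun h w hw (hqw : (delG G D).Adj q w) => C.not_adj_b M h w hw hqw.1) hn hcn (fun v hv => I1.adj_mem hv)
    (M.hmin _ _ _ _ hlt I) c0
  have hw : ∀ w ∈ (U \ D).filter (fun v => c v = false) ∪ B.filter (fun v => c v = false), w ∉ D ∧ c w = false := by
    intro w hw
    simp only [mem_union, mem_filter, mem_sdiff] at hw
    have : w ∈ B → w ∉ D := fun hw h => M.inst.b_not_u hw (C.hD h)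
    tauto
  exact ⟨c, h1, h2, h3, h4.of_del fun v hv => (hw v hv).1,
    fun h => (h5 h).of_del (fun v hv => (hw v hv).1) C.dp C.dq, hw⟩

/-- A coloring outside `D` with all `F`-vertices in `S ∪ B` extends to `D`. -/
def ExtD (G : SimpleGraph V) (D : Finset V) (c : V → Bool) (S B : Finset V) : Prop :=
  ∃ I S' : Finset V, I ⊆ D ∧ (∀ d ∈ I, ∀ v, G.Adj d v → v ∉ I ∧ (v ∉ D → c v = false)) ∧
    (∀ v, v ∈ D → v ∉ I → v ∈ S') ∧ S ⊆ S' ∧ Fst G S' B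

/-- The data used when extending a coloring to the deleted part of a triangle reduction. -/
structure TCol (G : SimpleGraph V) (D : Finset V) (c : V → Bool) (S B : Finset V) (t1 t2 t3 p r q q' : V) : Prop where
  d : Disjoint S B
  w : ∀ w ∈ S ∪ B, w ∉ D ∧ c w = false
  hB : ∀ v ∈ D, v ∉ B
  f : Fst G S B
  s : c p = false → Sep G S B p q
  m : ∀ v, G.Adj t1 v ∨ G.Adj r v → v ∉ D → c v = false → v ∈ S ∪ B
  qp : c q = c p

lemma TCfg.contra (M : MCE G U B E0 side p0) (C : TCfg G U side D t1 t2 t3 p r q q')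
    (I : Inst (mergeG (delG G D) p q) ((U \ D).erase q) B E0)
    (h : ∀ c S B1, TCol G D c S B1 t1 t2 t3 p r q q' → ExtD G D c S B1) : False := by
  apply M.hno
  intro c0
  obtain ⟨c, hB, hI, hqp, hF, hS, hw⟩ := C.pre M I c0
  have K : TCol G D c ((U \ D).filter (fun v => c v = false)) (B.filter (fun v => c v = false)) t1 t2 t3 p r q q' := by
    refine ⟨M.inst.disj.mono ((filter_subset _ _).trans sdiff_subset)
      (filter_subset _ _), hw, fun v hv hv' => M.inst.u_not_b (C.hD hv) (mem_filter.1 hv').1, hF, hS, ?_, hqp⟩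
    intro v hv hvD hc
    have h1 : v ∈ U ∨ v ∈ B := by
      rcases hv with h | h
      exacts [M.inst.adj_cases h, M.inst.adj_cases h]
    simp only [mem_union, mem_filter, mem_sdiff]
    tauto
  obtain ⟨I', S', h1, h2, h3, h4, h5⟩ := h c _ _ K
  exact M.extend C.hD I' h1 hB hI h2 h3 h4 h5

lemma Fst.leaf3 {S B : Finset V} (h : Fst G S B) {v x a b d : V} (n : ∀ w, G.Adj v w ↔ w = a ∨ w = b ∨ w = d)
    (ha : a ∈ S ∪ B → a = x) (hb : b ∈ S ∪ B → b = x) (hd : d ∈ S ∪ B → d = x) : Fst G (insert v S) B := by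
  refine h.leaf (x := x) fun w hw hvw => ?_
  rcases (n w).1 hvw with rfl | rfl | rfl
  exacts [ha hw, hb hw, hd hw]

lemma Sep.subdiv3 {S B : Finset V} (hdj : Disjoint S B) {p q v a b d : V} (h : Sep G S B p q) (hvS : v ∉ S) (hvB : v ∉ B)
    (n : ∀ w, G.Adj v w ↔ w = a ∨ w = b ∨ w = d) (ha : a ∈ S ∪ B → a = p ∨ a = q) (hb : b ∈ S ∪ B → b = p ∨ b = q)
    (hd : d ∈ S ∪ B → d = p ∨ d = q) : Fst G (insert v S) B := by
  refine h.subdiv hdj hvS hvB fun w hw hvw => ?_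
  rcases (n w).1 hvw with rfl | rfl | rfl
  exacts [ha hw, hb hw, hd hw]

lemma Sep.extend3 {S B : Finset V} (hdj : Disjoint S B) {p q t a b d : V} (h : Sep G S B p q) (htS : t ∉ S) (htB : t ∉ B)
    (hpt : p ≠ t) (htq : t ≠ q)
    (n : ∀ w, G.Adj t w ↔ w = a ∨ w = b ∨ w = d) (ha : a ∈ S ∪ B → a = p) (hb : b ∈ S ∪ B → b = p)
    (hd : d ∈ S ∪ B → d = p) (hq : q ≠ a ∧ q ≠ b ∧ q ≠ d) : Sep G (insert t S) B t q ∧ Disjoint (insert t S) B := by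
  refine ⟨h.extend hdj htS htB hpt (fun w hw hvw => ?_) htq ?_, disjoint_insert_left.2 ⟨htB, hdj⟩⟩
  · rcases (n w).1 hvw with rfl | rfl | rfl
    exacts [ha hw, hb hw, hd hw]
  · rw [n]; tauto

lemma Sep.leaf3 {S B : Finset V} {p q v x a b d : V} (h : Sep G S B p q) (n : ∀ w, G.Adj v w ↔ w = a ∨ w = b ∨ w = d)
    (ha : a ∈ S ∪ B → a = x) (hb : b ∈ S ∪ B → b = x) (hd : d ∈ S ∪ B → d = x) (hp : v ≠ p) (hq : v ≠ q) :
    Sep G (insert v S) B p q := by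
  refine h.leaf (x := x) (fun w hw hvw => ?_) hp hq
  rcases (n w).1 hvw with rfl | rfl | rfl
  exacts [ha hw, hb hw, hd hw]

lemma ExtD.mk3 {c : V → Bool} {S B : Finset V} {D I S' : Finset V} (h1 : I ⊆ D) (h4 : ∀ v ∈ S, v ∈ S') (h5 : Fst G S' B)
    (h2 : ∀ d ∈ I, ∃ a b e, (∀ w, G.Adj d w ↔ w = a ∨ w = b ∨ w = e) ∧ (a ∉ I ∧ (a ∈ D ∨ c a = false)) ∧
      (b ∉ I ∧ (b ∈ D ∨ c b = false)) ∧ (e ∉ I ∧ (e ∈ D ∨ c e = false)))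
    (h3 : ∀ d ∈ D, d ∈ I ∨ d ∈ S') : ExtD G D c S B := by
  refine ⟨I, S', h1, ?_, fun v hv hv' => (h3 v hv).resolve_left hv', h4, h5⟩
  intro d hd v hv
  obtain ⟨a, b, e, n, ha, hb, he⟩ := h2 d hd
  rcases (n v).1 hv with rfl | rfl | rfl
  exacts [⟨ha.1, fun h => ha.2.resolve_left h⟩, ⟨hb.1, fun h => hb.2.resolve_left h⟩, ⟨he.1, fun h => he.2.resolve_left h⟩]

lemma ExtD.mk1 {c : V → Bool} {S B : Finset V} {D S' : Finset V} {d a b e : V} (h1 : d ∈ D) (h4 : ∀ v ∈ S, v ∈ S')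
    (h5 : Fst G S' B) (n : ∀ w, G.Adj d w ↔ w = a ∨ w = b ∨ w = e) (ha : a ≠ d ∧ (a ∈ D ∨ c a = false))
    (hb : b ≠ d ∧ (b ∈ D ∨ c b = false)) (he : e ≠ d ∧ (e ∈ D ∨ c e = false)) (h3 : ∀ v ∈ D, v = d ∨ v ∈ S') :
    ExtD G D c S B :=
  .mk3 (I := {d}) (by simpa) h4 h5 (by simpa using ⟨a, b, e, n, ha, hb, he⟩) (by simpa)

lemma ExtD.mk2 {c : V → Bool} {S B : Finset V} {D S' : Finset V} {d d' a b e a' b' e' : V} (h1 : d ∈ D) (h1' : d' ∈ D)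
    (h4 : ∀ v ∈ S, v ∈ S') (h5 : Fst G S' B) (n : ∀ w, G.Adj d w ↔ w = a ∨ w = b ∨ w = e)
    (ha : (a ≠ d ∧ a ≠ d') ∧ (a ∈ D ∨ c a = false)) (hb : (b ≠ d ∧ b ≠ d') ∧ (b ∈ D ∨ c b = false))
    (he : (e ≠ d ∧ e ≠ d') ∧ (e ∈ D ∨ c e = false)) (n' : ∀ w, G.Adj d' w ↔ w = a' ∨ w = b' ∨ w = e')
    (ha' : (a' ≠ d ∧ a' ≠ d') ∧ (a' ∈ D ∨ c a' = false)) (hb' : (b' ≠ d ∧ b' ≠ d') ∧ (b' ∈ D ∨ c b' = false))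
    (he' : (e' ≠ d ∧ e' ≠ d') ∧ (e' ∈ D ∨ c e' = false)) (h3 : ∀ v ∈ D, (v = d ∨ v = d') ∨ v ∈ S') : ExtD G D c S B := by
  refine .mk3 (I := {d, d'}) (by simp [insert_subset_iff, *]) h4 h5 ?_ (by simpa)
  simp only [mem_insert, mem_singleton, forall_eq_or_imp, forall_eq, not_or]
  exact ⟨⟨_, _, _, n, ha, hb, he⟩, _, _, _, n', ha', hb', he'⟩

lemma TCol.facts {c : V → Bool} {S B : Finset V} (K : TCol G D c S B t1 t2 t3 p r q q') :
    (∀ v ∈ D, v ∉ S ∧ v ∉ B) ∧ (∀ v, c v = true → v ∉ S ∧ v ∉ B) ∧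
    (∀ v, G.Adj t1 v ∨ G.Adj r v → v ∉ D → c v = false → v ∈ S ∪ B) := by
  refine ⟨fun v hv => ⟨fun h => (K.w v (mem_union_left _ h)).1 hv, K.hB v hv⟩, fun v hv => ?_, K.m⟩
  have : v ∉ S ∪ B := fun h => by simpa [hv] using (K.w v h).2
  simpa using this

set_option maxHeartbeats 1000000 in
lemma TCol.extB {c : V → Bool} {S B : Finset V} (K : TCol G {t1, t2, r} c S B t1 t2 t3 p r q q')
    (a12 : t1 ≠ t2) (a23 : t2 ≠ t3) (a13 : t1 ≠ t3)
    (n1 : ∀ v, G.Adj t1 v ↔ v = t2 ∨ v = t3 ∨ v = p) (n2 : ∀ v, G.Adj t2 v ↔ v = t1 ∨ v = t3 ∨ v = r)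
    (nr : ∀ v, G.Adj r v ↔ v = t2 ∨ v = q ∨ v = q') (r1 : r ≠ t1) (r3 : r ≠ t3) (r2 : r ≠ t2)
    (hp : p ∉ ({t1, t2, r} : Finset V)) (hq : q ∉ ({t1, t2, r} : Finset V)) (hq' : q' ∉ ({t1, t2, r} : Finset V))
    (q3 : q ≠ t3) (q'3 : q' ≠ t3) (p3 : p ≠ t3) (pq : p ≠ q) :
    ExtD G {t1, t2, r} c S B := by
  obtain ⟨hD, hT, hm⟩ := K.facts
  obtain ⟨hd, -, -, hF, hS, -, hqp⟩ := K
  have hpm := hm p (.inl ((n1 p).2 (by simp))) hp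
  have hqm := hm q (.inr ((nr q).2 (by simp))) hq
  have h3m := hm t3 (.inl ((n1 t3).2 (by simp))) (by simp [a23.symm, a13.symm, r3.symm])
  obtain ⟨s1, b1⟩ := hD t1 (by simp)
  obtain ⟨s2, b2⟩ := hD t2 (by simp)
  obtain ⟨sr, br⟩ := hD r (by simp)
  simp only [mem_insert, mem_singleton, not_or] at hp hq hq'
  obtain ⟨p1, p2, pr⟩ := hp
  obtain ⟨q1, q2, qr⟩ := hq
  obtain ⟨q'1, q'2, q'r⟩ := hq'
  clear hm hD
  have a21 := a12.symm
  have a32 := a23.symm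
  have a31 := a13.symm
  have r1' := r1.symm
  have r2' := r2.symm
  have r3' := r3.symm
  by_cases hP : c p = true
  · have hQ := hqp.trans hP
    obtain ⟨sp, bp⟩ := hT p hP
    obtain ⟨sq, bq⟩ := hT q hQ
    by_cases h3 : c t3 = true
    · obtain ⟨s3, b3⟩ := hT t3 h3
      clear hT hS hpm hqm h3m
      have f1 := hF.leaf3 (x := q') nr (by simp [*]) (by simp [*]) (by simp [*])
      have f2 := f1.leaf3 (x := r) n2 (by simp [*]) (by simp [*]) (by simp [*])
      have f3 := f2.leaf3 (x := t2) n1 (by simp [*]) (by simp [*]) (by simp [*])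
      exact .mk3 (I := ∅) (by simp) (by simp +contextual) f3 (by simp) (by simp)
    · rw [Bool.not_eq_true] at h3
      clear hT hS hpm hqm h3m
      have f1 := hF.leaf3 (x := t3) n1 (by simp [*]) (by simp [*]) (by simp [*])
      have f2 := f1.leaf3 (x := q') nr (by simp [*]) (by simp [*]) (by simp [*])
      exact .mk1 (d := t2) (by simp) (by simp +contextual) f2 n2 (by simp [*]) (by simp [*]) (by simp [*])
        (by simp)
  rw [Bool.not_eq_true] at hP
  have hQ := hqp.trans hP
  have hS := hS hP
  by_cases hQ' : c q' = true
  · obtain ⟨sq', bq'⟩ := hT q' hQ'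
    by_cases h3 : c t3 = true
    · obtain ⟨s3, b3⟩ := hT t3 h3
      clear hT hpm hqm h3m
      obtain ⟨f1, hd1⟩ := Sep.extend3 hd hS s1 b1 p1 (Ne.symm q1) n1 (by simp [*]) (by simp [*]) (by simp [*])
        ⟨q2, q3, pq.symm⟩
      obtain ⟨f2, hd2⟩ := Sep.extend3 hd1 f1 (t := t2) (by simp [*]) b2 a12 (Ne.symm q2) n2 (by simp [*]) (by simp [*])
        (by simp [*]) ⟨q1, q3, qr⟩
      have f3 := f2.subdiv3 hd2 (v := r) (by simp [*]) br nr (by simp [*]) (by simp [*]) (by simp [*])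
      exact .mk3 (I := ∅) (by simp) (by simp +contextual) f3 (by simp) (by simp)
    · rw [Bool.not_eq_true] at h3
      rcases Sep.join hd hS (hpm hP) (hqm hQ) (h3m h3) with hj | hj
      · clear hT hpm hqm h3m
        have f1 := hj.subdiv3 hd s1 b1 n1 (by simp [*]) (by simp [*]) (by simp [*])
        have f2 := f1.leaf3 (x := q) nr (by simp [*]) (by simp [*]) (by simp [*])
        exact .mk1 (d := t2) (by simp) (by simp +contextual) f2 n2 (by simp [*]) (by simp [*]) (by simp [*])
          (by simp)
      · clear hT hpm hqm h3m
        obtain ⟨f1, hd1⟩ := Sep.extend3 hd hj sr br qr r3 nr (by simp [*]) (by simp [*]) (by simp [*])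
          ⟨a32, q3.symm, q'3.symm⟩
        have f2 := f1.subdiv3 hd1 (v := t2) (by simp [*]) b2 n2 (by simp [*]) (by simp [*]) (by simp [*])
        exact .mk1 (d := t1) (by simp) (by simp +contextual) f2 n1 (by simp [*]) (by simp [*]) (by simp [*])
          (by simp)
  · rw [Bool.not_eq_true] at hQ'
    by_cases h3 : c t3 = true
    · obtain ⟨s3, b3⟩ := hT t3 h3
      clear hT hS hpm hqm h3m
      have f1 := hF.leaf3 (x := p) n1 (by simp [*]) (by simp [*]) (by simp [*])
      have f2 := f1.leaf3 (x := t1) n2 (by simp [*]) (by simp [*]) (by simp [*])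
      exact .mk1 (d := r) (by simp) (by simp +contextual) f2 nr (by simp [*]) (by simp [*]) (by simp [*])
        (by simp)
    · rw [Bool.not_eq_true] at h3
      clear hT hS hpm hqm h3m
      have f1 := hF.leaf3 (x := t3) n2 (by simp [*]) (by simp [*]) (by simp [*])
      exact .mk2 (d := r) (d' := t1) (by simp) (by simp) (by simp +contextual) f1 nr (by simp [*]) (by simp [*]) (by simp [*])
        n1 (by simp [*]) (by simp [*]) (by simp [*]) (by simp)

variable {s s1 s2 : V}

set_option maxHeartbeats 1000000 in
lemma TCol.extA {c : V → Bool} {S B : Finset V} (K : TCol G {t1, t2, r, t3, s} c S B t1 t2 t3 p r q q')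
    (a12 : t1 ≠ t2) (a23 : t2 ≠ t3) (a13 : t1 ≠ t3)
    (n1 : ∀ v, G.Adj t1 v ↔ v = t2 ∨ v = t3 ∨ v = p) (n2 : ∀ v, G.Adj t2 v ↔ v = t1 ∨ v = t3 ∨ v = r)
    (nr : ∀ v, G.Adj r v ↔ v = t2 ∨ v = q ∨ v = q') (n3 : ∀ v, G.Adj t3 v ↔ v = t1 ∨ v = t2 ∨ v = s)
    (ns : ∀ v, G.Adj s v ↔ v = t3 ∨ v = s1 ∨ v = s2)
    (r1 : r ≠ t1) (r3 : r ≠ t3) (r2 : r ≠ t2) (ss1 : s ≠ t1) (ss2 : s ≠ t2) (ss3 : s ≠ t3) (sr' : s ≠ r)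
    (hp : p ∉ ({t1, t2, r, t3, s} : Finset V)) (hq : q ∉ ({t1, t2, r, t3, s} : Finset V))
    (hq' : q' ∉ ({t1, t2, r, t3, s} : Finset V))
    (hs1 : s1 ∉ ({t1, t2, r, t3, s} : Finset V)) (hs2 : s2 ∉ ({t1, t2, r, t3, s} : Finset V)) (pq : p ≠ q) :
    ExtD G {t1, t2, r, t3, s} c S B := by
  obtain ⟨hD, hT, hm⟩ := K.facts
  obtain ⟨hd, -, -, hF, hS, -, hqp⟩ := K
  obtain ⟨f1, b1⟩ := hD t1 (by simp)
  obtain ⟨f2, b2⟩ := hD t2 (by simp)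
  obtain ⟨f3, b3⟩ := hD t3 (by simp)
  obtain ⟨fr, br⟩ := hD r (by simp)
  obtain ⟨fs, bs⟩ := hD s (by simp)
  simp only [mem_insert, mem_singleton, not_or] at hp hq hq' hs1 hs2
  obtain ⟨p1, p2, pr, p3, ps⟩ := hp
  obtain ⟨q1, q2, qr, q3, qs⟩ := hq
  obtain ⟨q'1, q'2, q'r, q'3, q's⟩ := hq'
  obtain ⟨s11, s12, s1r, s13, s1s⟩ := hs1
  obtain ⟨s21, s22, s2r, s23, s2s⟩ := hs2
  clear hm hD
  have a21 := a12.symm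
  have a32 := a23.symm
  have a31 := a13.symm
  have r1' := r1.symm
  have r2' := r2.symm
  have r3' := r3.symm
  have ss1' := ss1.symm
  have ss2' := ss2.symm
  have ss3' := ss3.symm
  have ssr' := sr'.symm
  have hscases : (c s1 = false ∧ c s2 = false) ∨
      ∃ x, (s1 ∈ S ∪ B → s1 = x) ∧ (s2 ∈ S ∪ B → s2 = x) := by
    by_cases h1 : c s1 = true
    · exact .inr ⟨s2, fun h => by simp [hT s1 h1] at h, fun _ => rfl⟩
    by_cases h2 : c s2 = true
    · exact .inr ⟨s1, fun _ => rfl, fun h => by simp [hT s2 h2] at h⟩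
    simp only [Bool.not_eq_true] at h1 h2
    exact .inl ⟨h1, h2⟩
  by_cases hP : c p = true
  · have hQ := hqp.trans hP
    obtain ⟨sp, bp⟩ := hT p hP
    obtain ⟨sq, bq⟩ := hT q hQ
    clear hT hS
    rcases hscases with ⟨h1, h2⟩ | ⟨x, h1, h2⟩
    · have f1 := hF.leaf3 (x := q') nr (by simp [*]) (by simp [*]) (by simp [*])
      have f2 := f1.leaf3 (x := t3) n1 (by simp [*]) (by simp [*]) (by simp [*])
      have f3 := f2.leaf3 (x := t1) n3 (by simp [*]) (by simp [*]) (by simp [*])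
      exact .mk2 (d := t2) (d' := s) (by simp) (by simp) (by simp +contextual) f3 n2 (by simp [*]) (by simp [*]) (by simp [*])
        ns (by simp [*]) (by simp [*]) (by simp [*]) (by simp)
    · have f0 := hF.leaf3 (x := x) ns (by simp [*]) h1 h2
      clear h1 h2
      have f1 := f0.leaf3 (x := q') nr (by simp [*]) (by simp [*]) (by simp [*])
      have f2 := f1.leaf3 (x := r) n2 (by simp [*]) (by simp [*]) (by simp [*])
      have f3 := f2.leaf3 (x := t2) n1 (by simp [*]) (by simp [*]) (by simp [*])
      exact .mk1 (d := t3) (by simp) (by simp +contextual) f3 n3 (by simp [*]) (by simp [*]) (by simp [*])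
        (by simp)
  rw [Bool.not_eq_true] at hP
  have hQ := hqp.trans hP
  have hS := hS hP
  by_cases hQ' : c q' = true
  · obtain ⟨sq', bq'⟩ := hT q' hQ'
    clear hT
    rcases hscases with ⟨h1, h2⟩ | ⟨x, h1, h2⟩
    · clear hS
      have f1 := hF.leaf3 (x := q) nr (by simp [*]) (by simp [*]) (by simp [*])
      have f2 := f1.leaf3 (x := r) n2 (by simp [*]) (by simp [*]) (by simp [*])
      have f3 := f2.leaf3 (x := t2) n3 (by simp [*]) (by simp [*]) (by simp [*])
      exact .mk2 (d := s) (d' := t1) (by simp) (by simp) (by simp +contextual) f3 ns (by simp [*]) (by simp [*]) (by simp [*])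
        n1 (by simp [*]) (by simp [*]) (by simp [*]) (by simp)
    · have f0 := hS.leaf3 (x := x) ns (by simp [*]) h1 h2 (Ne.symm ps) (Ne.symm qs)
      clear h1 h2 hS
      have hd0 : Disjoint (insert s S) B := disjoint_insert_left.2 ⟨bs, hd⟩
      obtain ⟨g1, hd1⟩ := Sep.extend3 hd0 f0 (t := t1) (by simp [*]) b1 p1 (Ne.symm q1) n1 (by simp [*])
        (by simp [*]) (by simp [*]) ⟨q2, q3, pq.symm⟩
      obtain ⟨g2, hd2⟩ := Sep.extend3 hd1 g1 (t := t2) (by simp [*]) b2 a12 (Ne.symm q2) n2 (by simp [*]) (by simp [*])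
        (by simp [*]) ⟨q1, q3, qr⟩
      have g3 := g2.subdiv3 hd2 (v := r) (by simp [*]) br nr (by simp [*]) (by simp [*]) (by simp [*])
      exact .mk1 (d := t3) (by simp) (by simp +contextual) g3 n3 (by simp [*]) (by simp [*]) (by simp [*])
        (by simp)
  · rw [Bool.not_eq_true] at hQ'
    clear hT hS
    rcases hscases with ⟨h1, h2⟩ | ⟨x, h1, h2⟩
    · have f1 := hF.leaf3 (x := s) n3 (by simp [*]) (by simp [*]) (by simp [*])
      have f2 := f1.leaf3 (x := t3) n2 (by simp [*]) (by simp [*]) (by simp [*])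
      refine .mk3 (I := {s, r, t1}) (by simp [insert_subset_iff]) (by simp +contextual) f2 ?_ (by simp)
      rintro d hd
      rcases mem_insert.1 hd with rfl | hd
      · exact ⟨_, _, _, ns, by simp [*], by simp [*], by simp [*]⟩
      rcases mem_insert.1 hd with rfl | hd
      · exact ⟨_, _, _, nr, by simp [*], by simp [*], by simp [*]⟩
      obtain rfl := mem_singleton.1 hd
      exact ⟨_, _, _, n1, by simp [*], by simp [*], by simp [*]⟩
    · have f0 := hF.leaf3 (x := x) ns (by simp [*]) h1 h2
      clear h1 h2
      have f1 := f0.leaf3 (x := s) n3 (by simp [*]) (by simp [*]) (by simp [*])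
      have f2 := f1.leaf3 (x := t3) n2 (by simp [*]) (by simp [*]) (by simp [*])
      exact .mk2 (d := r) (d' := t1) (by simp) (by simp) (by simp +contextual) f2 nr (by simp [*]) (by simp [*]) (by simp [*])
        n1 (by simp [*]) (by simp [*]) (by simp [*]) (by simp)

lemma Far.off_tri (hf : Far G) {x y z u v : V} (hxy : G.Adj x y) (hyz : G.Adj y z) (hxz : G.Adj x z)
    (hu : u = x ∨ u = y ∨ u = z) (h : G.Adj v u ∨ ∃ w, G.Adj v w ∧ G.Adj w u) (hv : v ≠ x ∧ v ≠ y ∧ v ≠ z)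
    {S : Finset (Sym2 V)} (hS : Short G S) : ¬ On S v := by
  intro hon
  have hT := tri_short hxy hyz hxz
  have huT : On (tri x y z) u := on_tri.2 hu
  have : S = tri x y z := by
    rcases h with h | ⟨w, h1, h2⟩
    exacts [hf.eq_adj hS hT hon huT h, hf.eq_adj2 hS hT hon huT h1 h2]
  rw [this, on_tri] at hon
  tauto

lemma quad_on {w x y z : V} : On (quad w x y z) w ∧ On (quad w x y z) x ∧ On (quad w x y z) y ∧ On (quad w x y z) z :=
  ⟨⟨s(w, x), by simp [mem_quad]⟩, ⟨s(w, x), by simp [mem_quad]⟩, ⟨s(x, y), by simp [mem_quad]⟩,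
    ⟨s(y, z), by simp [mem_quad]⟩⟩

/-- Two edges leaving a triangle end in distinct non-adjacent vertices without common neighbours off the triangle. -/
lemma Far.tri_legs (hf : Far G) {x y z a b : V} (hxy : G.Adj x y) (hyz : G.Adj y z) (hxz : G.Adj x z)
    (ha : G.Adj x a) (hb : G.Adj y b) (ha1 : a ≠ y) (ha2 : a ≠ z) (hb1 : b ≠ x) (hb2 : b ≠ z) :
    a ≠ b ∧ ¬ G.Adj a b := by
  have key : ∀ S, Short G S → ¬ On S a := fun S hS =>
    hf.off_tri hxy hyz hxz (.inl rfl) (.inl ha.symm) ⟨ha.ne', ha1, ha2⟩ hS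
  constructor
  · rintro rfl
    exact key _ (tri_short hxy hb ha) (by simp [on_tri])
  · intro h
    exact key _ (quad_short ha.symm hxy hb h.symm ha1 hb1.symm) quad_on.1

lemma Far.tri_step (hf : Far G) {x y z a b : V} (hxy : G.Adj x y) (hyz : G.Adj y z) (hxz : G.Adj x z)
    (ha : G.Adj x a) (hab : G.Adj a b) (ha1 : a ≠ y) (ha2 : a ≠ z) (hbx : b ≠ x) : b ≠ y ∧ b ≠ z := by
  have key : ∀ S, Short G S → ¬ On S a := fun S hS =>
    hf.off_tri hxy hyz hxz (.inl rfl) (.inl ha.symm) ⟨ha.ne', ha1, ha2⟩ hS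
  constructor
  · rintro rfl
    exact key _ (tri_short hxy hab.symm ha) (by simp [on_tri])
  · rintro rfl
    exact key _ (tri_short hxz hab.symm ha) (by simp [on_tri])

/-- The triangle reduction when the third corner is kept. -/
lemma MCE.tredB (M : MCE G U B E0 side p0) {t1 t2 t3 p r b1 b2 : V} (u1 : t1 ∈ U) (u2 : t2 ∈ U) (ur : r ∈ U)
    (ub1 : b1 ∈ U) (ub2 : b2 ∈ U) (a12 : G.Adj t1 t2) (a23 : G.Adj t2 t3) (a13 : G.Adj t1 t3)
    (n1 : ∀ v, G.Adj t1 v ↔ v = t2 ∨ v = t3 ∨ v = p) (n2 : ∀ v, G.Adj t2 v ↔ v = t1 ∨ v = t3 ∨ v = r)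
    (nr : ∀ v, G.Adj r v ↔ v = t2 ∨ v = b1 ∨ v = b2) (p2 : p ≠ t2) (p3 : p ≠ t3) (r1 : r ≠ t1) (r3 : r ≠ t3)
    (hb : b1 ≠ b2) (hb1 : b1 ≠ t2) (hb2 : b2 ≠ t2) (h3 : t3 ∈ U → (nb G t3).card ≠ 3) :
    p ∈ B ∧ ∃ q w, (q = b1 ∨ q = b2) ∧ Apex G U E0 p q {t1, t2, r} w := by
  have hf := M.inst.far
  have g1 : G.Adj t1 p := (n1 _).2 (by simp)
  have g2 : G.Adj t2 r := (n2 _).2 (by simp)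
  obtain ⟨q, q', hqq, hlab⟩ := M.far_label u2 a12 a23 a13 r1 r3 n2 nr hb1 hb2 hb
  have hq2 : q ≠ t2 ∧ q' ≠ t2 ∧ q ≠ q' ∧ q ∈ U := by
    rcases hqq with ⟨rfl, rfl⟩ | ⟨rfl, rfl⟩
    exacts [⟨hb2, hb1, hb.symm, ub2⟩, ⟨hb1, hb2, hb, ub1⟩]
  have nr' : ∀ v, G.Adj r v ↔ v = t2 ∨ v = q ∨ v = q' := by
    intro v; rw [nr]
    rcases hqq with ⟨rfl, rfl⟩ | ⟨rfl, rfl⟩ <;> tauto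
  have gq : G.Adj r q := (nr' _).2 (by simp)
  have gq' : G.Adj r q' := (nr' _).2 (by simp)
  have sq := hf.tri_step a12.symm a13 a23 g2 gq r1 r3 hq2.1
  have sq' := hf.tri_step a12.symm a13 a23 g2 gq' r1 r3 hq2.2.1
  have hpr := (hf.tri_legs a12 a23 a13 g1 g2 p2 p3 r1 r3).1
  have C : TCfg G U side {t1, t2, r} t1 t2 t3 p r q q' :=
    { u1 := u1, u2 := u2, ur := ur, uq := .inl hq2.2.2.2, a12 := a12, a23 := a23, a13 := a13, n1 := n1, n2 := n2, nr := nr'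
      p2 := p2, p3 := p3, r1 := r1, r3 := r3, qq := hq2.2.2.1, q2 := hq2.1, q'2 := hq2.2.1, lab := hlab
      hD := by simp [insert_subset_iff, *]
      d1 := by simp
      d2 := by simp
      dr := by simp
      dp := by simp [g1.ne', p2, hpr]
      dq := by simp [sq.1, hq2.1, gq.ne']
      kill := fun h1 h2 => absurd h2 (h3 h1) }
  have npq := C.ne_pq hf
  rcases C.inst M with ⟨hpB, w, hw⟩ | I
  · exact ⟨hpB, q, w, by tauto, hw⟩
  · exact (C.contra M I fun c S B1 K => K.extB a12.ne a23.ne a13.ne n1 n2 nr' r1 r3 g2.ne' C.dp C.dq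
      (by simp [sq'.1, hq2.2.1, gq'.ne']) sq.2 sq'.2 p3 npq).elim

/-- The triangle reduction when the third corner is deleted. -/
lemma MCE.tredA (M : MCE G U B E0 side p0) {t1 t2 t3 p r b1 b2 s s1 s2 : V} (u1 : t1 ∈ U) (u2 : t2 ∈ U) (ur : r ∈ U)
    (u3 : t3 ∈ U) (us : s ∈ U)
    (hub : p ∈ B ∨ b1 ∈ U ∧ b2 ∈ U) (a12 : G.Adj t1 t2) (a23 : G.Adj t2 t3) (a13 : G.Adj t1 t3)
    (n1 : ∀ v, G.Adj t1 v ↔ v = t2 ∨ v = t3 ∨ v = p) (n2 : ∀ v, G.Adj t2 v ↔ v = t1 ∨ v = t3 ∨ v = r)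
    (nr : ∀ v, G.Adj r v ↔ v = t2 ∨ v = b1 ∨ v = b2) (p2 : p ≠ t2) (p3 : p ≠ t3) (r1 : r ≠ t1) (r3 : r ≠ t3)
    (hb : b1 ≠ b2) (hb1 : b1 ≠ t2) (hb2 : b2 ≠ t2) (n3 : ∀ v, G.Adj t3 v ↔ v = t1 ∨ v = t2 ∨ v = s)
    (ns : ∀ v, G.Adj s v ↔ v = t3 ∨ v = s1 ∨ v = s2) (ss1 : s ≠ t1) (ss2 : s ≠ t2) (hs1 : s1 ≠ t3) (hs2 : s2 ≠ t3) :
    p ∈ B ∧ ∃ q w, (q = b1 ∨ q = b2) ∧ q ∈ U ∧ Apex G U E0 p q {t1, t2, r, t3, s} w := by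
  have hf := M.inst.far
  have g1 : G.Adj t1 p := (n1 _).2 (by simp)
  have g2 : G.Adj t2 r := (n2 _).2 (by simp)
  have g3 : G.Adj t3 s := (n3 _).2 (by simp)
  have e1 : G.Adj s s1 := (ns _).2 (by simp)
  have e2 : G.Adj s s2 := (ns _).2 (by simp)
  obtain ⟨q, q', hqq, hlab⟩ := M.far_label u2 a12 a23 a13 r1 r3 n2 nr hb1 hb2 hb
  have hq2 : q ≠ t2 ∧ q' ≠ t2 ∧ q ≠ q' ∧ (q ∈ U ∨ p ∉ U) := by
    have hub : p ∉ U ∨ b1 ∈ U ∧ b2 ∈ U := hub.imp_left M.inst.b_not_u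
    rcases hqq with ⟨rfl, rfl⟩ | ⟨rfl, rfl⟩
    exacts [⟨hb2, hb1, hb.symm, by tauto⟩, ⟨hb1, hb2, hb, by tauto⟩]
  have nr' : ∀ v, G.Adj r v ↔ v = t2 ∨ v = q ∨ v = q' := by
    intro v; rw [nr]
    rcases hqq with ⟨rfl, rfl⟩ | ⟨rfl, rfl⟩ <;> tauto
  have gq : G.Adj r q := (nr' _).2 (by simp)
  have gq' : G.Adj r q' := (nr' _).2 (by simp)
  have sq := hf.tri_step a12.symm a13 a23 g2 gq r1 r3 hq2.1
  have sq' := hf.tri_step a12.symm a13 a23 g2 gq' r1 r3 hq2.2.1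
  have ts1 := hf.tri_step a13.symm a12 a23.symm g3 e1 ss1 ss2 hs1
  have ts2 := hf.tri_step a13.symm a12 a23.symm g3 e2 ss1 ss2 hs2
  have hpr := (hf.tri_legs a12 a23 a13 g1 g2 p2 p3 r1 r3).1
  have hps := (hf.tri_legs a13 a23.symm a12 g1 g3 p3 p2 ss1 ss2).1
  have hrs := hf.tri_legs a23 a13.symm a12.symm g2 g3 r3 r1 ss2 ss1
  have x1 : s1 ≠ r := by rintro rfl; exact hrs.2 e1.symm
  have x2 : s2 ≠ r := by rintro rfl; exact hrs.2 e2.symm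
  have x3 : q ≠ s := by rintro rfl; exact hrs.2 gq
  have x4 : q' ≠ s := by rintro rfl; exact hrs.2 gq'
  have C : TCfg G U side {t1, t2, r, t3, s} t1 t2 t3 p r q q' :=
    { u1 := u1, u2 := u2, ur := ur, uq := hq2.2.2.2, a12 := a12, a23 := a23, a13 := a13, n1 := n1, n2 := n2, nr := nr'
      p2 := p2, p3 := p3, r1 := r1, r3 := r3, qq := hq2.2.2.1, q2 := hq2.1, q'2 := hq2.2.1, lab := hlab
      hD := by simp [insert_subset_iff, *]
      d1 := by simp
      d2 := by simp
      dr := by simp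
      dp := by simp [g1.ne', p2, hpr, p3, hps]
      dq := by simp [sq.1, hq2.1, gq.ne', sq.2, x3]
      kill := fun h1 h2 => ⟨s, by simp, g3, ss1, ss2⟩ }
  have npq := C.ne_pq hf
  rcases C.inst M with ⟨hpB, w, hw⟩ | I
  · exact ⟨hpB, q, w, by tauto, C.q_mem M, hw⟩
  · exact (C.contra M I fun c S B1 K => K.extA a12.ne a23.ne a13.ne n1 n2 nr' n3 ns r1 r3 g2.ne' ss1 ss2 g3.ne'
      hrs.1.symm C.dp C.dq (by simp [sq'.1, hq2.2.1, gq'.ne', sq'.2, x4])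
      (by simp [ts1.1, ts1.2, hs1, x1, e1.ne']) (by simp [ts2.1, ts2.2, hs2, x2, e2.ne']) npq).elim

/-- All vertices off a circuit of length at most eight lie on the side of the outer face. -/
lemma MCE.out (M : MCE G U B E0 side p0) {S : Finset (Sym2 V)} (hS : IsCirc S) {u : V} (hu : u ∈ U) (hon : On S u)
    (h8 : S.card ≤ 8) {A : Set Φ} (hA : J G side A = S) {v w : V} (hv : ¬ On S v) (hvw : G.Adj v w) :
    side v w ∈ A ↔ p0 ∈ A := by
  have key : ∀ A : Set Φ, J G side A = S → p0 ∉ A → side v w ∉ A := by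
    intro A hA hp h
    subst hA
    exact M.none hp hS.1 h8 (M.not_sub hS hu hon) (M.mem_u_of_ins hp hv hvw h) hv ⟨w, hvw, h⟩
  by_cases hp : p0 ∈ A
  · simp only [hp, iff_true]
    by_contra h
    exact key Aᶜ (by rw [J_compl, hA]) (by simpa using hp) h
  · simp only [hp, iff_false]
    exact key A hA hp

lemma cross_aux {A AK : Set Φ} {p0 a a' k k' u u' t t' : Φ} (o1 : u' ∈ AK ↔ p0 ∈ AK) (o2 : t' ∈ AK ↔ p0 ∈ AK)
    (o3 : k' ∈ A ↔ p0 ∈ A) (o4 : t' ∈ A ↔ p0 ∈ A)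
    (l1 : (a' ∈ A ↔ a' ∈ AK) → (t ∈ A ↔ t ∈ AK)) (l2 : (t ∈ A ↔ t ∈ AK) → (a' ∈ A ↔ a' ∈ AK))
    (q1 : ¬¬(u ∈ AK ↔ u' ∈ AK)) (q2 : ¬¬(t ∈ AK ↔ t' ∈ AK)) (q3 : ¬¬(t ∈ A ↔ t' ∈ A)) (q4 : ¬¬(k ∈ A ↔ k' ∈ A))
    (k1 : ¬(a ∈ AK ↔ a' ∈ AK)) (k3 : ¬(k ∈ AK ↔ k' ∈ AK)) (z1 : ¬(a ∈ A ↔ a' ∈ A)) (z3 : ¬(u ∈ A ↔ u' ∈ A)) :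
    ¬(((a ∈ A ↔ p0 ∈ A) ∧ (a ∈ AK ↔ p0 ∈ AK)) ↔ ((a' ∈ A ↔ p0 ∈ A) ∧ (a' ∈ AK ↔ p0 ∈ AK))) ∧
    ¬(((k ∈ A ↔ p0 ∈ A) ∧ (k ∈ AK ↔ p0 ∈ AK)) ↔ ((k' ∈ A ↔ p0 ∈ A) ∧ (k' ∈ AK ↔ p0 ∈ AK))) ∧
    ¬(((u ∈ A ↔ p0 ∈ A) ∧ (u ∈ AK ↔ p0 ∈ AK)) ↔ ((u' ∈ A ↔ p0 ∈ A) ∧ (u' ∈ AK ↔ p0 ∈ AK))) := by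
  rw [not_not] at q1 q2 q3 q4
  rw [o1] at q1
  rw [o2] at q2
  rw [o4] at q3
  rw [o3] at q4
  rw [q2, q3] at l1 l2
  refine ⟨?_, ?_, ?_⟩
  · clear * - l1 l2 k1 z1
    by_cases h1 : a ∈ A <;> by_cases h2 : a ∈ AK <;> by_cases h3 : p0 ∈ A <;> by_cases h4 : p0 ∈ AK <;> simp_all
  · rw [q4, o3]
    clear * - k3
    tauto
  · rw [q1, o1]
    clear * - z3
    tauto

lemma MCE.cross (M : MCE G U B E0 side p0) {K Z : Finset (Sym2 V)} (hK : IsCirc K) (hZ : IsCirc Z)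
    (hKG : EIn G K) (hZG : EIn G Z) (hK8 : K.card ≤ 8) (hZ8 : Z.card ≤ 8) {v1 v2 v3 vk u1 u2 : V} (hU : v1 ∈ U)
    (n1 : ∀ w, G.Adj v1 w ↔ w = v2 ∨ w = vk ∨ w = u1) (n2 : ∀ w, G.Adj v2 w ↔ w = v1 ∨ w = v3 ∨ w = u2)
    (k1 : s(v1, v2) ∈ K) (k2 : s(v2, v3) ∈ K) (k3 : s(v1, vk) ∈ K) (z1 : s(v1, v2) ∈ Z) (z2 : s(v2, v3) ∈ Z)
    (z3 : s(v1, u1) ∈ Z) (ku1 : ¬ On K u1) (ku2 : ¬ On K u2) (zk : ¬ On Z vk) (zu2 : ¬ On Z u2)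
    (h2k : v2 ≠ vk) : False := by
  obtain ⟨AK, hAK, -⟩ := exA M.plane hKG hK.2.1 p0
  obtain ⟨A, hA, -⟩ := exA M.plane hZG hZ.2.1 p0
  have a12 : G.Adj v1 v2 := (n1 _).2 (by simp)
  have a1k : G.Adj v1 vk := (n1 _).2 (by simp)
  have a1u : G.Adj v1 u1 := (n1 _).2 (by simp)
  have a2u : G.Adj v2 u2 := (n2 _).2 (by simp)
  have o1 := M.out hK hU (on_left k1) hK8 hAK ku1 a1u.symm
  have o2 := M.out hK hU (on_left k1) hK8 hAK ku2 a2u.symm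
  have o3 := M.out hZ hU (on_left z1) hZ8 hA zk a1k.symm
  have o4 := M.out hZ hU (on_left z1) hZ8 hA zu2 a2u.symm
  have m : ∀ {u v}, G.Adj u v → (s(u, v) ∈ Z ↔ ¬ (side u v ∈ A ↔ side v u ∈ A)) := by
    intro u v h; rw [← hA, mem_J, and_iff_right h]
  have mK : ∀ {u v}, G.Adj u v → (s(u, v) ∈ K ↔ ¬ (side u v ∈ AK ↔ side v u ∈ AK)) := by
    intro u v h; rw [← hAK, mem_J, and_iff_right h]
  have q1 : s(v1, u1) ∉ K := fun h => ku1 (on_right h)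
  have q2 : s(v2, u2) ∉ K := fun h => ku2 (on_right h)
  have q3 : s(v2, u2) ∉ Z := fun h => zu2 (on_right h)
  have q4 : s(v1, vk) ∉ Z := fun h => zk (on_right h)
  have hvk : On K vk := on_right k3
  have l := M.plane.loc {f | (f ∈ A ↔ f ∈ AK)} v2 (by
    intro w hw
    have h1 := m hw
    have h2 := mK hw
    have h3 : s(v2, w) ∈ Z ↔ s(v2, w) ∈ K := by
      rcases (n2 w).1 hw with rfl | rfl | rfl
      · rw [Sym2.eq_swap]; exact iff_of_true z1 k1
      · exact iff_of_true z2 k2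
      · exact iff_of_false q3 q2
    simp only [Set.mem_setOf_eq]
    clear * - h1 h2 h3
    tauto)
  have l1 := l v1 u2 a12.symm a2u
  have l2 := l u2 v1 a2u a12.symm
  simp only [Set.mem_setOf_eq] at l1 l2
  rw [mK a1u] at q1
  rw [mK a2u] at q2
  rw [m a2u] at q3
  rw [m a1k] at q4
  rw [mK a12] at k1
  rw [mK a1k] at k3
  rw [m a12] at z1
  rw [m a1u] at z3
  have e := (even3 (M.plane.even {f | (f ∈ A ↔ p0 ∈ A) ∧ (f ∈ AK ↔ p0 ∈ AK)}) (y := v1) (x := v2) (z := vk) (b := u1) h2k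
    (by rintro rfl; exact ku1 (on_left k2)) (by rintro rfl; exact ku1 hvk)
    (fun v hv => (n1 v).1 (mem_J.1 hv).1)).1
  apply e
  simp only [mem_J, Set.mem_setOf_eq, a12, a1k, a1u, true_and]
  exact cross_aux o1 o2 o3 o4 l1 l2 q1 q2 q3 q4 k1 k3 z1 z3

lemma MCE.no_short_path (M : MCE G U B E0 side p0) {K S : Finset (Sym2 V)} (hK : Short G K)
    (hS : EIn G S) (hS4 : S.card ≤ 4) {v1 v2 v3 vk x u1 u2 u3 : V} (hU : v1 ∈ U)
    (n1 : ∀ w, G.Adj v1 w ↔ w = v2 ∨ w = vk ∨ w = u1) (n2 : ∀ w, G.Adj v2 w ↔ w = v1 ∨ w = v3 ∨ w = u2)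
    (n3 : ∀ w, G.Adj v3 w ↔ w = v2 ∨ w = x ∨ w = u3)
    (k1 : s(v1, v2) ∈ K) (k2 : s(v2, v3) ∈ K) (k3 : s(v1, vk) ∈ K)
    (ku1 : ¬ On K u1) (ku2 : ¬ On K u2) (ku3 : ¬ On K u3) (h3k : vk ≠ v3) (h2k : v2 ≠ vk) (h13 : v1 ≠ v3)
    (hSK : ∀ v, On S v → ¬ On K v) (hb : bd S = pt u1 + pt u3) : False := by
  have a12 : G.Adj v1 v2 := (n1 _).2 (by simp)
  have a1k : G.Adj v1 vk := (n1 _).2 (by simp)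
  have a1u : G.Adj v1 u1 := (n1 _).2 (by simp)
  have a2u : G.Adj v2 u2 := (n2 _).2 (by simp)
  have a23 : G.Adj v2 v3 := (n2 _).2 (by simp)
  have a3u : G.Adj v3 u3 := (n3 _).2 (by simp)
  have o1 : On K v1 := on_left k1
  have o2 : On K v2 := on_left k2
  have o3 : On K v3 := on_right k2
  have ok : On K vk := on_right k3
  have e1 : ∀ {v}, On K v → v ≠ u1 ∧ v ≠ u2 ∧ v ≠ u3 := fun h =>
    ⟨by rintro rfl; exact ku1 h, by rintro rfl; exact ku2 h, by rintro rfl; exact ku3 h⟩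
  obtain ⟨f1, f2, f3⟩ := e1 o1
  obtain ⟨g1, g2, g3⟩ := e1 o2
  obtain ⟨h1, h2, h3⟩ := e1 o3
  obtain ⟨i1, i2, i3⟩ := e1 ok
  have hS0 : ∀ {v w}, On K v → s(v, w) ∉ S := fun h h' => hSK _ (on_left h') h
  have hu13 : u1 ≠ u3 := by
    rintro rfl
    have := M.inst.far.eq (quad_short a1u.symm a12 a23 a3u (Ne.symm g1) h13) hK quad_on.2.1 o1
    exact ku1 (this ▸ quad_on.1)
  set P : Finset (Sym2 V) := insert s(u1, v1) {s(v1, v2), s(v2, v3), s(v3, u3)} with hP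
  have hbP : bd P = pt u1 + pt u3 := by
    rw [hP, bd_insert (Ne.symm f1) (by simp; tauto), bd_path3 a12.ne a23.ne a3u.ne g3 h13]
    linear_combination (pt v1) * two_zmod_pi (V := V)
  have hd : Disjoint S P := by
    rw [disjoint_right]
    intro e he
    simp only [hP, mem_insert, mem_singleton] at he
    rcases he with rfl | rfl | rfl | rfl
    · rw [Sym2.eq_swap]; exact hS0 o1
    · exact hS0 o1
    · exact hS0 o2
    · exact hS0 o3
  have hW : bd (S ∪ P) = 0 := bd_union_zero hd hb hbP
  have hWP : ∀ {v w}, On K v → s(v, w) ∈ S ∪ P → s(v, w) ∈ P := by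
    intro v w hv h
    exact (mem_union.1 h).resolve_left (hS0 hv)
  obtain ⟨Z, hZW, hZ, z1⟩ := exists_circ hW (e := s(v1, v2)) (by simp [hP])
  have hZG : EIn G Z := by
    refine EIn.mono ?_ hZW
    refine hS.union ?_
    exact (((EIn.empty.insert a3u).insert a23).insert a12).insert a1u.symm
  have hPc : P.card ≤ 4 := card_le_four
  have hZ8 : Z.card ≤ 8 := (card_le_card hZW).trans ((card_union_le _ _).trans (by omega))
  have q1 : s(v1, vk) ∉ Z := by
    intro h
    have := hWP o1 (hZW h)
    simp [hP] at this
    have := a1k.ne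
    have := a12.ne
    have := a23.ne
    grind
  have q2 : s(v2, u2) ∉ Z := by
    intro h
    have := hWP o2 (hZW h)
    simp [hP] at this
    have := a12.ne
    have := a23.ne
    grind
  have z3 : s(v1, u1) ∈ Z :=
    ((even3 hZ.2.1 (y := v1) (x := v2) (z := vk) (b := u1) h2k g1 i1
      (fun v hv => (n1 v).1 (hZG _ _ hv))).2.1 z1).resolve_left q1
  have z2 : s(v2, v3) ∈ Z :=
    ((even3 hZ.2.1 (y := v2) (x := v1) (z := v3) (b := u2) h13 f2 h2
      (fun v hv => (n2 v).1 (hZG _ _ hv))).2.1 (by rwa [Sym2.eq_swap])).resolve_right q2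
  have zk : ¬ On Z vk := by
    intro h
    obtain ⟨w, hw⟩ := on_iff.1 h
    have := hWP ok (hZW hw)
    simp [hP] at this
    have := a1k.ne
    grind
  have zu2 : ¬ On Z u2 := by
    intro h
    obtain ⟨T, hT, hT1, -⟩ := chord_short hZ hZG (by omega) (on_left z2) h a2u q2
    have := M.inst.far.eq hT hK (on_left hT1) o2
    exact ku2 (this ▸ on_right hT1)
  exact M.cross (Short.isCirc hK) hZ hK.1 hZG (by have := hK.2.2.2; omega) hZ8 hU n1 n2 k1 k2 k3 z1 z2 z3
    ku1 ku2 zk zu2 h2k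

lemma MCE.instK (M : MCE G U B E0 side p0) {K : Finset (Sym2 V)} (hK : Short G K) (hD : D ⊆ U)
    (hDK : ∀ v ∈ D, On K v) {v1 v2 v3 u1 u3 : V} (d1 : v1 ∈ D) (d2 : v2 ∈ D) (d3 : v3 ∈ D) (h13 : v1 ≠ v3)
    (a12 : G.Adj v1 v2) (a23 : G.Adj v2 v3) (a1u : G.Adj v1 u1) (a3u : G.Adj v3 u3)
    (hu1 : u1 ∈ U) (hu3 : u3 ∈ U) (du1 : u1 ∉ D) (du3 : u3 ∉ D)
    (nsp : ∀ S, EIn (delG G D) S → S.card ≤ 4 → bd S ≠ pt u1 + pt u3) :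
    u1 ≠ u3 ∧ ¬ G.Adj u1 u3 ∧ Inst (addG (delG G D) u1 u3) (U \ D) B E0 := by
  have hf := M.inst.far
  have I1 := M.inst.del hD
  have hne : u1 ≠ u3 := by
    rintro rfl
    exact nsp ∅ EIn.empty (by simp) (by rw [bd_empty]; linear_combination -(pt u1) * two_zmod_pi (V := V))
  have hn : ¬ G.Adj u1 u3 := fun h =>
    nsp {s(u1, u3)} (EIn.empty.insert ⟨h, by simpa using du1, by simpa using du3⟩) (by simp) (bd_singleton hne)
  have hadj : ∀ {v w}, (addG (delG G D) u1 u3).Adj v w → s(v, w) ≠ s(u1, u3) → (delG G D).Adj v w := by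
    rintro v w ⟨-, h | ⟨rfl, rfl⟩ | ⟨rfl, rfl⟩⟩ h'
    exacts [h, absurd rfl h', absurd Sym2.eq_swap h']
  have hsm : ∀ Z, Short (addG (delG G D) u1 u3) Z → Short (delG G D) Z := by
    rintro Z ⟨h1, h2, h3, h4⟩
    have hZ : s(u1, u3) ∉ Z := by
      intro h
      refine nsp (Z.erase s(u1, u3)) ?_ (by rw [card_erase_of_mem h]; omega) (by rw [bd_erase hne h, h2, add_zero])
      intro v w hvw
      exact hadj (h1 v w (mem_of_mem_erase hvw)) (ne_of_mem_erase hvw)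
    exact ⟨fun v w h => hadj (h1 v w h) (by rintro h'; exact hZ (h' ▸ h)), h2, h3, h4⟩
  have hnot : ∀ Z, Short (delG G D) Z → ∀ v u, v ∈ D → G.Adj v u → ¬ On Z u := by
    intro Z hZ v u hv hvu h
    have := hf.eq_adj (hZ.mono (delG_le (G := G) D)) hK h (hDK v hv) hvu.symm
    subst this
    obtain ⟨w, hw⟩ := on_iff.1 (hDK v hv)
    exact (hZ.1 _ _ hw).2.1 (by simpa using hv)
  have hE : EIn (delG G D) E0 := I1.e0
  refine ⟨hne, hn, I1.disj, ?_, ?_, I1.on, I1.circ, I1.le, ?_, ?_, ?_⟩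
  · intro v w hvw
    by_cases h : s(v, w) = s(u1, u3)
    · right
      have h1 : ∀ x, x ∈ s(v, w) → x = u1 ∨ x = u3 := by rw [h]; simp
      have h2 : ∀ x, x ∈ s(v, w) → x ∈ U \ D := fun x hx => by
        rcases h1 x hx with rfl | rfl <;> simp [*]
      have := h2 v (by simp)
      have := h2 w (by simp)
      simp only [mem_union]
      tauto
    · exact I1.edge v w (hadj hvw h)
  · exact fun v w h => ⟨(hE v w h).ne, .inl (hE v w h)⟩
  · exact M.inst.pl.path hE a1u.symm a12 a23 a3u (by simpa using d1) (by simpa using d2) (by simpa using d3)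
      (by simpa using du1) (by simpa using du3) h13 hne hn
  · intro Z1 Z2 h1 h2 h12 a b ha hb
    have t1 := hsm _ h1
    have t2 := hsm _ h2
    have key : ∀ Z a w, Short (delG G D) Z → On Z a → (addG (delG G D) u1 u3).Adj a w → (delG G D).Adj a w := by
      intro Z a w hZ ha h
      refine hadj h fun h' => ?_
      have : a = u1 ∨ a = u3 := by
        have : a ∈ s(u1, u3) := h' ▸ Sym2.mem_mk_left _ _
        simpa using this
      rcases this with rfl | rfl
      · exact hnot Z hZ v1 _ d1 a1u ha
      · exact hnot Z hZ v3 _ d3 a3u ha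
    obtain ⟨f1, f2, f3⟩ := I1.far Z1 Z2 t1 t2 h12 a b ha hb
    refine ⟨f1, fun h => f2 (key Z1 a b t1 ha h), fun w hw hw' => ?_⟩
    exact f3 w (key Z1 a w t1 ha hw) (key Z2 b w t2 hb hw'.symm).symm
  · intro h9
    have g := I1.good h9
    have toB : ∀ {v b}, b ∈ B → (addG (delG G D) u1 u3).Adj v b → (delG G D).Adj v b := by
      intro v b hb h
      refine hadj h fun h' => ?_
      have : b ∈ s(u1, u3) := h' ▸ Sym2.mem_mk_right _ _
      rcases (by simpa using this : b = u1 ∨ b = u3) with rfl | rfl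
      exacts [M.inst.b_not_u hb hu1, M.inst.b_not_u hb hu3]
    have hA : ∀ v, Att (addG (delG G D) u1 u3) B v → Att (delG G D) B v := fun v ⟨b, hb, h⟩ => ⟨b, hb, toB hb h⟩
    refine ⟨fun v hv a ha b hb c hc e1 e2 e3 e4 e5 e6 =>
      g.1 v hv a ha b hb c hc e1 e2 e3 (toB ha e4) (toB hb e5) (toB hc e6), ?_⟩
    intro x hx y hy z hz xy yz xz ax ay az
    have hT := (hsm _ (tri_short xy yz xz)).1
    exact g.2 x hx y hy z hz (hT _ _ (by simp [mem_tri])) (hT _ _ (by simp [mem_tri])) (hT _ _ (by simp [mem_tri]))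
      (hA _ ax) (hA _ ay) (hA _ az)

variable {v1 v2 v3 v4 v5 u1 u2 u3 u4 u5 : V}

/-- The data used when extending a coloring to a deleted short circuit. -/
structure KCol (G : SimpleGraph V) (D : Finset V) (c : V → Bool) (S B : Finset V) (u1 u3 : V) : Prop where
  d : Disjoint S B
  hD : ∀ v ∈ D, v ∉ S ∧ v ∉ B
  hT : ∀ v, c v = true → v ∉ S ∧ v ∉ B
  f : Fst G S B
  s : c u1 = false → c u3 = false → Sep G S B u1 u3
  m : ∀ v d, d ∈ D → G.Adj d v → v ∉ D → c v = false → v ∈ S ∪ B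
  nt : ¬ (c u1 = true ∧ c u3 = true)

lemma MCE.kcontra (M : MCE G U B E0 side p0) (hD : D ⊆ U) (hne : D.Nonempty) (hu1 : u1 ∈ U) (hu3 : u3 ∈ U)
    (du1 : u1 ∉ D) (du3 : u3 ∉ D) (h13 : u1 ≠ u3) (hn : ¬ G.Adj u1 u3)
    (I : Inst (addG (delG G D) u1 u3) (U \ D) B E0)
    (h : ∀ c S B1, KCol G D c S B1 u1 u3 → ExtD G D c S B1) : False := by
  apply M.hno
  intro c0
  obtain ⟨c, hB, hI, hF⟩ := M.hmin _ _ _ _ (card_sdiff_lt hD hne) I c0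
  have hw : ∀ w ∈ (U \ D).filter (fun v => c v = false) ∪ B.filter (fun v => c v = false), w ∉ D := by
    intro w hw
    simp only [mem_union, mem_filter, mem_sdiff] at hw
    have : w ∈ B → w ∉ D := fun hw h => M.inst.b_not_u hw (hD h)
    tauto
  have hF' : Fst (delG G D) ((U \ D).filter (fun v => c v = false)) (B.filter (fun v => c v = false)) :=
    hF.mono le_rfl fun u v _ _ huv => ⟨huv.ne, .inl huv⟩
  have K : KCol G D c ((U \ D).filter (fun v => c v = false)) (B.filter (fun v => c v = false)) u1 u3 := by
    refine ⟨M.inst.disj.mono ((filter_subset _ _).trans sdiff_subset) (filter_subset _ _),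
      fun v hv => ?_, fun v hv => by simp [hv], hF'.of_del hw, fun h1 h3 => ?_, ?_, ?_⟩
    · by_contra hcon
      exact hw v (by simp only [mem_union]; tauto) hv
    · refine Sep.of_del ⟨h13, fun h => hn h.1, .inl (by simp [*]), hF⟩ hw du1 du3
    · intro v d hd hdv hvD hc
      have := M.inst.adj_cases hdv
      simp only [mem_union, mem_filter, mem_sdiff]
      tauto
    · rintro ⟨h1, h3⟩
      have := hI u1 (by simp [*]) u3 ⟨h13, .inr (.inl ⟨rfl, rfl⟩)⟩ h1
      simp [h3] at this
  obtain ⟨I', S', h1, h2, h3, h4, h5⟩ := h c _ _ K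
  refine M.extend hD I' h1 hB (fun u hu v huv hc => hI u hu v ⟨huv.ne, .inl huv⟩ hc) h2 h3 h4 h5

set_option maxHeartbeats 1000000 in
lemma KCol.ext4 {c : V → Bool} {S B : Finset V} (hd4 : ∀ v, v ∈ D ↔ v = v1 ∨ v = v2 ∨ v = v3 ∨ v = v4)
    (hD : ∀ v ∈ D, v ∉ S ∧ v ∉ B) (hT : ∀ v, c v = true → v ∉ S ∧ v ∉ B) (hF : Fst G S B)
    (n1 : ∀ v, G.Adj v1 v ↔ v = v2 ∨ v = v4 ∨ v = u1) (n2 : ∀ v, G.Adj v2 v ↔ v = v1 ∨ v = v3 ∨ v = u2)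
    (n3 : ∀ v, G.Adj v3 v ↔ v = v2 ∨ v = v4 ∨ v = u3) (n4 : ∀ v, G.Adj v4 v ↔ v = v1 ∨ v = v3 ∨ v = u4)
    (h12 : v1 ≠ v2) (h13 : v1 ≠ v3) (h14 : v1 ≠ v4) (h23 : v2 ≠ v3) (h24 : v2 ≠ v4) (h34 : v3 ≠ v4)
    (hu1 : u1 ∉ D) (hu2 : u2 ∉ D) (hu3 : u3 ∉ D) (hu4 : u4 ∉ D) (c1 : c u1 = false) :
    ExtD G D c S B := by
  obtain ⟨f1, b1⟩ := hD v1 (by simp [hd4])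
  obtain ⟨f2, b2⟩ := hD v2 (by simp [hd4])
  obtain ⟨f3, b3⟩ := hD v3 (by simp [hd4])
  obtain ⟨f4, b4⟩ := hD v4 (by simp [hd4])
  have h21 := h12.symm
  have h31 := h13.symm
  have h41 := h14.symm
  have h32 := h23.symm
  have h42 := h24.symm
  have h43 := h34.symm
  obtain rfl : D = {v1, v2, v3, v4} := by ext v; simp [hd4]
  simp only [mem_insert, mem_singleton, not_or] at hu1 hu2 hu3 hu4
  obtain ⟨p1, p2, p3, p4⟩ := hu1
  obtain ⟨q1, q2, q3, q4⟩ := hu2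
  obtain ⟨r1, r2, r3, r4⟩ := hu3
  obtain ⟨s1, s2, s3, s4⟩ := hu4
  clear hD hd4
  by_cases c3 : c u3 = true
  swap
  · simp only [Bool.not_eq_true] at c3
    clear hT
    have g1 := hF.leaf3 (x := u2) n2 (by simp [*]) (by simp [*]) (by simp [*])
    have g2 := g1.leaf3 (x := u4) n4 (by simp [*]) (by simp [*]) (by simp [*])
    exact .mk2 (d := v1) (d' := v3) (by simp) (by simp) (by simp +contextual) g2 n1 (by simp [*]) (by simp [*]) (by simp [*])
      n3 (by simp [*]) (by simp [*]) (by simp [*]) (by simp)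
  obtain ⟨t3, t3'⟩ := hT u3 c3
  by_cases c2 : c u2 = true
  · obtain ⟨t2, t2'⟩ := hT u2 c2
    clear hT
    have g1 := hF.leaf3 (x := u4) n4 (by simp [*]) (by simp [*]) (by simp [*])
    have g2 := g1.leaf3 (x := v4) n3 (by simp [*]) (by simp [*]) (by simp [*])
    have g3 := g2.leaf3 (x := v3) n2 (by simp [*]) (by simp [*]) (by simp [*])
    exact .mk1 (d := v1) (by simp) (by simp +contextual) g3 n1 (by simp [*]) (by simp [*]) (by simp [*])
      (by simp)
  by_cases c4 : c u4 = true
  · obtain ⟨t4, t4'⟩ := hT u4 c4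
    clear hT
    have g1 := hF.leaf3 (x := u2) n2 (by simp [*]) (by simp [*]) (by simp [*])
    have g2 := g1.leaf3 (x := v2) n3 (by simp [*]) (by simp [*]) (by simp [*])
    have g3 := g2.leaf3 (x := v3) n4 (by simp [*]) (by simp [*]) (by simp [*])
    exact .mk1 (d := v1) (by simp) (by simp +contextual) g3 n1 (by simp [*]) (by simp [*]) (by simp [*])
      (by simp)
  simp only [Bool.not_eq_true] at c2 c4
  clear hT
  have g1 := hF.leaf3 (x := u1) n1 (by simp [*]) (by simp [*]) (by simp [*])
  have g2 := g1.leaf3 (x := u3) n3 (by simp [*]) (by simp [*]) (by simp [*])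
  exact .mk2 (d := v2) (d' := v4) (by simp) (by simp) (by simp +contextual) g2 n2 (by simp [*]) (by simp [*]) (by simp [*])
    n4 (by simp [*]) (by simp [*]) (by simp [*]) (by simp)

set_option maxHeartbeats 1000000 in
lemma KCol.ext5mixed {c : V → Bool} {S B : Finset V} (hd5 : ∀ v, v ∈ D ↔ v = v1 ∨ v = v2 ∨ v = v3 ∨ v = v4 ∨ v = v5)
    (hD : ∀ v ∈ D, v ∉ S ∧ v ∉ B) (hT : ∀ v, c v = true → v ∉ S ∧ v ∉ B) (hF : Fst G S B)
    (n1 : ∀ v, G.Adj v1 v ↔ v = v2 ∨ v = v5 ∨ v = u1) (n2 : ∀ v, G.Adj v2 v ↔ v = v1 ∨ v = v3 ∨ v = u2)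
    (n3 : ∀ v, G.Adj v3 v ↔ v = v2 ∨ v = v4 ∨ v = u3) (n4 : ∀ v, G.Adj v4 v ↔ v = v3 ∨ v = v5 ∨ v = u4)
    (n5 : ∀ v, G.Adj v5 v ↔ v = v1 ∨ v = v4 ∨ v = u5)
    (hnd : [v1, v2, v3, v4, v5].Nodup)
    (hu1 : u1 ∉ D) (hu2 : u2 ∉ D) (hu3 : u3 ∉ D) (hu4 : u4 ∉ D) (hu5 : u5 ∉ D) (c1 : c u1 = false) (c2 : c u2 = true) :
    ExtD G D c S B := by
  obtain ⟨f1, b1⟩ := hD v1 (by simp [hd5])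
  obtain ⟨f2, b2⟩ := hD v2 (by simp [hd5])
  obtain ⟨f3, b3⟩ := hD v3 (by simp [hd5])
  obtain ⟨f4, b4⟩ := hD v4 (by simp [hd5])
  obtain ⟨f5, b5⟩ := hD v5 (by simp [hd5])
  simp only [List.nodup_cons, List.mem_cons, List.not_mem_nil, or_false, not_or, not_false_eq_true, List.nodup_nil, and_true] at hnd
  obtain ⟨⟨h12, h13, h14, h15⟩, ⟨h23, h24, h25⟩, ⟨h34, h35⟩, h45⟩ := hnd
  have h21 := Ne.symm h12
  have h31 := Ne.symm h13
  have h41 := Ne.symm h14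
  have h51 := Ne.symm h15
  have h32 := Ne.symm h23
  have h42 := Ne.symm h24
  have h52 := Ne.symm h25
  have h43 := Ne.symm h34
  have h53 := Ne.symm h35
  have h54 := Ne.symm h45
  obtain rfl : D = {v1, v2, v3, v4, v5} := by ext v; simp [hd5]
  simp only [mem_insert, mem_singleton, not_or] at hu1 hu2 hu3 hu4 hu5
  obtain ⟨p1, p2, p3, p4, p5⟩ := hu1
  obtain ⟨q1, q2, q3, q4, q5⟩ := hu2
  obtain ⟨r1, r2, r3, r4, r5⟩ := hu3
  obtain ⟨s1, s2, s3, s4, s5⟩ := hu4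
  obtain ⟨x1, x2, x3, x4, x5⟩ := hu5
  clear hD hd5
  obtain ⟨t2, t2'⟩ := hT u2 c2
  by_cases c4 : c u4 = true
  swap
  · simp only [Bool.not_eq_true] at c4
    clear hT
    have g1 := hF.leaf3 (x := u5) n5 (by simp [*]) (by simp [*]) (by simp [*])
    have g2 := g1.leaf3 (x := u3) n3 (by simp [*]) (by simp [*]) (by simp [*])
    have g3 := g2.leaf3 (x := v3) n2 (by simp [*]) (by simp [*]) (by simp [*])
    exact .mk2 (d := v1) (d' := v4) (by simp) (by simp) (by simp +contextual) g3 n1 (by simp [*]) (by simp [*]) (by simp [*])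
      n4 (by simp [*]) (by simp [*]) (by simp [*]) (by simp)
  obtain ⟨t4, t4'⟩ := hT u4 c4
  by_cases c3 : c u3 = true
  swap
  · simp only [Bool.not_eq_true] at c3
    clear hT
    have g1 := hF.leaf3 (x := u5) n5 (by simp [*]) (by simp [*]) (by simp [*])
    have g2 := g1.leaf3 (x := v5) n4 (by simp [*]) (by simp [*]) (by simp [*])
    have g3 := g2.leaf3 (x := v5) n2 (by simp [*]) (by simp [*]) (by simp [*])
    exact .mk2 (d := v1) (d' := v3) (by simp) (by simp) (by simp +contextual) g3 n1 (by simp [*]) (by simp [*]) (by simp [*])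
      n3 (by simp [*]) (by simp [*]) (by simp [*]) (by simp)
  obtain ⟨t3, t3'⟩ := hT u3 c3
  clear hT
  have g1 := hF.leaf3 (x := u5) n5 (by simp [*]) (by simp [*]) (by simp [*])
  have g2 := g1.leaf3 (x := v5) n4 (by simp [*]) (by simp [*]) (by simp [*])
  have g3 := g2.leaf3 (x := v4) n3 (by simp [*]) (by simp [*]) (by simp [*])
  have g4 := g3.leaf3 (x := v3) n2 (by simp [*]) (by simp [*]) (by simp [*])
  exact .mk1 (d := v1) (by simp) (by simp +contextual) g4 n1 (by simp [*]) (by simp [*]) (by simp [*])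
    (by simp)

set_option maxHeartbeats 1000000 in
lemma KCol.ext5sep {c : V → Bool} {S B : Finset V} (hd5 : ∀ v, v ∈ D ↔ v = v1 ∨ v = v2 ∨ v = v3 ∨ v = v4 ∨ v = v5)
    (hD : ∀ v ∈ D, v ∉ S ∧ v ∉ B) (hdj : Disjoint S B)
    (n1 : ∀ v, G.Adj v1 v ↔ v = v2 ∨ v = v5 ∨ v = u1) (n2 : ∀ v, G.Adj v2 v ↔ v = v1 ∨ v = v3 ∨ v = u2)
    (n3 : ∀ v, G.Adj v3 v ↔ v = v2 ∨ v = v4 ∨ v = u3) (n4 : ∀ v, G.Adj v4 v ↔ v = v3 ∨ v = v5 ∨ v = u4)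
    (n5 : ∀ v, G.Adj v5 v ↔ v = v1 ∨ v = v4 ∨ v = u5)
    (hnd : [v1, v2, v3, v4, v5].Nodup)
    (hu1 : u1 ∉ D) (hu2 : u2 ∉ D) (hu3 : u3 ∉ D) (hu4 : u4 ∉ D) (hu5 : u5 ∉ D)
    (c3 : c u3 = false) (c5 : c u5 = false) (hS : Sep G S B u1 u2) :
    ExtD G D c S B := by
  obtain ⟨f1, b1⟩ := hD v1 (by simp [hd5])
  obtain ⟨f2, b2⟩ := hD v2 (by simp [hd5])
  obtain ⟨f3, b3⟩ := hD v3 (by simp [hd5])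
  obtain ⟨f4, b4⟩ := hD v4 (by simp [hd5])
  obtain ⟨f5, b5⟩ := hD v5 (by simp [hd5])
  simp only [List.nodup_cons, List.mem_cons, List.not_mem_nil, or_false, not_or, not_false_eq_true, List.nodup_nil, and_true] at hnd
  obtain ⟨⟨h12, h13, h14, h15⟩, ⟨h23, h24, h25⟩, ⟨h34, h35⟩, h45⟩ := hnd
  have h21 := Ne.symm h12
  have h31 := Ne.symm h13
  have h41 := Ne.symm h14
  have h51 := Ne.symm h15
  have h32 := Ne.symm h23
  have h42 := Ne.symm h24
  have h52 := Ne.symm h25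
  have h43 := Ne.symm h34
  have h53 := Ne.symm h35
  have h54 := Ne.symm h45
  obtain rfl : D = {v1, v2, v3, v4, v5} := by ext v; simp [hd5]
  simp only [mem_insert, mem_singleton, not_or] at hu1 hu2 hu3 hu4 hu5
  obtain ⟨p1, p2, p3, p4, p5⟩ := hu1
  obtain ⟨q1, q2, q3, q4, q5⟩ := hu2
  obtain ⟨r1, r2, r3, r4, r5⟩ := hu3
  obtain ⟨s1, s2, s3, s4, s5⟩ := hu4
  obtain ⟨x1, x2, x3, x4, x5⟩ := hu5
  clear hD hd5
  have sub3 : ∀ a b d, S ⊆ insert a (insert b (insert d S)) := fun a b d x hx => by simp [hx]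
  have h012 := hS.1
  have q1' := Ne.symm q1
  obtain ⟨g1, g1'⟩ := hS.extend3 hdj f1 b1 p1 q1' n1 (by simp [*]) (by simp [*]) (by simp [*]) (by simp [*]; exact Ne.symm h012)
  have g2 := g1.subdiv3 g1' (v := v2) (by simp [*]) (by simp [*]) n2 (by simp [*]) (by simp [*]) (by simp [*])
  have g3 := g2.leaf3 (x := u4) n4 (by simp [*]) (by simp [*]) (by simp [*])
  exact .mk2 (d := v3) (d' := v5) (by simp) (by simp) (by simp +contextual) g3 n3 (by simp [*]) (by simp [*]) (by simp [*])
    n5 (by simp [*]) (by simp [*]) (by simp [*]) (by simp)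

lemma on_quad {w x y z v : V} : On (quad w x y z) v ↔ v = w ∨ v = x ∨ v = y ∨ v = z := by
  constructor
  · rintro ⟨e, he, hv⟩
    rcases mem_quad.1 he with rfl | rfl | rfl | rfl <;> simp at hv <;> tauto
  · have := quad_on (w := w) (x := x) (y := y) (z := z)
    rintro (rfl | rfl | rfl | rfl) <;> tauto

lemma on_pent {u w x y z v : V} : On (pent u w x y z) v ↔ v = u ∨ v = w ∨ v = x ∨ v = y ∨ v = z := by
  constructor
  · rintro ⟨e, he, hv⟩
    rcases mem_pent.1 he with rfl | rfl | rfl | rfl | rfl <;> simp at hv <;> tauto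
  · rintro (rfl | rfl | rfl | rfl | rfl)
    exacts [⟨s(v, w), by simp [mem_pent]⟩, ⟨s(u, v), by simp [mem_pent]⟩, ⟨s(w, v), by simp [mem_pent]⟩,
      ⟨s(x, v), by simp [mem_pent]⟩, ⟨s(y, v), by simp [mem_pent]⟩]

lemma MCE.quad_red (M : MCE G U B E0 side p0) (hd4 : ∀ v, v ∈ D ↔ v = v1 ∨ v = v2 ∨ v = v3 ∨ v = v4) (hDU : D ⊆ U)
    (n1 : ∀ v, G.Adj v1 v ↔ v = v2 ∨ v = v4 ∨ v = u1) (n2 : ∀ v, G.Adj v2 v ↔ v = v1 ∨ v = v3 ∨ v = u2)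
    (n3 : ∀ v, G.Adj v3 v ↔ v = v2 ∨ v = v4 ∨ v = u3) (n4 : ∀ v, G.Adj v4 v ↔ v = v1 ∨ v = v3 ∨ v = u4)
    (h13 : v1 ≠ v3) (h24 : v2 ≠ v4) (du1 : u1 ∉ D) (du2 : u2 ∉ D) (du3 : u3 ∉ D) (du4 : u4 ∉ D)
    (hu1 : u1 ∈ U) (hu3 : u3 ∈ U) : False := by
  have a12 : G.Adj v1 v2 := (n1 _).2 (by simp)
  have a23 : G.Adj v2 v3 := (n2 _).2 (by simp)
  have a34 : G.Adj v3 v4 := (n3 _).2 (by simp)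
  have a41 : G.Adj v4 v1 := (n4 _).2 (by simp)
  have hK := quad_short a12 a23 a34 a41 h13 h24
  have hon : ∀ v, v ∈ D ↔ On (quad v1 v2 v3 v4) v := fun v => by rw [hd4, on_quad]
  have nsp : ∀ S, EIn (delG G D) S → S.card ≤ 4 → bd S ≠ pt u1 + pt u3 := by
    intro S hS h4 hb
    refine M.no_short_path hK (fun u v h => (hS u v h).1) h4 (hDU ((hd4 v1).2 (by simp))) n1 n2 n3 (by simp [mem_quad]) (by simp [mem_quad])
      (by simp [mem_quad]) (by rwa [← hon]) (by rwa [← hon]) (by rwa [← hon]) a34.ne' h24 h13 ?_ hb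
    intro v hv hv'
    obtain ⟨w, hw⟩ := on_iff.1 hv
    exact (hS _ _ hw).2.1 (by simpa using (hon v).2 hv')
  obtain ⟨f1, f2, f3⟩ := M.instK hK hDU (fun v hv => (hon v).1 hv) ((hd4 v1).2 (by simp)) ((hd4 v2).2 (by simp))
    ((hd4 v3).2 (by simp)) h13 a12 a23 ((n1 u1).2 (by simp)) ((n3 u3).2 (by simp)) hu1 hu3 du1 du3 nsp
  refine M.kcontra hDU ⟨v1, (hd4 v1).2 (by simp)⟩ hu1 hu3 du1 du3 f1 f2 f3 fun c S B1 K => ?_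
  by_cases c1 : c u1 = true
  · have c3 : c u3 = false := by simpa using fun h => K.nt ⟨c1, h⟩
    exact KCol.ext4 (v1 := v3) (v2 := v2) (v3 := v1) (v4 := v4) (fun v => by rw [hd4]; tauto) K.hD K.hT K.f n3
      (fun v => by rw [n2]; tauto) n1 (fun v => by rw [n4]; tauto) a23.ne' h13.symm a34.ne a12.ne' h24 a41.ne'
      du3 du2 du1 du4 c3
  · exact KCol.ext4 hd4 K.hD K.hT K.f n1 n2 n3 n4 a12.ne h13 a41.ne' a23.ne h24 a34.ne du1 du2 du3 du4 (by simpa using c1)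

lemma bool_cycle5 : ∀ a b c d e : Bool, ¬ (a = true ∧ c = true) →
    (a = false ∧ b = true) ∨ (b = false ∧ c = true) ∨ (c = false ∧ d = true) ∨ (d = false ∧ e = true) ∨ (e = false ∧ a = true) ∨
      (a = false ∧ b = false ∧ c = false ∧ d = false ∧ e = false) := by
  decide

set_option maxHeartbeats 1000000 in
lemma MCE.pent_red (M : MCE G U B E0 side p0) (hd5 : ∀ v, v ∈ D ↔ v = v1 ∨ v = v2 ∨ v = v3 ∨ v = v4 ∨ v = v5) (hDU : D ⊆ U)
    (n1 : ∀ v, G.Adj v1 v ↔ v = v2 ∨ v = v5 ∨ v = u1) (n2 : ∀ v, G.Adj v2 v ↔ v = v1 ∨ v = v3 ∨ v = u2)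
    (n3 : ∀ v, G.Adj v3 v ↔ v = v2 ∨ v = v4 ∨ v = u3) (n4 : ∀ v, G.Adj v4 v ↔ v = v3 ∨ v = v5 ∨ v = u4)
    (n5 : ∀ v, G.Adj v5 v ↔ v = v1 ∨ v = v4 ∨ v = u5)
    (h13 : v1 ≠ v3) (h14 : v1 ≠ v4) (h24 : v2 ≠ v4) (h25 : v2 ≠ v5) (h35 : v3 ≠ v5)
    (du1 : u1 ∉ D) (du2 : u2 ∉ D) (du3 : u3 ∉ D) (du4 : u4 ∉ D) (du5 : u5 ∉ D)
    (hu1 : u1 ∈ U) (hu3 : u3 ∈ U) : False := by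
  have a12 : G.Adj v1 v2 := (n1 _).2 (by simp)
  have a23 : G.Adj v2 v3 := (n2 _).2 (by simp)
  have a34 : G.Adj v3 v4 := (n3 _).2 (by simp)
  have a45 : G.Adj v4 v5 := (n4 _).2 (by simp)
  have a51 : G.Adj v5 v1 := (n5 _).2 (by simp)
  have hK := pent_short a12 a23 a34 a45 a51 h24 h35 h13 h14 h25
  have hon : ∀ v, v ∈ D ↔ On (pent v1 v2 v3 v4 v5) v := fun v => by rw [hd5, on_pent]
  have nsp : ∀ S, EIn (delG G D) S → S.card ≤ 4 → bd S ≠ pt u1 + pt u3 := by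
    intro S hS h4 hb
    refine M.no_short_path hK (fun u v h => (hS u v h).1) h4 (hDU ((hd5 v1).2 (by simp))) n1 n2 n3 (by simp [mem_pent]) (by simp [mem_pent])
      (by simp [mem_pent]) (by rwa [← hon]) (by rwa [← hon]) (by rwa [← hon]) h35.symm h25 h13 ?_ hb
    intro v hv hv'
    obtain ⟨w, hw⟩ := on_iff.1 hv
    exact (hS _ _ hw).2.1 (by simpa using (hon v).2 hv')
  have a1u := (n1 u1).2 (by simp)
  have a2u := (n2 u2).2 (by simp)
  have a3u := (n3 u3).2 (by simp)
  have d1 := (hd5 v1).2 (by simp)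
  have d2 := (hd5 v2).2 (by simp)
  have d3 := (hd5 v3).2 (by simp)
  obtain ⟨f1, f2, f3⟩ := M.instK hK hDU (fun v hv => (hon v).1 hv) d1 d2 d3 h13 a12 a23 a1u a3u hu1 hu3 du1 du3 nsp
  have hu12 : u1 ≠ u2 := by
    rintro rfl
    have := M.inst.far.eq (tri_short a1u.symm a12 a2u.symm) hK (a := v1) (by simp [on_tri]) (by simp [on_pent])
    exact du1 ((hon _).2 (this ▸ by simp [on_tri]))
  have hu32 : u3 ≠ u2 := by
    rintro rfl
    have := M.inst.far.eq (tri_short a3u.symm a23.symm a2u.symm) hK (a := v3) (by simp [on_tri]) (by simp [on_pent])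
    exact du3 ((hon _).2 (this ▸ by simp [on_tri]))
  refine M.kcontra hDU ⟨v1, d1⟩ hu1 hu3 du1 du3 f1 f2 f3 fun c S B1 K => ?_
  have h12 := a12.ne
  have h23 := a23.ne
  have h34 := a34.ne
  have h45 := a45.ne
  have h51 := a51.ne
  have N : [v1, v2, v3, v4, v5].Nodup := by
    simp only [List.nodup_cons, List.mem_cons, List.not_mem_nil, or_false, not_or, not_false_eq_true, List.nodup_nil, and_true]
    exact ⟨⟨h12, h13, h14, h51.symm⟩, ⟨h23, h24, h25⟩, ⟨h34, h35⟩, h45⟩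
  have N2 : [v2, v3, v4, v5, v1].Nodup := (List.nodup_rotate (n := 1)).2 N
  have N3 : [v3, v4, v5, v1, v2].Nodup := (List.nodup_rotate (n := 2)).2 N
  have N4 : [v4, v5, v1, v2, v3].Nodup := (List.nodup_rotate (n := 3)).2 N
  have N5 : [v5, v1, v2, v3, v4].Nodup := (List.nodup_rotate (n := 4)).2 N
  have sw : ∀ {x a b e : V}, (∀ v, G.Adj x v ↔ v = a ∨ v = b ∨ v = e) → ∀ v, G.Adj x v ↔ v = b ∨ v = a ∨ v = e :=
    fun h v => (h v).trans or_left_comm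
  have key : (c u1 = false ∧ c u2 = true) ∨ (c u2 = false ∧ c u3 = true) ∨ (c u3 = false ∧ c u4 = true) ∨
      (c u4 = false ∧ c u5 = true) ∨ (c u5 = false ∧ c u1 = true) ∨
      (c u1 = false ∧ c u2 = false ∧ c u3 = false ∧ c u4 = false ∧ c u5 = false) := by
    exact bool_cycle5 _ _ _ _ _ K.nt
  rcases key with ⟨e1, e2⟩ | ⟨e1, e2⟩ | ⟨e1, e2⟩ | ⟨e1, e2⟩ | ⟨e1, e2⟩ | ⟨e1, e2, e3, e4, e5⟩
  · exact KCol.ext5mixed hd5 K.hD K.hT K.f n1 n2 n3 n4 n5 N du1 du2 du3 du4 du5 e1 e2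
  · exact KCol.ext5mixed (fun v => by rw [hd5]; clear * -; tauto) K.hD K.hT K.f (sw n2) n3 n4 (sw n5) n1 N2 du2 du3 du4 du5 du1 e1 e2
  · exact KCol.ext5mixed (fun v => by rw [hd5]; clear * -; tauto) K.hD K.hT K.f (sw n3) n4 (sw n5) (sw n1) (sw n2) N3 du3 du4 du5 du1 du2 e1 e2
  · exact KCol.ext5mixed (fun v => by rw [hd5]; clear * -; tauto) K.hD K.hT K.f (sw n4) (sw n5) (sw n1) n2 (sw n3) N4 du4 du5 du1 du2 du3 e1 e2
  · exact KCol.ext5mixed (fun v => by rw [hd5]; clear * -; tauto) K.hD K.hT K.f n5 (sw n1) n2 n3 (sw n4) N5 du5 du1 du2 du3 du4 e1 e2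
  · have m1 := K.m u1 v1 d1 a1u du1 e1
    have m2 := K.m u2 v2 d2 a2u du2 e2
    have m3 := K.m u3 v3 d3 a3u du3 e3
    rcases (K.s e1 e3).join K.d m1 m3 m2 with h | h
    · exact KCol.ext5sep hd5 K.hD K.d n1 n2 n3 n4 n5 N du1 du2 du3 du4 du5 e3 e5 h
    · exact KCol.ext5sep (v1 := v3) (v2 := v2) (v3 := v1) (v4 := v5) (v5 := v4) (fun v => by rw [hd5]; clear * -; tauto) K.hD K.d
        n3 (sw n2) n1 n5 n4
        (by simp only [List.nodup_cons, List.mem_cons, List.not_mem_nil, or_false, not_or, not_false_eq_true, List.nodup_nil, and_true]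
            exact ⟨⟨h23.symm, h13.symm, h35, h34⟩, ⟨h12.symm, h25, h24⟩, ⟨h51.symm, h14⟩, h45.symm⟩)
        du3 du2 du1 du5 du4 e1 e4 h

/-- Short sets in a far graph are cycles of length three, four or five. -/
lemma Short.shape {Z : Finset (Sym2 V)} (hZ : Short G Z) (hf : Far G) :
    (∃ x y z, G.Adj x y ∧ G.Adj y z ∧ G.Adj x z ∧ Z = tri x y z) ∨
    (∃ w x y z, G.Adj w x ∧ G.Adj x y ∧ G.Adj y z ∧ G.Adj z w ∧ w ≠ y ∧ x ≠ z ∧ Z = quad w x y z) ∨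
    (∃ v w x y z, G.Adj v w ∧ G.Adj w x ∧ G.Adj x y ∧ G.Adj y z ∧ G.Adj z v ∧ w ≠ y ∧ x ≠ z ∧ v ≠ x ∧ v ≠ y ∧ w ≠ z ∧
      Z = pent v w x y z) := by
  have hC := hZ.isCirc
  obtain ⟨e, he⟩ := hZ.2.2.1
  induction e with | _ a b =>
  obtain ⟨p, hp, hpe⟩ := hC.exists_path hZ.1 he
  have hab := hZ.1 _ _ he
  have hlen : p.length + 1 = Z.card := by
    rw [← card_erase_add_one he, ← hpe, List.toFinset_card_of_nodup hp.isTrail.edges_nodup, Walk.length_edges]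
  have h3 := card_le_of_even (fun v hv => (hZ.1 v v hv).ne rfl) hZ.2.2.1 hZ.2.1
  have h5 := hZ.2.2.2
  have hZe : Z = insert s(a, b) p.edges.toFinset := by rw [hpe, insert_erase he]
  rw [hZe]
  rw [← hlen] at h3 h5
  clear hlen hpe hZe
  rcases p with _ | ⟨g1, p⟩
  · simp at h3
  rcases p with _ | ⟨g2, p⟩
  · simp at h3
  rcases p with _ | ⟨g3, p⟩
  · left
    refine ⟨_, _, _, g1, g2, hab, ?_⟩
    ext e; simp [mem_tri]; tauto
  rcases p with _ | ⟨g4, p⟩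
  · right; left
    simp at hp
    refine ⟨_, _, _, _, g1, g2, g3, hab.symm, by tauto, by tauto, ?_⟩
    ext e; simp [mem_quad, Sym2.eq_swap (a := b)]; tauto
  rcases p with _ | ⟨g5, p⟩
  · right; right
    simp at hp
    refine ⟨_, _, _, _, _, g1, g2, g3, g4, hab.symm, by tauto, by tauto, by tauto, by tauto, by tauto, ?_⟩
    ext e; simp [mem_pent, Sym2.eq_swap (a := b)]; tauto
  · simp only [Walk.length_cons] at h5
    omega

/-- The charge of a vertex. -/
noncomputable def ch (G : SimpleGraph V) (B : Finset V) (v : V) : ℕ := 2 * ((nb G v).card - 3) + (nb G v ∩ B).card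

/-- The closed neighbourhood of `K` in `U`. -/
noncomputable def ball (G : SimpleGraph V) (U : Finset V) (K : Finset (Sym2 V)) : Finset V :=
  U.filter (fun v => On K v ∨ ∃ w, On K w ∧ G.Adj w v)

lemma mem_ball {K : Finset (Sym2 V)} {v : V} : v ∈ ball G U K ↔ v ∈ U ∧ (On K v ∨ ∃ w, On K w ∧ G.Adj w v) := by
  simp [ball]

lemma MCE.deg3_of_ch (M : MCE G U B E0 side p0) {v : V} (hv : v ∈ U) (h : ch G B v ≤ 1) : (nb G v).card = 3 := by
  have := M.deg hv
  unfold ch at h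
  omega

lemma ch_pos {v b : V} (hb : b ∈ B) (h : G.Adj v b) : 1 ≤ ch G B v := by
  have : 0 < (nb G v ∩ B).card := card_pos.2 ⟨b, by simp [mem_nb, h, hb]⟩
  unfold ch
  omega

lemma ch_two {v b b' : V} (hb : b ∈ B) (h : G.Adj v b) (hb' : b' ∈ B) (h' : G.Adj v b') (hne : b ≠ b') : 2 ≤ ch G B v := by
  have : 1 < (nb G v ∩ B).card := one_lt_card.2 ⟨b, by simp [mem_nb, h, hb], b', by simp [mem_nb, h', hb'], hne⟩
  unfold ch
  omega

lemma nb_eq_of_three {v a b : V} (h : (nb G v).card = 3) (ha : G.Adj v a) (hb : G.Adj v b) (hab : a ≠ b) :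
    ∃ c, c ≠ a ∧ c ≠ b ∧ ∀ w, G.Adj v w ↔ w = a ∨ w = b ∨ w = c := by
  have h1 : ((nb G v).erase a).erase b = (nb G v) \ {a, b} := by ext; simp; tauto
  have hc : (((nb G v).erase a).erase b).card = 1 := by
    rw [card_erase_of_mem (by simp [mem_nb, hb, hab.symm]), card_erase_of_mem (by simp [mem_nb, ha]), h]
  obtain ⟨c, hc⟩ := card_eq_one.1 hc
  have key : ∀ w, (w ≠ b ∧ w ≠ a ∧ G.Adj v w) ↔ w = c := fun w => by
    have := congrArg (w ∈ ·) hc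
    simpa [mem_nb] using this
  refine ⟨c, ((key c).2 rfl).2.1, ((key c).2 rfl).1, fun w => ?_⟩
  constructor
  · intro hw
    by_cases h1 : w = a; · exact .inl h1
    by_cases h2 : w = b; · exact .inr (.inl h2)
    exact .inr (.inr ((key w).1 ⟨h2, h1, hw⟩))
  · rintro (rfl | rfl | h2)
    exacts [ha, hb, ((key w).2 h2).2.2]

lemma pair_le_sum {f : V → ℕ} {W : Finset V} {a b : V} (ha : a ∈ W) (hb : b ∈ W) (hab : a ≠ b) : f a + f b ≤ ∑ v ∈ W, f v := by
  rw [← sum_pair hab]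
  exact sum_le_sum_of_subset (by simp [insert_subset_iff, *])

lemma triple_le_sum {f : V → ℕ} {W : Finset V} {a b c : V} (ha : a ∈ W) (hb : b ∈ W) (hc : c ∈ W) (hab : a ≠ b) (hac : a ≠ c)
    (hbc : b ≠ c) : f a + f b + f c ≤ ∑ v ∈ W, f v := by
  have : ∑ v ∈ ({a, b, c} : Finset V), f v = f a + f b + f c := by
    rw [sum_insert (by simp [*]), sum_pair hbc, add_assoc]
  rw [← this]
  exact sum_le_sum_of_subset (by simp [insert_subset_iff, *])

lemma single_le_sum' {f : V → ℕ} {W : Finset V} {a : V} (ha : a ∈ W) : f a ≤ ∑ v ∈ W, f v :=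
  Finset.single_le_sum (fun _ _ => Nat.zero_le _) ha

lemma quad_card {w x y z : V} (hf : Far G) (hK : Short G (quad w x y z)) (awx : G.Adj w x) (axy : G.Adj x y) (ayz : G.Adj y z)
    (azw : G.Adj z w) (hwy : w ≠ y) (hxz : x ≠ z) : 4 ≤ (quad w x y z).card := by
  have hs : insert w (insert x (insert y ({z} : Finset V))) ⊆ univ.filter (On (quad w x y z)) := by
    intro v hv
    simp only [mem_insert, mem_singleton] at hv
    simpa [on_quad] using hv
  have hc := card_le_card hs
  rw [(hK.isCirc).card_on hK.1] at hc
  have h1 := awx.ne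
  have h2 := axy.ne
  have h3 := ayz.ne
  have h4 := azw.ne'
  rwa [card_insert_of_notMem (by simp [*]), card_insert_of_notMem (by simp [*]), card_pair h3] at hc

lemma pent_card {v w x y z : V} (hf : Far G) (hK : Short G (pent v w x y z)) (avw : G.Adj v w) (awx : G.Adj w x)
    (axy : G.Adj x y) (ayz : G.Adj y z) (azv : G.Adj z v)
    (hwy : w ≠ y) (hxz : x ≠ z) (hvx : v ≠ x) (hvy : v ≠ y) (hwz : w ≠ z) : 5 ≤ (pent v w x y z).card := by
  have hs : insert v (insert w (insert x (insert y ({z} : Finset V)))) ⊆ univ.filter (On (pent v w x y z)) := by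
    intro v hv
    simp only [mem_insert, mem_singleton] at hv
    simpa [on_pent] using hv
  have hc := card_le_card hs
  rw [(hK.isCirc).card_on hK.1] at hc
  have h1 := awx.ne
  have h2 := axy.ne
  have h3 := ayz.ne
  have h4 := azv.ne'
  have h5 := avw.ne
  rwa [card_insert_of_notMem (by simp [*]), card_insert_of_notMem (by simp [*]),
    card_insert_of_notMem (by simp [*]), card_pair h3] at hc

set_option maxHeartbeats 1000000 in
lemma MCE.quad_ch (M : MCE G U B E0 side p0) {w x y z : V} (hw : w ∈ U) (hx : x ∈ U) (hy : y ∈ U) (hz : z ∈ U)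
    (awx : G.Adj w x) (axy : G.Adj x y) (ayz : G.Adj y z) (azw : G.Adj z w) (hwy : w ≠ y) (hxz : x ≠ z) :
    2 ≤ ∑ v ∈ ball G U (quad w x y z), ch G B v := by
  by_contra hlt
  push Not at hlt
  have hf := M.inst.far
  have hK := quad_short awx axy ayz azw hwy hxz
  have bw : w ∈ ball G U (quad w x y z) := mem_ball.2 ⟨hw, by simp [on_quad]⟩
  have bx : x ∈ ball G U (quad w x y z) := mem_ball.2 ⟨hx, by simp [on_quad]⟩
  have bY : y ∈ ball G U (quad w x y z) := mem_ball.2 ⟨hy, by simp [on_quad]⟩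
  have bz : z ∈ ball G U (quad w x y z) := mem_ball.2 ⟨hz, by simp [on_quad]⟩
  have d3 : ∀ v ∈ ball G U (quad w x y z), (nb G v).card = 3 := fun v hv =>
    M.deg3_of_ch (mem_ball.1 hv).1 ((single_le_sum' hv).trans (by omega))
  have nch : ∀ {a b c d : V}, quad a b c d = quad w x y z → G.Adj a b → G.Adj b c → ¬ G.Adj a c := by
    intro a b c d he h1 h2 h3
    have hon : On (quad w x y z) a := by rw [← he]; simp [on_quad]
    have ht := hf.eq (tri_short h1 h2 h3) hK (a := a) (by simp [on_tri]) hon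
    have c1 := tri_card h1 h2 h3
    have := quad_card hf hK awx axy ayz azw hwy hxz
    rw [← ht, c1] at this
    omega
  have r1 : quad x y z w = quad w x y z := by ext e; simp only [mem_quad]; tauto
  have n13 := nch rfl awx axy
  have n24 := nch r1 axy ayz
  obtain ⟨u1, o1, o1', n1⟩ := nb_eq_of_three (d3 w bw) awx azw.symm hxz
  obtain ⟨u2, o2, o2', n2⟩ := nb_eq_of_three (d3 x bx) awx.symm axy hwy
  obtain ⟨u3, o3, o3', n3⟩ := nb_eq_of_three (d3 y bY) axy.symm ayz hxz
  obtain ⟨u4, o4, o4', n4⟩ := nb_eq_of_three (d3 z bz) azw ayz.symm hwy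
  have g1 := (n1 u1).2 (by simp)
  have g2 := (n2 u2).2 (by simp)
  have g3 := (n3 u3).2 (by simp)
  have g4 := (n4 u4).2 (by simp)
  have du1 : u1 ∉ ({w, x, y, z} : Finset V) := by
    simp [o1, o1', g1.ne']; rintro rfl; exact n13 g1
  have du2 : u2 ∉ ({w, x, y, z} : Finset V) := by
    simp [o2, o2', g2.ne']; rintro rfl; exact n24 g2
  have du3 : u3 ∉ ({w, x, y, z} : Finset V) := by
    simp [o3, o3', g3.ne']; rintro rfl; exact n13 g3.symm
  have du4 : u4 ∉ ({w, x, y, z} : Finset V) := by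
    simp [o4, o4', g4.ne']; rintro rfl; exact n24 g4.symm
  have hDU : ({w, x, y, z} : Finset V) ⊆ U := by simp [insert_subset_iff, *]
  have two : ∀ {a b c d : V}, a ∈ ball G U (quad w x y z) → b ∈ ball G U (quad w x y z) → a ≠ b → G.Adj a c → G.Adj b d → c ∉ U → d ∉ U → False := by
    intro a b c d ha hb hab hc hd hcU hdU
    have h1 := ch_pos ((M.inst.adj_cases hc).resolve_left hcU) hc
    have h2 := ch_pos ((M.inst.adj_cases hd).resolve_left hdU) hd
    have := pair_le_sum (f := ch G B) ha hb hab
    omega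
  have c1 : u1 ∈ U ∧ u3 ∈ U → False := fun h => M.quad_red (D := {w, x, y, z}) (by simp) hDU n1 n2 n3 n4 hwy hxz du1 du2 du3 du4 h.1 h.2
  have c2 : u2 ∈ U ∧ u4 ∈ U → False := fun h => M.quad_red (D := {w, x, y, z}) (v1 := x) (v2 := y) (v3 := z) (v4 := w)
    (by simp; tauto) hDU (fun v => (n2 v).trans or_left_comm) n3 (fun v => (n4 v).trans or_left_comm)
    (fun v => (n1 v).trans (by tauto)) hxz hwy.symm du2 du3 du4 du1 h.1 h.2
  have t12 := two bw bx awx.ne g1 g2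
  have t14 := two bw bz azw.ne' g1 g4
  have t32 := two bY bx axy.ne' g3 g2
  have t34 := two bY bz ayz.ne g3 g4
  clear * - c1 c2 t12 t14 t32 t34
  tauto

set_option maxHeartbeats 1000000 in
lemma MCE.pent_ch (M : MCE G U B E0 side p0) {v w x y z : V} (hv : v ∈ U) (hw : w ∈ U) (hx : x ∈ U) (hy : y ∈ U) (hz : z ∈ U)
    (avw : G.Adj v w) (awx : G.Adj w x) (axy : G.Adj x y) (ayz : G.Adj y z) (azv : G.Adj z v)
    (hwy : w ≠ y) (hxz : x ≠ z) (hvx : v ≠ x) (hvy : v ≠ y) (hwz : w ≠ z) :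
    1 ≤ ∑ v ∈ ball G U (pent v w x y z), ch G B v := by
  by_contra hlt
  push Not at hlt
  have hf := M.inst.far
  have hK := pent_short avw awx axy ayz azv hwy hxz hvx hvy hwz
  have bb : ∀ a, On (pent v w x y z) a → a ∈ U → a ∈ ball G U (pent v w x y z) := fun a h1 h2 => mem_ball.2 ⟨h2, .inl h1⟩
  have bv := bb v (by simp [on_pent]) hv
  have bw := bb w (by simp [on_pent]) hw
  have bx := bb x (by simp [on_pent]) hx
  have bY := bb y (by simp [on_pent]) hy
  have bz := bb z (by simp [on_pent]) hz
  have d3 : ∀ a ∈ ball G U (pent v w x y z), (nb G a).card = 3 := fun a ha =>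
    M.deg3_of_ch (mem_ball.1 ha).1 ((single_le_sum' ha).trans (by omega))
  have iU : ∀ {a c}, a ∈ ball G U (pent v w x y z) → G.Adj a c → c ∈ U := by
    intro a c ha hc
    refine (M.inst.adj_cases hc).resolve_right fun h => ?_
    have h1 := ch_pos h hc
    have := single_le_sum' (f := ch G B) ha
    omega
  have h5 := pent_card hf hK avw awx axy ayz azv hwy hxz hvx hvy hwz
  have nch : ∀ {a b c : V}, On (pent v w x y z) a → G.Adj a b → G.Adj b c → ¬ G.Adj a c := by
    intro a b c hon h1 h2 h3
    have ht := hf.eq (tri_short h1 h2 h3) hK (a := a) (by simp [on_tri]) hon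
    have c1 := tri_card h1 h2 h3
    rw [← ht, c1] at h5
    omega
  have m1 := nch (by simp [on_pent]) avw awx
  have m2 := nch (by simp [on_pent]) awx axy
  have m3 := nch (by simp [on_pent]) axy ayz
  have m4 := nch (by simp [on_pent]) ayz azv
  have m5 := nch (by simp [on_pent]) azv avw
  obtain ⟨u1, o1, o1', n1⟩ := nb_eq_of_three (d3 v bv) avw azv.symm hwz
  obtain ⟨u2, o2, o2', n2⟩ := nb_eq_of_three (d3 w bw) avw.symm awx hvx
  obtain ⟨u3, o3, o3', n3⟩ := nb_eq_of_three (d3 x bx) awx.symm axy hwy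
  obtain ⟨u4, o4, o4', n4⟩ := nb_eq_of_three (d3 y bY) axy.symm ayz hxz
  obtain ⟨u5, o5, o5', n5⟩ := nb_eq_of_three (d3 z bz) azv ayz.symm hvy
  have g1 := (n1 u1).2 (by simp)
  have g2 := (n2 u2).2 (by simp)
  have g3 := (n3 u3).2 (by simp)
  have g4 := (n4 u4).2 (by simp)
  have g5 := (n5 u5).2 (by simp)
  have nsw : ∀ {a b : V}, ¬ G.Adj a b → ¬ G.Adj b a := fun h h' => h h'.symm
  have du : ∀ {u a b c d e : V}, G.Adj a u → u ≠ b → u ≠ c → ¬ G.Adj a d → ¬ G.Adj a e → u ∉ ({a, b, c, d, e} : Finset V) := by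
    intro u a b c d e h1 h2 h3 h4 h5
    simp only [mem_insert, mem_singleton, not_or]
    exact ⟨h1.ne', h2, h3, by rintro rfl; exact h4 h1, by rintro rfl; exact h5 h1⟩
  have du1 := du g1 o1 o1' m1 (nsw m4)
  have du2 := du g2 o2 o2' m2 (nsw m5)
  have du3 := du g3 o3 o3' m3 (nsw m1)
  have du4 := du g4 o4 o4' m4 (nsw m2)
  have du5 := du g5 o5 o5' m5 (nsw m3)
  have pm : ∀ {u a b c d e : V}, u ∉ ({a, b, c, d, e} : Finset V) → (∀ t, (t = a ∨ t = b ∨ t = c ∨ t = d ∨ t = e) ↔ (t = v ∨ t = w ∨ t = x ∨ t = y ∨ t = z)) →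
      u ∉ ({v, w, x, y, z} : Finset V) := by
    intro u a b c d e h1 h2
    simp only [mem_insert, mem_singleton] at h1 ⊢
    rwa [← h2]
  exact M.pent_red (D := {v, w, x, y, z}) (by simp) (by simp [insert_subset_iff, *]) n1 n2 n3 n4 n5
    hvx hvy hwy hwz hxz (pm du1 (by clear * -; intro t; tauto)) (pm du2 (by clear * -; intro t; tauto))
    (pm du3 (by clear * -; intro t; tauto)) (pm du4 (by clear * -; intro t; tauto)) (pm du5 (by clear * -; intro t; tauto))
    (iU bv g1) (iU bx g3)

/-- An arc of a circuit starting in the start of a path around the circuit is an initial segment of that path. -/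
lemma IsCirc.getVert_card {Z X : Finset (Sym2 V)} (hZ : IsCirc Z) {a b p : V} (hab : s(a, b) ∈ Z) {w : G.Walk a b}
    (hw : w.IsPath) (hwe : w.edges.toFinset = Z.erase s(a, b)) (hX : X ⊆ Z.erase s(a, b)) (bX : bd X = pt a + pt p)
    (hap : a ≠ p) : p = w.getVert X.card := by
  have hp : p ∈ w.support := by
    rw [← on_iff_mem_support hab w hwe]
    exact (on_of_bd hap bX).2.mono (hX.trans (erase_subset _ _))
  have hT : (w.takeUntil p hp).edges.toFinset ⊆ Z.erase s(a, b) := by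
    rw [← hwe]
    intro e he
    exact List.mem_toFinset.2 (w.edges_takeUntil_subset_edges hp (List.mem_toFinset.1 he))
  have hsd : symmDiff X (w.takeUntil p hp).edges.toFinset ⊆ Z.erase s(a, b) :=
    fun e he => (mem_symmDiff.1 he).elim (fun h => hX h.1) fun h => hT h.1
  have hb : bd (symmDiff X (w.takeUntil p hp).edges.toFinset) = 0 := by
    rw [bd_symmDiff, bX, bd_walk_edges _ (hw.takeUntil hp).isTrail]
    linear_combination (pt a + pt p) * two_zmod_pi (V := V)
  have : X = (w.takeUntil p hp).edges.toFinset := by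
    rcases hZ.2.2 _ (hsd.trans (erase_subset _ _)) hb with h | h
    · exact symmDiff_eq_bot.1 h
    · rw [h] at hsd
      exact absurd (hsd hab) (by simp)
  rw [this, List.toFinset_card_of_nodup (hw.takeUntil hp).isTrail.edges_nodup, Walk.length_edges]
  exact (Walk.getVert_length_takeUntil hp).symm

lemma Anti.symm {p s1 s2 : V} (h : Anti E0 p s1 s2) : Anti E0 p s2 s1 := by
  obtain ⟨h9, he, X, Y, cX, cY, hE, bX, bY⟩ := h
  exact ⟨h9, Sym2.eq_swap ▸ he, Y, X, cY, cX, by rw [Sym2.eq_swap, union_comm]; exact hE, bY, bX⟩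

lemma Anti.parts {p s1 s2 : V} (h : Anti E0 p s1 s2) (hC : IsCirc E0) : s1 ≠ p ∧ ∃ X Y : Finset (Sym2 V), X.card = 4 ∧ Y.card = 4 ∧
    X ⊆ E0.erase s(s1, s2) ∧ Y ⊆ E0.erase s(s1, s2) ∧ Disjoint X Y ∧ bd X = pt s1 + pt p ∧ bd Y = pt s2 + pt p := by
  obtain ⟨h9, he, X, Y, cX, cY, hE, bX, bY⟩ := h
  have h1 := card_union_le X Y
  have hn : s(s1, s2) ∉ X ∪ Y := fun h => by
    rw [← hE, insert_eq_of_mem h] at h9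
    omega
  have hs : X ∪ Y = E0.erase s(s1, s2) := by rw [← hE, erase_insert hn]
  refine ⟨?_, X, Y, cX, cY, hs ▸ subset_union_left, hs ▸ subset_union_right, ?_, bX, bY⟩
  · rintro rfl
    rcases hC.2.2 X (hE ▸ subset_union_left.trans (subset_insert _ _))
      (by rw [bX]; linear_combination (pt s1) * two_zmod_pi (V := V)) with h | h
    · simp [h] at cX
    · rw [h] at cX; omega
  · rw [← card_union_eq_card_add_card, hs, card_erase_of_mem he]
    omega

lemma Anti.uniq_left {p p' s1 s2 : V} (h : Anti E0 p s1 s2) (h' : Anti E0 p' s1 s2) (hC : IsCirc E0) (hG : EIn G E0) :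
    p = p' := by
  obtain ⟨w, hw, hwe⟩ := hC.exists_path hG h.2.1
  obtain ⟨n, X, -, cX, -, sX, -, -, bX, -⟩ := h.parts hC
  obtain ⟨n', X', -, cX', -, sX', -, -, bX', -⟩ := h'.parts hC
  rw [hC.getVert_card h.2.1 hw hwe sX bX n, hC.getVert_card h.2.1 hw hwe sX' bX' n', cX, cX']

lemma Anti.uniq_right {p s1 s2 t1 t2 : V} (h : Anti E0 p s1 s2) (h' : Anti E0 p t1 t2) (hC : IsCirc E0) (hG : EIn G E0) :
    s(s1, s2) = s(t1, t2) := by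
  obtain ⟨n, X, Y, cX, cY, sX, sY, -, bX, bY⟩ := h.parts hC
  obtain ⟨p1, hp1⟩ := on_iff.1 ((on_of_bd n bX).2.mono (sX.trans (erase_subset _ _)))
  obtain ⟨w, hw, hwe⟩ := hC.exists_path hG hp1
  suffices key : ∀ {s1 s2 : V}, Anti E0 p s1 s2 → s(s1, s2) = s(w.getVert 4, w.getVert 5) from (key h).trans (key h').symm
  have main : ∀ {s1 s2 : V} (X : Finset (Sym2 V)), Anti E0 p s1 s2 → X.card = 4 → X ⊆ E0.erase s(s1, s2) →
      bd X = pt s1 + pt p → s(p, p1) ∉ X → s(s1, s2) = s(w.getVert 4, w.getVert 5) := by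
    intro s1 s2 X h cX sX bX hX
    have n1 := (h.parts hC).1
    have n2 := (h.symm.parts hC).1
    have hn : s(s1, s2) ∉ X := fun h => by simpa using sX h
    have h1 := hC.getVert_card hp1 hw hwe (X := X) (p := s1)
      (fun e he => mem_erase.2 ⟨fun h => hX (h ▸ he), mem_of_mem_erase (sX he)⟩) (by rw [bX, add_comm]) n1.symm
    have h2 := hC.getVert_card hp1 hw hwe (X := insert s(s1, s2) X) (p := s2) ?_ ?_ n2.symm
    · rw [cX] at h1
      rw [card_insert_of_notMem hn, cX] at h2
      rw [← h1, ← h2]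
    · intro e he
      rw [mem_insert] at he
      refine mem_erase.2 ?_
      rcases he with rfl | he
      · exact ⟨fun h => by simp only [Sym2.eq_iff] at h; tauto, h.2.1⟩
      · exact ⟨fun h => hX (h ▸ he), mem_of_mem_erase (sX he)⟩
    · rw [bd_insert (hG _ _ h.2.1).ne hn, bX]
      linear_combination (pt s1) * two_zmod_pi (V := V)
  intro s1 s2 h
  obtain ⟨n, X, Y, cX, cY, sX, sY, hd, bX, bY⟩ := h.parts hC
  by_cases hX : s(p, p1) ∈ X
  · rw [Sym2.eq_swap]
    exact main Y h.symm cY (Sym2.eq_swap (a := s1) ▸ sY) bY (Finset.disjoint_left.1 hd hX)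
  · exact main X h cX sX bX hX

lemma nb_of_three {v a : V} (h : (nb G v).card = 3) (ha : G.Adj v a) :
    ∃ b c, b ≠ a ∧ c ≠ a ∧ b ≠ c ∧ ∀ w, G.Adj v w ↔ w = a ∨ w = b ∨ w = c := by
  obtain ⟨b, hb, hba⟩ := exists_mem_ne (s := nb G v) (by omega) a
  obtain ⟨c, h1, h2, h3⟩ := nb_eq_of_three h ha (mem_nb.1 hb) hba.symm
  exact ⟨b, c, hba, h1, h2.symm, h3⟩

/-- The vertex `w` prevents the reduction of the triangle `K`. -/
def Viol (G : SimpleGraph V) (U B : Finset V) (E0 K : Finset (Sym2 V)) (w : V) : Prop :=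
  w ∈ U ∧ 4 ≤ (nb G w).card ∧ ∃ c v s1 s2, c ∈ B ∧ On K v ∧ G.Adj v c ∧ G.Adj w s1 ∧ G.Adj w s2 ∧ Anti E0 c s1 s2

lemma MCE.mem_u_of_ch (M : MCE G U B E0 side p0) {v w : V} (h : ch G B v = 0) (hw : G.Adj v w) : w ∈ U :=
  (M.inst.adj_cases hw).resolve_right fun hB => by have := ch_pos hB hw; omega

lemma MCE.tri_keep (M : MCE G U B E0 side p0) {x y z a b : V} (hx : x ∈ U) (hy : y ∈ U) (axy : G.Adj x y)
    (ayz : G.Adj y z) (axz : G.Adj x z) (nx : ∀ v, G.Adj x v ↔ v = y ∨ v = z ∨ v = a) (ny : ∀ v, G.Adj y v ↔ v = x ∨ v = z ∨ v = b)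
    (a1 : a ≠ y) (a2 : a ≠ z) (b1 : b ≠ x) (b2 : b ≠ z) (ha : a ∈ U) (hb : b ∈ U) (h0 : ch G B b = 0)
    (h3 : z ∈ U → (nb G z).card ≠ 3) : False := by
  obtain ⟨d, d', e1, e2, e3, nb'⟩ := nb_of_three (M.deg3_of_ch hb (by omega)) ((ny b).2 (by simp)).symm
  exact M.inst.u_not_b ha (M.tredB hx hy hb (M.mem_u_of_ch h0 ((nb' d).2 (by simp))) (M.mem_u_of_ch h0 ((nb' d').2 (by simp)))
    axy ayz axz nx ny nb' a1 a2 b1 b2 e3 e1 e2 h3).1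

lemma MCE.tri_free (M : MCE G U B E0 side p0) {x y z a b c : V} (hx : x ∈ U) (hy : y ∈ U) (hz : z ∈ U) (axy : G.Adj x y)
    (ayz : G.Adj y z) (axz : G.Adj x z) (nx : ∀ v, G.Adj x v ↔ v = y ∨ v = z ∨ v = a) (ny : ∀ v, G.Adj y v ↔ v = x ∨ v = z ∨ v = b)
    (nz : ∀ v, G.Adj z v ↔ v = x ∨ v = y ∨ v = c) (a1 : a ≠ y) (a2 : a ≠ z) (b1 : b ≠ x) (b2 : b ≠ z) (c1 : c ≠ x) (c2 : c ≠ y)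
    (ha : a ∈ U) (hb : b ∈ U) (hc : c ∈ U) (h0 : ch G B b = 0) (h1 : ch G B c ≤ 1) : False := by
  obtain ⟨d, d', e1, e2, e3, nb'⟩ := nb_of_three (M.deg3_of_ch hb (by omega)) ((ny b).2 (by simp)).symm
  obtain ⟨f, f', e4, e5, e6, nc⟩ := nb_of_three (M.deg3_of_ch hc h1) ((nz c).2 (by simp)).symm
  exact M.inst.u_not_b ha (M.tredA hx hy hb hz hc (.inr ⟨M.mem_u_of_ch h0 ((nb' d).2 (by simp)), M.mem_u_of_ch h0 ((nb' d').2 (by simp))⟩)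
    axy ayz axz nx ny nb' a1 a2 b1 b2 e3 e1 e2 nz nc c1 c2 e4 e5).1

set_option maxHeartbeats 1000000 in
lemma MCE.tri_att (M : MCE G U B E0 side p0) {x y z c : V} (hx : x ∈ U) (hy : y ∈ U) (hz : z ∈ U) (axy : G.Adj x y)
    (ayz : G.Adj y z) (axz : G.Adj x z) (hc : c ∈ B) (hzc : G.Adj z c) (hs : ∑ v ∈ ball G U (tri x y z), ch G B v ≤ 2) :
    ∃ w, Viol G U B E0 (tri x y z) w := by
  have hf := M.inst.far
  have on : ∀ v, v = x ∨ v = y ∨ v = z → On (tri x y z) v := fun v hv => on_tri.2 hv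
  have bx : x ∈ ball G U (tri x y z) := mem_ball.2 ⟨hx, .inl (on x (by simp))⟩
  have bY : y ∈ ball G U (tri x y z) := mem_ball.2 ⟨hy, .inl (on y (by simp))⟩
  have bz : z ∈ ball G U (tri x y z) := mem_ball.2 ⟨hz, .inl (on z (by simp))⟩
  have cx : c ≠ x := by rintro rfl; exact M.inst.b_not_u hc hx
  have cy : c ≠ y := by rintro rfl; exact M.inst.b_not_u hc hy
  have hz1 : 1 ≤ (nb G z ∩ B).card := card_pos.2 ⟨c, by simp [mem_nb, hzc, hc]⟩
  have dz : (nb G z).card = 3 := by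
    have h1 := single_le_sum' (f := ch G B) bz
    have h2 := M.deg hz
    unfold ch at h1 hs
    omega
  have d3 : ∀ v ∈ ball G U (tri x y z), (nb G v).card = 3 := by
    intro v hv
    by_cases h : v = z
    · rw [h, dz]
    · have := pair_le_sum (f := ch G B) hv bz h
      have := ch_pos hc hzc
      exact M.deg3_of_ch (mem_ball.1 hv).1 (by omega)
  obtain ⟨a, a1, a2, nx⟩ := nb_eq_of_three (d3 x bx) axy axz ayz.ne
  obtain ⟨b, b1, b2, ny⟩ := nb_eq_of_three (d3 y bY) axy.symm ayz axz.ne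
  obtain ⟨c', c1, c2, nz⟩ := nb_eq_of_three (d3 z bz) axz.symm ayz.symm axy.ne
  obtain rfl : c = c' := by
    have := (nz c).1 hzc
    tauto
  have ga : G.Adj x a := (nx a).2 (by simp)
  have gb : G.Adj y b := (ny b).2 (by simp)
  have ua : a ∈ U := (M.inst.adj_cases ga).resolve_right fun h => M.not_att_two hz hx hy axz.symm axy ayz.symm hc h hzc ga
  have ub : b ∈ U := (M.inst.adj_cases gb).resolve_right fun h => M.not_att_two hz hy hx ayz.symm axy.symm axz.symm hc h hzc gb
  obtain ⟨a', a'', e1, e2, e3, na⟩ := nb_of_three (d3 a (mem_ball.2 ⟨ua, .inr ⟨x, on x (by simp), ga⟩⟩)) ga.symm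
  obtain ⟨b', b'', f1, f2, f3, nb'⟩ := nb_of_three (d3 b (mem_ball.2 ⟨ub, .inr ⟨y, on y (by simp), gb⟩⟩)) gb.symm
  obtain ⟨-, q, w, hq, uq, uw, -, wq, s1, s2, ws1, ws2, an⟩ := M.tredA hz hy ub hx ua (.inl hc) ayz.symm axy.symm axz.symm
    (fun v => (nz v).trans or_left_comm) (fun v => (ny v).trans or_left_comm) nb' c2 c1 b2 b1 f3 f1 f2
    (fun v => (nx v).trans or_left_comm) na a2 a1 e1 e2
  obtain ⟨-, q', w', hq', uq', uw', -, wq', s1', s2', ws1', ws2', an'⟩ := M.tredA hz hx ua hy ub (.inl hc) axz.symm axy ayz.symm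
    nz (fun v => (nx v).trans or_left_comm) na c1 c2 a2 a1 e3 e1 e2
    (fun v => (ny v).trans or_left_comm) nb' b2 b1 f1 f2
  have bq : G.Adj b q := (nb' q).2 (by tauto)
  have aq' : G.Adj a q' := (na q').2 (by tauto)
  have qy : q ≠ y := by rcases hq with rfl | rfl <;> assumption
  have ab := hf.tri_legs axy ayz axz ga gb a1 a2 b1 b2
  have hqq : q ≠ q' := by
    rintro rfl
    have h1 := hf.tri_step axy.symm axz ayz gb bq b1 b2 qy
    have h2 := hf.eq (a := x) (pent_short ga.symm axy gb bq aq'.symm b1.symm qy.symm a1 ab.1 h1.1.symm) (tri_short axy ayz axz)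
      (by simp [on_pent]) (by simp [on_tri])
    have h3 : On (tri x y z) a := by rw [← h2]; simp [on_pent]
    simp [on_tri, ga.ne', a1, a2] at h3
  have hC : IsCirc E0 := M.inst.circ.resolve_left fun h => by simp [h] at an; exact absurd an.1 (by simp)
  have hss := an.uniq_right an' hC M.inst.e0
  have ass := M.inst.e0 _ _ an.2.1
  have sB : s1 ∈ B ∧ s2 ∈ B := ⟨(M.inst.on _).1 (on_left an.2.1), (M.inst.on _).1 (on_right an.2.1)⟩
  have hw1 : G.Adj w' s1 ∧ G.Adj w' s2 := by
    rcases Sym2.eq_iff.1 hss with ⟨rfl, rfl⟩ | ⟨rfl, rfl⟩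
    exacts [⟨ws1', ws2'⟩, ⟨ws2', ws1'⟩]
  obtain rfl : w = w' := by
    have h2 := hf.eq (a := s1) (tri_short ws1 ass ws2) (tri_short hw1.1 ass hw1.2) (by simp [on_tri]) (by simp [on_tri])
    have h3 : On (tri w' s1 s2) w := by rw [← h2]; simp [on_tri]
    simpa [on_tri, ws1.ne, ws2.ne] using h3
  refine ⟨w, uw, ?_, c, z, s1, s2, hc, on z (by simp), hzc, ws1, ws2, an⟩
  have n1 : ∀ {t s : V}, t ∈ U → s ∈ B → s ≠ t := by
    rintro t s ht hs rfl; exact M.inst.b_not_u hs ht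
  have hsub : ({s1, s2, q, q'} : Finset V) ⊆ nb G w := by
    simp [insert_subset_iff, mem_nb, ws1, ws2, wq, wq']
  refine le_trans ?_ (card_le_card hsub)
  rw [card_insert_of_notMem (by simp [ass.ne, n1 uq sB.1, n1 uq' sB.1]),
    card_insert_of_notMem (by simp [n1 uq sB.2, n1 uq' sB.2]), card_pair hqq]

/-- A triangle with a corner of degree at least four, or with a corner in `B`. -/
lemma MCE.tri_big (M : MCE G U B E0 side p0) {x y z : V} (hx : x ∈ U) (hy : y ∈ U) (axy : G.Adj x y)
    (ayz : G.Adj y z) (axz : G.Adj x z) (hz : z ∈ B ∨ z ∈ U ∧ (nb G z).card ≠ 3) :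
    3 ≤ ∑ v ∈ ball G U (tri x y z), ch G B v := by
  by_contra hlt
  push Not at hlt
  have on : ∀ v, v = x ∨ v = y ∨ v = z → On (tri x y z) v := fun v hv => on_tri.2 hv
  have bx : x ∈ ball G U (tri x y z) := mem_ball.2 ⟨hx, .inl (on x (by simp))⟩
  have bY : y ∈ ball G U (tri x y z) := mem_ball.2 ⟨hy, .inl (on y (by simp))⟩
  have key : ∀ v ∈ ball G U (tri x y z), (ch G B v ≤ 1 ∧ (v ≠ x → v ≠ y → v ≠ z → ch G B v = 0) ∨ v = z) ∧
      ((v = x ∨ v = y) → ∀ u, G.Adj v u → u ≠ z → u ∈ U) := by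
    intro v hv
    rcases hz with hz | ⟨hz, h4⟩
    · have c1 := ch_pos hz axz
      have c2 := ch_pos hz ayz
      have c3 := pair_le_sum (f := ch G B) bx bY axy.ne
      constructor
      · left
        constructor
        · by_cases h : v = x
          · rw [h]; omega
          · have := pair_le_sum (f := ch G B) hv bx h
            omega
        · intro n1 n2 _
          have := triple_le_sum (f := ch G B) hv bx bY n1 n2 axy.ne
          omega
      · intro h u hu huz
        refine (M.inst.adj_cases hu).resolve_right fun hB => ?_
        rcases h with rfl | rfl
        · have := ch_two hB hu hz axz huz; omega
        · have := ch_two hB hu hz ayz huz; omega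
    · have bz : z ∈ ball G U (tri x y z) := mem_ball.2 ⟨hz, .inl (on z (by simp))⟩
      have c1 : 2 ≤ ch G B z := by
        have := M.deg hz
        unfold ch
        omega
      by_cases h : v = z
      · refine ⟨.inr h, ?_⟩
        rintro (rfl | rfl)
        exacts [absurd h axz.ne, absurd h ayz.ne]
      · have := pair_le_sum (f := ch G B) hv bz h
        exact ⟨.inl ⟨by omega, fun _ _ _ => by omega⟩, fun _ u hu _ => M.mem_u_of_ch (by omega) hu⟩
  obtain ⟨a, a1, a2, nx⟩ := nb_eq_of_three (M.deg3_of_ch hx ((key x bx).1.resolve_right axz.ne).1) axy axz ayz.ne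
  obtain ⟨b, b1, b2, ny⟩ := nb_eq_of_three (M.deg3_of_ch hy ((key y bY).1.resolve_right ayz.ne).1) axy.symm ayz axz.ne
  have ga : G.Adj x a := (nx a).2 (by simp)
  have gb : G.Adj y b := (ny b).2 (by simp)
  have ua := (key x bx).2 (.inl rfl) a ga a2
  have ub := (key y bY).2 (.inr rfl) b gb b2
  refine M.tri_keep hx hy axy ayz axz nx ny a1 a2 b1 b2 ua ub ?_ ?_
  · exact ((key b (mem_ball.2 ⟨ub, .inr ⟨y, on y (by simp), gb⟩⟩)).1.resolve_right b2).2 b1 gb.ne' b2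
  · exact fun hzU => hz.elim (fun h => absurd hzU (M.inst.b_not_u h)) fun h => h.2

set_option maxHeartbeats 1000000 in
lemma MCE.tri_ch (M : MCE G U B E0 side p0) {x y z : V} (hx : x ∈ U) (hy : y ∈ U) (hz : z ∈ U) (axy : G.Adj x y)
    (ayz : G.Adj y z) (axz : G.Adj x z) :
    3 ≤ ∑ v ∈ ball G U (tri x y z), ch G B v ∨
      1 ≤ ∑ v ∈ ball G U (tri x y z), ch G B v ∧ ∃ w, Viol G U B E0 (tri x y z) w := by
  rcases Nat.lt_or_ge (∑ v ∈ ball G U (tri x y z), ch G B v) 3 with hlt | hge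
  swap
  · exact .inl hge
  have hf := M.inst.far
  have t1 : tri y z x = tri x y z := tri_perm.1.symm
  have t2 : tri z x y = tri x y z := tri_perm.1
  have on : ∀ v, v = x ∨ v = y ∨ v = z → On (tri x y z) v := fun v hv => on_tri.2 hv
  have bx : x ∈ ball G U (tri x y z) := mem_ball.2 ⟨hx, .inl (on x (by simp))⟩
  have bY : y ∈ ball G U (tri x y z) := mem_ball.2 ⟨hy, .inl (on y (by simp))⟩
  have bz : z ∈ ball G U (tri x y z) := mem_ball.2 ⟨hz, .inl (on z (by simp))⟩
  by_cases hat : Att G B x ∨ Att G B y ∨ Att G B z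
  · right
    rcases hat with ⟨c, hc, h⟩ | ⟨c, hc, h⟩ | ⟨c, hc, h⟩
    · refine ⟨(ch_pos hc h).trans (single_le_sum' bx), ?_⟩
      rw [← t1] at hlt ⊢
      exact M.tri_att hy hz hx ayz axz.symm axy.symm hc h (by omega)
    · refine ⟨(ch_pos hc h).trans (single_le_sum' bY), ?_⟩
      rw [← t2] at hlt ⊢
      exact M.tri_att hz hx hy axz.symm axy ayz.symm hc h (by omega)
    · exact ⟨(ch_pos hc h).trans (single_le_sum' bz), M.tri_att hx hy hz axy ayz axz hc h (by omega)⟩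
  exfalso
  have dx : (nb G x).card = 3 := by
    by_contra h
    have := M.tri_big hy hz ayz axz.symm axy.symm (.inr ⟨hx, h⟩)
    rw [t1] at this; omega
  have dy : (nb G y).card = 3 := by
    by_contra h
    have := M.tri_big hz hx axz.symm axy ayz.symm (.inr ⟨hy, h⟩)
    rw [t2] at this; omega
  have dz : (nb G z).card = 3 := by
    by_contra h
    have := M.tri_big hx hy axy ayz axz (.inr ⟨hz, h⟩)
    omega
  obtain ⟨a, a1, a2, nx⟩ := nb_eq_of_three dx axy axz ayz.ne
  obtain ⟨b, b1, b2, ny⟩ := nb_eq_of_three dy axy.symm ayz axz.ne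
  obtain ⟨c, c1, c2, nz⟩ := nb_eq_of_three dz axz.symm ayz.symm axy.ne
  have ga : G.Adj x a := (nx a).2 (by simp)
  have gb : G.Adj y b := (ny b).2 (by simp)
  have gc : G.Adj z c := (nz c).2 (by simp)
  have ua : a ∈ U := (M.inst.adj_cases ga).resolve_right fun h => hat (.inl ⟨a, h, ga⟩)
  have ub : b ∈ U := (M.inst.adj_cases gb).resolve_right fun h => hat (.inr (.inl ⟨b, h, gb⟩))
  have uc : c ∈ U := (M.inst.adj_cases gc).resolve_right fun h => hat (.inr (.inr ⟨c, h, gc⟩))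
  have ba : a ∈ ball G U (tri x y z) := mem_ball.2 ⟨ua, .inr ⟨x, on x (by simp), ga⟩⟩
  have bb : b ∈ ball G U (tri x y z) := mem_ball.2 ⟨ub, .inr ⟨y, on y (by simp), gb⟩⟩
  have bc : c ∈ ball G U (tri x y z) := mem_ball.2 ⟨uc, .inr ⟨z, on z (by simp), gc⟩⟩
  have nab := (hf.tri_legs axy ayz axz ga gb a1 a2 b1 b2).1
  have nac := (hf.tri_legs axz ayz.symm axy ga gc a2 a1 c1 c2).1
  have nbc := (hf.tri_legs ayz axz.symm axy.symm gb gc b2 b1 c2 c1).1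
  have hs := triple_le_sum (f := ch G B) ba bb bc nab nac nbc
  have f1 := M.tri_free hx hy hz axy ayz axz nx ny nz a1 a2 b1 b2 c1 c2 ua ub uc
  have f2 := M.tri_free hx hz hy axz ayz.symm axy (fun v => (nx v).trans or_left_comm) nz ny a2 a1 c1 c2 b1 b2 ua uc ub
  have f3 := M.tri_free hy hx hz axy.symm axz ayz ny nx (fun v => (nz v).trans or_left_comm) b1 b2 a1 a2 c2 c1 ub ua uc
  have f4 := M.tri_free hy hz hx ayz axz.symm axy.symm (fun v => (ny v).trans or_left_comm) (fun v => (nz v).trans or_left_comm) nx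
    b2 b1 c2 c1 a1 a2 ub uc ua
  have f5 := M.tri_free hz hx hy axz.symm axy ayz.symm nz (fun v => (nx v).trans or_left_comm) (fun v => (ny v).trans or_left_comm)
    c1 c2 a2 a1 b2 b1 uc ua ub
  have f6 := M.tri_free hz hy hx ayz.symm axy.symm axz.symm (fun v => (nz v).trans or_left_comm) (fun v => (ny v).trans or_left_comm) 
    (fun v => (nx v).trans or_left_comm) c2 c1 b2 b1 a2 a1 uc ub ua
  have cur : ∀ {P Q : Prop}, (P → Q → False) → ¬ (P ∧ Q) := fun h h' => h h'.1 h'.2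
  replace f1 := cur f1
  replace f2 := cur f2
  replace f3 := cur f3
  replace f4 := cur f4
  replace f5 := cur f5
  replace f6 := cur f6
  omega

lemma ball_disjoint (hf : Far G) (W : Finset V) {K K' : Finset (Sym2 V)} (hK : Short G K) (hK' : Short G K') (hne : K ≠ K') :
    Disjoint (ball G W K) (ball G W K') := by
  rw [Finset.disjoint_left]
  intro v hv hv'
  rcases (mem_ball.1 hv).2 with h | ⟨w, h, hw⟩ <;> rcases (mem_ball.1 hv').2 with h' | ⟨w', h', hw'⟩
  · exact hne (hf.eq hK hK' h h')
  · exact hne (hf.eq_adj hK hK' h h' hw'.symm)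
  · exact hne (hf.eq_adj hK hK' h h' hw)
  · exact hne (hf.eq_adj2 hK hK' h h' hw hw'.symm)

/-- A circuit crosses the boundary of a set at least twice. -/
lemma IsCirc.cross {Z : Finset (Sym2 V)} (hZ : IsCirc Z) (hG : EIn G Z) (S : Set V) {x y : V} (hx : On Z x) (hy : On Z y)
    (hxS : x ∈ S) (hyS : y ∉ S) : ∃ u v u' v', s(u, v) ∈ Z ∧ s(u', v') ∈ Z ∧ u ∈ S ∧ v ∉ S ∧ u' ∈ S ∧ v' ∉ S ∧ s(u, v) ≠ s(u', v') := by
  obtain ⟨x', hx'⟩ := on_iff.1 hx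
  obtain ⟨p, hp, hpe⟩ := hZ.exists_path hG hx'
  have hyp := (on_iff_mem_support hx' p hpe y).1 hy
  obtain ⟨d, hd, hd1, hd2⟩ := (p.takeUntil y hyp).exists_boundary_dart S hxS hyS
  have hdZ : s(d.fst, d.snd) ∈ Z := by
    have h1 : d.edge ∈ p.edges := p.edges_takeUntil_subset_edges hyp (List.mem_map_of_mem hd)
    rw [← List.mem_toFinset, hpe] at h1
    exact mem_of_mem_erase h1
  obtain ⟨q, hq, hqe⟩ := hZ.exists_path hG hdZ
  obtain ⟨d', hd', hd1', hd2'⟩ := q.exists_boundary_dart S hd1 hd2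
  have h1 : d'.edge ∈ q.edges := List.mem_map_of_mem hd'
  rw [← List.mem_toFinset, hqe, mem_erase] at h1
  exact ⟨_, _, _, _, hdZ, h1.2, hd1, hd2, hd1', hd2', h1.1.symm⟩

/-- All vertices of `K` are in `U`. -/
def InU (U : Finset V) (K : Finset (Sym2 V)) : Prop := ∀ v, On K v → v ∈ U

/-- `K` is a triangle with two vertices in `B`. -/
def Mixed (G : SimpleGraph V) (U B : Finset V) (K : Finset (Sym2 V)) : Prop :=
  ∃ v s1 s2, v ∈ U ∧ s1 ∈ B ∧ s2 ∈ B ∧ G.Adj v s1 ∧ G.Adj s1 s2 ∧ G.Adj v s2 ∧ K = tri v s1 s2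

lemma Inst.on_cases (h : Inst G U B E0) {K : Finset (Sym2 V)} (hK : EIn G K) {v : V} (hv : On K v) : v ∈ U ∨ v ∈ B := by
  obtain ⟨w, hw⟩ := on_iff.1 hv
  exact h.adj_cases (hK _ _ hw).symm

lemma Inst.exists_on_u (h : Inst G U B E0) {K : Finset (Sym2 V)} (hK : Short G K) (hne : K ≠ E0) : ∃ v ∈ U, On K v := by
  by_contra hcon
  push Not at hcon
  have hB : ∀ v, On K v → v ∈ B := fun v hv => (h.on_cases hK.1 hv).resolve_left fun hu => hcon v hu hv
  have hs : K ⊆ E0 := by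
    intro e he
    induction e with | _ a b =>
    exact h.adj_bb (hB _ (on_left he)) (hB _ (on_right he)) (hK.1 _ _ he)
  rcases h.circ with h0 | hC
  · exact hK.2.2.1.ne_empty (by rw [h0] at hs; exact subset_empty.1 hs)
  · rcases hC.2.2 K hs hK.2.1 with h1 | h1
    exacts [hK.2.2.1.ne_empty h1, hne h1]

lemma MCE.cross_ch (M : MCE G U B E0 side p0) {K : Finset (Sym2 V)} (hK : Short G K) (hne : K ≠ E0) (hU : ¬ InU U K) :
    2 ≤ ∑ v ∈ ball G U K, ch G B v := by
  obtain ⟨x, hx, hxK⟩ := M.inst.exists_on_u hK hne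
  simp only [InU, not_forall] at hU
  obtain ⟨y, hyK, hy⟩ := hU
  obtain ⟨u, v, u', v', h1, h2, h3, h4, h5, h6, h7⟩ := (hK.isCirc).cross hK.1 (U : Set V) hxK hyK
    (by simpa using hx) (by simpa using hy)
  simp only [mem_coe] at h3 h4 h5 h6
  have bu : u ∈ ball G U K := mem_ball.2 ⟨h3, .inl (on_left h1)⟩
  have bu' : u' ∈ ball G U K := mem_ball.2 ⟨h5, .inl (on_left h2)⟩
  have a1 := hK.1 _ _ h1
  have a2 := hK.1 _ _ h2
  have b1 := (M.inst.adj_cases a1).resolve_left h4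
  have b2 := (M.inst.adj_cases a2).resolve_left h6
  by_cases h : u = u'
  · subst h
    exact (ch_two b1 a1 b2 a2 (by rintro rfl; exact h7 rfl)).trans (single_le_sum' bu)
  · exact (Nat.add_le_add (ch_pos b1 a1) (ch_pos b2 a2)).trans (pair_le_sum bu bu' h)

/-- Triangles are in `U`, or have one vertex in `B`, or two. -/
lemma MCE.tri_cases (M : MCE G U B E0 side p0) {x y z : V} (axy : G.Adj x y) (ayz : G.Adj y z) (axz : G.Adj x z)
    (hne : tri x y z ≠ E0) : (x ∈ U ∧ y ∈ U ∧ z ∈ U) ∨ 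
    (∃ a b c, tri x y z = tri a b c ∧ G.Adj a b ∧ G.Adj b c ∧ G.Adj a c ∧ a ∈ U ∧ b ∈ U ∧ c ∈ B) ∨ Mixed G U B (tri x y z) := by
  obtain ⟨v, hv, hvK⟩ := M.inst.exists_on_u (tri_short axy ayz axz) hne
  have p1 : tri x y z = tri y z x := tri_perm.1
  have p2 : tri x y z = tri z x y := tri_perm.1.trans tri_perm.1
  have p3 : tri x y z = tri x z y := p2.trans tri_perm.2
  rcases M.inst.adj_cases axy.symm with hx | hx <;> rcases M.inst.adj_cases axy with hy | hy <;>
    rcases M.inst.adj_cases ayz with hz | hz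
  · exact .inl ⟨hx, hy, hz⟩
  · exact .inr (.inl ⟨x, y, z, rfl, axy, ayz, axz, hx, hy, hz⟩)
  · exact .inr (.inl ⟨x, z, y, p3, axz, ayz.symm, axy, hx, hz, hy⟩)
  · exact .inr (.inr ⟨x, y, z, hx, hy, hz, axy, ayz, axz, rfl⟩)
  · exact .inr (.inl ⟨y, z, x, p1, ayz, axz.symm, axy.symm, hy, hz, hx⟩)
  · exact .inr (.inr ⟨y, z, x, hy, hz, hx, ayz, axz.symm, axy.symm, p1⟩)
  · exact .inr (.inr ⟨z, x, y, hz, hx, hy, axz.symm, axy, ayz.symm, p2⟩)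
  · rw [on_tri] at hvK
    rcases hvK with rfl | rfl | rfl
    exacts [absurd hv (M.inst.b_not_u hx), absurd hv (M.inst.b_not_u hy), absurd hv (M.inst.b_not_u hz)]

lemma Mixed.not_inU {K : Finset (Sym2 V)} (h : Mixed G U B K) (hd : Disjoint U B) : ¬ InU U K := by
  obtain ⟨v, s1, s2, -, h1, -, -, -, -, rfl⟩ := h
  exact fun h => Finset.disjoint_left.1 hd (h s1 (by simp [on_tri])) h1

/-- The charge around a short cycle. -/
lemma MCE.charge (M : MCE G U B E0 side p0) {K : Finset (Sym2 V)} (hK : Short G K) (hne : K ≠ E0) :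
    3 * (6 - K.card) + (if InU U K then 6 - K.card else 0) ≤
      4 * ∑ v ∈ ball G U K, ch G B v + (if Mixed G U B K then 1 else 0) +
        (if InU U K ∧ K.card = 3 ∧ ∃ w, Viol G U B E0 K w then 8 else 0) := by
  have hf := M.inst.far
  have hcr := M.cross_ch hK hne
  rcases hK.shape hf with ⟨x, y, z, axy, ayz, axz, rfl⟩ | ⟨w, x, y, z, a1, a2, a3, a4, n1, n2, rfl⟩ |
      ⟨v, w, x, y, z, a1, a2, a3, a4, a5, n1, n2, n3, n4, n5, rfl⟩
  · have h3 := tri_card axy ayz axz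
    rcases M.tri_cases axy ayz axz hne with ⟨hx, hy, hz⟩ | ⟨a, b, c, h, ab, bc, ac, ha, hb, hc⟩ | hm
    · have hU : InU U (tri x y z) := by
        intro v hv
        rcases on_tri.1 hv with rfl | rfl | rfl <;> assumption
      rcases M.tri_ch hx hy hz axy ayz axz with h | ⟨h, h'⟩
      · rw [h3, if_pos hU]; omega
      · have hv : InU U (tri x y z) ∧ (tri x y z).card = 3 ∧ ∃ w, Viol G U B E0 (tri x y z) w := ⟨hU, h3, h'⟩
        rw [if_pos hU, if_pos hv, h3]; omega
    · have hU : ¬ InU U (tri x y z) := fun hU => M.inst.b_not_u hc (hU c (by rw [h]; simp [on_tri]))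
      have := M.tri_big ha hb ab bc ac (.inl hc)
      rw [← h] at this
      rw [h3, if_neg hU]; omega
    · have hU := hm.not_inU M.inst.disj
      have := hcr hU
      rw [h3, if_neg hU, if_pos hm]; omega
  · have h4 := quad_card hf hK a1 a2 a3 a4 n1 n2
    by_cases hU : InU U (quad w x y z)
    · have := M.quad_ch (hU w (by simp [on_quad])) (hU x (by simp [on_quad])) (hU y (by simp [on_quad]))
        (hU z (by simp [on_quad])) a1 a2 a3 a4 n1 n2
      rw [if_pos hU]; omega
    · have := hcr hU
      rw [if_neg hU]; omega
  · have h5 := pent_card hf hK a1 a2 a3 a4 a5 n1 n2 n3 n4 n5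
    by_cases hU : InU U (pent v w x y z)
    · have := M.pent_ch (hU v (by simp [on_pent])) (hU w (by simp [on_pent])) (hU x (by simp [on_pent])) (hU y (by simp [on_pent]))
        (hU z (by simp [on_pent])) a1 a2 a3 a4 a5 n1 n2 n3 n4 n5
      rw [if_pos hU]; omega
    · have := hcr hU
      rw [if_neg hU]; omega

/-- The apex triangle `K'` of a violator triangle `K`. -/
def ApexTri (G : SimpleGraph V) (U B : Finset V) (E0 K K' : Finset (Sym2 V)) : Prop :=
  ∃ w c v s1 s2, w ∈ U ∧ s1 ∈ B ∧ s2 ∈ B ∧ s1 ≠ s2 ∧ K' = tri w s1 s2 ∧ On K v ∧ G.Adj v c ∧ Anti E0 c s1 s2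

lemma ApexTri.inj (h : Inst G U B E0) {K1 K2 K' : Finset (Sym2 V)} (h1 : ApexTri G U B E0 K1 K')
    (h2 : ApexTri G U B E0 K2 K') (hK1 : Short G K1) (hK2 : Short G K2) : K1 = K2 := by
  obtain ⟨w, c, v, s1, s2, hw, b1, b2, hne, rfl, hv, hc, ha⟩ := h1
  obtain ⟨w', c', v', t1, t2, hw', d1, d2, hne', he, hv', hc', ha'⟩ := h2
  have hC := h.circ.resolve_left fun h0 => by have := ha.1; simp [h0] at this
  have e1 : On (tri w' t1 t2) s1 := he ▸ by simp [on_tri]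
  have e2 : On (tri w' t1 t2) s2 := he ▸ by simp [on_tri]
  rw [on_tri] at e1 e2
  have n1 : s1 ≠ w' := by rintro rfl; exact h.b_not_u b1 hw'
  have n2 : s2 ≠ w' := by rintro rfl; exact h.b_not_u b2 hw'
  have hcc : c = c' := by
    rcases e1.resolve_left n1 with rfl | rfl <;> rcases e2.resolve_left n2 with rfl | rfl
    · exact absurd rfl hne
    · exact ha.uniq_left ha' hC h.e0
    · exact ha.uniq_left ha'.symm hC h.e0
    · exact absurd rfl hne
  subst hcc
  exact h.far.eq_adj2 hK1 hK2 hv hv' hc hc'.symm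

lemma Viol.exists_apex (M : MCE G U B E0 side p0) {K : Finset (Sym2 V)} {w : V} (h : Viol G U B E0 K w) :
    ∃ K', Short G K' ∧ K' ≠ E0 ∧ Mixed G U B K' ∧ K'.card = 3 ∧ 4 ≤ ∑ v ∈ ball G U K', ch G B v ∧ ApexTri G U B E0 K K' := by
  obtain ⟨hw, h4, c, v, s1, s2, hc, hv, hvc, a1, a2, ha⟩ := h
  have b1 := (M.inst.on s1).1 (on_left ha.2.1)
  have b2 := (M.inst.on s2).1 (on_right ha.2.1)
  have a12 := M.inst.e0 _ _ ha.2.1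
  refine ⟨tri w s1 s2, tri_short a1 a12 a2, fun h => M.inst.u_not_on hw (h ▸ by simp [on_tri]), ⟨w, s1, s2, hw, b1, b2, a1, a12, a2, rfl⟩,
    tri_card a1 a12 a2, ?_, w, c, v, s1, s2, hw, b1, b2, a12.ne, rfl, hv, hvc, ha⟩
  refine le_trans ?_ (single_le_sum' (mem_ball.2 ⟨hw, .inl (by simp [on_tri])⟩) (a := w))
  have := one_lt_card.2 ⟨s1, show s1 ∈ nb G w ∩ B by simp [mem_nb, *], s2, by simp [mem_nb, *], a12.ne⟩
  unfold ch
  omega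

/-- The short sets other than `E0`. -/
noncomputable def SH (G : SimpleGraph V) (E0 : Finset (Sym2 V)) : Finset (Finset (Sym2 V)) :=
  univ.filter (fun K => Short G K ∧ K ≠ E0)

lemma mem_sh {K : Finset (Sym2 V)} : K ∈ SH G E0 ↔ Short G K ∧ K ≠ E0 := by simp [SH]

lemma sum_ball_le (hf : Far G) (W : Finset V) (f : V → ℕ) {S : Finset (Finset (Sym2 V))} (hS : ∀ K ∈ S, Short G K) :
    ∑ K ∈ S, ∑ v ∈ ball G W K, f v ≤ ∑ v ∈ W, f v := by
  rw [← sum_biUnion fun K hK K' hK' hne => ball_disjoint hf W (hS K hK) (hS K' hK') hne]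
  refine sum_le_sum_of_subset fun v hv => ?_
  obtain ⟨K, -, hv⟩ := mem_biUnion.1 hv
  exact (mem_ball.1 hv).1

lemma MCE.charge_sum (M : MCE G U B E0 side p0) :
    3 * ∑ K ∈ SH G E0, (6 - K.card) + ∑ K ∈ SH G E0, (if InU U K then 6 - K.card else 0) ≤
      4 * ∑ v ∈ U, ch G B v + ((SH G E0).filter (Mixed G U B)).card := by
  let P : Finset (Sym2 V) → Prop := fun K => InU U K ∧ K.card = 3 ∧ ∃ w, Viol G U B E0 K w
  have hφ : ∀ K, P K → ∃ K', Short G K' ∧ K' ≠ E0 ∧ Mixed G U B K' ∧ K'.card = 3 ∧ 4 ≤ ∑ v ∈ ball G U K', ch G B v ∧ ApexTri G U B E0 K K' :=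
    fun K ⟨_, _, w, hw⟩ => hw.exists_apex M
  choose! φ hφ using hφ
  set T := ((SH G E0).filter P).image φ with hT
  have hcard : T.card = ((SH G E0).filter P).card := by
    refine card_image_of_injOn fun K hK K' hK' h => ?_
    simp only [coe_filter, Set.mem_setOf_eq, mem_sh] at hK hK'
    exact ApexTri.inj M.inst (hφ K hK.2).2.2.2.2.2 (h ▸ (hφ K' hK'.2).2.2.2.2.2) hK.1.1 hK'.1.1
  have hTs : T ⊆ SH G E0 := by
    intro K hK
    obtain ⟨K0, hK0, rfl⟩ := mem_image.1 hK
    have := hφ K0 (mem_filter.1 hK0).2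
    exact mem_sh.2 ⟨this.1, this.2.1⟩
  have key : ∀ K ∈ SH G E0, 3 * (6 - K.card) + (if InU U K then 6 - K.card else 0) + (if K ∈ T then 8 else 0) ≤
      4 * ∑ v ∈ ball G U K, ch G B v + (if Mixed G U B K then 1 else 0) + (if P K then 8 else 0) := by
    intro K hK
    obtain ⟨hs, hne⟩ := mem_sh.1 hK
    by_cases hKT : K ∈ T
    · obtain ⟨K0, hK0, rfl⟩ := mem_image.1 hKT
      obtain ⟨-, -, h3, h4, h5, -⟩ := hφ K0 (mem_filter.1 hK0).2
      rw [if_neg (h3.not_inU M.inst.disj), if_pos h3, if_pos hKT]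
      omega
    · rw [if_neg hKT]
      exact M.charge hs hne
  have h1 := sum_le_sum key
  simp only [sum_add_distrib, ← mul_sum] at h1
  have h2 : ∑ K ∈ SH G E0, (if K ∈ T then 8 else 0) = 8 * T.card := by
    rw [← sum_filter, filter_mem_eq_inter, inter_eq_right.2 hTs]
    simp [mul_comm]
  have h3 : ∑ K ∈ SH G E0, (if P K then 8 else 0) = 8 * T.card := by
    rw [← sum_filter, hcard]
    simp [mul_comm]
  have h4 : ∑ K ∈ SH G E0, (if Mixed G U B K then 1 else 0) = ((SH G E0).filter (Mixed G U B)).card := by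
    rw [← sum_filter]
    simp
  have h5 := sum_ball_le M.inst.far U (ch G B) (S := SH G E0) fun K hK => (mem_sh.1 hK).1
  rw [h2, h3, h4] at h1
  omega

lemma Inst.card_b (h : Inst G U B E0) : B.card = E0.card := by
  rcases h.circ with h0 | h0
  · have : B = ∅ := by
      refine eq_empty_of_forall_notMem fun v hv => ?_
      obtain ⟨w, hw⟩ := on_iff.1 ((h.on v).2 hv)
      simp [h0] at hw
    simp [this, h0]
  · rw [← h0.card_on h.e0]
    congr 1
    ext v
    simp [h.on v]

lemma Inst.mixed_le (h : Inst G U B E0) : ((SH G E0).filter (Mixed G U B)).card ≤ 2 := by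
  have key : ∀ K ∈ (SH G E0).filter (Mixed G U B), 4 ≤ ∑ v ∈ ball G B K, 1 := by
    intro K hK
    obtain ⟨v, s1, s2, hv, b1, b2, a1, a12, a2, rfl⟩ := (mem_filter.1 hK).2
    have he := h.adj_bb b1 b2 a12
    have hbd : ∀ v, bd E0 v = 0 := by
      rcases h.circ with h0 | h0
      · simp [h0] at he
      · simp [h0.2.1]
    obtain ⟨x, hx, hxe⟩ := exists_other (hbd s1) he
    obtain ⟨y, hy, hye⟩ := exists_other (hbd s2) (Sym2.eq_swap ▸ he)
    have ax := h.e0 _ _ hxe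
    have ay := h.e0 _ _ hye
    have bx := (h.on x).1 (on_right hxe)
    have by' := (h.on y).1 (on_right hye)
    have hxy : x ≠ y := by
      rintro rfl
      have e := h.far.eq (tri_short a1 a12 a2) (tri_short a12 ay ax) (a := s1) (by simp [on_tri]) (by simp [on_tri])
      have : On (tri s1 s2 x) v := e ▸ by simp [on_tri]
      rcases on_tri.1 this with rfl | rfl | rfl
      exacts [h.b_not_u b1 hv, h.b_not_u b2 hv, h.b_not_u bx hv]
    have hc : ({s1, s2, x, y} : Finset V).card = 4 := by
      rw [card_insert_of_notMem, card_insert_of_notMem, card_pair hxy]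
      · simp [hx.symm, ay.ne, Ne.symm hx]
      · simp [a12.ne, ax.ne, Ne.symm hy]
    rw [← card_eq_sum_ones, ← hc]
    refine card_le_card fun u hu => ?_
    simp only [mem_insert, mem_singleton] at hu
    rcases hu with rfl | rfl | rfl | rfl
    · exact mem_ball.2 ⟨b1, .inl (by simp [on_tri])⟩
    · exact mem_ball.2 ⟨b2, .inl (by simp [on_tri])⟩
    · exact mem_ball.2 ⟨bx, .inr ⟨s1, by simp [on_tri], ax⟩⟩
    · exact mem_ball.2 ⟨by', .inr ⟨s2, by simp [on_tri], ay⟩⟩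
  have h1 := sum_le_sum key
  have h2 := sum_ball_le h.far B (fun _ => 1) (S := (SH G E0).filter (Mixed G U B)) fun K hK => (mem_sh.1 (mem_filter.1 hK).1).1
  have h3 := h.le
  rw [← h.card_b] at h3
  simp only [sum_const, smul_eq_mul, mul_one] at h1 h2
  omega

/-- The edges of `G`. -/
noncomputable def EE (G : SimpleGraph V) : Finset (Sym2 V) := univ.filter (· ∈ G.edgeSet)

lemma mem_ee {u v : V} : s(u, v) ∈ EE G ↔ G.Adj u v := by simp [EE]

lemma sum_nb (H : SimpleGraph V) : ∑ v, (nb H v).card = 2 * (EE H).card := by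
  have h := H.sum_degrees_eq_twice_card_edges
  have h1 : EE H = H.edgeFinset := by ext; simp [EE]
  rw [h1, ← h]
  refine sum_congr rfl fun v _ => ?_
  rw [← card_neighborFinset_eq_degree]
  congr 1
  ext; simp [nb]

lemma sum_nb_del (hd : Disjoint U B) (hadj : ∀ u v, G.Adj u v → u ∈ U ∪ B) :
    ∑ v ∈ U, (nb G v ∩ U).card = 2 * (EE (delG G B)).card := by
  rw [← sum_nb]
  symm
  rw [← sum_subset (subset_univ U)]
  · refine sum_congr rfl fun v hv => ?_
    congr 1
    ext w
    have h1 := Finset.disjoint_left.1 hd hv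
    have h2 : G.Adj v w → (w ∉ B ↔ w ∈ U) := fun h => by
      have := hadj _ _ h.symm
      rw [mem_union] at this
      exact ⟨this.resolve_right, fun h => Finset.disjoint_left.1 hd h⟩
    simp only [mem_nb, mem_inter, delG, mem_coe]
    tauto
  · intro v _ hv
    rw [card_eq_zero]
    refine eq_empty_of_forall_notMem fun w hw => ?_
    have h : G.Adj v w ∧ v ∉ (B : Set V) ∧ w ∉ (B : Set V) := mem_nb.1 hw
    rcases mem_union.1 (hadj _ _ h.1) with h' | h'
    exacts [hv h', h.2.1 h']

lemma Pl.euler_short (h : Pl H side) {W : Finset V} (h0 : W.Nonempty) (hW : ∀ u v, H.Adj u v → u ∈ W) (p : Φ)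
    {T : Finset (Finset (Sym2 V))} (hT : ∀ q, q ≠ p → Short H (J H side {q}) → J H side {q} ∈ T) :
    4 * (EE H).card + 6 + (J H side {p}).card ≤ 6 * W.card + ∑ Z ∈ T, (6 - Z.card) ∧
    ((∀ q, (J H side {q}).card ≤ 5) → (EE H).card + 1 ≤ W.card + T.card) := by
  obtain ⟨v0, hv0⟩ := h0
  obtain ⟨S, hS, h1, h2⟩ := h.euler (EE H) (fun u v => mem_ee) W v0 hv0 hW p
  have hs : ∀ Z ∈ S, Z.card ≤ 5 → Z ∈ T := by
    intro Z hZ hc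
    obtain ⟨hn, q, hq, rfl⟩ := hS Z hZ
    exact hT q hq ⟨eIn_J, h.even _, hn, hc⟩
  constructor
  · have h3 : ∑ Z ∈ S, 6 ≤ ∑ Z ∈ S, (Z.card + (6 - Z.card)) := sum_le_sum fun Z _ => by omega
    have h4 : ∑ Z ∈ S, (6 - Z.card) ≤ ∑ Z ∈ T, (6 - Z.card) := by
      rw [← sum_filter_add_sum_filter_not S (fun Z => Z.card ≤ 5)]
      rw [sum_eq_zero (s := S.filter (fun Z => ¬ Z.card ≤ 5)) fun Z hZ => by
        have := (mem_filter.1 hZ).2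
        omega]
      exact sum_le_sum_of_subset fun Z hZ => hs Z (mem_filter.1 hZ).1 (mem_filter.1 hZ).2
    rw [sum_add_distrib] at h3
    simp only [sum_const, smul_eq_mul] at h3
    omega
  · intro hq
    have := card_le_card (s := S) (t := T) fun Z hZ => hs Z hZ (by
      obtain ⟨-, q, -, rfl⟩ := hS Z hZ
      exact hq q)
    omega

lemma MCE.ball_card (M : MCE G U B E0 side p0) {K : Finset (Sym2 V)} (hK : Short G K) (hne : K ≠ E0) :
    6 - K.card + (if InU U K then 4 else 0) ≤ 2 * (ball G U K).card := by
  have hf := M.inst.far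
  have hC := hK.isCirc
  have hon : ∀ v ∈ U, On K v → v ∈ ball G U K := fun v hv h => mem_ball.2 ⟨hv, .inl h⟩
  have hle : InU U K → K.card ≤ (ball G U K).card := by
    intro hU
    rw [← hC.card_on hK.1]
    exact card_le_card fun v hv => hon v (hU v (mem_filter.1 hv).2) (mem_filter.1 hv).2
  have h1 : 0 < (ball G U K).card := by
    obtain ⟨v, hv, hvK⟩ := M.inst.exists_on_u hK hne
    exact card_pos.2 ⟨v, hon v hv hvK⟩
  by_cases h4 : 4 ≤ K.card
  · split_ifs with hU
    · have := hle hU; omega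
    · omega
  rcases hK.shape hf with ⟨x, y, z, axy, ayz, axz, rfl⟩ | ⟨w, x, y, z, a1, a2, a3, a4, n1, n2, rfl⟩ |
      ⟨v, w, x, y, z, a1, a2, a3, a4, a5, n1, n2, n3, n4, n5, rfl⟩
  · have h3 := tri_card axy ayz axz
    have third : ∀ u, u ∈ U → ∀ a b, ∃ c, G.Adj u c ∧ c ≠ a ∧ c ≠ b := by
      intro u hu a b
      obtain ⟨c, hc, hc'⟩ := exists_mem_notMem_of_card_lt_card (s := {a, b}) (t := nb G u)
        (card_le_two.trans_lt (M.deg hu))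
      simp only [mem_insert, mem_singleton, not_or] at hc'
      exact ⟨c, mem_nb.1 hc, hc'⟩
    rcases M.tri_cases axy ayz axz hne with ⟨hx, hy, hz⟩ | ⟨a, b, c, h, ab, bc, ac, ha, hb, hc⟩ | hm
    · have hU : InU U (tri x y z) := by
        intro v hv
        rcases on_tri.1 hv with rfl | rfl | rfl <;> assumption
      obtain ⟨x', ax, nxy, nxz⟩ := third x hx y z
      obtain ⟨y', ay, nyx, nyz⟩ := third y hy x z
      have key : ∃ w, w ∈ U ∧ w ≠ x ∧ w ≠ y ∧ w ≠ z ∧ w ∈ ball G U (tri x y z) := by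
        rcases M.inst.adj_cases ax with h | h
        · exact ⟨x', h, ax.ne', nxy, nxz, mem_ball.2 ⟨h, .inr ⟨x, by simp [on_tri], ax⟩⟩⟩
        · have h' := (M.inst.adj_cases ay).resolve_right fun h' => M.not_att_two hx hy hz axy ayz axz h h' ax ay
          exact ⟨y', h', nyx, ay.ne', nyz, mem_ball.2 ⟨h', .inr ⟨y, by simp [on_tri], ay⟩⟩⟩
      obtain ⟨w, hw, w1, w2, w3, hwb⟩ := key
      have : ({w, x, y, z} : Finset V).card ≤ (ball G U (tri x y z)).card := card_le_card fun u hu => by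
        simp only [mem_insert, mem_singleton] at hu
        rcases hu with rfl | rfl | rfl | rfl
        exacts [hwb, hon _ hx (by simp [on_tri]), hon _ hy (by simp [on_tri]), hon _ hz (by simp [on_tri])]
      rw [card_insert_of_notMem (by simp [*]), card_insert_of_notMem (by simp [axy.ne, axz.ne]),
        card_pair ayz.ne] at this
      split_ifs <;> omega
    · have hU : ¬ InU U (tri x y z) := fun hU => M.inst.b_not_u hc (hU c (by rw [h]; simp [on_tri]))
      have := one_lt_card.2 ⟨a, hon a ha (by rw [h]; simp [on_tri]), b, hon b hb (by rw [h]; simp [on_tri]), ab.ne⟩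
      rw [if_neg hU]; omega
    · have hU := hm.not_inU M.inst.disj
      obtain ⟨v, s1, s2, hv, b1, b2, a1, a12, a2, he⟩ := hm
      obtain ⟨c, hc, n1, n2⟩ := third v hv s1 s2
      have hcU := (M.inst.adj_cases hc).resolve_right fun hB => M.inst.no_claw hv b1 b2 hB a12.ne n2.symm n1.symm a1 a2 hc
      have := one_lt_card.2 ⟨v, hon v hv (by rw [he]; simp [on_tri]), c,
        mem_ball.2 ⟨hcU, .inr ⟨v, by rw [he]; simp [on_tri], hc⟩⟩, hc.ne⟩
      rw [if_neg hU]; omega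
  · have := quad_card hf hK a1 a2 a3 a4 n1 n2; omega
  · have := pent_card hf hK a1 a2 a3 a4 a5 n1 n2 n3 n4 n5; omega

lemma MCE.elim (M : MCE G U B E0 side p0) : False := by
  have I := M.inst
  have hUB : ∀ u v, G.Adj u v → u ∈ U ∪ B := fun u v h => I.adj_mem h.symm
  have hU0 : U.Nonempty := by
    by_contra h
    rw [not_nonempty_iff_eq_empty] at h
    refine M.hno fun c0 => ⟨c0, fun _ _ => rfl, by simp [h], fun X hX ⟨v, hv⟩ => ?_⟩
    have := hX hv
    simp [h] at this
  have eU := sum_nb_del I.disj hUB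
  have eB := sum_nb_del I.disj.symm (G := G) (by simpa [union_comm] using hUB)
  have hdel : (EE (delG G U)) = E0 := by
    ext e
    induction e with | _ u v =>
    rw [mem_ee]
    constructor
    · rintro ⟨h, h1, h2⟩
      exact I.adj_bb ((I.adj_cases h.symm).resolve_left (by simpa using h1)) ((I.adj_cases h).resolve_left (by simpa using h2)) h
    · intro h
      exact ⟨I.e0 _ _ h, by simpa using I.b_not_u ((I.on _).1 (on_left h)), by simpa using I.b_not_u ((I.on _).1 (on_right h))⟩
  have split : ∀ v, (nb G v).card = (nb G v ∩ U).card + (nb G v ∩ B).card := by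
    intro v
    rw [← card_union_of_disjoint ((I.disj.mono_left inter_subset_right).mono_right inter_subset_right),
      ← inter_union_distrib_left, inter_eq_left.2]
    exact fun w hw => I.adj_mem (mem_nb.1 hw)
  have eG : ∑ v ∈ U, (nb G v).card + ∑ v ∈ B, (nb G v).card = 2 * (EE G).card := by
    rw [← sum_nb, ← sum_union I.disj]
    refine sum_subset (subset_univ _) fun v _ hv => ?_
    rw [card_eq_zero]
    exact eq_empty_of_forall_notMem fun w hw => hv (hUB _ _ (mem_nb.1 hw))
  have hm : ∑ v ∈ U, (nb G v ∩ B).card = ∑ v ∈ B, (nb G v ∩ U).card := by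
    have := sum_card_bipartiteAbove_eq_sum_card_bipartiteBelow (s := U) (t := B) G.Adj
    convert this using 3 <;> ext w <;> simp [mem_nb, bipartiteAbove, bipartiteBelow, and_comm, G.adj_comm]
  have hch : ∑ v ∈ U, ch G B v + 6 * U.card = ∑ v ∈ U, (2 * (nb G v).card + (nb G v ∩ B).card) := by
    have h6 : 6 * U.card = ∑ v ∈ U, 6 := by simp [mul_comm]
    rw [h6, ← sum_add_distrib]
    refine sum_congr rfl fun v hv => ?_
    have := M.deg hv
    unfold ch; omega
  have hdeg : 3 * U.card ≤ ∑ v ∈ U, (nb G v).card := by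
    have h6 : 3 * U.card = ∑ v ∈ U, 3 := by simp [mul_comm]
    rw [h6]
    exact sum_le_sum fun v hv => M.deg hv
  simp only [split, sum_add_distrib, ← mul_sum, hdel] at eG hch hdeg eB
  have c1 := M.charge_sum
  have c2 := I.mixed_le
  have c3 := I.card_b
  -- Euler's formula for the whole graph
  have e1 : 4 * (EE G).card + 6 ≤ 6 * U.card + 5 * B.card + ∑ Z ∈ SH G E0, (6 - Z.card) + (if E0 = ∅ then 0 else 6 - B.card) := by
    have hW : (U ∪ B).Nonempty := hU0.mono subset_union_left
    have hc := card_union_of_disjoint I.disj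
    rcases eq_or_ne E0 ∅ with h0 | h0
    · have := (M.plane.euler_short hW hUB p0 (T := SH G E0) fun q _ hq => mem_sh.2 ⟨hq, h0 ▸ hq.2.2.1.ne_empty⟩).1
      have hb := I.card_b
      rw [h0, card_empty] at hb
      rw [if_pos h0]; omega
    · have := (M.plane.euler_short hW hUB p0 (T := insert E0 (SH G E0)) fun q _ hq => by
        rw [mem_insert, mem_sh]
        by_cases h : J G side {q} = E0
        exacts [.inl h, .inr ⟨hq, h⟩]).1
      rw [sum_insert (by simp [mem_sh]), M.outer.resolve_left h0, ← I.card_b] at this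
      rw [if_neg h0]; omega
  have hb9 : B.card + (if E0 = ∅ then 0 else 6 - B.card) ≤ 9 := by
    have := I.le
    rw [← I.card_b] at this
    split_ifs <;> omega
  -- Euler's formula inside
  have hpo : PlO G ∅ := ⟨Φ, side, p0, M.plane, .inl rfl⟩
  obtain ⟨Ψ, f, q0, hpl, -⟩ := hpo.del (delG_le _) (H := delG G (B : Set V)) (fun u v h => by simp at h)
  have hW : ∀ u v, (delG G (B : Set V)).Adj u v → u ∈ U := fun u v h =>
    (mem_union.1 (hUB _ _ h.1)).resolve_right (by simpa using h.2.1)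
  have hT : ∀ Z, Short (delG G (B : Set V)) Z → Z ∈ (SH G E0).filter (InU U) := by
    intro Z hZ
    have hU : InU U Z := fun v hv => by
      obtain ⟨w, hw⟩ := on_iff.1 hv
      exact hW _ _ (hZ.1 _ _ hw)
    refine mem_filter.2 ⟨mem_sh.2 ⟨hZ.mono (delG_le _), ?_⟩, hU⟩
    rintro rfl
    obtain ⟨e, he⟩ := hZ.2.2.1
    induction e with | _ u v =>
    exact I.u_not_on (hU u (on_left he)) (on_left he)
  have e2 := fun p => hpl.euler_short hU0 hW p (T := (SH G E0).filter (InU U)) fun q _ hq => hT _ hq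
  rw [sum_filter] at e2
  by_cases hp : ∃ p, 6 ≤ (J (delG G (B : Set V)) f {p}).card
  · obtain ⟨p, hp⟩ := hp
    have := (e2 p).1
    omega
  · push Not at hp
    have h1 := (e2 q0).2 fun q => by have := hp q; omega
    have h2 : ∑ K ∈ SH G E0, (6 - K.card + (if InU U K then 4 else 0)) ≤ ∑ K ∈ SH G E0, 2 * (ball G U K).card :=
      sum_le_sum fun K hK => M.ball_card (mem_sh.1 hK).1 (mem_sh.1 hK).2
    have h3 := sum_ball_le I.far U (fun _ => 1) (S := SH G E0) fun K hK => (mem_sh.1 hK).1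
    have h4 : ∑ K ∈ SH G E0, (if InU U K then 4 else 0) = 4 * ((SH G E0).filter (InU U)).card := by
      rw [← sum_filter]
      simp [mul_comm]
    rw [sum_add_distrib, ← mul_sum, h4] at h2
    simp only [sum_const, smul_eq_mul, mul_one] at h2 h3
    omega

lemma ecol_of_inst (n : ℕ) : ∀ (G : SimpleGraph V) (U B : Finset V) (E0 : Finset (Sym2 V)), U.card = n → Inst G U B E0 → ECol G U B := by
  induction n using Nat.strong_induction_on with
  | _ n ih =>
    intro G U B E0 hn h
    by_contra hno
    obtain ⟨Φ, side, p0, h1, h2⟩ := h.pl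
    exact MCE.elim ⟨h, h1, h2, fun G' U' B' E0' hlt h' => ih _ (hn ▸ hlt) G' U' B' E0' rfl h', hno⟩

end Charges

section Grid
variable {N : ℕ}

/-- The square grid. -/
def gridG (N : ℕ) : SimpleGraph (Fin N × Fin N) where
  Adj u v := ((u.1 : ℕ) + 1 = v.1 ∧ (u.2 : ℕ) = v.2) ∨ ((v.1 : ℕ) + 1 = u.1 ∧ (u.2 : ℕ) = v.2) ∨
    ((u.1 : ℕ) = v.1 ∧ (u.2 : ℕ) + 1 = v.2) ∨ ((u.1 : ℕ) = v.1 ∧ (v.2 : ℕ) + 1 = u.2)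
  symm := ⟨fun u v h => by omega⟩
  loopless := ⟨fun u h => by omega⟩

/-- The faces of the grid, given by the corners of its cells. -/
def face (N i j : ℕ) : ℕ × ℕ := if 0 < i ∧ i < N ∧ 0 < j ∧ j < N then (i, j) else (0, 0)

/-- The face to the left of a dart. -/
def gside (N : ℕ) (u v : Fin N × Fin N) : ℕ × ℕ :=
  if (u.1 : ℕ) < v.1 then face N (u.1 + 1) (u.2 + 1) else if (v.1 : ℕ) < u.1 then face N u.1 u.2 else
    if (u.2 : ℕ) < v.2 then face N u.1 (u.2 + 1) else face N (u.1 + 1) u.2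

/-- The indicator of an edge with given ends. -/
noncomputable def eind (Z : Finset (Sym2 (Fin N × Fin N))) (i j i' j' : ℕ) : ZMod 2 :=
  if ∃ u w : Fin N × Fin N, s(u, w) ∈ Z ∧ (u.1 : ℕ) = i ∧ (u.2 : ℕ) = j ∧ (w.1 : ℕ) = i' ∧ (w.2 : ℕ) = j' then 1 else 0

variable {Z : Finset (Sym2 (Fin N × Fin N))}

lemma eind_cell (u w : Fin N × Fin N) : eind Z u.1 u.2 w.1 w.2 = if s(u, w) ∈ Z then 1 else 0 := by
  unfold eind
  congr 1
  rw [eq_iff_iff]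
  refine ⟨?_, fun h => ⟨u, w, h, rfl, rfl, rfl, rfl⟩⟩
  rintro ⟨u', w', h, h1, h2, h3, h4⟩
  rwa [show u' = u from Prod.ext (Fin.ext h1) (Fin.ext h2), show w' = w from Prod.ext (Fin.ext h3) (Fin.ext h4)] at h

lemma eind_comm (i j i' j' : ℕ) : eind Z i j i' j' = eind Z i' j' i j := by
  unfold eind
  congr 1
  rw [eq_iff_iff]
  constructor <;> exact fun ⟨u, w, h, h1, h2, h3, h4⟩ => ⟨w, u, Sym2.eq_swap ▸ h, h3, h4, h1, h2⟩

lemma eind_zero (hZ : EIn (gridG N) Z) {i j i' j' : ℕ} (h : (i' = i ∧ j' = j) ∨ N ≤ i' ∨ N ≤ j') : eind Z i j i' j' = 0 := by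
  refine if_neg ?_
  rintro ⟨u, w, h0, h1, h2, h3, h4⟩
  have := hZ _ _ h0
  simp only [gridG] at this
  omega

lemma sum_eind (u : Fin N × Fin N) (i' j' : ℕ) :
    ∑ w : Fin N × Fin N, (if s(u, w) ∈ Z ∧ (w.1 : ℕ) = i' ∧ (w.2 : ℕ) = j' then 1 else 0) = eind Z u.1 u.2 i' j' := by
  by_cases h : i' < N ∧ j' < N
  · have := eind_cell (Z := Z) u (⟨i', h.1⟩, ⟨j', h.2⟩)
    rw [this, sum_eq_single (⟨i', h.1⟩, ⟨j', h.2⟩)]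
    · simp
    · rintro w - hw
      exact if_neg fun h' => hw (Prod.ext (Fin.ext h'.2.1) (Fin.ext h'.2.2))
    · simp
  · rw [eind, if_neg, sum_eq_zero]
    · intro w _
      exact if_neg fun h' => h (by omega)
    · rintro ⟨_, w, -, -, -, h1, h2⟩
      exact h (by omega)

lemma bd_grid (hZ : EIn (gridG N) Z) (u : Fin N × Fin N) :
    bd Z u = eind Z u.1 u.2 (u.1 + 1) u.2 + eind Z u.1 u.2 (u.1 - 1) u.2 +
      (eind Z u.1 u.2 u.1 (u.2 + 1) + eind Z u.1 u.2 u.1 (u.2 - 1)) := by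
  rw [bd_nbrs univ fun _ _ => mem_univ _]
  simp only [← sum_eind, ← sum_add_distrib]
  refine sum_congr rfl fun w _ => ?_
  by_cases h : s(u, w) ∈ Z
  · have := hZ _ _ h
    simp only [gridG] at this
    simp only [h, true_and, if_true]
    split_ifs <;> first | omega | simp
  · simp [h]

lemma gside_face (u w : Fin N × Fin N) (h : (gridG N).Adj u w) :
    ((u.1 : ℕ) + 1 = w.1 ∧ (u.2 : ℕ) = w.2 ∧ gside N u w = face N (u.1 + 1) (u.2 + 1) ∧ gside N w u = face N (u.1 + 1) u.2) ∨
    ((w.1 : ℕ) + 1 = u.1 ∧ (u.2 : ℕ) = w.2 ∧ gside N u w = face N u.1 u.2 ∧ gside N w u = face N u.1 (u.2 + 1)) ∨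
    ((u.1 : ℕ) = w.1 ∧ (u.2 : ℕ) + 1 = w.2 ∧ gside N u w = face N u.1 (u.2 + 1) ∧ gside N w u = face N (u.1 + 1) (u.2 + 1)) ∨
    ((u.1 : ℕ) = w.1 ∧ (w.2 : ℕ) + 1 = u.2 ∧ gside N u w = face N (u.1 + 1) u.2 ∧ gside N w u = face N u.1 u.2) := by
  unfold gside
  rcases h with ⟨h1, h2⟩ | ⟨h1, h2⟩ | ⟨h1, h2⟩ | ⟨h1, h2⟩
  · refine .inl ⟨h1, h2, if_pos (by omega), ?_⟩
    rw [if_neg (by omega), if_pos (by omega), h1, h2]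
  · refine .inr (.inl ⟨h1, h2, ?_, ?_⟩)
    · rw [if_neg (by omega), if_pos (by omega)]
    · rw [if_pos (by omega), h1, h2]
  · refine .inr (.inr (.inl ⟨h1, h2, ?_, ?_⟩))
    · rw [if_neg (by omega), if_neg (by omega), if_pos (by omega)]
    · rw [if_neg (by omega), if_neg (by omega), if_neg (by omega), h1, h2]
  · refine .inr (.inr (.inr ⟨h1, h2, ?_, ?_⟩))
    · rw [if_neg (by omega), if_neg (by omega), if_neg (by omega)]
    · rw [if_neg (by omega), if_neg (by omega), if_pos (by omega), h1, h2]

/-- The number of jumps across a potential edge of the grid. -/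
lemma eind_J (A : Set (ℕ × ℕ)) (u : Fin N × Fin N) (a : ℕ → ℕ → ZMod 2) (ha : ∀ i j, a i j = if face N i j ∈ A then 1 else 0) :
    let Z := J (gridG N) (gside N) A
    eind Z u.1 u.2 (u.1 + 1) u.2 = a (u.1 + 1) (u.2 + 1) + a (u.1 + 1) u.2 ∧ eind Z u.1 u.2 (u.1 - 1) u.2 = a u.1 u.2 + a u.1 (u.2 + 1) ∧
    eind Z u.1 u.2 u.1 (u.2 + 1) = a u.1 (u.2 + 1) + a (u.1 + 1) (u.2 + 1) ∧ eind Z u.1 u.2 u.1 (u.2 - 1) = a (u.1 + 1) u.2 + a u.1 u.2 := by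
  intro Z
  have hZ : EIn (gridG N) Z := eIn_J
  have key : ∀ w, (gridG N).Adj u w → ∀ c d, gside N u w = c → gside N w u = d →
      (if s(u, w) ∈ Z then (1 : ZMod 2) else 0) = (if c ∈ A then 1 else 0) + (if d ∈ A then 1 else 0) := by
    rintro w hw _ _ rfl rfl
    have hs : s(u, w) ∈ Z ↔ _ := mem_J
    by_cases h1 : gside N u w ∈ A <;> by_cases h2 : gside N w u ∈ A <;> simp [hs, hw, h1, h2]
    exact (add_self_zmod 1).symm
  have hb : ∀ i j i' j', face N i j = face N i' j' → (0 : ZMod 2) = a i j + a i' j' := by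
    intro i j i' j' h
    rw [ha, ha, h]
    exact (add_self_zmod _).symm
  have l1 := u.1.2
  have l2 := u.2.2
  refine ⟨?_, ?_, ?_, ?_⟩
  · by_cases h : (u.1 : ℕ) + 1 < N
    · rw [eind_cell u (⟨u.1 + 1, h⟩, u.2), ha, ha]
      have hw : (gridG N).Adj u (⟨u.1 + 1, h⟩, u.2) := by simp [gridG]
      rcases gside_face _ _ hw with h' | h' | h' | h' <;> first | exact key _ hw _ _ h'.2.2.1 h'.2.2.2 | (simp at h'; try omega)
    · rw [eind_zero hZ (by omega)]
      exact hb _ _ _ _ (by simp [face, h])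
  · by_cases h : 0 < (u.1 : ℕ)
    · rw [eind_cell u (⟨u.1 - 1, by omega⟩, u.2), ha, ha]
      have hw : (gridG N).Adj u (⟨u.1 - 1, by omega⟩, u.2) := by simp [gridG]; omega
      rcases gside_face _ _ hw with h' | h' | h' | h' <;> first | exact key _ hw _ _ h'.2.2.1 h'.2.2.2 | (simp at h'; try omega)
    · rw [eind_zero hZ (by omega)]
      exact hb _ _ _ _ (by simp [face, h])
  · by_cases h : (u.2 : ℕ) + 1 < N
    · rw [eind_cell u (u.1, ⟨u.2 + 1, h⟩), ha, ha]
      have hw : (gridG N).Adj u (u.1, ⟨u.2 + 1, h⟩) := by simp [gridG]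
      rcases gside_face _ _ hw with h' | h' | h' | h' <;> first | exact key _ hw _ _ h'.2.2.1 h'.2.2.2 | (simp at h'; try omega)
    · rw [eind_zero hZ (by omega)]
      exact hb _ _ _ _ (by simp [face, h])
  · by_cases h : 0 < (u.2 : ℕ)
    · rw [eind_cell u (u.1, ⟨u.2 - 1, by omega⟩), ha, ha]
      have hw : (gridG N).Adj u (u.1, ⟨u.2 - 1, by omega⟩) := by simp [gridG]; omega
      rcases gside_face _ _ hw with h' | h' | h' | h' <;> first | exact key _ hw _ _ h'.2.2.1 h'.2.2.2 | (simp at h'; try omega)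
    · rw [eind_zero hZ (by omega)]
      exact hb _ _ _ _ (by simp [face, h])

end Grid

section Grid2
variable {N : ℕ}

lemma grid_even (A : Set (ℕ × ℕ)) : bd (J (gridG N) (gside N) A) = 0 := by
  funext u
  obtain ⟨h1, h2, h3, h4⟩ := eind_J A u (fun i j => if face N i j ∈ A then 1 else 0) fun _ _ => rfl
  rw [bd_grid eIn_J, h1, h2, h3, h4]
  generalize (if face N (u.1 + 1) (u.2 + 1) ∈ A then (1 : ZMod 2) else 0) = a
  generalize (if face N (u.1 + 1) u.2 ∈ A then (1 : ZMod 2) else 0) = b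
  generalize (if face N u.1 (u.2 + 1) ∈ A then (1 : ZMod 2) else 0) = c
  generalize (if face N u.1 u.2 ∈ A then (1 : ZMod 2) else 0) = d
  show _ = (0 : ZMod 2)
  revert a b c d
  decide

lemma grid_loc (A : Set (ℕ × ℕ)) (v : Fin N × Fin N)
    (h : ∀ w, (gridG N).Adj v w → (gside N v w ∈ A ↔ gside N w v ∈ A)) (w w' : Fin N × Fin N)
    (hw : (gridG N).Adj v w) (hw' : (gridG N).Adj v w') (hA : gside N v w ∈ A) : gside N v w' ∈ A := by
  have key : ∀ w c d, (gridG N).Adj v w → gside N v w = c → gside N w v = d → (c ∈ A ↔ d ∈ A) := by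
    rintro w _ _ hw rfl rfl
    exact h w hw
  have hb : ∀ i j i' j', face N i j = face N i' j' → (face N i j ∈ A ↔ face N i' j' ∈ A) := fun i j i' j' h => by rw [h]
  have l1 := v.1.2
  have l2 := v.2.2
  have k1 : face N (v.1 + 1) (v.2 + 1) ∈ A ↔ face N (v.1 + 1) v.2 ∈ A := by
    by_cases h : (v.1 : ℕ) + 1 < N
    · have hw : (gridG N).Adj v (⟨v.1 + 1, h⟩, v.2) := by simp [gridG]
      rcases gside_face _ _ hw with h' | h' | h' | h' <;> first | exact key _ _ _ hw h'.2.2.1 h'.2.2.2 | (simp at h'; try omega)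
    · exact hb _ _ _ _ (by simp [face, h])
  have k2 : face N v.1 v.2 ∈ A ↔ face N v.1 (v.2 + 1) ∈ A := by
    by_cases h : 0 < (v.1 : ℕ)
    · have hw : (gridG N).Adj v (⟨v.1 - 1, by omega⟩, v.2) := by simp [gridG]; omega
      rcases gside_face _ _ hw with h' | h' | h' | h' <;> first | exact key _ _ _ hw h'.2.2.1 h'.2.2.2 | (simp at h'; try omega)
    · exact hb _ _ _ _ (by simp [face, h])
  have k3 : face N v.1 (v.2 + 1) ∈ A ↔ face N (v.1 + 1) (v.2 + 1) ∈ A := by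
    by_cases h : (v.2 : ℕ) + 1 < N
    · have hw : (gridG N).Adj v (v.1, ⟨v.2 + 1, h⟩) := by simp [gridG]
      rcases gside_face _ _ hw with h' | h' | h' | h' <;> first | exact key _ _ _ hw h'.2.2.1 h'.2.2.2 | (simp at h'; try omega)
    · exact hb _ _ _ _ (by simp [face, h])
  have all : ∀ w, (gridG N).Adj v w → (gside N v w ∈ A ↔ face N v.1 v.2 ∈ A) := by
    intro w hw
    rcases gside_face _ _ hw with h' | h' | h' | h' <;> rw [h'.2.2.1]
    exacts [(k2.trans k3).symm, k2.symm, (k2.trans k3 |>.trans k1).symm]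
  exact (all w' hw').2 ((all w hw).1 hA)

lemma grid_cyc (Z : Finset (Sym2 (Fin N × Fin N))) (hZ : EIn (gridG N) Z) (hb : bd Z = 0) :
    ∃ A : Set (ℕ × ℕ), J (gridG N) (gside N) A = Z := by
  obtain ⟨χ, hχ⟩ : ∃ χ : ℕ → ℕ → ZMod 2, χ = fun i j => ∑ k ∈ range j, eind Z (i - 1) k i k := ⟨_, rfl⟩
  have hs : ∀ i j, χ i (j + 1) = χ i j + eind Z (i - 1) j i j := fun i j => by rw [hχ]; exact sum_range_succ _ _
  have h0 : ∀ j, χ 0 j = 0 := fun j => by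
    rw [hχ]; exact sum_eq_zero fun k _ => eind_zero hZ (.inl ⟨rfl, rfl⟩)
  have hN : ∀ j, χ N j = 0 := fun j => by
    rw [hχ]; exact sum_eq_zero fun k _ => eind_zero hZ (.inr (.inl le_rfl))
  have h0' : ∀ i, χ i 0 = 0 := fun i => by rw [hχ]; simp
  have c1 : ∀ i < N, ∀ k ≤ N, χ (i + 1) k + χ i k = eind Z i (k - 1) i k := by
    intro i hi k
    induction k with
    | zero => exact fun _ => by rw [h0', h0', eind_zero hZ (.inl ⟨rfl, rfl⟩), add_zero]
    | succ k ih =>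
      intro hk
      have e1 := ih (by omega)
      have e2 := congrFun hb (⟨i, hi⟩, ⟨k, hk⟩)
      rw [bd_grid hZ] at e2
      simp only [Pi.zero_apply] at e2
      rw [hs, hs, eind_comm (i - 1), Nat.add_sub_cancel, Nat.add_sub_cancel]
      rw [eind_comm i (k - 1)] at e1
      clear hs hN h0 h0' hχ ih
      revert e1 e2
      generalize χ (i + 1) k = x1
      generalize χ i k = x2
      generalize eind Z i k (i + 1) k = x3
      generalize eind Z i k (i - 1) k = x4
      generalize eind Z i k i (k + 1) = x5
      generalize eind Z i k i (k - 1) = x6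
      revert x1 x2 x3 x4 x5 x6
      decide
  have hN' : ∀ i ≤ N, χ i N = 0 := by
    intro i
    induction i with
    | zero => exact fun _ => h0 _
    | succ i ih =>
      intro hi
      have := c1 i hi N le_rfl
      rwa [ih (by omega), add_zero, eind_zero hZ (.inr (.inr le_rfl))] at this
  obtain ⟨A, hA⟩ : ∃ A : Set (ℕ × ℕ), A = {c | χ c.1 c.2 = 1} := ⟨_, rfl⟩
  have ha : ∀ i j, (if i ≤ N ∧ j ≤ N then χ i j else if face N i j ∈ A then 1 else 0) = if face N i j ∈ A then (1 : ZMod 2) else 0 := by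
    intro i j
    split_ifs with h1 h2 h2
    · rw [hA] at h2
      simp only [face] at h2
      split_ifs at h2 with h3
      · exact h2
      · exact absurd h2 (by simp [h0])
    · rcases zmod_cases (χ i j) with h | h
      · exact h
      · refine absurd ?_ h2
        have : 0 < i ∧ i < N ∧ 0 < j ∧ j < N := by
          refine ⟨?_, ?_, ?_, ?_⟩ <;> by_contra h3
          · rw [show i = 0 by omega, h0] at h; exact zero_ne_one h
          · rw [show i = N by omega, hN] at h; exact zero_ne_one h
          · rw [show j = 0 by omega, h0'] at h; exact zero_ne_one h
          · rw [show j = N by omega, hN' i h1.1] at h; exact zero_ne_one h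
        rw [hA]
        simpa [face, this] using h
    · rfl
    · rfl
  refine ⟨A, ?_⟩
  have key : ∀ u w : Fin N × Fin N, ((u.1 : ℕ) + 1 = w.1 ∧ (u.2 : ℕ) = w.2) ∨ ((u.1 : ℕ) = w.1 ∧ (u.2 : ℕ) + 1 = w.2) →
      (s(u, w) ∈ J (gridG N) (gside N) A ↔ s(u, w) ∈ Z) := by
    intro u w h
    obtain ⟨e1, -, e3, -⟩ := eind_J A u _ ha
    have l1 := u.1.2
    have l2 := u.2.2
    suffices h : eind (J (gridG N) (gside N) A) u.1 u.2 w.1 w.2 = eind Z u.1 u.2 w.1 w.2 by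
      rw [eind_cell, eind_cell] at h
      split_ifs at h with h1 h2 h2
      exacts [iff_of_true h1 h2, absurd h one_ne_zero, absurd h zero_ne_one, iff_of_false h1 h2]
    rcases h with ⟨h1, h2⟩ | ⟨h1, h2⟩
    · rw [← h1, ← h2, e1, if_pos ⟨by omega, by omega⟩, if_pos ⟨by omega, by omega⟩, hs, Nat.add_sub_cancel, add_right_comm, add_self_zmod, zero_add]
    · rw [← h1, ← h2, e3, if_pos ⟨by omega, by omega⟩, if_pos ⟨by omega, by omega⟩, add_comm, c1 _ l1 _ l2, Nat.succ_sub_one]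
  refine eset_ext fun u w => ?_
  by_cases h : (gridG N).Adj u w
  · rcases h with h | h | h | h
    · exact key u w (.inl h)
    · rw [Sym2.eq_swap]; exact key w u (.inl ⟨h.1, h.2.symm⟩)
    · exact key u w (.inr h)
    · rw [Sym2.eq_swap]; exact key w u (.inr ⟨h.1.symm, h.2⟩)
  · exact iff_of_false (fun h' => h (eIn_J _ _ h')) fun h' => h (hZ _ _ h')

lemma plO_grid (N : ℕ) : PlO (gridG N) ∅ :=
  ⟨_, gside N, (0, 0), ⟨grid_even, grid_cyc, grid_loc⟩, .inl rfl⟩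

end Grid2

section Minor
variable {C : Type} [Finite C] {G : SimpleGraph V} {root : V → C}

lemma bd_transfer [Finite V] (hi : Function.Injective root) {Z : Finset (Sym2 V)} {Z' : Finset (Sym2 C)}
    (h : ∀ u v, s(u, v) ∈ Z ↔ s(root u, root v) ∈ Z') (hZ : EIn (G.map (⟨root, hi⟩ : V ↪ C)) Z') : bd Z = 0 ↔ bd Z' = 0 := by
  have := Fintype.ofFinite V
  have h1 : ∀ v, bd Z v = bd Z' (root v) := by
    intro v
    rw [bd_nbrs univ fun _ _ => mem_univ _, bd_nbrs (univ.image root), sum_image fun _ _ _ _ e => hi e]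
    · simp only [h]
    · intro w hw
      obtain ⟨a, b, -, -, rfl⟩ := (SimpleGraph.map_adj _ _ _ _).1 (hZ _ _ hw)
      simp
  have h2 : ∀ c, (∀ v, root v ≠ c) → bd Z' c = 0 := by
    intro c hc
    rw [bd_nbrs ∅, sum_empty]
    intro w hw
    obtain ⟨a, b, -, rfl, -⟩ := (SimpleGraph.map_adj _ _ _ _).1 (hZ _ _ hw)
    exact absurd rfl (hc a)
  constructor
  · intro h0
    funext c
    by_cases hc : ∃ v, root v = c
    · obtain ⟨v, rfl⟩ := hc
      rw [← h1, h0]; rfl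
    · exact h2 c fun v hv => hc ⟨v, hv⟩
  · intro h0
    funext v
    rw [h1, h0]; rfl

lemma PlO.transfer [Finite V] {Gr : SimpleGraph C} (h : PlO Gr ∅) (hi : Function.Injective root)
    (hG : ∀ u v, G.Adj u v → Gr.Adj (root u) (root v)) : PlO G ∅ := by
  have hle : G.map (⟨root, hi⟩ : V ↪ C) ≤ Gr := by
    intro a b hab
    obtain ⟨u, v, h, rfl, rfl⟩ := (SimpleGraph.map_adj _ _ _ _).1 hab
    exact hG _ _ h
  obtain ⟨Φ, side, p, hp, -⟩ := h.del hle (by intro _ _ h; simp at h)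
  have hadj : ∀ u v, (G.map (⟨root, hi⟩ : V ↪ C)).Adj (root u) (root v) ↔ G.Adj u v := fun u v => SimpleGraph.map_adj_apply (f := ⟨root, hi⟩)
  have hJ : ∀ A u v, s(u, v) ∈ J G (fun u v => side (root u) (root v)) A ↔ s(root u, root v) ∈ J (G.map (⟨root, hi⟩ : V ↪ C)) side A := by
    intro A u v
    rw [mem_J, mem_J, hadj]
  refine ⟨Φ, _, p, ⟨fun A => (bd_transfer hi (hJ A) eIn_J).2 (hp.even A), fun Z hZ hb => ?_, fun A v hv w w' hw hw' => ?_⟩, .inl rfl⟩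
  · have hm : ∀ u v, s(u, v) ∈ Z ↔ s(root u, root v) ∈ Z.image (Sym2.map root) := by
      intro u v
      rw [mem_image]
      refine ⟨fun h => ⟨_, h, rfl⟩, ?_⟩
      rintro ⟨e, he, h⟩
      rwa [← Sym2.map.injective hi (h.trans (Sym2.map_mk root u v).symm)]
    have hE : EIn (G.map (⟨root, hi⟩ : V ↪ C)) (Z.image (Sym2.map root)) := by
      intro a b hab
      obtain ⟨e, he, h⟩ := mem_image.1 hab
      induction e with | _ u v =>
      rw [← SimpleGraph.mem_edgeSet, ← h]
      exact (hadj u v).2 (hZ _ _ he)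
    obtain ⟨A, hA⟩ := hp.cyc _ hE ((bd_transfer hi hm hE).1 hb)
    exact ⟨A, eset_ext fun u v => by rw [hJ, hA, hm]⟩
  · refine hp.loc A (root v) (fun c hc => ?_) _ _ ((hadj _ _).2 hw) ((hadj _ _).2 hw')
    obtain ⟨a, b, hab, h1, rfl⟩ := (SimpleGraph.map_adj _ _ _ _).1 hc
    obtain rfl := hi h1
    exact hv b hab

/-- Reachability inside a class of a labelling. -/
def Rch (Gr : SimpleGraph C) (lab : C → V) : C → C → Prop :=
  Relation.ReflTransGen fun x y => Gr.Adj x y ∧ lab x = lab y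

lemma exists_contract {lab : C → V} (hr : ∀ v, lab (root v) = v) (n : ℕ) :
    ∀ Gr : SimpleGraph C, PlO Gr ∅ → {x | ∃ y, Gr.Adj x y}.ncard = n →
      (∀ u v, G.Adj u v → ∃ x y, Gr.Adj x y ∧ lab x = u ∧ lab y = v ∧ Rch Gr lab x (root u) ∧ Rch Gr lab y (root v)) →
      ∃ Gr' : SimpleGraph C, PlO Gr' ∅ ∧ ∀ u v, G.Adj u v → Gr'.Adj (root u) (root v) := by
  induction n using Nat.strong_induction_on with
  | _ n ih =>
  intro Gr hGr hn hG
  by_cases hex : ∃ p q, Gr.Adj p q ∧ lab p = lab q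
  · obtain ⟨p, q, hpq, hl, hq⟩ : ∃ p q, Gr.Adj p q ∧ lab p = lab q ∧ q ≠ root (lab q) := by
      obtain ⟨p, q, hpq, hl⟩ := hex
      by_cases hq : q = root (lab q)
      · exact ⟨q, p, hpq.symm, hl.symm, fun hp => hpq.ne (by rw [hp, hl, ← hq])⟩
      · exact ⟨p, q, hpq, hl, hq⟩
    obtain ⟨H, hH⟩ : ∃ H : SimpleGraph C, ∀ u v, H.Adj u v ↔ Gr.Adj u v ∧ ¬ (u = q ∧ Gr.Adj p v) ∧ ¬ (v = q ∧ Gr.Adj p u) :=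
      ⟨⟨fun u v => Gr.Adj u v ∧ ¬ (u = q ∧ Gr.Adj p v) ∧ ¬ (v = q ∧ Gr.Adj p u), ⟨fun u v h => ⟨h.1.symm, h.2.2, h.2.1⟩⟩,
        ⟨fun v h => h.1.ne rfl⟩⟩, fun _ _ => Iff.rfl⟩
    have hne := hpq.ne
    have hHpq : H.Adj p q := (hH _ _).2 ⟨hpq, fun h => hne h.1, fun h => Gr.irrefl h.2⟩
    have hM := (hGr.del (H := H) (fun u v h => ((hH _ _).1 h).1) (by intro _ _ h; simp at h)).merge hHpq
      (fun w h1 h2 => ((hH _ _).1 h2).2.1 ⟨rfl, ((hH _ _).1 h1).1⟩) (by rintro ⟨e, he, -⟩; simp at he)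
    have hml : ∀ x, lab (mrg p q x) = lab x := by
      intro x
      unfold mrg
      split_ifs with h
      · rw [hl, h]
      · rfl
    have hmr : ∀ v, mrg p q (root v) = root v := fun v => if_neg fun h => hq (by rw [← h, hr])
    have hma : ∀ x y, Gr.Adj x y → mrg p q x ≠ mrg p q y → (mergeG H p q).Adj (mrg p q x) (mrg p q y) := by
      have key : ∀ y, Gr.Adj q y → y ≠ p → (mergeG H p q).Adj p y := by
        intro y hy hyp
        refine ⟨hne, hy.ne', Ne.symm hyp, ?_⟩
        by_cases h : Gr.Adj p y
        · exact .inl ((hH _ _).2 ⟨h, fun h' => hne h'.1, fun h' => hy.ne' h'.1⟩)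
        · exact .inr (.inl ⟨rfl, (hH _ _).2 ⟨hy, fun h' => h h'.2, fun h' => hy.ne' h'.1⟩⟩)
      intro x y hxy hm
      unfold mrg at hm ⊢
      split_ifs at hm ⊢ with h1 h2 h2
      · exact absurd rfl hm
      · exact key y (h1 ▸ hxy) (Ne.symm hm)
      · exact (key x (h2 ▸ hxy.symm) hm).symm
      · exact ⟨h1, h2, hm, .inl ((hH _ _).2 ⟨hxy, fun h => h1 h.1, fun h => h2 h.1⟩)⟩
    have hR : ∀ x y, Rch Gr lab x y → Rch (mergeG H p q) lab (mrg p q x) (mrg p q y) := by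
      intro x y h
      refine Relation.ReflTransGen.lift' (mrg p q) (fun a b hab => ?_) _ _ h
      by_cases e : mrg p q a = mrg p q b
      · rw [Function.onFun, e]
      · exact .single ⟨hma _ _ hab.1 e, by rw [hml, hml, hab.2]⟩
    refine ih _ ?_ _ hM rfl fun u v huv => ?_
    · rw [← hn]
      refine Set.ncard_lt_ncard ⟨?_, fun h => ?_⟩ (Set.toFinite _)
      · rintro x ⟨y, h1, h2, h3, h4 | ⟨rfl, h4⟩ | ⟨-, h4⟩⟩
        exacts [⟨y, ((hH _ _).1 h4).1⟩, ⟨q, hpq⟩, ⟨q, ((hH _ _).1 h4).1⟩]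
      · obtain ⟨y, h1, -⟩ := h (show q ∈ _ from ⟨p, hpq.symm⟩)
        exact h1 rfl
    · obtain ⟨x, y, h1, h2, h3, h4, h5⟩ := hG u v huv
      refine ⟨mrg p q x, mrg p q y, hma _ _ h1 fun e => huv.ne ?_, by rw [hml, h2], by rw [hml, h3], ?_, ?_⟩
      · rw [← h2, ← h3, ← hml x, ← hml y, e]
      · rw [← hmr u]; exact hR _ _ h4
      · rw [← hmr v]; exact hR _ _ h5
  · have hR : ∀ x y, Rch Gr lab x y → x = y := by
      intro x y h
      induction h with
      | refl => rfl
      | tail _ h _ => exact absurd ⟨_, _, h⟩ hex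
    refine ⟨Gr, hGr, fun u v huv => ?_⟩
    obtain ⟨x, y, h1, -, -, h4, h5⟩ := hG u v huv
    rwa [← hR _ _ h4, ← hR _ _ h5]

lemma PlO.minor [Finite V] {Gr : SimpleGraph C} (h : PlO Gr ∅) {lab : C → V} (hr : ∀ v, lab (root v) = v)
    (hG : ∀ u v, G.Adj u v → ∃ x y, Gr.Adj x y ∧ lab x = u ∧ lab y = v ∧ Rch Gr lab x (root u) ∧ Rch Gr lab y (root v)) :
    PlO G ∅ := by
  have hi : Function.Injective root := fun a b e => by rw [← hr a, ← hr b, e]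
  obtain ⟨Gr', h1, h2⟩ := exists_contract hr _ Gr h rfl hG
  exact h1.transfer hi h2

end Minor

section Topo
open scoped Topology

lemma exists_thickening_disjoint {ι : Type} [Finite ι] {K : ι → Set (ℝ × ℝ)} (hc : ∀ i, IsCompact (K i)) :
    ∃ η > 0, ∀ i j, Disjoint (K i) (K j) → Disjoint (Metric.thickening η (K i)) (Metric.thickening η (K j)) := by
  have : ∀ᶠ η in 𝓝[>] (0 : ℝ), ∀ i j, Disjoint (K i) (K j) → Disjoint (Metric.thickening η (K i)) (Metric.thickening η (K j)) := by
    simp only [Filter.eventually_all]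
    intro i j h
    obtain ⟨δ, h1, h2⟩ := h.exists_thickenings (hc i) (hc j).isClosed
    filter_upwards [Ioo_mem_nhdsGT h1] with η hη
    exact h2.mono (Metric.thickening_mono hη.2.le _) (Metric.thickening_mono hη.2.le _)
  obtain ⟨η, h1, h2⟩ := (this.and self_mem_nhdsWithin).exists
  exact ⟨η, h2, h1⟩

/-- Finitely many compact connected sets can be approximated by connected sets of grid cells. -/
lemma exists_discretization {ι : Type} [Finite ι] {K : ι → Set (ℝ × ℝ)} (hc : ∀ i, IsCompact (K i))
    (hp : ∀ i, IsPreconnected (K i)) :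
    ∃ (N : ℕ) (q : ℝ × ℝ → Fin N × Fin N) (D : ι → Set (Fin N × Fin N)), (∀ i j, Disjoint (K i) (K j) → Disjoint (D i) (D j)) ∧
      ∀ i, ∀ x ∈ K i, ∀ y ∈ K i, q x ∈ D i ∧
        Relation.ReflTransGen (fun a b => (gridG N).Adj a b ∧ a ∈ D i ∧ b ∈ D i) (q x) (q y) := by
  obtain ⟨η, hη, hd⟩ := exists_thickening_disjoint hc
  obtain ⟨μ, hμ, hμη⟩ : ∃ μ > 0, 3 * μ = η := ⟨η / 3, by positivity, by ring⟩
  obtain ⟨R, hR⟩ := (isCompact_iUnion hc).isBounded.subset_closedBall 0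
  obtain ⟨N, hN⟩ : ∃ N : ℕ, N = ⌊2 * R / μ⌋₊ + 1 := ⟨_, rfl⟩
  have : Nonempty (Fin N) := ⟨⟨0, by omega⟩⟩
  have hfl : ∀ t, |t| ≤ R → ∃ k : Fin N, (k : ℝ) * μ ≤ t + R ∧ t + R < k * μ + μ := by
    intro t ht
    have h1 := abs_le.1 ht
    have h2 : 0 ≤ (t + R) / μ := div_nonneg (by linarith) hμ.le
    refine ⟨⟨⌊(t + R) / μ⌋₊, ?_⟩, (le_div_iff₀ hμ).1 (Nat.floor_le h2), ?_⟩
    · rw [hN, Nat.lt_succ_iff]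
      exact Nat.floor_mono (div_le_div_of_nonneg_right (by linarith) hμ.le)
    · have := (div_lt_iff₀ hμ).1 (Nat.lt_floor_add_one ((t + R) / μ))
      linarith
  have hK : ∀ x ∈ Metric.closedBall (0 : ℝ × ℝ) R, ∃ c : Fin N × Fin N,
      ((c.1 : ℝ) * μ ≤ x.1 + R ∧ x.1 + R < c.1 * μ + μ) ∧ (c.2 : ℝ) * μ ≤ x.2 + R ∧ x.2 + R < c.2 * μ + μ := by
    intro x hx
    have h := mem_closedBall_zero_iff.1 hx
    obtain ⟨k, hk⟩ := hfl x.1 ((norm_fst_le x).trans h)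
    obtain ⟨l, hl⟩ := hfl x.2 ((norm_snd_le x).trans h)
    exact ⟨(k, l), hk, hl⟩
  choose! q hq using hK
  refine ⟨N, q, fun i => {c | ((c.1 : ℝ) * μ - R, (c.2 : ℝ) * μ - R) ∈ Metric.thickening η (K i)}, fun i j h => ?_, fun i => ?_⟩
  · exact Set.disjoint_left.2 fun c h1 h2 => Set.disjoint_left.1 (hd i j h) h1 h2
  set D := {c : Fin N × Fin N | ((c.1 : ℝ) * μ - R, (c.2 : ℝ) * μ - R) ∈ Metric.thickening η (K i)} with hD
  have hq' := fun x hx => hq x (hR (Set.mem_iUnion_of_mem i hx))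
  have hmem : ∀ x ∈ K i, ∀ y ∈ K i, dist x y < μ → ((q y).1, (q x).2) ∈ D := by
    intro x hx y hy hxy
    obtain ⟨⟨-, -⟩, a3, a4⟩ := hq' x hx
    obtain ⟨⟨b1, b2⟩, -⟩ := hq' y hy
    obtain ⟨h1, -⟩ := max_lt_iff.1 hxy
    rw [Real.dist_eq, abs_lt] at h1
    refine Metric.mem_thickening_iff.2 ⟨x, hx, max_lt ?_ ?_⟩ <;> rw [Real.dist_eq, abs_lt] <;> constructor <;> dsimp only <;> linarith
  have hmem' : ∀ x ∈ K i, q x ∈ D := fun x hx => hmem x hx x hx (by simpa)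
  have hclose : ∀ (k l : Fin N) (s t : ℝ), |s - t| < μ → ((k : ℝ) * μ ≤ s + R ∧ s + R < k * μ + μ) →
      ((l : ℝ) * μ ≤ t + R ∧ t + R < l * μ + μ) → (k : ℕ) ≤ l + 1 := by
    intro k l s t h h1 h2
    have := abs_lt.1 h
    have h3 : (k : ℝ) < l + 2 := lt_of_mul_lt_mul_right (a := μ) (by linarith) hμ.le
    exact Nat.lt_succ_iff.1 (by exact_mod_cast h3)
  refine fun x hx y hy => ⟨hmem' x hx, (hp i).induction₂
    (fun x y => Relation.ReflTransGen (fun a b => (gridG N).Adj a b ∧ a ∈ D ∧ b ∈ D) (q x) (q y))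
    (fun x hx => ?_) (fun _ _ _ _ _ _ => .trans) (fun _ _ _ _ h => ?_) hx hy⟩
  · filter_upwards [inter_mem_nhdsWithin (K i) (Metric.ball_mem_nhds x hμ)] with y hy
    have hxy : dist x y < μ := Metric.mem_ball'.1 hy.2
    have hm := hmem x hx y hy.1 hxy
    obtain ⟨h1, h2⟩ := max_lt_iff.1 hxy
    obtain ⟨a1, a2⟩ := hq' x hx
    obtain ⟨b1, b2⟩ := hq' y hy.1
    have c1 := hclose _ _ _ _ h1 a1 b1
    have c2 := hclose _ _ _ _ h2 a2 b2
    rw [_root_.dist_comm] at h1 h2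
    have c3 := hclose _ _ _ _ h1 b1 a1
    have c4 := hclose _ _ _ _ h2 b2 a2
    have step : ∀ a b, a ∈ D → b ∈ D → (a ≠ b → (gridG N).Adj a b) →
        Relation.ReflTransGen (fun a b => (gridG N).Adj a b ∧ a ∈ D ∧ b ∈ D) a b := by
      intro a b ha hb h
      by_cases e : a = b
      · rw [e]
      · exact .single ⟨h e, ha, hb⟩
    refine (step _ _ (hmem' x hx) hm fun h => ?_).trans (step _ _ hm (hmem' y hy.1) fun h => ?_) <;>
      rw [Ne, Prod.ext_iff, Fin.ext_iff, Fin.ext_iff] at h <;> simp only [gridG, true_and, and_true] at h ⊢ <;> omega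
  · have : Std.Symm fun a b => (gridG N).Adj a b ∧ a ∈ D ∧ b ∈ D := ⟨fun a b h => ⟨h.1.symm, h.2.2, h.2.1⟩⟩
    exact Relation.ReflTransGen.symmetric.symm _ _ h

end Topo

section Topo2
variable {G : SimpleGraph V} {vtx : V → ℝ × ℝ} {arc : V → V → ℝ → ℝ × ℝ}

lemma IsPlaneEmbedding.arc_eq (h : IsPlaneEmbedding G vtx arc) {u v a b : V} {s t : ℝ} (huv : G.Adj u v) (hab : G.Adj a b)
    (hs : s ∈ Set.Ioo (0 : ℝ) 1) (ht : t ∈ Set.Ioo (0 : ℝ) 1) (e : arc u v s = arc a b t) :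
    (u = a ∧ v = b ∧ s = t) ∨ (u = b ∧ v = a ∧ s = 1 - t) := by
  by_cases hne : s(u, v) = s(a, b)
  · have hI := Set.Ioo_subset_Icc_self (a := (0 : ℝ)) (b := 1)
    rcases Sym2.eq_iff.1 hne with ⟨rfl, rfl⟩ | ⟨rfl, rfl⟩
    · exact .inl ⟨rfl, rfl, h.arc_injOn huv (hI hs) (hI ht) e⟩
    · rw [h.arc_symm huv] at e
      exact .inr ⟨rfl, rfl, h.arc_injOn huv (hI hs) (hI ⟨by linarith [ht.2], by linarith [ht.1]⟩) e⟩
  · exact ((h.arc_disjoint huv hab hne).subset ⟨⟨s, hs, rfl⟩, ⟨t, ht, e.symm⟩⟩).elim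

/-- A vertex together with the initial thirds of its edges. -/
def star (G : SimpleGraph V) (vtx : V → ℝ × ℝ) (arc : V → V → ℝ → ℝ × ℝ) (w : V) : Set (ℝ × ℝ) :=
  insert (vtx w) (⋃ x ∈ {x | G.Adj w x}, arc w x '' Set.Icc 0 (1 / 3))

lemma IsPlaneEmbedding.mem_star (h : IsPlaneEmbedding G vtx arc) {w : V} {z : ℝ × ℝ} (hz : z ∈ star G vtx arc w) :
    z = vtx w ∨ ∃ x, G.Adj w x ∧ ∃ s ∈ Set.Ioo (0 : ℝ) 1, s ≤ 1 / 3 ∧ arc w x s = z := by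
  rcases hz with hz | hz
  · exact .inl hz
  · obtain ⟨x, hx, s, hs, rfl⟩ := Set.mem_iUnion₂.1 hz
    rcases hs.1.eq_or_lt with rfl | h0
    · exact .inl (h.arc_start hx)
    · exact .inr ⟨x, hx, s, ⟨h0, by linarith [hs.2]⟩, hs.2, rfl⟩

lemma IsPlaneEmbedding.disjoint_star (h : IsPlaneEmbedding G vtx arc) {u v : V} (huv : u ≠ v) :
    Disjoint (star G vtx arc u) (star G vtx arc v) := by
  refine Set.disjoint_left.2 fun z hu hv => ?_
  rcases h.mem_star hu with rfl | ⟨x, hx, s, hs, h1, e1⟩ <;> rcases h.mem_star hv with e | ⟨y, hy, t, ht, h2, e2⟩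
  · exact huv (h.vtx_inj e)
  · exact h.arc_avoids_vtx hy _ ⟨t, ht, e2⟩
  · exact h.arc_avoids_vtx hx _ ⟨s, hs, e1.trans e⟩
  · rcases h.arc_eq hx hy hs ht (e1.trans e2.symm) with ⟨e, -⟩ | ⟨-, -, e⟩
    · exact huv e
    · linarith

lemma IsPlaneEmbedding.disjoint_star_arc (h : IsPlaneEmbedding G vtx arc) {w a b : V} (hab : G.Adj a b) (ha : w ≠ a) (hb : w ≠ b) :
    Disjoint (star G vtx arc w) (arc a b '' Set.Icc (1 / 3) (2 / 3)) := by
  refine Set.disjoint_left.2 ?_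
  rintro z hw ⟨t, ht, rfl⟩
  have ht' : t ∈ Set.Ioo (0 : ℝ) 1 := ⟨by linarith [ht.1], by linarith [ht.2]⟩
  rcases h.mem_star hw with e | ⟨x, hx, s, hs, h1, e1⟩
  · exact h.arc_avoids_vtx hab _ ⟨t, ht', e⟩
  · rcases h.arc_eq hx hab hs ht' e1 with ⟨e, -⟩ | ⟨e, -⟩
    exacts [ha e, hb e]

lemma IsPlaneEmbedding.isCompact_star [Finite V] (h : IsPlaneEmbedding G vtx arc) (w : V) : IsCompact (star G vtx arc w) :=
  ((Set.toFinite _).isCompact_biUnion fun x hx => isCompact_Icc.image_of_continuousOn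
    ((h.arc_cont hx).mono (Set.Icc_subset_Icc_right (by norm_num)))).insert _

lemma IsPlaneEmbedding.isPreconnected_star (h : IsPlaneEmbedding G vtx arc) (w : V) : IsPreconnected (star G vtx arc w) := by
  refine isPreconnected_of_forall (vtx w) ?_
  rintro y (rfl | hy)
  · exact ⟨{vtx w}, by simp [star], rfl, rfl, isPreconnected_singleton⟩
  · obtain ⟨x, hx, hy⟩ := Set.mem_iUnion₂.1 hy
    exact ⟨_, (Set.subset_biUnion_of_mem (u := fun x => arc w x '' Set.Icc 0 (1 / 3)) hx).trans (Set.subset_insert _ _),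
      ⟨0, by norm_num, h.arc_start hx⟩, hy, isPreconnected_Icc.image _ ((h.arc_cont hx).mono (Set.Icc_subset_Icc_right (by norm_num)))⟩

lemma IsPlaneEmbedding.plO [Finite V] [Nonempty V] (h : IsPlaneEmbedding G vtx arc) : PlO G ∅ := by
  have hab' : ∀ e : G.edgeSet, ∃ a b, s(a, b) = e.1 := fun e => ⟨e.1.out.1, e.1.out.2, Quot.out_eq _⟩
  choose a b hab using hab'
  have hadj : ∀ e, G.Adj (a e) (b e) := fun e => by rw [← SimpleGraph.mem_edgeSet, hab]; exact e.2
  have hI : Set.Icc (1 / 3 : ℝ) (2 / 3) ⊆ Set.Icc 0 1 := Set.Icc_subset_Icc (by norm_num) (by norm_num)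
  obtain ⟨N, q, D, hdis, hconn⟩ := exists_discretization
    (K := fun i : V ⊕ G.edgeSet => i.elim (star G vtx arc) fun e => arc (a e) (b e) '' Set.Icc (1 / 3) (2 / 3))
    (by rintro (w | e)
        exacts [h.isCompact_star w, isCompact_Icc.image_of_continuousOn ((h.arc_cont (hadj e)).mono hI)])
    (by rintro (w | e)
        exacts [h.isPreconnected_star w, isPreconnected_Icc.image _ ((h.arc_cont (hadj e)).mono hI)])
  have dV : ∀ u v c, c ∈ D (.inl u) → c ∈ D (.inl v) → u = v := fun u v c hu hv => by
    by_contra huv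
    exact Set.disjoint_left.1 (hdis (.inl u) (.inl v) (h.disjoint_star huv)) hu hv
  have dVE : ∀ w e c, c ∈ D (.inl w) → c ∈ D (.inr e) → w = a e ∨ w = b e := fun w e c hw he => by
    by_contra hne
    rw [not_or] at hne
    exact Set.disjoint_left.1 (hdis (.inl w) (.inr e) (h.disjoint_star_arc (hadj e) hne.1 hne.2)) hw he
  have dE : ∀ e e' c, c ∈ D (.inr e) → c ∈ D (.inr e') → e = e' := fun e e' c h1 h2 => by
    by_contra hne
    refine Set.disjoint_left.1 (hdis (.inr e) (.inr e') (Set.disjoint_left.2 ?_)) h1 h2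
    rintro _ ⟨s, hs, rfl⟩ ⟨t, ht, e0⟩
    refine hne (Subtype.ext ?_)
    rw [← hab, ← hab]
    rcases h.arc_eq (hadj e') (hadj e) ⟨by linarith [ht.1], by linarith [ht.2]⟩ ⟨by linarith [hs.1], by linarith [hs.2]⟩ e0 with e | e
    · rw [e.1, e.2.1]
    · rw [e.1, e.2.1, Sym2.eq_swap]
  obtain ⟨C, hC⟩ : ∃ C : V → Set (Fin N × Fin N), ∀ w c, c ∈ C w ↔
      Relation.ReflTransGen (fun x y => (gridG N).Adj x y ∧ x ∈ D (.inl w) ∧ y ∈ D (.inl w)) (q (vtx w)) c := ⟨fun w => {c | _}, fun _ _ => Iff.rfl⟩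
  have hv : ∀ w, vtx w ∈ star G vtx arc w := fun w => .inl rfl
  have hCD : ∀ w c, c ∈ C w → c ∈ D (.inl w) := fun w c hc => by
    rcases ((hC w c).1 hc).cases_tail with rfl | ⟨_, -, h⟩
    exacts [(hconn (.inl w) _ (hv w) _ (hv w)).1, h.2.2]
  have hlab : ∀ c, ∃ l, (∀ w, c ∈ C w → l = w) ∧ ∀ e, c ∈ D (.inr e) → (∀ w, c ∉ C w) → l = a e := by
    intro c
    by_cases h1 : ∃ w, c ∈ C w
    · obtain ⟨w, hw⟩ := h1
      exact ⟨w, fun w' hw' => dV _ _ _ (hCD _ _ hw) (hCD _ _ hw'), fun e _ h => absurd hw (h w)⟩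
    · by_cases h2 : ∃ e, c ∈ D (.inr e)
      · obtain ⟨e, he⟩ := h2
        exact ⟨a e, fun w hw => absurd ⟨w, hw⟩ h1, fun e' he' _ => by rw [dE _ _ _ he he']⟩
      · exact ⟨Classical.arbitrary V, fun w hw => absurd ⟨w, hw⟩ h1, fun e he => absurd ⟨e, he⟩ h2⟩
  choose lab hl1 hl2 using hlab
  have hroot : ∀ w, q (vtx w) ∈ C w := fun w => (hC _ _).2 .refl
  have hreach : ∀ w c, c ∈ C w → Rch (gridG N) lab c (q (vtx w)) := fun w c hc => by
    have hc' := (hC w c).1 hc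
    clear hc
    induction hc' with
    | refl => exact .refl
    | tail h1 h2 ih => exact .head ⟨h2.1.symm, by rw [hl1 _ w ((hC _ _).2 (h1.tail h2)), hl1 _ w ((hC _ _).2 h1)]⟩ ih
  have hthird : ∀ u v, G.Adj u v → q (arc u v (1 / 3)) ∈ C u := fun u v huv =>
    (hC _ _).2 (hconn (.inl u) _ (hv u) _ (.inr (Set.mem_iUnion₂.2 ⟨v, huv, 1 / 3, by norm_num, rfl⟩))).2
  have cross : ∀ e, ∃ x y, (gridG N).Adj x y ∧ lab x = a e ∧ lab y = b e ∧ Rch (gridG N) lab x (q (vtx (a e))) ∧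
      Rch (gridG N) lab y (q (vtx (b e))) := by
    intro e
    by_contra hno
    have hp := (hconn (.inr e) _ ⟨1 / 3, by norm_num, rfl⟩ _ ⟨2 / 3, by norm_num, rfl⟩).2
    have key : ∀ c, Relation.ReflTransGen (fun x y => (gridG N).Adj x y ∧ x ∈ D (.inr e) ∧ y ∈ D (.inr e)) (q (arc (a e) (b e) (1 / 3))) c →
        lab c = a e ∧ Rch (gridG N) lab c (q (vtx (a e))) := by
      intro c hc
      induction hc with
      | refl => exact ⟨hl1 _ _ (hthird _ _ (hadj e)), hreach _ _ (hthird _ _ (hadj e))⟩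
      | @tail c d _ h2 ih =>
        suffices hd : lab d = a e from ⟨hd, .head ⟨h2.1.symm, hd.trans ih.1.symm⟩ ih.2⟩
        by_cases hd : ∃ w, d ∈ C w
        · obtain ⟨w, hw⟩ := hd
          rcases dVE w e d (hCD _ _ hw) h2.2.2 with rfl | rfl
          · exact hl1 _ _ hw
          · exact absurd ⟨c, d, h2.1, ih.1, hl1 _ _ hw, ih.2, hreach _ _ hw⟩ hno
        · exact hl2 _ _ h2.2.2 fun w hw => hd ⟨w, hw⟩
    have h1 := (key _ hp).1
    rw [show arc (a e) (b e) (2 / 3) = arc (b e) (a e) (1 / 3) by rw [h.arc_symm (hadj e)]; norm_num,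
      hl1 _ _ (hthird _ _ (hadj e).symm)] at h1
    exact (hadj e).ne' h1
  refine (plO_grid N).minor (root := fun v => q (vtx v)) (lab := lab) (fun v => hl1 _ _ (hroot v)) fun u v huv => ?_
  obtain ⟨x, y, h1, h2, h3, h4, h5⟩ := cross ⟨s(u, v), huv⟩
  rcases Sym2.eq_iff.1 (hab ⟨s(u, v), huv⟩) with ⟨e1, e2⟩ | ⟨e1, e2⟩ <;> rw [e1] at h2 h4 <;> rw [e2] at h3 h5
  exacts [⟨x, y, h1, h2, h3, h4, h5⟩, ⟨y, x, h1.symm, h3, h2, h5, h4⟩]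

end Topo2

section Final

lemma Short.exists_cycle {G : SimpleGraph V} {Z : Finset (Sym2 V)} (h : Short G Z) {a : V} (ha : On Z a) :
    ∃ c : G.Walk a a, c.IsCycle ∧ c.length ≤ 5 ∧ ∀ e, e ∈ c.edges ↔ e ∈ Z := by
  obtain ⟨e, he, hae⟩ := ha
  obtain ⟨b, rfl⟩ := hae
  rw [Sym2.eq_swap] at he
  obtain ⟨p, hp, hpe⟩ := h.isCirc.exists_path h.1 he
  have hm : ∀ e, e ∈ p.edges ↔ e ≠ s(b, a) ∧ e ∈ Z := fun e => by
    rw [← List.mem_toFinset, hpe, mem_erase]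
  refine ⟨.cons (h.1 b a he).symm p, (Walk.cons_isCycle_iff _ _).2 ⟨hp, fun hn => ((hm _).1 hn).1 Sym2.eq_swap⟩, ?_, fun e => ?_⟩
  · rw [Walk.length_cons, ← Walk.length_edges, ← List.toFinset_card_of_nodup hp.isTrail.edges_nodup, hpe,
      card_erase_add_one he]
    exact h.2.2.2
  · rw [Walk.edges_cons, List.mem_cons, hm, Sym2.eq_swap (a := a)]
    by_cases hb : e = s(b, a) <;> simp [hb, he]

lemma Far.of_cycles5Apart {G : SimpleGraph V} (h : Cycles5Apart G) (s : Set V) : Far (G.induce s) := by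
  intro Z Z' h1 h2 hne a b ha hb
  obtain ⟨c, c1, c2, c3⟩ := h1.exists_cycle ha
  obtain ⟨c', c1', c2', c3'⟩ := h2.exists_cycle hb
  have hinj : Function.Injective (Embedding.induce (G := G) s).toHom := Subtype.val_injective
  have key : 3 ≤ G.dist a.1 b.1 := h (c.map (Embedding.induce s).toHom) (c'.map (Embedding.induce s).toHom) (c1.map hinj)
    (c1'.map hinj) (by rwa [Walk.length_map]) (by rwa [Walk.length_map]) (fun e => hne ?_) _ (Walk.start_mem_support _) _
    (Walk.start_mem_support _)
  · refine ⟨fun e => ?_, fun e => ?_, fun w e e' => ?_⟩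
    · rw [e, SimpleGraph.dist_self] at key
      omega
    · have := key.trans (SimpleGraph.dist_le (Walk.cons (show G.Adj a b from e) .nil))
      simp at this
    · have := key.trans (SimpleGraph.dist_le (Walk.cons (show G.Adj a w from e) (.cons (show G.Adj w b from e') .nil)))
      simp at this
  · ext x
    rw [← c3, ← c3']
    have := Set.ext_iff.1 e (x.map Subtype.val)
    rw [Set.mem_setOf_eq, Set.mem_setOf_eq, Walk.edges_map, Walk.edges_map] at this
    exact (List.mem_map_of_injective (Sym2.map.injective hinj)).symm.trans
      (this.trans (List.mem_map_of_injective (Sym2.map.injective hinj)))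

lemma exists_finite_coloring {G : SimpleGraph V} (hp : IsPlanarGraph G) (hd : Cycles5Apart G) (s : Finset V) :
    ∃ c : V → Bool, (∀ u ∈ s, ∀ v ∈ s, G.Adj u v → c u = true → c v = false) ∧
      ∀ X ⊆ s, X.Nonempty → (∀ x ∈ X, c x = false) → ∃ v ∈ X, ∀ w ∈ X, ∀ w' ∈ X, G.Adj v w → G.Adj v w' → w = w' := by
  rcases s.eq_empty_or_nonempty with rfl | hs
  · exact ⟨fun _ => true, by simp, fun X h1 h2 => absurd (subset_empty.1 h1) h2.ne_empty⟩
  obtain ⟨vtx, arc, h⟩ := hp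
  have : Nonempty s := hs.to_subtype
  have hE : IsPlaneEmbedding (G.induce (s : Set V)) (fun v => vtx v) (fun u v => arc u v) :=
    ⟨fun _ _ e => Subtype.ext (h.vtx_inj e), fun _ _ e => h.arc_cont e, fun _ _ e => h.arc_injOn e, fun _ _ e => h.arc_start e,
      fun _ _ e => h.arc_end e, fun _ _ e => h.arc_symm e, fun _ _ e w => h.arc_avoids_vtx e w,
      fun u v u' v' e e' hne => h.arc_disjoint e e' fun e0 => hne (Sym2.map.injective Subtype.val_injective e0)⟩
  obtain ⟨c, -, h1, h2⟩ := ecol_of_inst _ (G.induce (s : Set V)) univ ∅ ∅ rfl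
    ⟨by simp, by simp, by intro _ _ h; simp at h, by simp [On], .inl rfl, by simp, hE.plO, Far.of_cycles5Apart hd _, by simp⟩ fun _ => true
  refine ⟨fun v => if hv : v ∈ s then c ⟨v, hv⟩ else true, fun u hu v hv huv => ?_, fun X hX hne hF => ?_⟩
  · simp only [hu, hv, dif_pos]
    exact h1 ⟨u, hu⟩ (mem_univ _) ⟨v, hv⟩ huv
  · obtain ⟨x, hx⟩ := hne
    obtain ⟨v, hv, hv'⟩ := h2 (univ.filter fun x => x.1 ∈ X) (fun x hx => by
      have := hF x.1 (by simpa using hx)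
      simpa using this) ⟨⟨x, hX hx⟩, by simpa⟩
    refine ⟨v, by simpa using hv, fun w hw w' hw' e e' => ?_⟩
    exact congrArg Subtype.val (hv' ⟨w, hX hw⟩ ⟨w', hX hw'⟩ (by simpa) (by simpa) e e')

end Final

end Coloring

/-- Every planar graph in which any two distinct cycles of
length at most `5` are at distance at least `3` is `(I,F)`-colorable. -/
theorem planar_dStar_ge_three_IFColorable {V : Type} (G : SimpleGraph V)
    (hplanar : IsPlanarGraph G) (hdist : Cycles5Apart G) :
    IFColorable G := by
  classical
  choose g h1 h2 using exists_finite_coloring hplanar hdist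
  obtain ⟨χ, hχ⟩ := Finset.rado_selection g
  refine ⟨χ, fun u v huv hu => ?_, fun v w hw hF => ?_⟩
  · obtain ⟨t, ht, h⟩ := hχ {u, v}
    rw [h u (by simp)] at hu
    rw [h v (by simp)]
    exact h1 t u (ht (by simp)) v (ht (by simp)) huv hu
  · obtain ⟨t, ht, h⟩ := hχ w.support.toFinset
    obtain ⟨x, hx, hx'⟩ := h2 t _ ht ⟨v, by simp⟩ fun x hx => by rw [← h x hx]; exact hF x (by simpa using hx)
    rw [List.mem_toFinset] at hx
    have hc := hw.rotate hx
    have hs : ∀ y ∈ (w.rotate x hx).support, y ∈ w.support.toFinset := fun y hy => by simpa [Walk.mem_support_rotate_iff] using hy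
    exact hc.snd_ne_penultimate (hx' _ (hs _ (Walk.getVert_mem_support _ _)) _ (hs _ (Walk.getVert_mem_support _ _))
      (Walk.adj_snd hc.not_nil) (Walk.adj_penultimate hc.not_nil).symm)

end IFPaper
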